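/- Every minimal transitive subgroup G of the symmetric group S_48 is imprimitive and preserves a block system whose blocks have size 2, 3, or 4. -/

import Mathlib

open Pointwise

/-- `minGen G` is the minimal size of a generating set of the group `G` (denoted `d(G)`). -/
noncomputable def minGen (G : Type*) [Group G] : ℕ :=
  sInf {n | ∃ S : Finset G, S.card = n ∧ Subgroup.closure (S : Set G) = ⊤}

/-- A subgroup of `Sym(Fin m)` is transitive if its natural action on the `m` points is
transitive. -/
def IsTransitiveSub {m : ℕ} (H : Subgroup (Equiv.Perm (Fin m))) : Prop :=
  ∀ x y : Fin m, ∃ g ∈ H, g x = y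

/-- `H` preserves a block system (a `H`-invariant partition of the points) all of whose
blocks have size `k`. -/
def HasBlockSystem {m : ℕ} (H : Subgroup (Equiv.Perm (Fin m))) (k : ℕ) : Prop :=
  ∃ P : Set (Set (Fin m)), Setoid.IsPartition P ∧ (∀ B ∈ P, B.ncard = k) ∧
    ∀ g ∈ H, ∀ B ∈ P, (⇑g '' B) ∈ P

/-- Two subgroups of `Sym(Fin m)` are conjugate in `Sym(Fin m)`. -/
def ConjSub {m : ℕ} (H K : Subgroup (Equiv.Perm (Fin m))) : Prop :=
  ∃ σ : Equiv.Perm (Fin m), Subgroup.map (MulAut.conj σ).toMonoidHom H = K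

/-- A transitive subgroup is minimal transitive if no proper subgroup is transitive. -/
def IsMinimalTransitive {m : ℕ} (H : Subgroup (Equiv.Perm (Fin m))) : Prop :=
  IsTransitiveSub H ∧ ∀ K : Subgroup (Equiv.Perm (Fin m)), K < H → ¬ IsTransitiveSub K

set_option linter.all false
universe u
open Equiv (Perm swap)
open Function (Injective Surjective iterate_succ_apply')
open Finset (card_bij' card_filter sum_filter sum_congr sum_comm card_eq_one card_le_card mem_image mem_univ mul_sum mem_range mem_filter mem_singleton univ card_univ mem_sdiff mem_insert subset_univ card_pair)
open MulAction (IsPretransitive exists_smul_eq stabilizer index_stabilizer index_stabilizer_of_transitive toPerm_injective)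
open Fintype (sum_prod_type ofSurjective ofFinite)
open Nat (dvd_prime le_of_dvd beq beq_eq ble ble_eq blt blt_eq mod_eq_of_lt Coprime card_eq_fintype_card prime_two card_perm card_congr card_zpowers eq_of_beq_eq_true zero_mod beq_refl)
open Set (toFinite ncard_coe_finset ncard_le_ncard)
open Subgroup (index_dvd_card eq_of_le_of_card_ge center mem_center_iff mem_bot centralizer index_eq_one card_subgroup_dvd_card index_dvd_of_le relIndex_mul_index inf_relIndex_right relIndex_top_right relIndex_sup_left relIndex_dvd_card index_ker normalizer le_normalizer card_dvd_of_le mem_centralizer_iff zpowers mem_zpowers normalCore_normal normalCore_le relIndex_eq_one orderOf_coe card_mul_index relIndex_mul_relIndex card_map_of_injective mem_normalizer_iff map_subtype_le relIndex relIndex_bot_left mem_comap mem_top zpowers_le orderOf_mk)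
open Bool (not_eq_true and_eq_true or_eq_true not_eq_true' eq_false_iff)
open List (any_eq_true all_eq_true map_nil not_mem_nil)
open Matrix (trace_one)
open MonoidHom (ker_eq_bot_iff range_eq_map ofInjective mem_ker map_zpowers)
open QuotientGroup (mk')
open Equiv.Perm (isCycle_of_prime_order' mem_support mem_alternatingGroup inv_eq_iff_eq)
open IsPGroup (iff_card of_card)
open MulAut (conjNormal)
open Fin (val_last val_zero revPerm)
namespace Sch
open Finset
section
variable {G Ω : Type*} [Group G] [MulAction G Ω]
abbrev Q (G Ω : Type*) [Group G] [MulAction G Ω] := MulAction.orbitRel.Quotient G (Ω × Ω)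
variable (G) in
def col (a b : Ω) : Q G Ω := Quotient.mk _ (a,b)
lemma col_eq {a b a' b' : Ω} : col G a b = col G a' b' ↔ ∃ g : G,g•a' = a ∧ g•b' = b := by
 unfold col
 rw [Quotient.eq,MulAction.orbitRel_apply,MulAction.mem_orbit_iff]
 simp [Prod.ext_iff]
lemma col_smul (g : G) (a b : Ω) : col G (g•a) (g•b) = col G a b :=
 col_eq.2 ⟨g,rfl,rfl⟩
lemma col_ind {P : Q G Ω → Prop} (h : ∀ a b,P (col G a b)) (q) : P q := by
 induction q using Quotient.inductionOn with
 | h x => exact h x.1 x.2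
def star : Q G Ω → Q G Ω := Quotient.lift (fun x => col G x.2 x.1) (by
 rintro ⟨a,b⟩ ⟨a',b'⟩ h
 obtain ⟨g,h1,h2⟩ := (col_eq (G := G)).1 (Quotient.sound h)
 exact col_eq.2 ⟨g,h2,h1⟩)
lemma star_col (a b : Ω) : star (col G a b) = col G b a := rfl
lemma star_star (q : Q G Ω) : star (star q) = q := by
 induction q using col_ind with | h a b => rfl
lemma col_star {a b : Ω} {q : Q G Ω} : col G a b = star q ↔ col G b a = q := by
 rw [←star_col,(show Injective (star (G := G) (Ω := Ω)) from
  Function.LeftInverse.injective star_star).eq_iff]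
variable [Fintype Ω]
open Classical in
/-- out-valency at a -/
noncomputable def val (q : Q G Ω) (a : Ω) : ℕ := #{b | col G a b = q}
open Classical in
noncomputable def pp (i j : Q G Ω) (x y : Ω) : ℕ := #{z | col G x z = i ∧ col G z y = j}
open Classical in
noncomputable def TT (i j k : Q G Ω) (a : Ω) : ℕ :=
 #{z : Ω × Ω | col G a z.1 = i ∧ col G z.1 z.2 = j ∧ col G z.2 a = k}
lemma val_smul (q : Q G Ω) (g : G) (a : Ω) : val q (g•a) = val q a := by
 classical
 refine (card_bij' (fun b _ => g•b) (fun b _ => g⁻¹•b) ?_ ?_ ?_ ?_).symm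
 ·intro b; simp [col_smul]
 ·intro b
  simp only [mem_filter,mem_univ,true_and]
  intro h; rw [←h,←col_smul g a]; simp
 ·simp
 ·simp
lemma pp_smul (i j : Q G Ω) (g : G) (x y : Ω) : pp i j (g•x) (g•y) = pp i j x y := by
 classical
 refine (card_bij' (fun b _ => g•b) (fun b _ => g⁻¹•b) ?_ ?_ ?_ ?_).symm
 ·intro b; simp [col_smul]
 ·intro b
  simp only [mem_filter,mem_univ,true_and]
  rintro ⟨h,h'⟩; rw [←h,←h',←col_smul g x,←col_smul g _ y]; simp
 ·simp
 ·simp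
lemma TT_smul (i j k : Q G Ω) (g : G) (x : Ω) : TT i j k (g•x) = TT i j k x := by
 classical
 refine (card_bij' (fun b _ => g•b) (fun b _ => g⁻¹•b) ?_ ?_ ?_ ?_).symm
 ·intro b; simp [col_smul]
 ·intro b
  simp only [mem_filter,mem_univ,true_and]
  rintro ⟨h,h',h''⟩
  rw [←h,←h',←h'',←col_smul g x,←col_smul g _ x,←col_smul g (g⁻¹•b).1]; simp
 ·simp
 ·simp
lemma pp_col (i j : Q G Ω) {x y x' y' : Ω} (h : col G x y = col G x' y') :
  pp i j x y = pp i j x' y' := by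
 obtain ⟨g,rfl,rfl⟩ := col_eq.1 h
 exact pp_smul ..
variable [IsPretransitive G Ω]
lemma val_const (q : Q G Ω) (a b : Ω) : val q a = val q b := by
 obtain ⟨g,rfl⟩ := exists_smul_eq G b a
 exact val_smul ..
lemma TT_const (i j k : Q G Ω) (a b : Ω) : TT i j k a = TT i j k b := by
 obtain ⟨g,rfl⟩ := exists_smul_eq G b a
 exact TT_smul ..
variable (a : Ω)
lemma col_self (b : Ω) : col G a a = col G b b := by
 obtain ⟨g,rfl⟩ := exists_smul_eq G b a
 exact col_smul ..
lemma col_diag {b c : Ω} : col G b c = col G a a ↔ b = c := by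
 constructor
 ·intro h; obtain ⟨g,h1,h2⟩ := col_eq.1 h; rw [←h1,h2]
 ·rintro rfl; exact col_self ..
lemma exists_col (q : Q G Ω) : ∃ b,col G a b = q := by
 induction q using col_ind with
 | h x y =>
  obtain ⟨g,rfl⟩ := exists_smul_eq G a x
  exact ⟨g⁻¹•y,by rw [←col_smul g]; simp⟩
lemma val_pos (q : Q G Ω) : 0 < val q a := by
 obtain ⟨b,hb⟩ := exists_col a q
 exact Finset.card_pos.2 ⟨b,by simp [hb]⟩
open Classical in
lemma TT_cyc (i j k : Q G Ω) : TT i j k a = TT j k i a := by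
 have key : ∀ i j k : Q G Ω,Fintype.card Ω*TT i j k a =
   #{z : Ω × Ω × Ω | col G z.1 z.2.1 = i ∧ col G z.2.1 z.2.2 = j ∧ col G z.2.2 z.1 = k} := by
  intro i j k
  rw [card_filter,sum_prod_type]
  simp_rw [←card_filter]
  have : ∀ x : Ω,TT i j k x = TT i j k a := fun x => TT_const i j k x a
  trans ∑ x : Ω,TT i j k x
  ·simp [this]
  ·rfl
 have h : 0 < Fintype.card Ω := Fintype.card_pos_iff.2 ⟨a⟩
 apply Nat.eq_of_mul_eq_mul_left h
 rw [key,key]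
 refine card_bij' (fun z _ => (z.2.1,z.2.2,z.1)) (fun z _ => (z.2.2,z.1,z.2.1)) ?_ ?_ ?_ ?_ <;> simp
 all_goals tauto
lemma TT_rev (i j k : Q G Ω) : TT i j k a = TT (star k) (star j) (star i) a := by
 classical
 refine card_bij' (fun z _ => (z.2,z.1)) (fun z _ => (z.2,z.1)) ?_ ?_ ?_ ?_ <;> simp
 all_goals simp [col_star]
 all_goals tauto
lemma val_star (q : Q G Ω) : val (star q) a = val q a := by
 classical
 have key : ∀ i : Q G Ω,Fintype.card Ω*val i a = #{z : Ω × Ω | col G z.1 z.2 = i} := by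
  intro i
  rw [card_filter,sum_prod_type]
  simp_rw [←card_filter]
  have : ∀ x : Ω,val i x = val i a := fun x => val_const i x a
  trans ∑ x : Ω,val i x
  ·simp [this]
  ·rfl
 have h : 0 < Fintype.card Ω := Fintype.card_pos_iff.2 ⟨a⟩
 apply Nat.eq_of_mul_eq_mul_left h
 rw [key,key]
 refine card_bij' (fun z _ => (z.2,z.1)) (fun z _ => (z.2,z.1)) ?_ ?_ ?_ ?_ <;> simp [col_star]
/-- `T(i,j,l*) = k_l p_{ij}^l`. -/
lemma TT_pp (i j l : Q G Ω) {x y : Ω} (h : col G x y = l) :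
  TT i j (star l) a = val l a*pp i j x y := by
 classical
 have : TT i j (star l) a = ∑ y ∈ {y | col G a y = l},pp i j a y := by
  unfold TT pp
  rw [card_filter,Fintype.sum_prod_type_right,sum_filter]
  refine sum_congr rfl fun y _ => ?_
  simp only [col_star]
  split_ifs with h
  ·rw [card_filter]
   simp [h]
  ·simp [h]
 rw [this,sum_congr rfl (fun z hz => pp_col i j (show col G a z = col G x y by
  rw [h]; simpa using hz))]
 simp [val]
variable [Fintype (Q G Ω)]
lemma assoc (i j l : Q G Ω) (x y : Ω) (R : Q G Ω → Ω × Ω) (hR : ∀ q,col G (R q).1 (R q).2 = q) :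
  ∑ m,pp i j (R m).1 (R m).2*pp m l x y = ∑ m,pp j l (R m).1 (R m).2*pp i m x y := by
 classical
 have h1 : ∑ m,pp i j (R m).1 (R m).2*pp m l x y =
   ∑ w,∑ z,if col G x z = i ∧ col G z w = j ∧ col G w y = l then 1 else 0 := by
  have : ∀ m,pp i j (R m).1 (R m).2*pp m l x y =
    ∑ w,if col G x w = m ∧ col G w y = l then pp i j x w else 0 := by
   intro m
   rw [←sum_filter,sum_congr rfl (fun w hw => pp_col i j
    (show col G x w = col G (R m).1 (R m).2 by rw [hR]; simp at hw; exact hw.1))]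
   simp [pp,mul_comm]
  simp_rw [this]
  rw [sum_comm]
  refine sum_congr rfl fun w _ => ?_
  rw [Finset.sum_eq_single (col G x w)]
  ·by_cases h : col G w y = l
   ·rw [if_pos (by simp [h]),pp]; simp [h]
   ·simp [h]
  ·intro b _ hb; simp [Ne.symm hb]
  ·simp
 have h2 : ∑ m,pp j l (R m).1 (R m).2*pp i m x y =
   ∑ z,∑ w,if col G x z = i ∧ col G z w = j ∧ col G w y = l then 1 else 0 := by
  have : ∀ m,pp j l (R m).1 (R m).2*pp i m x y =
    ∑ z,if col G x z = i ∧ col G z y = m then pp j l z y else 0 := by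
   intro m
   rw [←sum_filter,sum_congr rfl (fun w hw => pp_col j l
    (show col G w y = col G (R m).1 (R m).2 by rw [hR]; simp at hw; exact hw.2))]
   simp [pp,mul_comm]
  simp_rw [this]
  rw [sum_comm]
  refine sum_congr rfl fun w _ => ?_
  rw [Finset.sum_eq_single (col G w y)]
  ·by_cases h : col G x w = i
   ·rw [if_pos (by simp [h]),pp]; simp [h]
   ·simp [h]
  ·intro b _ hb; simp [Ne.symm hb]
  ·simp
 rw [h1,h2,sum_comm]
/-- row sums -/
lemma sum_TT (i j : Q G Ω) : ∑ k,TT i j k a = val i a*val j a := by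
 classical
 have h1 : ∀ k,TT i j k a = ∑ b,if col G a b = i then (∑ z,if col G b z = j ∧ col G z a = k then 1 else 0) else 0 := by
  intro k
  unfold TT
  rw [card_filter,sum_prod_type]
  refine sum_congr rfl fun b _ => ?_
  by_cases h : col G a b = i <;> simp [h]
 simp_rw [h1]
 rw [sum_comm]
 have h2 : ∀ b,(∑ k,if col G a b = i then (∑ z,if col G b z = j ∧ col G z a = k then 1 else 0) else 0) =
   if col G a b = i then val j a else 0 := by
  intro b
  split_ifs with h
  ·rw [sum_comm,val_const j a b,val,card_filter]
   refine sum_congr rfl fun z _ => ?_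
   by_cases h : col G b z = j <;> simp [h]
  ·simp
 simp_rw [h2]
 rw [←sum_filter]
 simp [val]
lemma TT_diag (i j : Q G Ω) (x : Ω) [DecidableEq (Q G Ω)]: TT i j (col G x x) a = if j = star i then val i a else 0 := by
 have h := TT_pp a i j (col G x x) rfl
 rw [star_col] at h
 rw [h]
 have hv : val (col G x x) a = 1 := by
  classical
  unfold val; rw [card_eq_one]
  refine ⟨a,?_⟩
  ext b; simp [col_diag,eq_comm]
 rw [hv,one_mul]
 split_ifs with h
 ·subst h
  rw [val_const i a x]
  simp only [pp,val,col_star,and_self]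
  congr
 ·rw [pp,Finset.card_eq_zero]
  ext z; simp
  rintro rfl rfl
  exact h rfl
lemma sum_val : ∑ k : Q G Ω,val k a = Fintype.card Ω := by
 classical
 unfold val
 simp_rw [card_filter]
 rw [sum_comm]
 simp
end
end Sch
namespace Sch
open Finset
/-- primitivity, via invariant equivalence relations -/
def Prim (G Ω : Type*) [Group G] [MulAction G Ω] : Prop :=
 ∀ r : Ω → Ω → Prop,Equivalence r → (∀ (g : G) a b,r a b → r (g•a) (g•b)) →
  (∀ a b,r a b → a = b) ∨ ∀ a b,r a b
section
variable {G Ω : Type*} [Group G] [MulAction G Ω]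
lemma Prim.univ_of (hP : Prim G Ω) {A : Type*} (f : Ω → A) (hf : ∀ (g : G) a b,f a = f b → f (g•a) = f (g•b))
  {a b : Ω} (hab : a ≠ b) (h : f a = f b) : ∀ x y,f x = f y := by
 rcases hP (fun x y => f x = f y) ⟨fun _ => rfl,fun h => h.symm,fun h h' => h.trans h'⟩ hf with h' | h'
 ·exact absurd (h' a b h) hab
 ·exact h'
variable [Fintype Ω] [IsPretransitive G Ω] [Finite G] [FaithfulSMul G Ω]
lemma T2 (hP : Prim G Ω) {r : ℕ} (hr : r.Prime) {g : G} (hg : g ≠ 1) {a : Ω} (hga : g•a = a) (hgr : g^r = 1)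
  {q : Q G Ω} (hq : q ≠ col G a a) : r ≤ val q a := by
 classical
 by_contra hlt
 push Not at hlt
 obtain ⟨b,hb⟩ := exists_col a q
 have hab : a ≠ b := by rintro rfl; exact hq hb.symm
 have fix : ∀ g : G,g•a = a → g^r = 1 → g•b = b := by
  intro g hga hgr
  have hper : Function.IsPeriodicPt (fun x : Ω => g•x) r b := by
   show (fun x : Ω => g•x)^[r] b = b
   rw [smul_iterate_apply,hgr,one_smul]
  have hmp := hper.minimalPeriod_dvd
  rcases (dvd_prime hr).1 hmp with h1 | h1
  ·have := Function.isPeriodicPt_minimalPeriod (fun x : Ω => g•x) b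
   rw [h1] at this; exact this
  ·exfalso
   have hinj := Function.iterate_injOn_Iio_minimalPeriod (f := fun x : Ω => g•x) (x := b)
   rw [h1] at hinj
   have : #((Finset.range r).image fun n => (fun x : Ω => g•x)^[n] b) ≤ val q a := by
    apply card_le_card
    intro x hx
    obtain ⟨n, -,rfl⟩ := mem_image.1 hx
    simp only [mem_filter,mem_univ,true_and]
    rw [smul_iterate_apply]
    have : g^n•a = a := (stabilizer G a).pow_mem (show g ∈ stabilizer G a from hga) n
    conv_lhs => rw [←this,col_smul]
    exact hb
   rw [Finset.card_image_of_injOn (by simpa using hinj),Finset.card_range] at this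
   omega
 let A : Ω → Set G := fun x => {g | g•x = x ∧ g^r = 1}
 have hA : ∀ (h : G) x,A (h•x) = (fun g => h*g*h⁻¹) '' A x := by
  intro h x
  ext k
  simp only [A,Set.mem_ofPred_eq,Set.mem_image]
  constructor
  ·rintro ⟨h1,h2⟩
   refine ⟨h⁻¹*k*h,⟨?_,?_⟩,by group⟩
   ·rw [mul_smul,mul_smul,h1,inv_smul_smul]
   ·have := conj_pow (a := h⁻¹) (b := k) (i := r)
    rw [inv_inv] at this
    rw [this,h2]; group
  ·rintro ⟨k',⟨h1,h2⟩,rfl⟩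
   refine ⟨?_,?_⟩
   ·rw [mul_smul,mul_smul,inv_smul_smul,h1]
   ·rw [conj_pow,h2]; group
 have hc : ∀ (h : G) x,(A (h•x)).ncard = (A x).ncard := by
  intro h x
  rw [hA,Set.ncard_image_of_injective]
  intro u v huv
  simpa using huv
 have hAab : A a = A b := by
  apply Set.eq_of_subset_of_ncard_le
  ·rintro k ⟨h1,h2⟩; exact ⟨fix k h1 h2,h2⟩
  ·obtain ⟨h,rfl⟩ := exists_smul_eq G a b
   exact (hc h a).le
  ·exact toFinite _
 have huniv := hP.univ_of A (by intro h x y hxy; rw [hA,hA,hxy]) hab hAab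
 apply hg
 apply FaithfulSMul.eq_of_smul_eq_smul (α := Ω)
 intro x
 rw [one_smul]
 have : g ∈ A x := by rw [huniv x a]; exact ⟨hga,hgr⟩
 exact this.1
lemma val_dvd (q : Q G Ω) (a : Ω) : val q a ∣ Nat.card (stabilizer G a) := by
 classical
 obtain ⟨b,rfl⟩ := exists_col a q
 have h : val (col G a b) a = Nat.card (MulAction.orbit (stabilizer G a) b) := by
  rw [Nat.card_coe_set_eq,val,←ncard_coe_finset]
  congr 1
  ext x
  simp only [coe_filter,mem_univ,true_and,Set.mem_ofPred_eq,MulAction.mem_orbit_iff,col_eq]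
  constructor
  ·rintro ⟨g,h1,h2⟩
   exact ⟨⟨g,h1⟩,h2⟩
  ·rintro ⟨⟨g,hg⟩,h2⟩
   exact ⟨g,hg,h2⟩
 rw [h,Nat.card_coe_set_eq,←index_stabilizer (stabilizer G a) b]
 exact index_dvd_card _
lemma T2' (hP : Prim G Ω) {r : ℕ} (hr : r.Prime) {a : Ω} (h : r ∣ Nat.card (stabilizer G a))
  {q : Q G Ω} (hq : q ≠ col G a a) : r ≤ val q a := by
 have := Fact.mk hr
 obtain ⟨g,hg⟩ := exists_prime_orderOf_dvd_card' r h
 refine T2 hP hr (g := (g : G)) ?_ g.2 ?_ hq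
 ·intro h1
  have : g = 1 := by ext; exact h1
  rw [this,orderOf_one] at hg
  exact hr.one_lt.ne hg
 ·rw [←Subgroup.coe_pow,←hg,pow_orderOf_eq_one]; rfl
lemma T2'' (hP : Prim G Ω) {r : ℕ} (hr : r.Prime) {a : Ω} {q' : Q G Ω} (h : r ∣ val q' a)
  {q : Q G Ω} (hq : q ≠ col G a a) : r ≤ val q a := T2' hP hr (h.trans (val_dvd q' a)) hq
lemma val_dvd_TT (a : Ω) (i j k : Q G Ω) : val k a ∣ TT i j k a := by
 obtain ⟨b,hb⟩ := exists_col a (star k)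
 have := TT_pp a i j (star k) hb
 rw [star_star,val_star] at this
 exact this ▸ dvd_mul_right _ _
lemma weiss (hP : Prim G Ω) (a : Ω) {i j : Q G Ω} (hj : j ≠ col G a a) (h2 : 2 ≤ val i a)
  (hlt : val i a < val j a) (hco : (val i a).Coprime (val j a)) :
  ∃ l : Q G Ω,val j a < val l a ∧ val l a ∣ val i a*val j a := by
 classical
 letI : Fintype (Q G Ω) := ofSurjective (fun b => col G a b) (exists_col a)
 have hdvd : ∀ l,val i a*val j a ∣ TT i j (star l) a := by
  intro l
  apply hco.mul_dvd_of_dvd_of_dvd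
  ·rw [TT_cyc]; exact val_dvd_TT a _ _ _
  ·rw [TT_cyc,TT_cyc]; exact val_dvd_TT a _ _ _
 have hpos : 0 < val i a*val j a := Nat.mul_pos (val_pos a i) (val_pos a j)
 obtain ⟨k, -,hk⟩ : ∃ k ∈ (univ : Finset (Q G Ω)),TT i j k a ≠ 0 := by
  apply Finset.exists_ne_zero_of_sum_ne_zero
  rw [sum_TT]; exact hpos.ne'
 obtain ⟨l,rfl⟩ : ∃ l,k = star l := ⟨star k,(star_star k).symm⟩
 have hle : TT i j (star l) a ≤ val i a*val j a := by
  rw [←sum_TT a i j]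
  exact Finset.single_le_sum (f := fun k => TT i j k a) (fun _ _ => Nat.zero_le _) (mem_univ _)
 have heq : TT i j (star l) a = val i a*val j a :=
  le_antisymm hle (le_of_dvd (Nat.pos_of_ne_zero hk) (hdvd l))
 obtain ⟨y,hy⟩ := exists_col a l
 have hT := TT_pp a i j l hy
 rw [heq] at hT
 have hple : ∀ y,pp i j a y ≤ val i a := by
  intro y
  apply card_le_card
  intro z; simp +contextual
 refine ⟨l,?_,hT ▸ dvd_mul_right _ _⟩
 by_contra hnot
 push Not at hnot
 have hge : val j a ≤ val l a := by
  have h1 := hple y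
  by_contra hcon
  push Not at hcon
  have : val l a*pp i j a y < val j a*val i a :=
   Nat.mul_lt_mul_of_lt_of_le hcon h1 (val_pos a i)
  rw [mul_comm (val j a)] at this
  omega
 have hjl : val l a = val j a := le_antisymm hnot hge
 have hfull : ∀ y,col G a y = l → ∀ z,col G a z = i → col G z y = j := by
  intro y hy z hz
  have hT := TT_pp a i j l hy
  rw [heq,hjl,mul_comm] at hT
  have hp : pp i j a y = val i a := (Nat.eq_of_mul_eq_mul_left (val_pos a j) hT).symm
  have hsub : ({z | col G a z = i ∧ col G z y = j} : Finset Ω) = ({z | col G a z = i} : Finset Ω) := by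
   apply Finset.eq_of_subset_of_card_le
   ·intro z; simp +contextual
   ·exact hp.ge
  have : z ∈ ({z | col G a z = i} : Finset Ω) := by simp [hz]
  rw [←hsub] at this
  simpa using (by simpa using this : _ ∧ _).2
 let f : Ω → Finset Ω := fun z => {y | col G z y = j}
 have hfz : ∀ z,col G a z = i → f z = ({y | col G a y = l} : Finset Ω) := by
  intro z hz
  symm
  apply Finset.eq_of_subset_of_card_le
  ·intro y hy
   simp only [f,mem_filter,mem_univ,true_and] at hy ⊢
   exact hfull y hy z hz
  ·show val j z ≤ val l a
   rw [hjl,val_const j z a]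
 obtain ⟨z,hz,z',hz',hne⟩ := Finset.one_lt_card.1 (show 1 < #{b | col G a b = i} from h2)
 simp only [mem_filter,mem_univ,true_and] at hz hz'
 have hu := hP.univ_of f (by
  intro g x y hxy
  have : ∀ x,f (g•x) = (f x).image (fun w => g•w) := by
   intro x
   ext w
   simp only [f,mem_filter,mem_univ,true_and,mem_image]
   constructor
   ·intro h; exact ⟨g⁻¹•w,by rw [←h,←col_smul g x]; simp,by simp⟩
   ·rintro ⟨w,h,rfl⟩; rw [col_smul,h]
  rw [this,this,hxy]) hne ((hfz z hz).trans (hfz z' hz').symm)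
 obtain ⟨w,hw⟩ := exists_col a j
 have : w ∈ f a := by simp [f,hw]
 rw [hu a w] at this
 simp only [f,mem_filter,mem_univ,true_and] at this
 exact hj (this.symm.trans (col_self w a))
end
end Sch
namespace Slv
open Finset
def kf (K i : ℕ) : ℕ := Nat.mod (Nat.shiftRight K (Nat.mul (nat_lit 8) i)) (nat_lit 256)
def sf (S i : ℕ) : ℕ := Nat.mod (Nat.shiftRight S (Nat.mul (nat_lit 4) i)) (nat_lit 16)
def cd (i j k : ℕ) : ℕ := Nat.mul (nat_lit 12) (Nat.add (Nat.add (Nat.mul (nat_lit 64) i) (Nat.mul (nat_lit 8) j)) k)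
lemma cd_eq (i j k : ℕ) : cd i j k = 12*(64*i+8*j+k) := rfl
def dig (s c : ℕ) : ℕ := Nat.mod (Nat.shiftRight s c) (nat_lit 4096)
lemma dig_eq (s c : ℕ) : dig s c = (s >>> c) % 4096 := rfl
structure Sol (m K ST : ℕ) (T : ℕ → ℕ → ℕ → ℕ) : Prop where
 m_le : m ≤ 8
 st_lt : ∀ i < m,sf ST i < m
 cyc : ∀ i < m,∀ j < m,∀ k < m,T i j k = T j k i
 rev : ∀ i < m,∀ j < m,∀ k < m,T i j k = T (sf ST k) (sf ST j) (sf ST i)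
 dvd : ∀ i < m,∀ j < m,∀ k < m,kf K i ∣ T i j k
 kpos : ∀ i < m,0 < kf K i
 row : ∀ i < m,∀ j < m,∑ k ∈ range m,T i j k+(if sf ST i = j then kf K i else 0) = kf K i*kf K j
 assoc : ∀ i < m,∀ j < m,∀ l < m,∀ k < m,
  (if sf ST i = j ∧ l = k then kf K i*kf K k else 0) +
   ∑ n ∈ range m,T i j (sf ST n) / kf K n*T n l (sf ST k) =
  (if sf ST j = l ∧ i = k then kf K j*kf K k else 0) +
   ∑ n ∈ range m,T j l (sf ST n) / kf K n*T i n (sf ST k)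
 conn : ∀ S : List ℕ,(∀ a ∈ S,a < m ∧ sf ST a ∈ S) → S ≠ [] → (∃ c < m,c ∉ S) →
  ∃ a ∈ S,∃ b ∈ S,∃ c < m,c ∉ S ∧ T a b (sf ST c) ≠ 0
 bound : ∀ i < m,∀ j < m,∀ k < m,T i j k < 4000
/-- agreement of a state with a solution -/
def Ag (m : ℕ) (T : ℕ → ℕ → ℕ → ℕ) (s : ℕ) : Prop :=
 ∀ i < m,∀ j < m,∀ k < m,dig s (cd i j k) = 0 ∨ dig s (cd i j k) = T i j k+1
def set1 (s c x : ℕ) : ℕ := Nat.lor s (Nat.shiftLeft x c)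
lemma set1_eq (s c x : ℕ) : set1 s c x = s ||| (x <<< c) := rfl
lemma dig_testBit (s c b : ℕ) : (dig s c).testBit b = (decide (b < 12) && s.testBit (c+b)) := by
 have : (4096 : ℕ) = 2^12 := by norm_num
 rw [dig_eq,this,Nat.testBit_mod_two_pow,Nat.testBit_shiftRight]
lemma dig_set1 (s i j k i' j' k' x : ℕ) (hx : x < 4096) (hi : j < 8) (hj : j' < 8) (hk : k < 8) (hk' : k' < 8) :
  dig (set1 s (cd i j k) x) (cd i' j' k') =
   dig s (cd i' j' k') ||| (if i = i' ∧ j = j' ∧ k = k' then x else 0) := by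
 apply Nat.eq_of_testBit_eq
 intro b
 rw [Nat.testBit_or,dig_testBit,dig_testBit,set1_eq,Nat.testBit_or,Nat.testBit_shiftLeft]
 have h4 : (4096 : ℕ) = 2^12 := by norm_num
 by_cases hb : b < 12
 ·by_cases he : i = i' ∧ j = j' ∧ k = k'
  ·obtain ⟨rfl,rfl,rfl⟩ := he
   simp [hb]
  ·rw [if_neg he]
   simp only [hb,decide_true,Bool.true_and,Nat.zero_testBit,Bool.or_false]
   by_cases hc : cd i' j' k'+b ≥ cd i j k
   ·have : x.testBit (cd i' j' k'+b - cd i j k) = false := by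
     apply Nat.testBit_lt_two_pow
     refine lt_of_lt_of_le (h4 ▸ hx) (Nat.pow_le_pow_right (by norm_num) ?_)
     simp only [cd_eq] at *
     omega
    simp [this]
   ·simp [hc]
 ·have : x.testBit b = false := by
   apply Nat.testBit_lt_two_pow
   exact lt_of_lt_of_le (h4 ▸ hx) (Nat.pow_le_pow_right (by norm_num) (by omega))
  split_ifs <;> simp [hb,this]
variable {m K ST : ℕ} {T : ℕ → ℕ → ℕ → ℕ}
lemma Ag_set1 (hm : m ≤ 8) {s : ℕ} (h : Ag m T s) {i j k : ℕ} (hi : i < m) (hj : j < m) (hk : k < m)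
  {x : ℕ} (hx : x < 4000) (hT : T i j k = x) : Ag m T (set1 s (cd i j k) (x+1)) := by
 intro i' hi' j' hj' k' hk'
 rw [dig_set1 _ _ _ _ _ _ _ _ (by omega) (by omega) (by omega) (by omega) (by omega)]
 have := h i' hi' j' hj' k' hk'
 split_ifs with he
 ·obtain ⟨rfl,rfl,rfl⟩ := he
  right
  rcases this with h | h <;> rw [h,hT]
  ·simp
  ·simp
 ·simpa using this
def upd (ST s i j k x : ℕ) : ℕ :=
 set1 (set1 (set1 (set1 (set1 (set1 s (cd i j k) (Nat.succ x)) (cd j k i) (Nat.succ x)) (cd k i j) (Nat.succ x))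
  (cd (sf ST k) (sf ST j) (sf ST i)) (Nat.succ x)) (cd (sf ST j) (sf ST i) (sf ST k)) (Nat.succ x))
  (cd (sf ST i) (sf ST k) (sf ST j)) (Nat.succ x)
lemma Ag_upd (H : Sol m K ST T) {s : ℕ} (h : Ag m T s) {i j k : ℕ} (hi : i < m) (hj : j < m) (hk : k < m)
  {x : ℕ} (hT : T i j k = x) : Ag m T (upd ST s i j k x) := by
 have hb : x < 4000 := hT ▸ H.bound i hi j hj k hk
 have e1 := H.cyc i hi j hj k hk
 have e2 := H.cyc j hj k hk i hi
 have f1 := H.rev i hi j hj k hk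
 have f2 := H.rev j hj k hk i hi
 have f3 := H.rev k hk i hi j hj
 have si := H.st_lt i hi
 have sj := H.st_lt j hj
 have sk := H.st_lt k hk
 unfold upd
 refine Ag_set1 H.m_le (Ag_set1 H.m_le (Ag_set1 H.m_le (Ag_set1 H.m_le (Ag_set1 H.m_le (Ag_set1 H.m_le h ?_ ?_ ?_ hb ?_) ?_ ?_ ?_ hb ?_) ?_ ?_ ?_ hb ?_) ?_ ?_ ?_ hb ?_) ?_ ?_ ?_ hb ?_) ?_ ?_ ?_ hb ?_
 all_goals first | assumption | omega
/-- step -/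
def stp (K i j k : ℕ) : ℕ := Nat.lcm (Nat.lcm (kf K i) (kf K j)) (kf K k)
lemma stp_dvd (H : Sol m K ST T) {i j k : ℕ} (hi : i < m) (hj : j < m) (hk : k < m) : stp K i j k ∣ T i j k := by
 refine Nat.lcm_dvd (Nat.lcm_dvd (H.dvd i hi j hj k hk) ?_) ?_
 ·rw [H.cyc i hi j hj k hk]; exact H.dvd j hj k hk i hi
 ·rw [H.cyc i hi j hj k hk,H.cyc j hj k hk i hi]; exact H.dvd k hk i hi j hj
def force (n : ℕ) (f : ℕ → Bool) : Bool := Nat.rec (f (nat_lit 0)) (fun k _ => f (Nat.succ k)) n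
lemma force_eq (n f) : force n f = f n := by cases n <;> rfl
/-- continuation-style row summary: sum of the known, gcd of steps of the unknown -/
def rowl (K s i j : ℕ) (n : ℕ) (sum g : ℕ) (f : ℕ → ℕ → Bool) : Bool :=
 Nat.rec (motive := fun _ => ℕ → ℕ → Bool) (fun sum g => f sum g)
  (fun k ih sum g => Nat.rec (motive := fun _ => Bool) (ih sum (Nat.gcd g (stp K i j k)))
   (fun d _ => ih (Nat.add sum d) g) (dig s (cd i j k))) n sum g
lemma rowl_spec (H : Sol m K ST T) {s : ℕ} (h : Ag m T s) {i j : ℕ} (hi : i < m) (hj : j < m) (f : ℕ → ℕ → Bool)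
  (n : ℕ) (hn : n ≤ m) (sum g : ℕ) :
  ∃ sum' g' u,rowl K s i j n sum g f = f (sum+sum') g' ∧ sum'+u = ∑ k ∈ range n,T i j k ∧
   g' ∣ g ∧ g' ∣ u ∧ (∀ k < n,dig s (cd i j k) = 0 → T i j k ≤ u) := by
 induction n generalizing sum g with
 | zero => exact ⟨0,g,0,rfl,by simp,dvd_rfl,by simp,by simp⟩
 | succ k ih =>
  have hk : k < m := hn
  have key : rowl K s i j (k+1) sum g f = Nat.rec (motive := fun _ => Bool) (rowl K s i j k sum (Nat.gcd g (stp K i j k)) f)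
   (fun d _ => rowl K s i j k (sum+d) g f) (dig s (cd i j k)) := rfl
  rw [key,sum_range_succ]
  rcases h i hi j hj k hk with h0 | h0 <;> rw [h0]
  ·obtain ⟨sum',g',u,h1,h2,h3,h4,h5⟩ := ih (by omega) sum (Nat.gcd g (stp K i j k))
   refine ⟨sum',g',u+T i j k,h1,by omega,h3.trans (Nat.gcd_dvd_left _ _),?_,?_⟩
   ·exact dvd_add h4 ((h3.trans (Nat.gcd_dvd_right _ _)).trans (stp_dvd H hi hj hk))
   ·intro k' hk' hd
    rcases Nat.lt_or_eq_of_le (Nat.le_of_lt_succ hk') with hlt | rfl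
    ·have := h5 k' hlt hd; omega
    ·omega
  ·obtain ⟨sum',g',u,h1,h2,h3,h4,h5⟩ := ih (by omega) (sum+T i j k) g
   refine ⟨sum'+T i j k,g',u,by rw [←add_assoc,add_right_comm]; exact h1,by omega,h3,h4,?_⟩
   intro k' hk' hd
   rcases Nat.lt_or_eq_of_le (Nat.le_of_lt_succ hk') with hlt | rfl
   ·exact h5 k' hlt hd
   ·omega
def rtot (K ST i j : ℕ) : ℕ := Nat.sub (Nat.mul (kf K i) (kf K j)) (bif beq (sf ST i) j then kf K i else nat_lit 0)
lemma rtot_eq (K ST i j : ℕ) : rtot K ST i j = kf K i*kf K j - (if sf ST i = j then kf K i else 0) := by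
 unfold rtot
 by_cases h : sf ST i = j
 ·simp [h]
 ·have : beq (sf ST i) j = false := by
   rw [←not_eq_true,beq_eq]; exact h
  rw [this,if_neg h]; rfl
/-- row check: `true` when consistent -/
def rowchk (m K ST s i j : ℕ) : Bool :=
 rowl K s i j m 0 0 fun sum g => ble sum (rtot K ST i j) && beq (Nat.mod (Nat.sub (rtot K ST i j) sum) g) (nat_lit 0)
lemma rowchk_sound (H : Sol m K ST T) {s : ℕ} (h : Ag m T s) {i j : ℕ} (hi : i < m) (hj : j < m) :
  rowchk m K ST s i j = true := by
 obtain ⟨sum',g',u,h1,h2,h3,h4,h5⟩ := rowl_spec H h hi hj (fun sum g => ble sum (rtot K ST i j) && beq ((rtot K ST i j - sum) % g) 0) m le_rfl 0 0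
 have hr := H.row i hi j hj
 have e : rtot K ST i j = sum'+u := by rw [rtot_eq]; omega
 refine Eq.trans (show rowchk m K ST s i j = _ from h1) ?_
 rw [e]
 simp only [zero_add,and_eq_true,ble_eq,beq_eq]
 refine ⟨by omega,?_⟩
 rw [show sum'+u - sum' = u by omega]
 exact Nat.mod_eq_zero_of_dvd h4
/-- all candidates `x = base + t*step` -/
def cand (st : ℕ) (f : ℕ → Bool) (n : ℕ) : Bool :=
 Nat.rec (motive := fun _ => Bool) (f (nat_lit 0)) (fun t ih => f (Nat.mul (Nat.succ t) st) && ih) n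
lemma cand_spec {st : ℕ} {f : ℕ → Bool} {n : ℕ} (h : cand st f n = true) (t : ℕ) (ht : t ≤ n) : f (t*st) = true := by
 induction n with
 | zero =>
  obtain rfl : t = 0 := by omega
  simpa [cand] using h
 | succ n ih =>
  have : (f ((n+1)*st) && cand st f n) = true := h
  rw [and_eq_true] at this
  rcases Nat.lt_or_eq_of_le ht with h' | rfl
  ·exact ih this.2 (by omega)
  ·exact this.1
inductive Ins where
 | br (i j k : ℕ) -- branch
 | fo (i j k : ℕ) -- forced : all unknowns in row (i,j) are of the class of (i,j,k)
 | row (i j : ℕ)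
 | eq (i j l k : ℕ)
 | cl (S : List ℕ)
 | fb
/-- same class -/
def same (ST i j k k' : ℕ) : Bool :=
 (beq k k') || (beq j i && beq k j && beq k' i)
  || (beq i k && beq j i && beq k' j) || (beq i k' && beq j k && beq k i)
  || (beq i (sf ST k) && beq j (sf ST j) && beq k' (sf ST i))
  || (beq i (sf ST j) && beq j (sf ST i) && beq k' (sf ST k))
  || (beq i (sf ST i) && beq j (sf ST k) && beq k' (sf ST j))
lemma same_sound (H : Sol m K ST T) {i j k k' : ℕ} (hi : i < m) (hj : j < m) (hk : k < m) (hk' : k' < m)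
  (h : same ST i j k k' = true) : T i j k' = T i j k := by
 have e1 := H.cyc i hi j hj k hk
 have e2 := H.cyc j hj k hk i hi
 have f1 := H.rev i hi j hj k hk
 have f2 := H.rev j hj k hk i hi
 have f3 := H.rev k hk i hi j hj
 simp only [same,or_eq_true,and_eq_true,beq_eq] at h
 rcases h with (((((h | h) | h) | h) | h) | h) | h
 ·rw [h]
 ·obtain ⟨⟨rfl,rfl⟩,rfl⟩ := h; rfl
 ·obtain ⟨⟨rfl,rfl⟩,rfl⟩ := h; rfl
 ·obtain ⟨⟨rfl,rfl⟩,rfl⟩ := h; rfl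
 ·obtain ⟨⟨h1,h2⟩,h3⟩ := h
  rw [f1,←h1,←h2,←h3]
 ·obtain ⟨⟨h1,h2⟩,h3⟩ := h
  rw [e1,e2,f3,←h1,←h2,←h3]
 ·obtain ⟨⟨h1,h2⟩,h3⟩ := h
  rw [e1,f2,←h1,←h2,←h3]
/-- summary for a forced row: known sum, number of unknowns; gives `true` for failing shape -> false -/
def fol (ST s i j k0 : ℕ) (n : ℕ) (sum c : ℕ) (f : ℕ → ℕ → Bool) : Bool :=
 Nat.rec (motive := fun _ => ℕ → ℕ → Bool) (fun sum c => f sum c)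
  (fun k ih sum c => Nat.rec (motive := fun _ => Bool) (same ST i j k0 k && ih sum (c+1))
   (fun d _ => ih (Nat.add sum d) c) (dig s (cd i j k))) n sum c
lemma fol_spec (H : Sol m K ST T) {s : ℕ} (h : Ag m T s) {i j k0 : ℕ} (hi : i < m) (hj : j < m) (hk0 : k0 < m)
  (f : ℕ → ℕ → Bool) (n : ℕ) (hn : n ≤ m) (sum c : ℕ) (hf : fol ST s i j k0 n sum c f = true) :
  ∃ sum' c',f (sum+sum') (c+c') = true ∧ sum'+c'*T i j k0 = ∑ k ∈ range n,T i j k := by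
 induction n generalizing sum c with
 | zero => exact ⟨0,0,hf,by simp⟩
 | succ k ih =>
  have hk : k < m := hn
  have key : fol ST s i j k0 (k+1) sum c f = Nat.rec (motive := fun _ => Bool) (same ST i j k0 k && fol ST s i j k0 k sum (c+1) f)
   (fun d _ => fol ST s i j k0 k (sum+d) c f) (dig s (cd i j k)) := rfl
  rw [key] at hf
  rw [sum_range_succ]
  rcases h i hi j hj k hk with h0 | h0 <;> rw [h0] at hf
  ·replace hf : (same ST i j k0 k && fol ST s i j k0 k sum (c+1) f) = true := hf
   simp only [and_eq_true] at hf
   obtain ⟨sum',c',h1,h2⟩ := ih (by omega) sum (c+1) hf.2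
   refine ⟨sum',c'+1,by rw [←add_assoc,add_right_comm]; exact h1,?_⟩
   rw [←h2,same_sound H hi hj hk0 hk hf.1]; ring
  ·obtain ⟨sum',c',h1,h2⟩ := ih (by omega) (sum+T i j k) c hf
   exact ⟨sum'+T i j k,c',by rw [←add_assoc,add_right_comm]; exact h1,by omega⟩
/-- half of an associativity equation; flag `1` if unknown products are present -/
def half (K s : ℕ) (A B : ℕ → ℕ) (n : ℕ) (acc fl : ℕ) (f : ℕ → ℕ → Bool) : Bool :=
 Nat.rec (motive := fun _ => ℕ → ℕ → Bool) (fun acc fl => f acc fl)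
  (fun k ih acc fl => Nat.rec (motive := fun _ => Bool)
    (Nat.rec (motive := fun _ => Bool) (ih acc 1) (fun d _ => Nat.rec (motive := fun _ => Bool) (ih acc fl) (fun _ _ => ih acc 1) d) (dig s (B k)))
   (fun a _ => Nat.rec (motive := fun _ => Bool) (ih acc fl) (fun a' _ =>
    Nat.rec (motive := fun _ => Bool) (ih acc 1) (fun b _ => ih (Nat.add acc (Nat.mul (Nat.div (Nat.succ a') (kf K k)) b)) fl) (dig s (B k))) a)
   (dig s (A k))) n acc fl
lemma half_spec (s : ℕ) (A B : ℕ → ℕ) (tA tB : ℕ → ℕ) (f : ℕ → ℕ → Bool)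
  (n : ℕ) (hA : ∀ k < n,dig s (A k) = 0 ∨ dig s (A k) = tA k+1)
  (hB : ∀ k < n,dig s (B k) = 0 ∨ dig s (B k) = tB k+1)
  (acc fl : ℕ) : ∃ acc' fl' u,half K s A B n acc fl f = f (acc+acc') fl' ∧
   acc'+u = ∑ k ∈ range n,tA k / kf K k*tB k ∧ (fl' = 0 → fl = 0 ∧ u = 0) := by
 induction n generalizing acc fl with
 | zero => exact ⟨0,fl,0,rfl,by simp,by simp⟩
 | succ k ih =>
  have key : half K s A B (k+1) acc fl f = Nat.rec (motive := fun _ => Bool)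
    (Nat.rec (motive := fun _ => Bool) (half K s A B k acc 1 f) (fun d _ => Nat.rec (motive := fun _ => Bool) (half K s A B k acc fl f) (fun _ _ => half K s A B k acc 1 f) d) (dig s (B k)))
   (fun a _ => Nat.rec (motive := fun _ => Bool) (half K s A B k acc fl f) (fun a' _ =>
    Nat.rec (motive := fun _ => Bool) (half K s A B k acc 1 f) (fun b _ => half K s A B k (acc+(a'+1) / kf K k*b) fl f) (dig s (B k))) a)
   (dig s (A k)) := rfl
  have ih' := ih (fun k hk => hA k (by omega)) (fun k hk => hB k (by omega))
  have unk : ∃ acc' fl' u,half K s A B k acc 1 f = f (acc+acc') fl' ∧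
   acc'+u = ∑ k ∈ range (k+1),tA k / kf K k*tB k ∧ (fl' = 0 → fl = 0 ∧ u = 0) := by
   obtain ⟨acc',fl',u,h1,h2,h3⟩ := ih' acc 1
   refine ⟨acc',fl',u+tA k / kf K k*tB k,h1,by rw [sum_range_succ]; omega,?_⟩
   intro h; have := h3 h; omega
  have zer : tA k / kf K k*tB k = 0 → ∃ acc' fl' u,half K s A B k acc fl f = f (acc+acc') fl' ∧
   acc'+u = ∑ k ∈ range (k+1),tA k / kf K k*tB k ∧ (fl' = 0 → fl = 0 ∧ u = 0) := by
   intro hz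
   obtain ⟨acc',fl',u,h1,h2,h3⟩ := ih' acc fl
   exact ⟨acc',fl',u,h1,by rw [sum_range_succ]; omega,h3⟩
  rw [key]
  rcases hA k (by omega) with h0 | h0 <;> rw [h0] <;> rcases hB k (by omega) with h1 | h1 <;> rw [h1]
  ·exact unk
  ·rcases ht : tB k with _ | t
   ·exact zer (by simp [ht])
   ·exact unk
  ·rcases ht : tA k with _ | t
   ·exact zer (by simp [ht])
   ·exact unk
  ·rcases ht : tA k with _ | t
   ·exact zer (by simp [ht])
   ·obtain ⟨acc',fl',u,h1,h2,h3⟩ := ih' (acc+(t+1) / kf K k*tB k) fl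
    refine ⟨acc'+(t+1) / kf K k*tB k,fl',u,?_,by rw [sum_range_succ,ht]; omega,h3⟩
    rw [show acc+(acc'+(t+1) / kf K k*tB k) = acc+(t+1) / kf K k*tB k+acc' by ring]; exact h1
def cst (K ST i j l k : ℕ) : ℕ :=
 bif beq (sf ST i) j && beq l k then Nat.mul (kf K i) (kf K k) else nat_lit 0
lemma cst_eq (K ST i j l k : ℕ) : cst K ST i j l k = (if sf ST i = j ∧ l = k then kf K i*kf K k else 0) := by
 unfold cst
 by_cases h : sf ST i = j ∧ l = k
 ·rw [if_pos h,h.1,h.2]; simp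
 ·have : (beq (sf ST i) j && beq l k) = false := by
   rw [←not_eq_true,and_eq_true,beq_eq,beq_eq]; exact h
  rw [this,if_neg h]; rfl
def eqchk (m K ST s i j l k : ℕ) : Bool :=
 half K s (fun n => cd i j (sf ST n)) (fun n => cd n l (sf ST k)) m
  (cst K ST i j l k) (nat_lit 0) fun a fa =>
 half K s (fun n => cd j l (sf ST n)) (fun n => cd i n (sf ST k)) m
  (cst K ST j l i k) (nat_lit 0) fun b fb =>
 (ble a b || !(beq fb 0)) && (ble b a || !(beq fa 0))
lemma eqchk_sound (H : Sol m K ST T) {s : ℕ} (h : Ag m T s) {i j l k : ℕ} (hi : i < m) (hj : j < m) (hl : l < m)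
  (hk : k < m) : eqchk m K ST s i j l k = true := by
 have hs := H.st_lt
 unfold eqchk
 rw [cst_eq,cst_eq]
 obtain ⟨a',fa,ua,h1,h2,h3⟩ := half_spec (K := K) s (fun n => cd i j (sf ST n)) (fun n => cd n l (sf ST k))
  (fun n => T i j (sf ST n)) (fun n => T n l (sf ST k)) (fun a fa =>
   half K s (fun n => cd j l (sf ST n)) (fun n => cd i n (sf ST k)) m
    (if sf ST j = l ∧ i = k then kf K j*kf K k else 0) 0 fun b fb =>
    (ble a b || !(beq fb 0)) && (ble b a || !(beq fa 0))) m
  (fun n hn => h i hi j hj _ (hs n hn)) (fun n hn => h n hn l hl _ (hs k hk))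
  (if sf ST i = j ∧ l = k then kf K i*kf K k else 0) 0
 rw [h1]
 generalize hca : (if sf ST i = j ∧ l = k then kf K i*kf K k else 0) = ca at *
 obtain ⟨b',fb,ub,g1,g2,g3⟩ := half_spec (K := K) s (fun n => cd j l (sf ST n)) (fun n => cd i n (sf ST k))
  (fun n => T j l (sf ST n)) (fun n => T i n (sf ST k)) (fun b fb =>
    (ble (ca+a') b || !(beq fb 0)) && (ble b (ca+a') || !(beq fa 0))) m
  (fun n hn => h j hj l hl _ (hs n hn)) (fun n hn => h i hi n hn _ (hs k hk))
  (if sf ST j = l ∧ i = k then kf K j*kf K k else 0) 0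
 rw [g1]
 have e := H.assoc i hi j hj l hl k hk
 rw [hca] at e
 generalize (if sf ST j = l ∧ i = k then kf K j*kf K k else 0) = cb at *
 simp only [and_eq_true,or_eq_true,ble_eq,not_eq_true',←not_eq_true,beq_eq]
 constructor
 ·by_cases hb : fb = 0
  ·left; have := g3 hb; omega
  ·right; exact hb
 ·by_cases hb : fa = 0
  ·left; have := h3 hb; omega
  ·right; exact hb
/-- closed set present (`true` if `S` is a proper closed set according to the state) -/
def clchk (m ST s : ℕ) (S : List ℕ) : Bool :=
 (S.all fun a => blt a m && S.any (beq (sf ST a))) && !S.isEmpty &&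
 ((List.range m).any fun c => !(S.any (beq c))) &&
 S.all fun a => S.all fun b => (List.range m).all fun c => S.any (beq c) || beq (dig s (cd a b (sf ST c))) 1
lemma any_beq (S : List ℕ) (c : ℕ) : S.any (beq c) = true ↔ c ∈ S := by
 rw [any_eq_true]
 constructor
 ·rintro ⟨x,hx,h⟩; rw [beq_eq] at h; exact h ▸ hx
 ·intro h; exact ⟨c,h,by simp⟩
lemma clchk_sound (H : Sol m K ST T) {s : ℕ} (h : Ag m T s) {S : List ℕ} : clchk m ST s S = false := by
 by_contra hc
 rw [Bool.not_eq_false] at hc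
 unfold clchk at hc
 simp only [and_eq_true,all_eq_true,any_beq,blt_eq,or_eq_true] at hc
 obtain ⟨⟨⟨h1,h2⟩,h3⟩,h4⟩ := hc
 obtain ⟨c,hc,h3⟩ := any_eq_true.1 h3
 have h3 : c ∉ S := by
  intro hcs; rw [(any_beq S c).2 hcs] at h3; simp at h3
 obtain ⟨a,ha,b,hb,d,hd,hdS,hT⟩ := H.conn S h1 (by rintro rfl; simp at h2) ⟨c,by simpa using hc,h3⟩
 rcases h4 a ha b hb d (by simpa using hd) with h5 | h5
 ·exact hdS h5
 ·rw [beq_eq] at h5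
  rcases h a (h1 a ha).1 b (h1 b hb).1 _ (H.st_lt d hd) with h6 | h6 <;> omega
/-- forbidden (completely described) assignments -/
def fbchk (s : ℕ) (F : List (List (ℕ × ℕ × ℕ × ℕ))) : Bool :=
 F.any fun L => L.all fun x => beq (dig s (cd x.1 x.2.1 x.2.2.1)) (x.2.2.2+1)
def Forb (m : ℕ) (T : ℕ → ℕ → ℕ → ℕ) (F : List (List (ℕ × ℕ × ℕ × ℕ))) : Prop :=
 ∀ L ∈ F,(∀ x ∈ L,x.1 < m ∧ x.2.1 < m ∧ x.2.2.1 < m) ∧ ¬ ∀ x ∈ L,T x.1 x.2.1 x.2.2.1 = x.2.2.2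
lemma fbchk_sound {s : ℕ} (h : Ag m T s) {F} (hF : Forb m T F) : fbchk s F = false := by
 by_contra hc
 rw [Bool.not_eq_false] at hc
 unfold fbchk at hc
 simp only [any_eq_true,all_eq_true,beq_eq] at hc
 obtain ⟨L,hL,hx⟩ := hc
 obtain ⟨h1,h2⟩ := hF L hL
 apply h2
 intro x hxL
 have a := h1 x hxL
 have b := hx x hxL
 rcases h _ a.1 _ a.2.1 _ a.2.2 with h6 | h6 <;> omega
noncomputable def run (m K ST : ℕ) (F : List (List (ℕ × ℕ × ℕ × ℕ))) (P : List Ins) : ℕ → Bool :=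
 List.rec (motive := fun _ => ℕ → Bool) (fun _ => false)
  (fun I _ ih s => Ins.rec (motive := fun _ => Bool)
   (fun i j k => blt i m && blt j m && blt k m && beq (dig s (cd i j k)) 0 && rowl K s i j m 0 0 fun sum _ =>
    cand (stp K i j k) (fun x => force (upd ST s i j k x) ih) ((rtot K ST i j - sum) / stp K i j k))
   (fun i j k => blt i m && blt j m && blt k m && fol ST s i j k m 0 0 fun sum c =>
    (!(beq ((rtot K ST i j - sum) % (c*stp K i j k)) 0)) || (beq c 0 && !(beq sum (rtot K ST i j)))
     || (blt 0 c && force (upd ST s i j k ((rtot K ST i j - sum) / c)) ih))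
   (fun i j => blt i m && blt j m && (!(rowchk m K ST s i j) || ih s))
   (fun i j l k => blt i m && blt j m && blt l m && blt k m && (!(eqchk m K ST s i j l k) || ih s))
   (fun S => clchk m ST s S || ih s)
   (fbchk s F || ih s) I) P
lemma run_sound (H : Sol m K ST T) {F} (hF : Forb m T F) (P : List Ins) {s : ℕ} (h : Ag m T s) :
  run m K ST F P s = false := by
 induction P generalizing s with
 | nil => rfl
 | cons I P ih =>
  by_contra hc
  rw [Bool.not_eq_false] at hc
  cases I with
  | br i j k =>
   replace hc : (blt i m && blt j m && blt k m && beq (dig s (cd i j k)) 0 && rowl K s i j m 0 0 fun sum _ =>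
    cand (stp K i j k) (fun x => force (upd ST s i j k x) (run m K ST F P)) ((rtot K ST i j - sum) / stp K i j k)) = true := hc
   simp only [and_eq_true,blt_eq,beq_eq] at hc
   obtain ⟨⟨⟨⟨hi,hj⟩,hk⟩,hd⟩,hc⟩ := hc
   obtain ⟨sum',g',u,h1,h2,h3,h4,h5⟩ := rowl_spec H h hi hj (fun sum _ =>
    cand (stp K i j k) (fun x => force (upd ST s i j k x) (run m K ST F P)) ((rtot K ST i j - sum) / stp K i j k)) m le_rfl 0 0
   rw [h1,zero_add] at hc
   have hr := H.row i hi j hj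
   have e : rtot K ST i j = sum'+u := by rw [rtot_eq]; omega
   obtain ⟨t,ht⟩ := stp_dvd H hi hj hk
   have hu := h5 k hk hd
   have hpos : 0 < stp K i j k :=
    Nat.lcm_pos (Nat.lcm_pos (H.kpos i hi) (H.kpos j hj)) (H.kpos k hk)
   have hc' := cand_spec hc t (by
    rw [Nat.le_div_iff_mul_le hpos,mul_comm,←ht]; omega)
   rw [force_eq,ih (Ag_upd H h hi hj hk (by rw [ht,mul_comm]))] at hc'
   exact absurd hc' (by simp)
  | fo i j k =>
   replace hc : (blt i m && blt j m && blt k m && fol ST s i j k m 0 0 fun sum c =>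
    (!(beq ((rtot K ST i j - sum) % (c*stp K i j k)) 0)) || (beq c 0 && !(beq sum (rtot K ST i j)))
     || (blt 0 c && force (upd ST s i j k ((rtot K ST i j - sum) / c)) (run m K ST F P))) = true := hc
   simp only [and_eq_true,blt_eq] at hc
   obtain ⟨⟨⟨hi,hj⟩,hk⟩,hc⟩ := hc
   obtain ⟨sum',c',h1,h2⟩ := fol_spec H h hi hj hk _ m le_rfl 0 0 hc
   rw [zero_add,zero_add] at h1
   have hr := H.row i hi j hj
   have e : rtot K ST i j - sum' = c'*T i j k := by rw [rtot_eq]; omega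
   have e' : rtot K ST i j = sum'+c'*T i j k := by rw [rtot_eq]; omega
   rw [e] at h1
   simp only [or_eq_true,and_eq_true,not_eq_true',←not_eq_true,beq_eq,blt_eq] at h1
   rcases h1 with (h1 | h1) | h1
   ·exact h1 (Nat.mod_eq_zero_of_dvd (mul_dvd_mul_left _ (stp_dvd H hi hj hk)))
   ·apply h1.2; rw [e',h1.1]; simp
   ·rw [force_eq,Nat.mul_div_cancel_left _ h1.1,ih (Ag_upd H h hi hj hk rfl)] at h1
    exact absurd h1.2 (by simp)
  | row i j =>
   replace hc : (blt i m && blt j m && (!(rowchk m K ST s i j) || run m K ST F P s)) = true := hc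
   simp only [and_eq_true,blt_eq] at hc
   rw [rowchk_sound H h hc.1.1 hc.1.2,ih h] at hc
   simp at hc
  | eq i j l k =>
   replace hc : (blt i m && blt j m && blt l m && blt k m && (!(eqchk m K ST s i j l k) || run m K ST F P s)) = true := hc
   simp only [and_eq_true,blt_eq] at hc
   rw [eqchk_sound H h hc.1.1.1.1 hc.1.1.1.2 hc.1.1.2 hc.1.2,ih h] at hc
   simp at hc
  | cl S =>
   replace hc : (clchk m ST s S || run m K ST F P s) = true := hc
   rw [clchk_sound H h,ih h] at hc
   simp at hc
  | fb =>
   replace hc : (fbchk s F || run m K ST F P s) = true := hc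
   rw [fbchk_sound h hF,ih h] at hc
   simp at hc
end Slv
namespace Slv
open Finset
def exk : List ℕ → List ℕ
 | [] => []
 | c :: cs => bif beq (c % 2) 0 then (c / 2) :: exk cs else (c / 2) :: (c / 2) :: exk cs
def exs : ℕ → List ℕ → List ℕ
 | _,[] => []
 | p,c :: cs => bif beq (c % 2) 0 then p :: exs (p+1) cs else (p+1) :: p :: exs (p+2) cs
def pack (b : ℕ) : List ℕ → ℕ
 | [] => 0
 | x :: l => x+2^b*pack b l
lemma pack_get (b : ℕ) (l : List ℕ) (h : ∀ x ∈ l,x < 2^b) (i : ℕ) :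
  (pack b l >>> (b*i)) % 2^b = l.getD i 0 := by
 induction l generalizing i with
 | nil => simp [pack]
 | cons x l ih =>
  have hx : x < 2^b := h x (by simp)
  rw [pack,Nat.shiftRight_eq_div_pow]
  cases i with
  | zero => simp [mod_eq_of_lt hx]
  | succ i =>
   rw [mul_add,mul_one,add_comm,add_comm (b*i),pow_add,←Nat.div_div_eq_div_mul,Nat.mul_add_div (by positivity),
    Nat.div_eq_of_lt hx,add_zero,←Nat.shiftRight_eq_div_pow,ih (fun x hx => h x (by simp [hx]))]
   simp
lemma kf_pack {l : List ℕ} (h : ∀ x ∈ l,x < 256) (i : ℕ) : kf (pack 8 l) i = l.getD i 0 :=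
 pack_get 8 l h i
lemma sf_pack {l : List ℕ} (h : ∀ x ∈ l,x < 16) (i : ℕ) : sf (pack 4 l) i = l.getD i 0 :=
 pack_get 4 l h i
end Slv
namespace Sch
open Finset
open Slv
section
variable {G Ω : Type*} [Group G] [MulAction G Ω] [Fintype Ω] [IsPretransitive G Ω]
open Classical in
noncomputable def code (a : Ω) (q : Q G Ω) : ℕ := 2*val q a+if star q = q then 0 else 1
open Classical in
noncomputable def Ex (L : List (Q G Ω)) : List (Q G Ω) := L.flatMap fun q => if star q = q then [q] else [q,star q]
lemma Ex_val (a : Ω) (L : List (Q G Ω)) : (Ex L).map (fun q => val q a) = exk (L.map (code a)) := by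
 induction L with
 | nil => rfl
 | cons q L ih =>
  classical
  have hE : Ex (q :: L) = (if star q = q then [q] else [q,star q]) ++ Ex L := by
   unfold Ex; rw [List.flatMap_cons]
  rw [hE,List.map_append,ih,List.map_cons,exk]
  by_cases h : star q = q
  ·have : code a q = 2*val q a := by simp [code,h]
   rw [if_pos h,this]
   simp
  ·have : code a q = 2*val q a+1 := by simp [code,h]
   rw [if_neg h,this]
   have h2 : (2*val q a+1) / 2 = val q a := by omega
   have h3 : (2*val q a+1) % 2 = 1 := by omega
   rw [h2,h3]
   simp only [List.map_cons,map_nil,val_star]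
   rfl
lemma Ex_star (a : Ω) (L pre : List (Q G Ω)) :
  (exs pre.length (L.map (code a))).map (fun t => (pre ++ Ex L)[t]?) = (Ex L).map (fun q => some (star q)) := by
 induction L generalizing pre with
 | nil => rfl
 | cons q L ih =>
  classical
  have hE : Ex (q :: L) = (if star q = q then [q] else [q,star q]) ++ Ex L := by
   unfold Ex; rw [List.flatMap_cons]
  rw [hE,List.map_cons,exs]
  by_cases h : star q = q
  ·have : code a q = 2*val q a := by simp [code,h]
   rw [if_pos h,this]
   have := ih (pre ++ [q])
   simp only [List.length_append,List.length_singleton,List.append_assoc] at this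
   simp [h]
   simpa using this
  ·have : code a q = 2*val q a+1 := by simp [code,h]
   rw [if_neg h,this]
   have h3 : (2*val q a+1) % 2 = 1 := by omega
   rw [h3]
   have := ih (pre ++ [q,star q])
   simp only [List.length_append,List.append_assoc] at this
   simp only [List.map_append,List.map_cons,map_nil,star_star]
   change List.map _ ((pre.length+1) :: pre.length :: exs (pre.length+2) (List.map (code a) L)) = _
   simp only [List.map_cons]
   simpa using this
lemma exists_enum (a : Ω) : ∃ L : List (Q G Ω),(L.map (code a)).Pairwise (· ≥ ·) ∧ (Ex L).Nodup ∧
  ∀ q,q ∈ Ex L ↔ q ≠ col G a a := by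
 classical
 letI : Fintype (Q G Ω) := ofSurjective (fun b => col G a b) (exists_col a)
 let f := Fintype.equivFin (Q G Ω)
 have hDs : star (col G a a) = col G a a := rfl
 let R : Finset (Q G Ω) := {q | q ≠ col G a a ∧ f q ≤ f (star q)}
 let L := R.toList.insertionSort (fun p q => code a p ≥ code a q)
 have hperm : L.Perm R.toList := List.perm_insertionSort _ _
 have hmem : ∀ q,q ∈ L ↔ q ≠ col G a a ∧ f q ≤ f (star q) := by
  intro q; rw [hperm.mem_iff]; simp [R]
 have : Std.Total (fun p q : Q G Ω => code a p ≥ code a q) := ⟨fun p q => le_total _ _⟩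
 have : IsTrans (Q G Ω) (fun p q : Q G Ω => code a p ≥ code a q) := ⟨fun p q r h h' => le_trans h' h⟩
 refine ⟨L,?_,?_,?_⟩
 ·rw [List.pairwise_map]
  exact List.pairwise_insertionSort (fun p q => code a p ≥ code a q) _
 ·unfold Ex
  rw [List.nodup_flatMap]
  refine ⟨?_,?_⟩
  ·intro q _
   split_ifs with h
   ·simp
   ·simp [Ne.symm h]
  ·have hnd : L.Nodup := hperm.nodup_iff.2 (Finset.nodup_toList R)
   refine (List.Pairwise.and_mem.1 hnd).imp ?_
   rintro p q ⟨hp,hq,hne⟩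
   rw [hmem] at hp hq
   have h1 : star p ≠ q := by
    rintro rfl
    rw [star_star] at hq
    exact hne (f.injective (le_antisymm hp.2 hq.2))
   have h1' : p ≠ star q := by
    rintro rfl
    exact h1 (star_star q)
   have h2 : star p ≠ star q := fun h => hne (by rw [←star_star p,h,star_star])
   intro x hx hx'
   dsimp only [Function.onFun] at hx hx'
   split_ifs at hx hx' <;> simp at hx hx' <;> (try rcases hx with rfl | rfl) <;> (try rcases hx' with h | h) <;> simp_all
 ·intro q
  unfold Ex
  rw [List.mem_flatMap]
  constructor
  ·rintro ⟨p,hp,hq⟩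
   rw [hmem] at hp
   split_ifs at hq with h
   ·simp at hq; exact hq ▸ hp.1
   ·simp at hq
    rcases hq with rfl | rfl
    ·exact hp.1
    ·intro h'; apply hp.1; rw [←star_star p,h',hDs]
  ·intro hq
   rcases le_total (f q) (f (star q)) with h | h
   ·exact ⟨q,(hmem q).2 ⟨hq,h⟩,by split_ifs <;> simp⟩
   ·refine ⟨star q,(hmem _).2 ⟨?_,by rwa [star_star]⟩,?_⟩
    ·intro h'; apply hq; rw [←star_star q,h',hDs]
    ·rw [star_star]; split_ifs with h <;> simp; exact h
variable [Finite G] [FaithfulSMul G Ω]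
noncomputable def eI (a : Ω) (L : List (Q G Ω)) (i : ℕ) : Q G Ω := (Ex L).getD i (col G a a)
variable {a : Ω} {L : List (Q G Ω)}
lemma eI_eq {i : ℕ} (hi : i < (Ex L).length) : eI a L i = (Ex L)[i] := by
 simp [eI,hi]
lemma eI_mem {i : ℕ} (hi : i < (Ex L).length) : eI a L i ∈ Ex L := by
 rw [eI_eq hi]; simp
lemma eI_inj (hn : (Ex L).Nodup) {i j : ℕ} (hi : i < (Ex L).length) (hj : j < (Ex L).length)
  (h : eI a L i = eI a L j) : i = j := by
 rw [eI_eq hi,eI_eq hj] at h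
 exact (hn.getElem_inj_iff).1 h
lemma eI_surj (hm : ∀ q,q ∈ Ex L ↔ q ≠ col G a a) {q : Q G Ω} (hq : q ≠ col G a a) :
  ∃ i < (Ex L).length,eI a L i = q := by
 obtain ⟨i,hi,h⟩ := List.mem_iff_getElem.1 ((hm q).2 hq)
 exact ⟨i,hi,by rw [eI_eq hi,h]⟩
lemma sum_eI [Fintype (Q G Ω)] (hn : (Ex L).Nodup) (hm : ∀ q,q ∈ Ex L ↔ q ≠ col G a a) {M : Type*} [AddCommMonoid M] (f : Q G Ω → M) :
  ∑ n ∈ range (Ex L).length,f (eI a L n)+f (col G a a) = ∑ q,f q := by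
 classical
 rw [←Finset.sum_erase_add _ _ (mem_univ (col G a a))]
 congr 1
 refine Finset.sum_bij (fun n _ => eI a L n) ?_ ?_ ?_ ?_
 ·intro n hn; simp at hn; simpa using (hm _).1 (eI_mem hn)
 ·intro i hi j hj h; simp at hi hj; exact eI_inj hn hi hj h
 ·intro q hq; simp at hq
  obtain ⟨i,hi,h⟩ := eI_surj hm hq
  exact ⟨i,by simpa using hi,h⟩
 ·intros; rfl
lemma val_le_card (q : Q G Ω) (b : Ω) : val q b ≤ Fintype.card Ω := by
 unfold val; exact Finset.card_le_univ _
lemma val_diag (b x : Ω) : val (col G b b) x = 1 := by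
  classical
  unfold val; rw [card_eq_one]
  refine ⟨x,?_⟩
  ext y; simp only [mem_filter,mem_univ,true_and,mem_singleton]; rw [col_diag b]; exact eq_comm
lemma kf_eI (hc : Fintype.card Ω < 256) {i : ℕ} (hi : i < (Ex L).length) :
  kf (pack 8 (exk (L.map (code a)))) i = val (eI a L i) a := by
 rw [kf_pack,←Ex_val,eI_eq hi]
 ·simp [hi]
 ·rw [←Ex_val]; intro x hx; simp at hx
  obtain ⟨q,_,rfl⟩ := hx
  exact lt_of_le_of_lt (val_le_card _ _) hc
lemma sf_eI (hl : (Ex L).length ≤ 8) (a : Ω) {i : ℕ} (hi : i < (Ex L).length) :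
  sf (pack 4 (exs 0 (L.map (code a)))) i < (Ex L).length ∧
  eI a L (sf (pack 4 (exs 0 (L.map (code a)))) i) = star (eI a L i) := by
 have h := Ex_star a L []
 simp only [List.length_nil,List.nil_append] at h
 have hlen : (exs 0 (L.map (code a))).length = (Ex L).length := by
  have := congrArg List.length h; simpa using this
 have key : ∀ j (hj : j < (exs 0 (L.map (code a))).length),(Ex L)[(exs 0 (L.map (code a)))[j]]? = some (star ((Ex L)[j]'(hlen ▸ hj))) := by
  intro j hj
  have h1 : j < (List.map (fun t => (Ex L)[t]?) (exs 0 (List.map (code a) L))).length := by simpa using hj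
  have := List.getElem_of_eq h h1
  simpa using this
 have key2 : ∀ j (hj : j < (exs 0 (L.map (code a))).length),(exs 0 (L.map (code a)))[j] < (Ex L).length := by
  intro j hj
  by_contra hcon
  have := key j hj
  rw [List.getElem?_eq_none (by omega)] at this
  exact absurd this (by simp)
 rw [sf_pack]
 ·have hi' : i < (exs 0 (L.map (code a))).length := hlen ▸ hi
  rw [List.getD_eq_getElem _ _ hi']
  refine ⟨key2 i hi',?_⟩
  rw [eI_eq (key2 i hi'),eI_eq hi]
  have := key i hi'
  rw [List.getElem?_eq_getElem (key2 i hi')] at this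
  exact Option.some.inj this
 ·intro x hx
  obtain ⟨j,hj,rfl⟩ := List.mem_iff_getElem.1 hx
  have := key2 j hj
  omega
lemma sol (hP : Prim G Ω) (hc : Fintype.card Ω ≤ 48) (hl : (Ex L).length ≤ 8) (hn : (Ex L).Nodup)
  (hm : ∀ q,q ∈ Ex L ↔ q ≠ col G a a) :
  Sol (Ex L).length (pack 8 (exk (L.map (code a)))) (pack 4 (exs 0 (L.map (code a))))
   (fun i j k => TT (eI a L i) (eI a L j) (eI a L k) a) := by
 classical
 letI : Fintype (Q G Ω) := ofSurjective (fun b => col G a b) (exists_col a)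
 have hk : ∀ i < (Ex L).length,kf (pack 8 (exk (L.map (code a)))) i = val (eI a L i) a := fun i hi => kf_eI (by omega) hi
 have hs1 : ∀ i < (Ex L).length,sf (pack 4 (exs 0 (L.map (code a)))) i < (Ex L).length := fun i hi => (sf_eI hl a hi).1
 have hs2 : ∀ i < (Ex L).length,eI a L (sf (pack 4 (exs 0 (L.map (code a)))) i) = star (eI a L i) := fun i hi => (sf_eI hl a hi).2
 generalize pack 8 (exk (L.map (code a))) = K at *
 generalize pack 4 (exs 0 (L.map (code a))) = ST at *
 have hs3 : ∀ i < (Ex L).length,∀ j < (Ex L).length,(sf ST i = j ↔ eI a L j = star (eI a L i)) := by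
  intro i hi j hj
  rw [←hs2 i hi]
  constructor
  ·rintro rfl; rfl
  ·intro h; exact (eI_inj hn hj (hs1 i hi) h).symm
 have hne : ∀ i < (Ex L).length,eI a L i ≠ col G a a := fun i hi => (hm _).1 (eI_mem hi)
 choose R hR using (fun q : Q G Ω => (⟨(a,(exists_col a q).choose),(exists_col a q).choose_spec⟩ : ∃ x : Ω × Ω,col G x.1 x.2 = q))
 have hpp : ∀ i j l x y,col G x y = l → pp i j x y = TT i j (star l) a / val l a := by
  intro i j l x y h
  rw [TT_pp a i j l h,Nat.mul_div_cancel_left _ (val_pos _ _)]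
 refine ⟨hl,hs1,?_,?_,?_,?_,?_,?_,?_,?_⟩
 ·intro i _ j _ k _; exact TT_cyc ..
 ·intro i hi j hj k hk; rw [hs2 i hi,hs2 j hj,hs2 k hk]; exact TT_rev ..
 ·intro i hi j hj k hk'; rw [hk i hi,TT_cyc]; exact val_dvd_TT ..
 ·intro i hi; rw [hk i hi]; exact val_pos ..
 ·intro i hi j hj
  rw [hk i hi,hk j hj,←sum_TT,←sum_eI hn hm,TT_diag]
  simp only [hs3 i hi j hj]
 ·intro i hi j hj l hl k hkk
  have hA := assoc (eI a L i) (eI a L j) (eI a L l) (R (eI a L k)).1 (R (eI a L k)).2 R hR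
  rw [←sum_eI hn hm,←sum_eI hn hm] at hA
  have hA := congrArg (fun t => val (eI a L k) a*t) hA
  rw [mul_add,mul_add,mul_sum,mul_sum] at hA
  have e0 : ∀ i j : Q G Ω,pp i j (R (col G a a)).1 (R (col G a a)).2 = if j = star i then val i a else 0 := by
   intro i j
   rw [hpp i j _ _ _ (hR _),val_diag,Nat.div_one,star_col,TT_diag]
  have e1 : ∀ i l : Q G Ω,val (eI a L k) a*pp i l (R (eI a L k)).1 (R (eI a L k)).2 = TT i l (star (eI a L k)) a := by
   intro i l
   rw [TT_pp a i l _ (hR _)]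
  have e2 : ∀ n,val (eI a L k) a*(pp (eI a L i) (eI a L j) (R n).1 (R n).2*pp n (eI a L l) (R (eI a L k)).1 (R (eI a L k)).2)
    = TT (eI a L i) (eI a L j) (star n) a / val n a*TT n (eI a L l) (star (eI a L k)) a := by
   intro n; rw [←e1,hpp _ _ _ _ _ (hR n)]; ring
  have e3 : ∀ n,val (eI a L k) a*(pp (eI a L j) (eI a L l) (R n).1 (R n).2*pp (eI a L i) n (R (eI a L k)).1 (R (eI a L k)).2)
    = TT (eI a L j) (eI a L l) (star n) a / val n a*TT (eI a L i) n (star (eI a L k)) a := by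
   intro n; rw [←e1,hpp _ _ _ _ _ (hR n)]; ring
  simp only [e2,e3] at hA
  rw [star_col,TT_diag,TT_diag,val_diag,Nat.div_one,Nat.div_one] at hA
  have d1 : ∀ l,TT (col G a a) l (star (eI a L k)) a = if l = eI a L k then val (eI a L k) a else 0 := by
   intro l
   rw [TT_cyc,TT_diag]
   by_cases h : l = eI a L k
   ·simp [h]
   ·have : star (eI a L k) ≠ star l := fun h' => h (by rw [←star_star l,←h',star_star])
    simp [h,this]
  have d2 : ∀ l,TT l (col G a a) (star (eI a L k)) a = if l = eI a L k then val (eI a L k) a else 0 := by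
   intro l
   rw [TT_cyc,TT_cyc,TT_diag,star_star,val_star]
  rw [d1,d2] at hA
  have f1 : (if sf ST i = j ∧ l = k then kf K i*kf K k else 0) = (if eI a L j = star (eI a L i) then val (eI a L i) a else 0) *
    if eI a L l = eI a L k then val (eI a L k) a else 0 := by
   rw [hk i hi,hk k hkk]
   have : l = k ↔ eI a L l = eI a L k := ⟨fun h => by rw [h],eI_inj hn hl hkk⟩
   simp only [hs3 i hi j hj,this]
   by_cases hu : eI a L j = star (eI a L i) <;> by_cases hv : eI a L l = eI a L k <;> simp [hu,hv]
  have f2 : (if sf ST j = l ∧ i = k then kf K j*kf K k else 0) = (if eI a L l = star (eI a L j) then val (eI a L j) a else 0) *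
    if eI a L i = eI a L k then val (eI a L k) a else 0 := by
   rw [hk j hj,hk k hkk]
   have : i = k ↔ eI a L i = eI a L k := ⟨fun h => by rw [h],eI_inj hn hi hkk⟩
   simp only [hs3 j hj l hl,this]
   by_cases hu : eI a L l = star (eI a L j) <;> by_cases hv : eI a L i = eI a L k <;> simp [hu,hv]
  rw [f1,f2,add_comm,add_comm (_*_)]
  convert hA using 2
  ·refine sum_congr rfl fun n hn' => ?_
   rw [mem_range] at hn'
   rw [hk n hn',hs2 n hn',hs2 k hkk]
  ·refine sum_congr rfl fun n hn' => ?_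
   rw [mem_range] at hn'
   rw [hk n hn',hs2 n hn',hs2 k hkk]
 ·intro S hS hS0 ⟨c,hc,hcS⟩
  by_contra hcon
  push Not at hcon
  have key := hP (fun x y => x = y ∨ ∃ i ∈ S,col G x y = eI a L i) ⟨fun _ => Or.inl rfl,by
   rintro x y (h | ⟨i,hi,h⟩)
   ·exact Or.inl h.symm
   ·exact Or.inr ⟨sf ST i,(hS i hi).2,by rw [hs2 i (hS i hi).1,col_star,h]⟩,by
   rintro x y z (rfl | ⟨i,hi,h⟩) (rfl | ⟨j,hj,h'⟩)
   ·exact Or.inl rfl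
   ·exact Or.inr ⟨j,hj,h'⟩
   ·exact Or.inr ⟨i,hi,h⟩
   ·by_cases hxz : x = z
    ·exact Or.inl hxz
    ·obtain ⟨t,ht,hte⟩ := eI_surj (q := col G x z) hm (by rw [Ne,col_diag]; exact hxz)
     by_cases hts : t ∈ S
     ·exact Or.inr ⟨t,hts,hte.symm⟩
     ·have h0 := hcon i hi j hj t ht hts
      rw [hs2 t ht,TT_pp a _ _ _ hte.symm,Nat.mul_eq_zero] at h0
      rcases h0 with h0 | h0
      ·exact absurd h0 (val_pos _ _).ne'
      ·rw [pp,Finset.card_eq_zero] at h0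
       have : y ∈ ({z_1 | col G x z_1 = eI a L i ∧ col G z_1 z = eI a L j} : Finset Ω) := by simp [h,h']
       rw [h0] at this; simp at this⟩ (by
   rintro g x y (rfl | ⟨i,hi,h⟩)
   ·exact Or.inl rfl
   ·exact Or.inr ⟨i,hi,by rw [col_smul,h]⟩)
  rcases key with h | h
  ·obtain ⟨i,hi⟩ := List.exists_mem_of_ne_nil S hS0
   obtain ⟨b,hb⟩ := exists_col a (eI a L i)
   have := h a b (Or.inr ⟨i,hi,hb⟩)
   exact hne i (hS i hi).1 (by rw [←hb,this])
  ·obtain ⟨b,hb⟩ := exists_col a (eI a L c)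
   rcases h a b with h | ⟨i,hi,h⟩
   ·exact hne c hc (by rw [←hb,h])
   ·rw [hb] at h
    have := eI_inj hn hc (hS i hi).1 h
    exact hcS (this ▸ hi)
 ·intro i hi j hj k hk
  have : TT (eI a L i) (eI a L j) (eI a L k) a ≤ val (eI a L i) a*val (eI a L j) a := by
   rw [←sum_TT]; exact Finset.single_le_sum (f := fun k => TT (eI a L i) (eI a L j) k a) (fun _ _ => Nat.zero_le _) (mem_univ _)
  have h1 := val_le_card (eI a L i) a
  have h2 := val_le_card (eI a L j) a
  nlinarith
end
end Sch
namespace Slv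
open Finset
def wt (c : ℕ) : ℕ := Nat.mul (Nat.div c 2) (Nat.succ (Nat.mod c 2))
def srch (chk : List ℕ → Bool) (lo : ℕ) : ℕ → ℕ → ℕ → ℕ → List ℕ → Bool
 | 0,_,_,_,_ => false
 | f+1,rem,mx,h,cur =>
  bif beq rem 0 then chk cur else
  bif blt mx (Nat.mul 2 lo) then true else
   (bif ble (wt mx) rem && !(beq (Nat.gcd h (Nat.div mx 2)) 1) then
    force (Nat.sub rem (wt mx)) fun r => force (bif beq h 0 then Nat.div mx 2 else h) fun h' => srch chk lo f r mx h' (mx :: cur)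
    else true) && force (Nat.pred mx) fun m' => srch chk lo f rem m' h cur
def nxt (h : ℕ) (l : List ℕ) : ℕ := if h = 0 then l.headD 0 / 2 else h
lemma srch_sound (chk : List ℕ → Bool) (lo : ℕ) (hlo : 2 ≤ lo) (f rem mx h : ℕ) (cur : List ℕ) (H : srch chk lo f rem mx h cur = true)
  (l : List ℕ) (hd : l.Pairwise (· ≥ ·)) (hmx : ∀ c ∈ l,c ≤ mx) (hl : ∀ c ∈ l,2*lo ≤ c)
  (hs : (l.map wt).sum = rem) (hg : ∀ c ∈ l,Nat.gcd (nxt h l) (c / 2) ≠ 1) : chk (l.reverse ++ cur) = true := by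
 induction f generalizing rem mx h cur l with
 | zero => simp [srch] at H
 | succ f ih =>
  rw [srch] at H
  have hwpos : ∀ c ∈ l,0 < wt c := fun c hc => by
   have := hl c hc
   unfold wt
   apply Nat.mul_pos
   ·change 0 < c / 2; omega
   ·omega
  cases l with
  | nil =>
   simp at hs
   subst hs
   simpa using H
  | cons c l =>
   have hr : beq rem 0 = false := by
    have := hwpos c (by simp)
    simp at hs
    rw [←not_eq_true,beq_eq]
    omega
   rw [hr,cond_false] at H
   have hb : blt mx (Nat.mul 2 lo) = false := by
    rw [←not_eq_true,blt_eq]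
    have h1 := hl c (by simp)
    have h2 := hmx c (by simp)
    change ¬ (mx < 2*lo); omega
   rw [hb,cond_false,and_eq_true,force_eq] at H
   by_cases hc : c = mx
   ·subst hc
    have H1 := H.1
    have e1 : ble (wt c) rem = true := by
     rw [ble_eq]; simp at hs; omega
    have e2 : beq (Nat.gcd h (Nat.div c 2)) 1 = false := by
     rw [←not_eq_true,beq_eq]
     change ¬ (Nat.gcd h (c / 2) = 1)
     have := hg c (by simp)
     have h2 := hl c (by simp)
     unfold nxt at this
     split_ifs at this with h0
     ·subst h0; rw [Nat.gcd_zero_left]; omega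
     ·exact this
    rw [e1,e2] at H1
    simp only [Bool.not_false,Bool.and_true,cond_true,force_eq] at H1
    have := ih _ _ _ _ H1 l (List.Pairwise.of_cons hd) (fun d hd' => List.rel_of_pairwise_cons hd hd')
     (fun d hd => hl d (by simp [hd])) (by simp at hs; change _ = rem - wt c; omega) ?_
    ·simpa using this
    ·intro d hd'
     have := hg d (by simp [hd'])
     convert this using 2
     unfold nxt
     by_cases h0 : h = 0
     ·subst h0
      have h2 := hl c (by simp)
      have : c / 2 ≠ 0 := by omega
      change (if c / 2 = 0 then _ else c / 2) = _
      simp [this]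
     ·have : beq h 0 = false := by rw [←not_eq_true,beq_eq]; exact h0
      rw [this]; simp [h0]
   ·have H2 := H.2
    rw [force_eq] at H2
    refine ih _ _ _ _ H2 (c :: l) hd ?_ hl hs hg
    have h2 := hmx c (by simp)
    intro d hd'
    have : d ≤ c := by
     rcases List.mem_cons.1 hd' with h | h
     ·exact h.le
     ·exact List.rel_of_pairwise_cons hd h
    change d ≤ mx - 1
    omega
def leq : List ℕ → List ℕ → Bool
 | [],[] => true
 | a :: l,b :: l' => beq a b && leq l l'
 | _,_ => false
lemma leq_eq (l l' : List ℕ) (h : leq l l' = true) : l = l' := by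
 induction l generalizing l' with
 | nil => cases l' <;> simp [leq] at *
 | cons a l ih =>
  cases l' with
  | nil => simp [leq] at h
  | cons b l' =>
   simp only [leq,and_eq_true,beq_eq] at h
   rw [h.1,ih _ h.2]
def prs : List ℕ := [3,5,7,11,13,17,19,23,29,31,37,41,43,47]
def good (cs : List ℕ) : Bool :=
 (cs.all fun c => prs.all fun p => !(beq (Nat.mod (Nat.div c 2) p) 0) || cs.all fun c' => ble p (Nat.div c' 2)) &&
 (cs.all fun c => cs.all fun c' => !(blt (Nat.div c 2) (Nat.div c' 2)) || (!(beq (Nat.gcd (Nat.div c 2) (Nat.div c' 2)) 1) ||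
  cs.any fun d => blt (Nat.div c' 2) (Nat.div d 2) && beq (Nat.mod (Nat.mul (Nat.div c 2) (Nat.div c' 2)) (Nat.div d 2)) 0))
lemma good_of (cs : List ℕ) (h1 : ∀ p : ℕ,p.Prime → ∀ c ∈ cs,∀ c' ∈ cs,p ∣ c / 2 → p ≤ c' / 2)
  (h2 : ∀ c ∈ cs,∀ c' ∈ cs,c / 2 < c' / 2 → Coprime (c / 2) (c' / 2) → ∃ d ∈ cs,c' / 2 < d / 2 ∧ d / 2 ∣ (c / 2)*(c' / 2)) :
  good cs = true := by
 have hp : ∀ p ∈ prs,p.Prime := by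
  intro p hp; simp only [prs,List.mem_cons,not_mem_nil,or_false] at hp
  rcases hp with rfl | rfl | rfl | rfl | rfl | rfl | rfl | rfl | rfl | rfl | rfl | rfl | rfl | rfl <;> norm_num
 unfold good
 simp only [and_eq_true,all_eq_true,or_eq_true,not_eq_true',any_eq_true]
 constructor
 ·intro c hc p hp'
  by_cases h : beq (Nat.mod (Nat.div c 2) p) 0 = true
  ·right
   rw [beq_eq] at h
   intro c' hc'
   rw [ble_eq]
   exact h1 p (hp p hp') c hc c' hc' (Nat.dvd_of_mod_eq_zero h)
  ·left; rwa [not_eq_true] at h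
 ·intro c hc c' hc'
  by_cases h : c / 2 < c' / 2
  ·right
   by_cases h' : Coprime (c / 2) (c' / 2)
   ·right
    obtain ⟨d,hd,hd1,hd2⟩ := h2 c hc c' hc' h h'
    refine ⟨d,hd,?_,?_⟩
    ·rw [blt_eq]; exact hd1
    ·rw [beq_eq]; exact Nat.mod_eq_zero_of_dvd hd2
   ·left
    rw [←not_eq_true,beq_eq]; exact h'
  ·left
   rw [←not_eq_true,blt_eq]; exact h
def chkT (n : ℕ) (tb : List (List ℕ × List Ins)) (cur : List ℕ) : Bool :=
 !(good cur.reverse) || (leq cur [2*n] || (leq cur [24,28,42] || (leq cur [24,30,40] || tb.any fun e => leq e.1 cur.reverse)))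
noncomputable def runT (e : List ℕ × List Ins) : Bool :=
 ble (exk e.1).length 8 && force (pack 8 (exk e.1)) fun K => force (pack 4 (exs 0 e.1)) fun S => force ((exk e.1).length) fun m => run m K S [] e.2 0
end Slv
section
set_option maxHeartbeats 0
set_option maxRecDepth 100000
namespace Slv
open Finset
/-- Decodes a certificate: a number whose octal digits (lowest first) spell the instructions. -/
def dec : ℕ → ℕ → List Ins
 | 0,_ => []
 | f+1,n =>
  bif beq n 0 then []
  else bif beq (n % 8) 1 then .br (n / 8 % 8) (n / 64 % 8) (n / 512 % 8) :: dec f (n / 4096)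
  else bif beq (n % 8) 2 then .fo (n / 8 % 8) (n / 64 % 8) (n / 512 % 8) :: dec f (n / 4096)
  else bif beq (n % 8) 3 then .row (n / 8 % 8) (n / 64 % 8) :: dec f (n / 512)
  else bif beq (n % 8) 4 then
   .eq (n / 8 % 8) (n / 64 % 8) (n / 512 % 8) (n / 4096 % 8) :: dec f (n / 32768)
  else .cl ((List.range (n / 8 % 8)).map fun i => n / 64 / 8^i % 8) :: dec f (n / 64 / 8^(n / 8 % 8))
/-- The certificates. -/
def table : List (List ℕ × List Ins) := ([
 ([60,24,10],25203550577917782340752567490230675441556459665),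
 ([60,13,10],49671283812133467017036242563412123137325882123628315754314607032815610748415611097),
 ([60,12,12,10],7985857983760243495601491919347100209127899795104055497719754254050763560041530576776364719721076436012275191054700761),
 ([56,24,14],51879130777533779070177970905087457459563941658399377),
 ([48,30,16],51879130777533779070177970905087457459563941658399377),
 ([48,18,16,12],806303023943234770736193468166947565157928143325876627629461339224885221021085640782581961),
 ([44,28,22],2063296844594764413521661260048288223889),
 ([42,24,15],17795751554783640158285078652057834820241),
 ([42,24,14,14],1478930597211493400561711575234554313793930773206589824472905954431633),
 ([40,30,13],6721366690503757795423102847395691529834641),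
 ([40,30,12,12],14410682027439617830127868211221043519765171189785985489043595395430473248494794578442810202195558312808657),
 ([40,24,20,10],73656536055125874397293944563823301881492443731232329624264905578800006614218253104233686701844206692178998434725830613792799790302302937),
 ([40,24,11,10],959866508338658952171582439434294811269699607618519038965303253930893146873936062638820997381421940403732260988551012554316969979386086666531983549470012312461841041),
 ([40,24,10,10,10],1384003842593648201169274978942263739251985491568321274057749893130487445560380395465678453812926781537748727374238342269404447251324589273652594643071794146610381589922457642960078363508585976970008797405591999686118352583920856692117440448762513),
 ([40,20,13,10],19804175509176271875048657300522222929231803065651601656764818753485329811120534007952819275028425450786961),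
 ([40,20,12,12,10],4729159469852849018118912372271695335901286784639771307244078692510666711413825913939804011197333026203907379740933731107363164305),
 ([36,24,18,16],34430208062809611107716315348695621599339778236651641221338517840641919549294088409),
 ([36,21,18],72222399142638714809794020384325528517245306099241689),
 ([36,20,20,18],256535439017533376056777773330636445442867821262515919552497399542301168345),
 ([36,18,16,13],446979363825588718866569548699294764894491606842397175835578445733355136881571069090641809553),
 ([36,18,16,12,12],22984236607549613730591703073514573380656652771081043572100057622553692637502726309844813163174462556530097080111257178138940542692566510812341320743521750659996177960707998365207331190396143496174571260853054641836177),
 ([31,24,10],3378754293984316368333379573717929478818116266488271918175449),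
 ([31,13,10],20307564282084125110538274522619590436311159656750481080546670447697876511454885615809814921452240835873),
 ([31,12,12,10],212791346300217170057114586059793598805389179768582632813938762699540557448530107700513),
 ([30,30,24,10],4443703583642990128909149287011439394261235495652280398902312334399915821048778299237068281316614270034190174723388102882557170905),
 ([30,30,13,10],26807266827722042960834988450609860993836544108923527577012012680658418355598541841908800631529010371791835474548641670437382005935976813857),
 ([30,30,12,12,10],2255038968384326422387927677372419588705341607895915958690979368349703674595051156301143881177510718525969579510395640616225),
 ([30,24,21],4996291856308655766505548990123389855044101199745775169231362850681260605456069892936509074048881297),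
 ([30,24,20,20],493747131172269622979223384844705152316208045337294799681335093271792570441751788507622515202886939862269749299427660101701497402529342713025112596082922201),
 ([30,24,20,11],68818330445976297918287202459550113359868052894544749462873874067750557117791395347063360643487650885940062658780795601),
 ([30,24,20,10,10],4333783156018775807864004426373231595851249131122163245690280290710749723834429481518595171804064926650822154504671599423717708561),
 ([30,24,18,12,10],39696411981741964142542980241268842436641718450900377278945795924458996355372819956997187105161286273),
 ([30,24,11,11],165819000428684276854978667755955750538972958049137235909867217022790111932825796791001747345987952456831633),
 ([30,24,11,10,10],105826115292677360541334497725184553734938296520412741930750314466592214787607089143987139917564023502472373819933392052400610441431945873),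
 ([30,24,10,10,10,10],889467107015064076719960669455523846947411337145636373184930375786454662586683003512522945811916202844809513738701363052801983753270648002549885526245008499437681035193571371660340962778032028626511587391890068177),
 ([30,21,13],80135682569449161653355656119500599403227925159138112441800160486333530214866570523838306226273340895245141167649517017017432452166450171458329),
 ([30,21,12,12],7535068878966739851099503368653135627119372446464452959510928525997744797086034176215291428060207454525691325760031710917409),
 ([30,20,20,13],59927879512564745222113788246781895164649613718285765747481823832117571309868221692038278786549911769),
 ([30,20,20,12,12],91156861848471605235639075610696376391790264169419558760583301575119326325485587182145112447074302196028747867222807769),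
 ([30,20,13,11],126899605983899094533011039523967542067786912322514698772134878340658706130918804230150828188940181648961056354835632464805112921140473015294732792407026207972267297),
 ([30,20,13,10,10],345783059948718763138110634143973295048248883893783884394448945319870609703936887744637214946073423581393801645669645564487482467791547337348747896280592788121367102266478901499233),
 ([30,20,12,12,11],431968051844784937655605077486885460987661707398109927551857037267368458174171555279647785057457289553907933394197951933163234485678481993257462695065769316592878413634791150881),
 ([30,20,12,12,10,10],10649120441865924197146188367541676229209027716671443193224448203377965759286462879694693140467432620065545556033905842441757842236985179521815905),
 ([30,19,18,10],620178102792590846137028322071719063939022524214977184180197452790236854486864898571829427442544173759195124513),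
 ([30,18,18,18,10],2517542670478547390620870428702035374255807598105649287073280896967984859421652905355816783413524715150300378286401878035127962168110907265825),
 ([30,18,13,12,10],59108428689141533268901141343429672509341266919885438176087676837280036945959761678340147670157561412516427292015633914088635373449195885250592607781295788169),
 ([30,18,12,12,12,10],78568578197508092598386293874491958090327858383446884755298950303954377294972541273284610428499234672954760053476751003725655813259511835781565392725645410846700399539802904409772821227621879945),
 ([30,13,11,11],135742370928331562926688153327452513038987583765653994547426108947774800996170702497442006436109552948199618838353148462838178163383057093337),
 ([30,13,11,10,10],25439419214602957251081882694591773614065384135192935412856265125154543305883496031672775188728253217360671652737836164310284495251959112567363897950648203949533106799531512318424730481643093618023367849255639143318393561),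
 ([30,13,10,10,10,10],36621787699866240203847734644364165065830638292341384179276546885105442131753453635888664779441671775419879251225852759632023462221055336384142438567668099730288358298513716122969),
 ([30,12,12,11,11],12773660409169059018242772715402530362902034067810862828262520752345252530493723426802366167130001539100002212983064935320483594054505177),
 ([30,12,12,11,10,10],4960245184913232232621873777816774146361994868315631012671279764958438767457751244166200945499709951601219902232061774728177041562107032551020052463891422982060058645399051394375490966463288025),
 ([30,12,12,10,10,10,10],437501093655831694407607800928267881766776669822667364820057347924035589709902910580073363478311826228954000744420452564080483315325900702826978366996850939991153111525093265760184301621977),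
 ([29,24,14],1636866001261791285599735635708681662079404560093911009835563390746042058450794590049497),
 ([28,28,24,14],31661042643595973702602262830364259626444146622693982750659234285115244397791281925460473311560093783807855498457),
 ([28,24,15,14],1680408775527233366298715287330580652175171244267670409873),
 ([28,24,14,14,14],10841494094174821726504435676624055340097043979607401815071865560699537),
 ([28,20,17,14],231625069365266654714591162887345803967552001010903443321394241),
 ([28,20,16,16,14],31088190558048492465804704331695746326439357273524611503097919268197441),
 ([25,18,16,12],1155060923413400097299145593088061184513659210072462050334088681957713485117582423362704601),
 ([24,24,18,16,12],416590086033447096955800492504748629554993141535425602067400502470661779076834002080326880799252500496880109536596314800800792160339726199118291998938024538473531021073),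
 ([24,19,18,16],58977257160077555317000107335853575735922510256650147270507288300383383073649352980716159255980986789344006317404268179769649171017498700819837693858593),
 ([24,18,18,18,16],16990702775767731117511889019285759961844697605878537618773780483889708693268389125288863134974185684717248152546664413117978307592993647020368744852863397159682501121313),
 ([24,18,16,13,12],1044876498473569222251263587334929416479324267489937240309800504021698855066584151623375170606835645861365203637104666512126428504024172529345171481121992942996231497),
 ([24,18,16,12,12,12],3519190365943077419493325378319385494752962084715400996911460594540340165376487775236664264469708208442597019309918276741116042519464203519746010411423801551714768645300916915117699279723918245962500581792278433795778563877932667537),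
 ([21,20,13,10],2863033309297225001428230490267938650726780468676603285615276602934800467203620933718384224908581346059744522996050103141112305750148051938501297131824233823700354417673058070140324637998093368601907722081999696143046832793471342486318313181678587770481215990233487605897065),
 ([21,20,12,12,10],144944046736066878634446171202290518564769612397360013953766475491565741973690377146111849),
 ([21,17,12,10],219908745094899213225712021535847651362627580311955585810733699781160471705592039529705363251595972149337170976912663021433554087277314606716715062421186074543803177580557008377985),
 ([21,16,16,12,10],404952313466228106892008369280868878221992076216450506393673997022706522775418107410622925783553601728125556191717052289599643073334381797965582461087054382015529380211960904478570261034108757602160663710612769514274945767553),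
 ([21,13,11,10],822751181322125449210735497051857152480876940341608093515338739714002129459356237213432273999286476570740740675226153165033073351192971778741163623823257277457829883384837944206267296650174197826477554269462431828850751330231732198892037460151207891633312916610045865752639908924246509011015613074086112355935599254952165787673819710475599929318644520361),
 ([21,13,10,10,10],138492621710878908518205326426272183975373130631211856074381138765567568095250137748286408347732557540804809850005786390253760782730781684757656993490315240843129816768056951936520899881324252746067936234779730184026873002898978125629842246237696712750628884180902531268569104387306274510939391026507237538087289042313560076853848112360277869362406147571612384710609165024521667237332089118304082491675660535380578953591662152387905528599286021570064212384602019668806679749076887599980104403621374321523333168000786045334991911786252294842599617067796867036361135529),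
 ([21,12,12,11,10],85487151918511743351153663939843427503375389119916286924527747521692174984641031332303245940525616000626788402543310837885659415302677261333173537),
 ([21,12,12,10,10,10],71554149661169642105067848707159312920677756069997486109203386194866109939705374025390691634648516859809792264409878964269618601),
 ([20,20,20,13,10],8317774290602478479471327554181979422035301561981817294013000115257721344359606449203071565217448191706354098843074670324644737860370300134760895917000595164976152128281098791032659243344974593935573574770459277503033941718970386024493859416342256410025321315497014867799052961514052001338309930370045801),
 ([20,20,20,12,12,10],2611077358823276121840966187340758445787593232382206362074146407598951348549230594565828090881594302568297),
 ([20,20,17,12,10],244337271350632760228769848518512274760794366917368001571573302386412429300668728534321823376193443819656833049026510503351573861532418774629966288938358065752694296247832082574436436167960273787017),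
 ([20,20,16,16,12,10],8650300150129863081474582235506365678941083040988339645826546850041628935517862055180073188351046652713395476394649939065487220914553253121697265656249828023377136163135544616551865911718854180181472292946220012553706265),
 ([20,20,13,11,10],14702623713354057567824752494455127523116930391923511649961666376050004293463459437924632887256119503668451523440052202595913690030613487680991548594292500795557841576212221690772717548235742292211139765825071839190894510965927488789284798765313093700295624366866007155965526530436189889203977816099295222191158086435945409720370314037860265),
 ([20,20,13,10,10,10],3549798339607249640419528717519335718418980989223359094234973376868794420015881236598040195858537300665908197169301688368578832375450558043701832427033655342134429246126047255052828473246650330145924512956802384804026174733899716070740655935401667859795288843097242565379080553803277809197840540649912220562548986606065104513997376605371622447705247139033886607040638602621932767964187613960038541797889884909389258373743271444505740612068947262509973155550561),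
 ([20,20,12,12,11,10],158247429217054875885259819986528703317417661075680722768266167763496930162717384102221909079084718093542785891752903285833389481303348513),
 ([20,20,12,12,10,10,10],1131074646388065766722039571101890713625264491746134687098819352412081074946064989151120107205679202483397071769010622473078023080849594966341228465),
 ([20,17,17,10],120697689297191604480680747254443986815533670518602172315248472255810646940158731099241681456705622046453525181819069373700668428394261015539637435311232873),
 ([20,17,16,16,10],7545605743299493765839600015939230969849274892980801593882107668979050043882638844488168991286796186615793052234262823540034198241392309049097922803045225),
 ([20,17,12,11,10],196039581329010826061268277057502905223806028987881584359488431554520456723252060953526730108665590221818176991244728122863656970491457),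
 ([20,17,12,10,10,10],46961404660994951242015319027413949268167160689166060649404023431153374019566233177785113095017932012066674077622806676178701241079426360123011774056485236423743905470017),
 ([20,16,16,16,16,10],1476261443880552284603550262650972272457700931950091109579878498949396205636218473241479181245750746405030486909620556178453626004815680105377245880170587138462569),
 ([20,16,16,12,11,10],705753956200213552001132036088324859336929626536425396799879703252772421720985327741302810969651505679780308611607925334596703836341403231149440270772784087783206567939370408308252350017),
 ([20,16,16,12,10,10,10],583831627380213104280021958501633082016583380031204594622118176003882748133832001586173593944033850056639222666663493294418060050778496218414492178839550056092929667273827686911275139608957177873113262966124722484438342178209),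
 ([20,16,13,13,10],2136480038406592957851443276316906661005344826695020067511748591491093407860003905),
 ([20,16,13,12,12,10],35844187084035707645662554723979225609245927470947818603959372731095015452904663116158017),
 ([20,16,12,12,12,12,10],601365669053277218884133911431001342581788783479821925028484996161762449507059474083320183395393),
 ([20,16,10],1056407984762098481783908831078284194517649),
 ([20,13,11,11,10],2514941319645818380099403108287972449514178907294183928091236234204361167918314731657070341410923499748260244328467222765412983213056750359257),
 ([20,13,11,10,10,10],2514941319645818380099403108287972449514178907294183928092207331508275274383883431057718457407312598265429168098892905181657182306489609589465),
 ([20,13,10,10,10,10,10],8194902901896069899311108398222341108679201049289272174426507897171556354570242851057149217905987334146715197441301714698114253628309180719532121901969556462430420699710591705),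
 ([20,12,12,11,11,10],48426568629704903069865146306999693748530273205373421294417146771619585017099807510015833793682439780651172728908615865630565749750968748467108595955995919811797788308844322545859688078672767472236221283165115097),
 ([20,12,12,11,10,10,10],14878916445879526364236208991308528015587489742625420998057256651252682149160633569727852616359853660027532119311686537056507881038972725383584875323124598201200012887913204817094419685565365634011671407042561983321838297),
 ([20,12,12,10,10,10,10,10],366283938931478140486781361241018542781577286985306652060843940022324131357395456971359089028563397018748358883309872066147646493930900819641950227406979280656880371062543974210961823146416584629013040380301382625)] : List (List ℕ × ℕ)).map fun r => (r.1,dec 146 r.2)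
theorem table_ok : table.all runT = true := by decide +kernel
theorem srch_6 : srch (chkT 5 table) 2 200 5 10 0 [] = true := by decide +kernel
theorem srch_12 : srch (chkT 11 table) 5 200 11 22 0 [] = true := by decide +kernel
theorem srch_24 : srch (chkT 23 table) 5 200 23 46 0 [] = true := by decide +kernel
theorem srch_48 : srch (chkT 47 table) 5 200 47 94 0 [] = true := by decide +kernel
def forb0 : List (List (ℕ × ℕ × ℕ × ℕ)) := [[(0,0,0,210),(0,0,1,126),(0,0,2,84),(0,1,1,84),(0,1,2,84),(0,2,2,84),(1,1,1,14),(1,1,2,84),(1,2,2,0),(2,2,2,48)]]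
theorem run_sp0 : run 3 790037 528 forb0 [.br 2 2 0,.br 2 2 1,.fo 2 2 2,.br 1 2 0,.fo 0 2 0,.eq 0 0 2 2,.fo 1 2 1,.eq 0 1 2 2,.br 1 1 0,.eq 0 1 2 2,.eq 1 1 2 2,.fo 0 1 0,.row 0 0,.fo 0 0 0,.fo 1 1 1,.fb] 0 = true := by decide +kernel
def forb1 : List (List (ℕ × ℕ × ℕ × ℕ)) := [[(0,0,0,20),(0,0,1,180),(0,0,2,180),(0,1,1,60),(0,1,2,60),(0,2,2,0),(1,1,1,150),(1,1,2,0),(1,2,2,120),(2,2,2,12)],[(0,0,0,140),(0,0,1,120),(0,0,2,120),(0,1,1,120),(0,1,2,60),(0,2,2,60),(1,1,1,30),(1,1,2,60),(1,2,2,60),(2,2,2,12)],[(0,0,0,320),(0,0,1,60),(0,0,2,0),(0,1,1,120),(0,1,2,120),(0,2,2,120),(1,1,1,30),(1,1,2,60),(1,2,2,0),(2,2,2,12)]]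
theorem run_sp1 : run 3 790292 528 forb1 [.br 2 2 0,.br 2 2 1,.fo 2 2 2,.br 1 2 0,.row 0 2,.fo 0 2 0,.eq 0 0 2 2,.fo 1 2 1,.eq 0 1 2 2,.br 1 1 0,.eq 0 1 2 2,.eq 1 1 2 2,.eq 0 1 1 2,.fo 0 1 0,.row 0 0,.eq 0 1 2 2,.fo 0 0 0,.fo 1 1 1,.cl [1],.fb] 0 = true := by decide +kernel
end Slv
end
namespace Sch
open Finset Polynomial
lemma deg_dvd_finrank {W : Type*} [AddCommGroup W] [Module ℚ W] [FiniteDimensional ℚ W] (f : ℚ[X]) (hf : Irreducible f)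
  (φ : W →ₗ[ℚ] W) (h : aeval φ f = 0) : f.natDegree ∣ Module.finrank ℚ W := by
 have := Fact.mk hf
 let ψ : AdjoinRoot f →ₐ[ℚ] Module.End ℚ W := Ideal.Quotient.liftₐ (Ideal.span {f}) (aeval φ) (by
  intro g hg
  obtain ⟨u,rfl⟩ := Ideal.mem_span_singleton.1 hg
  rw [map_mul,h,zero_mul])
 letI : Module (AdjoinRoot f) W := Module.compHom W ψ.toRingHom
 have : IsScalarTower ℚ (AdjoinRoot f) W := by
  constructor
  intro r x w
  change ψ (r•x) w = r•(ψ x w)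
  rw [map_smul]; rfl
 have h1 := Module.finrank_mul_finrank ℚ (AdjoinRoot f) W
 have h2 : Module.finrank ℚ (AdjoinRoot f) = f.natDegree := by
  rw [(AdjoinRoot.powerBasis hf.ne_zero).finrank,AdjoinRoot.powerBasis_dim]
 exact ⟨_,by rw [←h1,h2]⟩
lemma tr_idem {Ω : Type*} [Fintype Ω] [DecidableEq Ω] (A F : Matrix Ω Ω ℚ) (hF : F*F = F) (hc : A*F = F*A)
  (f : ℚ[X]) (hf : Irreducible f) (h : aeval A f*F = 0) : ∃ k : ℕ,F.trace = f.natDegree*k := by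
 let e : Matrix Ω Ω ℚ ≃ₐ[ℚ] _ := Matrix.toLinAlgEquiv'
 have hp : LinearMap.IsProj (LinearMap.range (e F)) (e F) := by
  refine ⟨fun x => ⟨x,rfl⟩,?_⟩
  rintro _ ⟨y,rfl⟩
  change (e F*e F) y = _
  rw [←map_mul,hF]
 have ht := hp.trace
 have ht2 : LinearMap.trace ℚ _ (e F) = F.trace := Matrix.trace_toLin'_eq F
 have hAW : ∀ x ∈ LinearMap.range (e F),(e A) x ∈ LinearMap.range (e F) := by
  rintro _ ⟨y,rfl⟩
  refine ⟨e A y,?_⟩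
  change (e F*e A) y = (e A*e F) y
  rw [←map_mul,←map_mul,hc]
 have hφ : aeval ((e A).restrict hAW) f = 0 := by
  ext ⟨x,hx⟩ : 2
  have h3 : ∀ p : ℚ[X],((aeval ((e A).restrict hAW) p) ⟨x,hx⟩ : Ω → ℚ) = aeval (e A) p x := by
   intro p
   induction p using Polynomial.induction_on' with
   | add p q hp hq => simp [hp,hq]
   | monomial n c =>
    rw [aeval_monomial,aeval_monomial]
    change c•(((((e A).restrict hAW)^n) ⟨x,hx⟩ : LinearMap.range (e F)) : Ω → ℚ) = c•(((e A)^n) x)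
    congr 1
    rw [Module.End.pow_restrict n]
    rfl
  rw [h3]
  obtain ⟨y,rfl⟩ := hx
  change (aeval (e A) f*e F) y = 0
  rw [aeval_algHom_apply e A f]
  change (e (aeval A f)*e F) y = 0
  rw [←map_mul,h,map_zero]; rfl
 obtain ⟨k,hk⟩ := deg_dvd_finrank f hf _ hφ
 refine ⟨k,?_⟩
 rw [←ht2,ht,hk]; push_cast; rfl
lemma int_root {x : ℚ} (b c d : ℤ) (h : x^3+b*x^2+c*x+d = 0) : ∃ n : ℤ,n^3+b*n^2+c*n+d = 0 := by
 have hm : (X^3+C b*X^2+C c*X+C d : ℤ[X]).Monic := by monicity!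
 obtain ⟨n,hn⟩ := isInteger_of_is_root_of_monic (K := ℚ) hm (r := x) (by simpa using h)
 refine ⟨n,?_⟩
 have hn' : (n : ℚ) = x := by simpa using hn
 rw [←hn'] at h
 exact_mod_cast h
lemma irr_cubic (b c d : ℤ) (h : ∀ n : ℤ,n^3+b*n^2+c*n+d ≠ 0) :
  Irreducible (X^3+C (b : ℚ)*X^2+C (c : ℚ)*X+C (d : ℚ) : ℚ[X]) ∧
  (X^3+C (b : ℚ)*X^2+C (c : ℚ)*X+C (d : ℚ) : ℚ[X]).natDegree = 3 := by
 have hd : (X^3+C (b : ℚ)*X^2+C (c : ℚ)*X+C (d : ℚ) : ℚ[X]).natDegree = 3 := by compute_degree!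
 refine ⟨irreducible_of_degree_le_three_of_not_isRoot (by rw [hd]; simp) ?_,hd⟩
 intro x hx
 obtain ⟨n,hn⟩ := int_root b c d (x := x) (by simpa using hx)
 exact h n hn
lemma irr_quad (b c : ℤ) (h : ∀ n : ℤ,n^3+b*n^2+c*n+0 = 0 → n = 0) (hc : c ≠ 0) :
  Irreducible (X^2+C (b : ℚ)*X+C (c : ℚ) : ℚ[X]) ∧
  (X^2+C (b : ℚ)*X+C (c : ℚ) : ℚ[X]).natDegree = 2 := by
 have hd : (X^2+C (b : ℚ)*X+C (c : ℚ) : ℚ[X]).natDegree = 2 := by compute_degree!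
 refine ⟨irreducible_of_degree_le_three_of_not_isRoot (by rw [hd]; simp) ?_,hd⟩
 intro x hx
 have hx' : x^2+b*x+c = 0 := by simpa using hx
 have hm : (X^2+C b*X+C c : ℤ[X]).Monic := by monicity!
 obtain ⟨n,hn⟩ := isInteger_of_is_root_of_monic (K := ℚ) hm (r := x) (by simpa using hx)
 have hn' : (n : ℚ) = x := by simpa using hn
 rw [←hn'] at hx'
 have h3 : n^2+b*n+c = 0 := by exact_mod_cast hx'
 have := h n (by linear_combination n*h3)
 subst this
 simp at h3
 exact hc h3
section kills
variable {Ω : Type*} [Fintype Ω] [DecidableEq Ω] {M0 M1 M2 : Matrix Ω Ω ℚ} {v0 v1 v2 a0 a1 a2 b0 b1 b2 c0 c1 c2 d0 d1 d2 f0 f1 f2 g0 g1 g2 : ℕ}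
/-- a linear combination of `1, M0, M1, M2` -/
def lin (M0 M1 M2 : Matrix Ω Ω ℚ) (a b c d : ℚ) : Matrix Ω Ω ℚ := a•1+b•M0+c•M1+d•M2
/-- the multiplication table of a symmetric scheme of rank 4 on 48 points -/
structure Tab (M0 M1 M2 : Matrix Ω Ω ℚ) (v0 v1 v2 a0 a1 a2 b0 b1 b2 c0 c1 c2 d0 d1 d2 f0 f1 f2 g0 g1 g2 : ℕ) : Prop where
 t0 : M0.trace = 0
 t1 : M1.trace = 0
 t2 : M2.trace = 0
 hc : Fintype.card Ω = 48
 h00 : M0*M0 = lin M0 M1 M2 v0 a0 a1 a2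
 h01 : M0*M1 = lin M0 M1 M2 0 b0 b1 b2
 h02 : M0*M2 = lin M0 M1 M2 0 c0 c1 c2
 h10 : M1*M0 = lin M0 M1 M2 0 b0 b1 b2
 h11 : M1*M1 = lin M0 M1 M2 v1 d0 d1 d2
 h12 : M1*M2 = lin M0 M1 M2 0 f0 f1 f2
 h20 : M2*M0 = lin M0 M1 M2 0 c0 c1 c2
 h21 : M2*M1 = lin M0 M1 M2 0 f0 f1 f2
 h22 : M2*M2 = lin M0 M1 M2 v2 g0 g1 g2
local notation "L" => lin M0 M1 M2
lemma Tab.mul (T : Tab M0 M1 M2 v0 v1 v2 a0 a1 a2 b0 b1 b2 c0 c1 c2 d0 d1 d2 f0 f1 f2 g0 g1 g2) (a b c d a' b' c' d' : ℚ) :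
  L a b c d*L a' b' c' d' = L (a*a'+v0*b*b'+v1*c*c'+v2*d*d')
   (a*b'+b*a'+a0*b*b'+b0*(b*c'+c*b')+c0*(b*d'+d*b')+d0*c*c'+f0*(c*d'+d*c')+g0*d*d')
   (a*c'+c*a'+a1*b*b'+b1*(b*c'+c*b')+c1*(b*d'+d*b')+d1*c*c'+f1*(c*d'+d*c')+g1*d*d')
   (a*d'+d*a'+a2*b*b'+b2*(b*c'+c*b')+c2*(b*d'+d*b')+d2*c*c'+f2*(c*d'+d*c')+g2*d*d') := by
 simp only [lin,mul_add,add_mul,smul_mul_assoc,mul_smul_comm,one_mul,mul_one,T.h00,T.h01,T.h02,T.h10,T.h11,T.h12,T.h20,T.h21,T.h22]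
 module
lemma Tab.fin (T : Tab M0 M1 M2 v0 v1 v2 a0 a1 a2 b0 b1 b2 c0 c1 c2 d0 d1 d2 f0 f1 f2 g0 g1 g2) (a b c d : ℚ)
  (hF : L a b c d*L a b c d = L a b c d) (u v w x : ℤ) {f : ℚ[X]}
  (hf : Irreducible f) (e : f = C (u : ℚ)*X^3+C (v : ℚ)*X^2+C (w : ℚ)*X+C (x : ℚ))
  (h : L 0 0 0 1*(L 0 0 0 1*(L 0 0 0 u+L v 0 0 0)+L w 0 0 0)*L a b c d
   = L (-x*a) (-x*b) (-x*c) (-x*d)) : ∃ k : ℕ,48*a = f.natDegree*k := by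
 obtain ⟨k,hk⟩ := tr_idem (L 0 0 0 1) _ hF (by rw [T.mul,T.mul]; congr 1 <;> ring) f hf (by
  have h3 : aeval (L 0 0 0 1) f = L 0 0 0 1*(L 0 0 0 1*(L 0 0 0 u+L v 0 0 0)+L w 0 0 0)+(x : ℚ)•1 := by
   simp only [e,map_add,map_mul,map_pow,aeval_X,aeval_C,Algebra.algebraMap_eq_smul_one,pow_succ,pow_zero,one_mul,lin]
   simp only [mul_add,smul_mul_assoc,mul_smul_comm,one_mul,mul_one,zero_smul,mul_assoc,one_smul,zero_add,add_zero]
  rw [h3,add_mul,h,smul_mul_assoc,one_mul]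
  simp only [lin]
  module)
 simp [lin,Matrix.trace_add,Matrix.trace_smul,trace_one,T.t0,T.t1,T.t2,T.hc] at hk
 exact ⟨k,by linarith⟩
lemma lin_add (a b c d a' b' c' d' : ℚ) : L a b c d+L a' b' c' d' = L (a+a') (b+b') (c+c') (d+d') := by
 simp only [lin]; module
lemma bd_twelve {n : ℤ} (h1 : n ∣ 12) : -12 ≤ n ∧ n ≤ 12 := by
 have h2 := Int.le_of_dvd (by norm_num) h1
 have h3 := Int.le_of_dvd (by norm_num) ((neg_dvd).2 h1)
 omega
lemma kill0 (T : Tab M0 M1 M2 21 14 12 10 9 7 6 6 7 4 6 7 4 1 7 4 6 0 4 0 4) : False := by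
 obtain ⟨k,hk⟩ := T.fin (2 / 15) 0 (-1 / 15) (1 / 15) (by rw [T.mul]; congr 1 <;> norm_num) 0 0 1 (-6) (irreducible_X_sub_C 6)
  (by simp [sub_eq_add_neg]) (by simp only [T.mul,lin_add]; congr 1 <;> norm_num)
 rw [natDegree_X_sub_C] at hk
 have : (32 : ℚ) = 5*k := by linarith
 have : 32 = 5*k := by exact_mod_cast this
 omega
lemma kill_cubic {b c d : ℤ} (T : Tab M0 M1 M2 20 15 12 a0 a1 a2 b0 b1 b2 c0 c1 c2 d0 d1 d2 f0 f1 f2 g0 g1 g2)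
  (hr : ∀ n : ℤ,n^3+b*n^2+c*n+d ≠ 0)
  (hF : L (47 / 48) (-1 / 48) (-1 / 48) (-1 / 48)*L (47 / 48) (-1 / 48) (-1 / 48) (-1 / 48) = L (47 / 48) (-1 / 48) (-1 / 48) (-1 / 48))
  (h : L 0 0 0 1*(L 0 0 0 1*(L 0 0 0 (1 : ℤ)+L b 0 0 0)+L c 0 0 0)*L (47 / 48) (-1 / 48) (-1 / 48) (-1 / 48)
   = L (-d*(47 / 48)) (-d*(-1 / 48)) (-d*(-1 / 48)) (-d*(-1 / 48))) : False := by
 obtain ⟨hi,hdeg⟩ := irr_cubic b c d hr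
 obtain ⟨k,hk⟩ := T.fin _ _ _ _ hF 1 b c d hi (by simp) h
 rw [hdeg] at hk
 have : (47 : ℚ) = 3*k := by push_cast at hk; linarith
 have : 47 = 3*k := by exact_mod_cast this
 omega
lemma kill1 (T : Tab M0 M1 M2 20 15 12 1 12 15 9 4 5 9 4 0 3 10 0 3 0 10 0 8 1) : False := by
 refine kill_cubic (b := 2) (c := -71) (d := -12) T (fun n hn => ?_) (by rw [T.mul]; congr 1 <;> norm_num)
  (by simp only [T.mul,lin_add]; congr 1 <;> norm_num)
 obtain ⟨h4,h5⟩ := bd_twelve (n := n) ⟨n^2+2*n - 71,by linarith⟩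
 interval_cases n <;> omega
lemma kill2 (T : Tab M0 M1 M2 20 15 12 7 8 10 6 8 5 6 4 5 6 2 5 3 4 5 3 4 1) : False := by
 refine kill_cubic (b := 1) (c := -13) (d := 12) T (fun n hn => ?_) (by rw [T.mul]; congr 1 <;> norm_num)
  (by simp only [T.mul,lin_add]; congr 1 <;> norm_num)
 obtain ⟨h4,h5⟩ := bd_twelve (n := n) ⟨-(n^2+n - 13),by linarith⟩
 interval_cases n <;> omega
lemma kill3 (T : Tab M0 M1 M2 20 15 12 16 4 0 3 8 10 0 8 10 6 2 5 6 4 0 6 0 1) : False := by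
 obtain ⟨hi,hdeg⟩ := irr_quad 11 12 (by
  intro n hn
  by_contra h0
  have hn : n^2+11*n+12 = 0 := by
   apply mul_left_cancel₀ h0; linear_combination hn
  obtain ⟨h4,h5⟩ := bd_twelve (n := n) ⟨-(n+11),by linarith⟩
  interval_cases n <;> omega) (by norm_num)
 obtain ⟨k,hk⟩ := T.fin (35 / 48) (-1 / 48) (3 / 48) (-5 / 48) (by rw [T.mul]; congr 1 <;> norm_num) 0 1 11 12 hi
  (by simp) (by simp only [T.mul,lin_add]; congr 1 <;> norm_num)
 rw [hdeg] at hk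
 have : (35 : ℚ) = 2*k := by push_cast at hk; linarith
 have : 35 = 2*k := by exact_mod_cast this
 omega
end kills
end Sch
namespace Slv
open Finset
lemma Ag_zero (m : ℕ) (T) : Ag m T 0 := by
 intro i _ j _ k _; left
 rw [dig_eq]; simp
lemma exk_sum (cs : List ℕ) : (exk cs).sum = (cs.map wt).sum := by
 induction cs with
 | nil => rfl
 | cons c cs ih =>
  rw [exk,List.map_cons,List.sum_cons]
  have hw : wt c = (c / 2)*(c % 2+1) := rfl
  rcases Nat.mod_two_eq_zero_or_one c with h | h
  ·rw [hw,h]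
   simp [ih]
  ·rw [hw,h]
   change ((c / 2) :: (c / 2) :: exk cs).sum = _
   simp [ih]; ring
end Slv
namespace Sch
open Finset
open Slv
section
variable {G Ω : Type*} [Group G] [MulAction G Ω] [Fintype Ω] [IsPretransitive G Ω] [Finite G] [FaithfulSMul G Ω]
lemma code_div (a : Ω) (q : Q G Ω) : code a q / 2 = val q a := by
 unfold code; split_ifs <;> omega
open Classical in
noncomputable def Mq (q : Q G Ω) : Matrix Ω Ω ℚ := Matrix.of fun x y => if col G x y = q then 1 else 0
open Classical in
lemma Mq_mul (i j : Q G Ω) (x y : Ω) : (Mq i*Mq j) x y = (pp i j x y : ℚ) := by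
 rw [Matrix.mul_apply]
 simp only [Mq,Matrix.of_apply,pp,card_filter]
 push_cast
 refine sum_congr rfl fun z _ => ?_
 by_cases h1 : col G x z = i <;> by_cases h2 : col G z y = j <;> simp [h1,h2]
open Classical in
lemma Mq_trace (a : Ω) (q : Q G Ω) (hq : q ≠ col G a a) : (Mq q).trace = 0 := by
 unfold Matrix.trace
 apply Finset.sum_eq_zero
 intro x _
 have : col G x x ≠ q := by rw [col_self x a]; exact hq.symm
 simp [Mq,this]
open Classical in
lemma mul3 (a : Ω) {q0 q1 q2 : Q G Ω} (hcov : ∀ q,q = col G a a ∨ q = q0 ∨ q = q1 ∨ q = q2)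
  (s0 : star q0 = q0) (s1 : star q1 = q1) (s2 : star q2 = q2)
  (n0 : q0 ≠ col G a a) (n1 : q1 ≠ col G a a) (n2 : q2 ≠ col G a a) (h01 : q0 ≠ q1) (h02 : q0 ≠ q2) (h12 : q1 ≠ q2)
  {i j : Q G Ω} (si : star i = i) (c0 c1 c2 d : ℕ) (e0 : TT i j q0 a = val q0 a*c0) (e1 : TT i j q1 a = val q1 a*c1)
  (e2 : TT i j q2 a = val q2 a*c2) (ed : d = if j = i then val i a else 0) :
  Mq i*Mq j = (d : ℚ)•1+(c0 : ℚ)•Mq q0+(c1 : ℚ)•Mq q1+(c2 : ℚ)•Mq q2 := by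
 ext x y
 rw [Mq_mul]
 have h1 : ∀ q,star q = q → col G x y = q → ∀ c,TT i j q a = val q a*c → pp i j x y = c := by
  intro q hs hq c hc
  have := TT_pp a i j q hq
  rw [hs,hc] at this
  exact (Nat.eq_of_mul_eq_mul_left (val_pos _ _) this).symm
 simp only [Matrix.add_apply,Matrix.smul_apply,Mq,Matrix.of_apply,smul_eq_mul]
 rcases hcov (col G x y) with h | h | h | h
 ·have hxy := (col_diag a).1 h
  subst hxy
  rw [h1 _ (star_col a a) h d (by rw [TT_diag,val_diag,one_mul,ed,si]),h]
  simp [n0.symm,n1.symm,n2.symm]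
 ·have hxy : x ≠ y := fun hh => n0 (by rw [←h,(col_diag a).2 hh])
  rw [h1 _ s0 h c0 e0,h]; simp [hxy,h01,h02]
 ·have hxy : x ≠ y := fun hh => n1 (by rw [←h,(col_diag a).2 hh])
  rw [h1 _ s1 h c1 e1,h]; simp [hxy,h01.symm,h12]
 ·have hxy : x ≠ y := fun hh => n2 (by rw [←h,(col_diag a).2 hh])
  rw [h1 _ s2 h c2 e2,h]; simp [hxy,h02.symm,h12.symm]
lemma enum_facts (hP : Prim G Ω) (a : Ω) (lo : ℕ) (h2 : 2 ≤ lo) (hlo : ∀ q : Q G Ω,q ≠ col G a a → lo ≤ val q a) (hcard : 2 ≤ Fintype.card Ω) :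
  ∃ L : List (Q G Ω),(Ex L).Nodup ∧ (∀ q,q ∈ Ex L ↔ q ≠ col G a a) ∧
  ∀ chk f,srch chk lo f (Fintype.card Ω - 1) (2*(Fintype.card Ω - 1)) 0 [] = true → chk (L.map (code a)).reverse = true ∧ good (L.map (code a)) = true := by
 classical
 letI : Fintype (Q G Ω) := ofSurjective (fun b => col G a b) (exists_col a)
 obtain ⟨L,hL,hnd,hmem⟩ := exists_enum (G := G) a
 have hLE : ∀ q ∈ L,q ∈ Ex L := by
  intro q hq
  unfold Ex
  rw [List.mem_flatMap]
  exact ⟨q,hq,by split_ifs <;> simp⟩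
 have hEL : ∀ q,q ≠ col G a a → ∃ q' ∈ L,val q' a = val q a := by
  intro q hq
  have := (hmem q).2 hq
  unfold Ex at this
  rw [List.mem_flatMap] at this
  obtain ⟨p,hp,hpq⟩ := this
  refine ⟨p,hp,?_⟩
  split_ifs at hpq <;> simp at hpq
  ·rw [hpq]
  ·rcases hpq with rfl | rfl
   ·rfl
   ·rw [val_star]
 have hn : ∀ q ∈ L,q ≠ col G a a := fun q hq => (hmem q).1 (hLE q hq)
 refine ⟨L,hnd,hmem,?_⟩
 intro chk f H
 have hsum : ((L.map (code a)).map wt).sum = Fintype.card Ω - 1 := by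
  rw [←exk_sum,←Ex_val,←sum_val (G := G) a,←Finset.sum_erase_add _ _ (mem_univ (col G a a)),val_diag,Nat.add_sub_cancel]
  have : (univ.erase (col G a a)) = (Ex L).toFinset := by
   ext q; simp [hmem]
  rw [this,List.sum_toFinset _ hnd]
 have hw : ∀ q1 ∈ L,∀ q2 ∈ L,val q1 a < val q2 a → (val q1 a).Coprime (val q2 a) → ∃ d ∈ L,val q2 a < val d a ∧ val d a ∣ val q1 a*val q2 a := by
  intro q1 h1 q2 h2' hlt hco
  obtain ⟨l,hl1,hl2⟩ := weiss hP a (hn q2 h2') (h2.trans (hlo q1 (hn q1 h1))) hlt hco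
  obtain ⟨l',hl',he⟩ := hEL l (by rintro rfl; rw [val_diag] at hl1; have := val_pos a q2; omega)
  exact ⟨l',hl',by rw [he]; exact ⟨hl1,hl2⟩⟩
 constructor
 ·have := srch_sound chk lo h2 f _ _ _ _ H (L.map (code a)) hL ?_ ?_ hsum ?_
  ·simpa using this
  ·intro c hc
   have h1 : wt c ≤ ((L.map (code a)).map wt).sum := List.single_le_sum (by simp) _ (List.mem_map_of_mem hc)
   rw [hsum] at h1
   have : wt c = (c / 2)*(c % 2+1) := rfl
   rcases Nat.mod_two_eq_zero_or_one c with h | h <;> rw [h] at this <;> omega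
  ·intro c hc
   obtain ⟨q,hq,rfl⟩ := List.mem_map.1 hc
   have := hlo q (hn q hq)
   have h' := code_div a q
   omega
  ·intro c hc
   obtain ⟨q,hq,rfl⟩ := List.mem_map.1 hc
   rw [code_div]
   unfold nxt
   rw [if_pos rfl]
   cases hLL : L with
   | nil => simp [hLL] at hq
   | cons p L' =>
    have hp : p ∈ L := by simp [hLL]
    simp only [List.map_cons,List.headD_cons,code_div]
    have hmax : ∀ d ∈ L,val d a ≤ val p a := by
     intro d hd
     rw [←code_div,←code_div]
     rw [hLL] at hL hd
     rcases List.mem_cons.1 hd with h | h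
     ·rw [h]
     ·have := List.rel_of_pairwise_cons hL (List.mem_map_of_mem (f := code a) h)
      exact Nat.div_le_div_right this
    rcases (hmax q hq).lt_or_eq with h | h
    ·intro hg
     obtain ⟨d,hd,hd1,_⟩ := hw q hq p hp h (by rw [Coprime,Nat.gcd_comm]; exact hg)
     exact absurd (hmax d hd) (by omega)
    ·rw [h,Nat.gcd_self]
     have := hlo p (hn p hp)
     omega
 ·apply good_of
  ·intro p hp c hc c' hc' hdv
   obtain ⟨q,hq,rfl⟩ := List.mem_map.1 hc
   obtain ⟨q',hq',rfl⟩ := List.mem_map.1 hc'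
   rw [code_div] at *
   exact T2'' hP hp hdv (hn q' hq')
  ·intro c hc c' hc' hlt hco
   obtain ⟨q,hq,rfl⟩ := List.mem_map.1 hc
   obtain ⟨q',hq',rfl⟩ := List.mem_map.1 hc'
   rw [code_div,code_div] at *
   obtain ⟨d,hd,h1,h2⟩ := hw q hq q' hq' hlt hco
   exact ⟨code a d,List.mem_map_of_mem hd,by rw [code_div]; exact ⟨h1,h2⟩⟩
lemma code_even {a : Ω} {q : Q G Ω} {c : ℕ} (h : code a q = 2*c) : star q = q ∧ val q a = c := by
 unfold code at h
 split_ifs at h with h1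
 ·exact ⟨h1,by omega⟩
 ·omega
lemma Ex_three {a : Ω} {L : List (Q G Ω)} {c0 c1 c2 : ℕ} (h : L.map (code a) = [2*c0,2*c1,2*c2]) :
  ∃ q0 q1 q2,Ex L = [q0,q1,q2] ∧ star q0 = q0 ∧ star q1 = q1 ∧ star q2 = q2 ∧ val q0 a = c0 ∧ val q1 a = c1 ∧ val q2 a = c2 := by
 have hl : L.length = 3 := by simpa using congrArg List.length h
 obtain ⟨q0,q1,q2,rfl⟩ := List.length_eq_three.1 hl
 ·simp only [List.map_cons,map_nil,List.cons.injEq,and_true] at h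
  obtain ⟨a0,b0⟩ := code_even h.1
  obtain ⟨a1,b1⟩ := code_even h.2.1
  obtain ⟨a2,b2⟩ := code_even h.2.2
  refine ⟨q0,q1,q2,?_,a0,a1,a2,b0,b1,b2⟩
  simp [Ex,a0,a1,a2]
open Classical in
lemma nine (a : Ω) {q0 q1 q2 : Q G Ω} (hcov : ∀ q,q = col G a a ∨ q = q0 ∨ q = q1 ∨ q = q2)
  (s0 : star q0 = q0) (s1 : star q1 = q1) (s2 : star q2 = q2)
  (n0 : q0 ≠ col G a a) (n1 : q1 ≠ col G a a) (n2 : q2 ≠ col G a a) (h01 : q0 ≠ q1) (h02 : q0 ≠ q2) (h12 : q1 ≠ q2)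
  {v0 v1 v2 : ℕ} (e0 : val q0 a = v0) (e1 : val q1 a = v1) (e2 : val q2 a = v2)
  (a0 a1 a2 b0 b1 b2 c0 c1 c2 d0 d1 d2 f0 f1 f2 g0 g1 g2 : ℕ)
  (t000 : TT q0 q0 q0 a = v0*a0) (t001 : TT q0 q0 q1 a = v1*a1) (t002 : TT q0 q0 q2 a = v2*a2)
  (x0 : TT q0 q0 q1 a = v0*b0) (t011 : TT q0 q1 q1 a = v1*b1) (t012 : TT q0 q1 q2 a = v2*b2)
  (x1 : TT q0 q0 q2 a = v0*c0) (x2 : TT q0 q1 q2 a = v1*c1) (t022 : TT q0 q2 q2 a = v2*c2)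
  (x3 : TT q0 q1 q1 a = v0*d0) (t111 : TT q1 q1 q1 a = v1*d1) (t112 : TT q1 q1 q2 a = v2*d2)
  (x4 : TT q0 q1 q2 a = v0*f0) (x5 : TT q1 q1 q2 a = v1*f1) (t122 : TT q1 q2 q2 a = v2*f2)
  (x6 : TT q0 q2 q2 a = v0*g0) (x7 : TT q1 q2 q2 a = v1*g1) (t222 : TT q2 q2 q2 a = v2*g2)
  (hc : Fintype.card Ω = 48) : Tab (Mq q0) (Mq q1) (Mq q2) v0 v1 v2 a0 a1 a2 b0 b1 b2 c0 c1 c2 d0 d1 d2 f0 f1 f2 g0 g1 g2 := by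
 have cyc := fun i j k : Q G Ω => TT_cyc (a := a) i j k
 have sw : ∀ i j k : Q G Ω,star i = i → star j = j → star k = k → TT i j k a = TT j i k a := by
  intro i j k hi hj hk
  rw [TT_rev,hi,hj,hk,TT_cyc]
 have M := fun i j si c0 c1 c2 d h0 h1 h2 h3 => mul3 a hcov s0 s1 s2 n0 n1 n2 h01 h02 h12 (i := i) (j := j) si c0 c1 c2 d h0 h1 h2 h3
 subst e0 e1 e2
 refine ⟨Mq_trace a q0 n0,Mq_trace a q1 n1,Mq_trace a q2 n2,hc,?_,?_,?_,?_,?_,?_,?_,?_,?_⟩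
 ·exact M _ _ s0 _ _ _ _ t000 t001 t002 (by simp)
 ·exact M _ _ s0 _ _ _ _ (by rw [sw _ _ _ s0 s1 s0,cyc,x0]) t011 t012 (by simp [h01.symm])
 ·exact M _ _ s0 _ _ _ _ (by rw [sw _ _ _ s0 s2 s0,cyc,x1]) (by rw [sw _ _ _ s0 s2 s1,cyc,x2]) t022 (by simp [h02.symm])
 ·exact M _ _ s1 _ _ _ _ (by rw [cyc,x0]) (by rw [sw _ _ _ s1 s0 s1,t011]) (by rw [sw _ _ _ s1 s0 s2,t012]) (by simp [h01])
 ·exact M _ _ s1 _ _ _ _ (by rw [cyc,cyc,x3]) t111 t112 (by simp)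
 ·exact M _ _ s1 _ _ _ _ (by rw [cyc,cyc,x4]) (by rw [sw _ _ _ s1 s2 s1,cyc,x5]) t122 (by simp [h12.symm])
 ·exact M _ _ s2 _ _ _ _ (by rw [cyc,x1]) (by rw [cyc,x2]) (by rw [sw _ _ _ s2 s0 s2,t022]) (by simp [h02])
 ·exact M _ _ s2 _ _ _ _ (by rw [sw _ _ _ s2 s1 s0,cyc,cyc,x4]) (by rw [cyc,x5]) (by rw [sw _ _ _ s2 s1 s2,t122]) (by simp [h12])
 ·exact M _ _ s2 _ _ _ _ (by rw [cyc,cyc,x6]) (by rw [cyc,cyc,x7]) t222 (by simp)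
lemma card_of_codes {a : Ω} {L : List (Q G Ω)} (hn : (Ex L).Nodup) (hm : ∀ q,q ∈ Ex L ↔ q ≠ col G a a) :
  Fintype.card Ω = 1+(exk (L.map (code a))).sum := by
 classical
 letI : Fintype (Q G Ω) := ofSurjective (fun b => col G a b) (exists_col a)
 rw [←Ex_val,←sum_val (G := G) a,←Finset.add_sum_erase _ _ (mem_univ (col G a a)),val_diag]
 have : (univ.erase (col G a a)) = (Ex L).toFinset := by
  ext q; simp [hm]
 rw [this,List.sum_toFinset _ hn]
lemma no_sp (hP : Prim G Ω) {a : Ω} {L : List (Q G Ω)} (hn : (Ex L).Nodup) (hm : ∀ q,q ∈ Ex L ↔ q ≠ col G a a) {u0 u1 u2 m : ℕ}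
  (h : L.map (code a) = [2*u0,2*u1,2*u2]) (hu : 1+(exk [2*u0,2*u1,2*u2]).sum = 48)
  (hK : pack 8 (exk [2*u0,2*u1,2*u2]) = m) (hS : pack 4 (exs 0 [2*u0,2*u1,2*u2]) = 528)
  {F P} (hr : run 3 m 528 F P 0 = true) (hk : ∀ l ∈ F,∃ a0 a1 a2 b0 b1 b2 c0 c1 c2 d0 d1 d2 f0 f1 f2 g0 g1 g2,
   l = [(0,0,0,u0*a0),(0,0,1,u1*a1),(0,0,2,u2*a2),(0,1,1,u1*b1),(0,1,2,u2*b2),(0,2,2,u2*c2),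
    (1,1,1,u1*d1),(1,1,2,u2*d2),(1,2,2,u2*f2),(2,2,2,u2*g2)] ∧
   (u1*a1 = u0*b0 ∧ u2*a2 = u0*c0 ∧ u2*b2 = u1*c1 ∧ u1*b1 = u0*d0 ∧ u2*b2 = u0*f0 ∧ u2*d2 = u1*f1 ∧
    u2*c2 = u0*g0 ∧ u2*f2 = u1*g1) ∧ ∀ [DecidableEq Ω] (M0 M1 M2 : Matrix Ω Ω ℚ),
   ¬ Tab M0 M1 M2 u0 u1 u2 a0 a1 a2 b0 b1 b2 c0 c1 c2 d0 d1 d2 f0 f1 f2 g0 g1 g2) : False := by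
 classical
 have hc : Fintype.card Ω = 48 := by rw [card_of_codes hn hm,h,hu]
 obtain ⟨q0,q1,q2,hE,s0,s1,s2,v0,v1,v2⟩ := Ex_three h
 have S := sol hP hc.le (by rw [hE]; simp) hn hm
 rw [h,hE,hK,hS] at S
 have i0 : eI a L 0 = q0 := by simp [eI,hE]
 have i1 : eI a L 1 = q1 := by simp [eI,hE]
 have i2 : eI a L 2 = q2 := by simp [eI,hE]
 rw [hE] at hn hm
 simp at hn
 have hcov : ∀ q,q = col G a a ∨ q = q0 ∨ q = q1 ∨ q = q2 := by
  intro q; have := hm q; simp at this; tauto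
 have N := nine a hcov s0 s1 s2 ((hm q0).1 (by simp)) ((hm q1).1 (by simp)) ((hm q2).1 (by simp)) hn.1.1 hn.1.2 hn.2 v0 v1 v2
 replace S : Sol 3 _ _ _ := S
 suffices hF : Forb 3 (fun i j k => TT (eI a L i) (eI a L j) (eI a L k) a) F by
  exact absurd ((run_sound S hF _ (Ag_zero _ _)).symm.trans hr) (by simp)
 intro l hl
 obtain ⟨_,_,_,_,_,_,_,_,_,_,_,_,_,_,_,_,_,_,rfl,⟨x0,x1,x2,x3,x4,x5,x6,x7⟩,K⟩ := hk l hl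
 refine ⟨by simp,?_⟩
 simp only [List.mem_cons,not_mem_nil,or_false,forall_eq_or_imp,forall_eq,i0,i1,i2]
 rintro ⟨t000,t001,t002,t011,t012,t022,t111,t112,t122,t222⟩
 exact K _ _ _ (N _ _ _ _ _ _ _ _ _ _ _ _ _ _ _ _ _ _ t000 t001 t002 (t001.trans x0) t011 t012 (t002.trans x1) (t012.trans x2) t022
  (t011.trans x3) t111 t112 (t012.trans x4) (t112.trans x5) t122 (t022.trans x6) (t122.trans x7) t222 hc)
lemma no_sp0 (hP : Prim G Ω) {a : Ω} {L : List (Q G Ω)} (hn : (Ex L).Nodup) (hm : ∀ q,q ∈ Ex L ↔ q ≠ col G a a)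
  (h : L.map (code a) = [42,28,24]) : False :=
 no_sp hP hn hm (u0 := 21) (u1 := 14) (u2 := 12) h (by decide) (by decide) (by decide) run_sp0 fun l hl => by
  rw [forb0,List.mem_singleton] at hl
  exact ⟨10,9,7,6,6,7,4,6,7,4,1,7,4,6,0,4,0,4,hl,by decide,fun _ _ _ => kill0⟩
lemma no_sp1 (hP : Prim G Ω) {a : Ω} {L : List (Q G Ω)} (hn : (Ex L).Nodup) (hm : ∀ q,q ∈ Ex L ↔ q ≠ col G a a)
  (h : L.map (code a) = [40,30,24]) : False :=
 no_sp hP hn hm (u0 := 20) (u1 := 15) (u2 := 12) h (by decide) (by decide) (by decide) run_sp1 fun l hl => by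
  simp only [forb1,List.mem_cons,not_mem_nil,or_false] at hl
  rcases hl with hl | hl | hl
  ·exact ⟨1,12,15,9,4,5,9,4,0,3,10,0,3,0,10,0,8,1,hl,by decide,fun _ _ _ => kill1⟩
  ·exact ⟨7,8,10,6,8,5,6,4,5,6,2,5,3,4,5,3,4,1,hl,by decide,fun _ _ _ => kill2⟩
  ·exact ⟨16,4,0,3,8,10,0,8,10,6,2,5,6,4,0,6,0,1,hl,by decide,fun _ _ _ => kill3⟩
lemma no_tab (hP : Prim G Ω) (hc : Fintype.card Ω ≤ 48) {a : Ω} {L : List (Q G Ω)} (hn : (Ex L).Nodup) (hm : ∀ q,q ∈ Ex L ↔ q ≠ col G a a)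
  {e} (he : e ∈ table) (h : e.1 = L.map (code a)) : False := by
 have h1 := all_eq_true.1 table_ok e he
 unfold runT at h1
 rw [and_eq_true,ble_eq,force_eq,force_eq,force_eq,h] at h1
 have hl : (exk (L.map (code a))).length = (Ex L).length := by rw [←Ex_val,List.length_map]
 rw [hl] at h1
 have := run_sound (sol hP hc h1.1 hn hm) (F := []) (by intro l hl; simp at hl) e.2 (Ag_zero _ _)
 rw [this] at h1
 simp at h1
lemma two_col (hP : Prim G Ω) (a : Ω) (lo : ℕ) (h2 : 2 ≤ lo) (hlo : ∀ q : Q G Ω,q ≠ col G a a → lo ≤ val q a)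
  (hcard : 2 ≤ Fintype.card Ω) (hc : Fintype.card Ω ≤ 48)
  (H : srch (chkT (Fintype.card Ω - 1) table) lo 200 (Fintype.card Ω - 1) (2*(Fintype.card Ω - 1)) 0 [] = true) :
  ∀ q q' : Q G Ω,q ≠ col G a a → q' ≠ col G a a → q = q' := by
 obtain ⟨L,hn,hm,hs⟩ := enum_facts hP a lo h2 hlo hcard
 obtain ⟨h1,hg⟩ := hs _ _ H
 unfold chkT at h1
 rw [List.reverse_reverse,hg] at h1
 simp only [Bool.not_true,Bool.false_or,or_eq_true,any_eq_true] at h1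
 rcases h1 with h1 | h1 | h1 | ⟨e,he,h1⟩
 ·have h3 := List.reverse_eq_iff.1 (leq_eq _ _ h1)
  simp only [List.reverse_cons,List.reverse_nil,List.nil_append] at h3
  have h4 := Ex_val a L
  rw [h3] at h4
  have h5 : (Ex L).length = 1 := by
   have := congrArg List.length h4
   rw [List.length_map] at this
   rw [this,exk]
   simp [exk]
  obtain ⟨x,hx⟩ := List.length_eq_one_iff.1 h5
  intro q q' hq hq'
  rw [hx] at hm
  simp at hm
  rw [(hm q).2 hq,(hm q').2 hq']
 ·exact (no_sp0 hP hn hm (by have := List.reverse_eq_iff.1 (leq_eq _ _ h1); simpa using this)).elim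
 ·exact (no_sp1 hP hn hm (by have := List.reverse_eq_iff.1 (leq_eq _ _ h1); simpa using this)).elim
 ·exact (no_tab hP hc hn hm he (leq_eq _ _ h1)).elim
lemma trans_of_col {a : Ω} (h : ∀ q q' : Q G Ω,q ≠ col G a a → q' ≠ col G a a → q = q') {b c : Ω} (hb : b ≠ a) (hc : c ≠ a) :
  ∃ g : G,g•a = a ∧ g•b = c := by
 have := h (col G a c) (col G a b) (fun h => hc ((col_diag a).1 h).symm) (fun h => hb ((col_diag a).1 h).symm)
 exact (col_eq ..).1 this
/-- primitive groups of degree 6, 12, 24, 48 with order divisible by a prime at least 5 are 2-transitive -/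
theorem prim_two_trans (hP : Prim G Ω) (hd : Fintype.card Ω ∈ [6,12,24,48]) {r : ℕ} (hr : r.Prime) (h5 : 5 ≤ r)
  (hrG : r ∣ Nat.card G) (a : Ω) : ∀ b c : Ω,b ≠ a → c ≠ a → ∃ g : G,g•a = a ∧ g•b = c := by
 classical
 intro b c hb hc
 refine trans_of_col ?_ hb hc
 have hrH : r ∣ Nat.card (stabilizer G a) := by
  have h1 := (stabilizer G a).card_mul_index
  rw [index_stabilizer_of_transitive,card_eq_fintype_card (α := Ω)] at h1
  rw [←h1] at hrG
  refine ((hr.dvd_mul).1 hrG).resolve_right ?_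
  intro h
  have h48 : r ∣ 48 := h.trans (by simp at hd; rcases hd with h | h | h | h <;> rw [h] <;> decide)
  have : r ∣ 2^4*3 := by simpa using h48
  rcases (hr.dvd_mul).1 this with h | h
  ·have := le_of_dvd (by norm_num) (hr.dvd_of_dvd_pow h); omega
  ·have := le_of_dvd (by norm_num) h; omega
 have hlo : ∀ q : Q G Ω,q ≠ col G a a → 5 ≤ val q a := fun q hq => h5.trans (T2' hP hr hrH hq)
 simp at hd
 rcases hd with hd | hd | hd | hd
 ·exact two_col hP a 2 le_rfl (fun q hq => by have := hlo q hq; omega) (by omega) (by omega) (by rw [hd]; exact srch_6)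
 ·exact two_col hP a 5 (by omega) hlo (by omega) (by omega) (by rw [hd]; exact srch_12)
 ·exact two_col hP a 5 (by omega) hlo (by omega) (by omega) (by rw [hd]; exact srch_24)
 ·exact two_col hP a 5 (by omega) hlo (by omega) (by omega) (by rw [hd]; exact srch_48)
/-- primitive groups of degree 6 are 2-transitive -/
theorem prim_six (hP : Prim G Ω) (hd : Fintype.card Ω = 6) (a : Ω) : ∀ b c : Ω,b ≠ a → c ≠ a → ∃ g : G,g•a = a ∧ g•b = c := by
 classical
 intro b c hb hc
 refine trans_of_col ?_ hb hc
 refine two_col hP a 2 le_rfl ?_ (by omega) (by omega) (by rw [hd]; exact srch_6)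
 intro q hq
 by_contra hlt
 have h1 : val q a = 1 := by have := val_pos a q; omega
 obtain ⟨b,rfl⟩ := exists_col a q
 have hba : b ≠ a := fun h => hq (by rw [h])
 have hfix : ∀ g : G,g•a = a → g•b = b := by
  intro g hg
  rw [val,card_eq_one] at h1
  obtain ⟨x,hx⟩ := h1
  have m1 : b ∈ ({b' | col G a b' = col G a b} : Finset Ω) := by simp
  have m2 : g•b ∈ ({b' | col G a b' = col G a b} : Finset Ω) := by
   simp only [mem_filter,mem_univ,true_and]
   exact (col_eq ..).2 ⟨g,hg,rfl⟩
  rw [hx,mem_singleton] at m1 m2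
  rw [m1] at m2
  rw [m1]; exact m2
 have hstab : ∀ g : G,g•a = a → g = 1 := by
  intro g hg
  have hle : stabilizer G a = stabilizer G b := by
   have : stabilizer G a ≤ stabilizer G b := fun g hg => hfix g hg
   refine eq_of_le_of_card_ge this ?_
   have h3 := (stabilizer G a).card_mul_index
   have h4 := (stabilizer G b).card_mul_index
   rw [index_stabilizer_of_transitive] at h3 h4
   exact (Nat.eq_of_mul_eq_mul_right (Nat.card_pos_iff.2 ⟨⟨a⟩,inferInstance⟩) (h3.trans h4.symm)).ge
  have hr : ∀ x y : Ω,stabilizer G x = stabilizer G y := by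
   have := hP (fun x y => stabilizer G x = stabilizer G y) ⟨fun _ => rfl,fun h => h.symm,fun h h' => h.trans h'⟩
    (by
     intro g x y h
     rw [MulAction.stabilizer_smul_eq_stabilizer_map_conj,MulAction.stabilizer_smul_eq_stabilizer_map_conj,h])
   rcases this with h | h
   ·exact absurd (h _ _ hle).symm hba
   ·exact h
  apply eq_of_smul_eq_smul (α := Ω)
  intro x
  have : g ∈ stabilizer G x := by rw [hr x a]; exact hg
  rw [one_smul]; exact this
 have hcard : Nat.card G = 6 := by
  have h3 := (stabilizer G a).card_mul_index
  rw [index_stabilizer_of_transitive,card_eq_fintype_card (α := Ω),hd] at h3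
  have : stabilizer G a = ⊥ := by
   rw [eq_bot_iff]; intro g hg; exact hstab g hg
  rw [this] at h3
  simpa using h3.symm
 have : Fact (Nat.Prime 2) := ⟨prime_two⟩
 obtain ⟨k,hk⟩ := exists_prime_orderOf_dvd_card' (G := G) 2 (by rw [hcard]; decide)
 have hkk : k*k = 1 := by rw [←pow_two,←hk,pow_orderOf_eq_one]
 have hk1 : k ≠ 1 := by rintro rfl; simp at hk
 have := hP (fun x y => ∃ u v : G,x = u•a ∧ y = v•a ∧ (v = u ∨ v = u*k)) ⟨?_,?_,?_⟩ ?_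
 ·rcases this with h | h
  ·have h2 := h a (k•a) ⟨1,k,by simp,rfl,by simp⟩
   exact hk1 (hstab k h2.symm)
  ·have : (univ : Finset Ω) ⊆ {a,k•a} := by
    intro y _
    obtain ⟨u,v,h1,h2,h3⟩ := h a y
    have hu := hstab u h1.symm
    subst hu
    rcases h3 with rfl | rfl
    ·simp [h2]
    ·simp [h2]
   have h2 := card_le_card this
   rw [card_univ,hd] at h2
   have := Finset.card_le_two (a := a) (b := k•a)
   omega
 ·intro x
  obtain ⟨u,rfl⟩ := exists_smul_eq G a x
  exact ⟨u,u,rfl,rfl,by simp⟩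
 ·rintro x y ⟨u,v,h1,h2,rfl | rfl⟩
  ·exact ⟨v,v,h2,h1,by simp⟩
  ·exact ⟨_,u,h2,h1,Or.inr (by rw [mul_assoc,hkk,mul_one])⟩
 ·rintro x y z ⟨u,v,h1,h2,h3⟩ ⟨u',v',h1',h2',h3'⟩
  have : u' = v := by
   have := h2.symm.trans h1'
   have h5 := hstab (u'⁻¹*v) (by rw [mul_smul,this,inv_smul_smul])
   exact (inv_mul_eq_one.1 h5)
  subst this
  refine ⟨u,v',h1,h2',?_⟩
  rcases h3 with rfl | rfl <;> rcases h3' with rfl | rfl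
  ·simp
  ·simp
  ·simp
  ·left; rw [mul_assoc,hkk,mul_one]
 ·rintro g x y ⟨u,v,rfl,rfl,h3⟩
  refine ⟨g*u,g*v,by rw [mul_smul],by rw [mul_smul],?_⟩
  rcases h3 with rfl | rfl
  ·simp
  ·right; rw [mul_assoc]
end
end Sch
namespace Brn
open Finset
open Polynomial
lemma norm_root {z : ℂ} {m : ℕ} (hm : m ≠ 0) (h : z^m = 1) : ‖z‖ = 1 := by
 have : ‖z‖^m = 1 := by rw [←norm_pow,h,norm_one]
 exact (pow_eq_one_iff_of_nonneg (norm_nonneg _) hm).1 this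
lemma int_root {z : ℂ} {m : ℕ} (hm : m ≠ 0) (h : z^m = 1) : IsIntegral ℤ z := by
 refine ⟨X^m - 1,monic_X_pow_sub_C 1 hm,?_⟩
 simp [h]
/-- average of roots of unity -/
lemma avg (s : Multiset ℂ) {m : ℕ} (hm : m ≠ 0) (hs : ∀ z ∈ s,z^m = 1) (h0 : s.sum ≠ 0)
  (hi : IsIntegral ℤ (s.sum / (Multiset.card s : ℂ))) : ‖s.sum‖ = Multiset.card s := by
 classical
 have hc : (Multiset.card s : ℝ) ≠ 0 := by
  intro h
  have : s = 0 := by rw [←Multiset.card_eq_zero]; exact_mod_cast h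
  rw [this] at h0; simp at h0
 have : NeZero m := ⟨hm⟩
 set ζ := Complex.exp (2*Real.pi*Complex.I / m) with hζ
 have hprim : IsPrimitiveRoot ζ m := Complex.isPrimitiveRoot_exp m hm
 let K := IntermediateField.adjoin ℚ {ζ}
 have hζint : IsIntegral ℚ ζ := (int_root hm hprim.pow_eq_one).tower_top
 have : FiniteDimensional ℚ K := IntermediateField.adjoin.finiteDimensional hζint
 have : NumberField K := NumberField.mk
 have hK : ∀ z ∈ s,∃ y : K,(y : ℂ) = z ∧ y^m = 1 := by
  intro z hz
  obtain ⟨i,hi,rfl⟩ := hprim.eq_pow_of_pow_eq_one (hs z hz)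
  refine ⟨⟨ζ,IntermediateField.mem_adjoin_simple_self ℚ ζ⟩^i,by simp,?_⟩
  apply Subtype.ext
  simp only [IntermediateField.coe_pow,IntermediateField.coe_one]
  exact hs _ hz
 choose! f hf using hK
 have hfs : (((s.map f).sum : K) : ℂ) = s.sum := by
  have : algebraMap K ℂ (s.map f).sum = s.sum := by
   rw [map_multiset_sum,Multiset.map_map]
   congr 1
   conv_rhs => rw [←Multiset.map_id s]
   exact Multiset.map_congr rfl fun z hz => (hf z hz).1
  exact this
 set x : K := (s.map f).sum / (Multiset.card s : K) with hx
 have hxc : (x : ℂ) = s.sum / (Multiset.card s : ℂ) := by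
  rw [hx,IntermediateField.coe_div,hfs]; simp
 have hxi : IsIntegral ℤ x := by
  rw [←hxc] at hi
  exact (isIntegral_algebraMap_iff (A := K) (B := ℂ) (algebraMap K ℂ).injective).1 hi
 have hx0 : x ≠ 0 := by
  intro h
  have := congrArg (fun y : K => (y : ℂ)) h
  simp only [hxc] at this
  rw [IntermediateField.coe_zero,div_eq_zero_iff] at this
  rcases this with h | h
  ·exact h0 h
  ·exact hc (by exact_mod_cast h)
 obtain ⟨n,hn,hxn⟩ := NumberField.Embeddings.pow_eq_one_of_norm_le_one K ℂ hx0 hxi (by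
  intro φ
  rw [hx,map_div₀,map_natCast,norm_div,map_multiset_sum,Complex.norm_natCast]
  apply div_le_one_of_le₀ _ (Nat.cast_nonneg _)
  refine (norm_multiset_sum_le _).trans ?_
  rw [Multiset.map_map,Multiset.map_map]
  have : (s.map ((fun y => ‖φ y‖) ∘ f)) = s.map (fun _ => (1 : ℝ)) := by
   refine Multiset.map_congr rfl fun z hz => ?_
   exact norm_root hm (by rw [←map_pow,(hf z hz).2,map_one])
  simp only [Function.comp_def] at this ⊢
  rw [this]; simp)
 have h1 : ‖(x : ℂ)‖ = 1 := norm_root hn.ne' (by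
  have := congrArg (fun y : K => (y : ℂ)) hxn
  simpa using this)
 rw [hxc,norm_div,Complex.norm_natCast,div_eq_one_iff_eq hc] at h1
 exact h1
lemma eq_of_norm (s : Multiset ℂ) (hs : ∀ z ∈ s,‖z‖ = 1) (h : ‖s.sum‖ = Multiset.card s) : ∃ ζ,∀ z ∈ s,z = ζ := by
 by_cases h0 : s.sum = 0
 ·rw [h0,norm_zero] at h
  have : s = 0 := by rw [←Multiset.card_eq_zero]; exact_mod_cast h.symm
  exact ⟨0,by simp [this]⟩
 set w := s.sum with hw
 have hwn : ‖w‖ ≠ 0 := norm_ne_zero_iff.2 h0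
 set u := (starRingEnd ℂ w) / ‖w‖ with hu
 have hun : ‖u‖ = 1 := by rw [hu,norm_div,RCLike.norm_conj,Complex.norm_real,norm_norm,div_self hwn]
 have huw : u*w = (‖w‖ : ℂ) := by
  rw [hu,div_mul_eq_mul_div,mul_comm,Complex.mul_conj,Complex.normSq_eq_norm_sq]
  push_cast
  rw [sq,mul_div_assoc,div_self (by exact_mod_cast hwn),mul_one]
 have h1 : (s.map fun z => 1 - (u*z).re).sum = 0 := by
  rw [Multiset.sum_map_sub]
  have : (s.map fun z => (u*z).re).sum = ‖w‖ := by
   have h2 : (u*w).re = ‖w‖ := by rw [huw]; simp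
   have h3 : u*w = (s.map fun z => u*z).sum := by rw [Multiset.sum_map_mul_left,Multiset.map_id']
   have h4 := map_multiset_sum Complex.reLm (s.map fun z => u*z)
   rw [Multiset.map_map] at h4
   rw [←h2,h3]
   exact h4.symm
  rw [this,h]; simp
 have h2 : ∀ y ∈ (s.map fun z => 1 - (u*z).re),0 ≤ y := by
  intro y hy
  obtain ⟨z,hz,rfl⟩ := Multiset.mem_map.1 hy
  have := Complex.re_le_norm (u*z)
  rw [norm_mul,hun,hs z hz] at this
  linarith
 refine ⟨u⁻¹,fun z hz => ?_⟩
 have h3 : 1 - (u*z).re = 0 := Multiset.all_zero_of_le_zero_le_of_sum_eq_zero h2 h1 _ (Multiset.mem_map_of_mem _ hz)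
 have h4 : ‖u*z‖ = 1 := by rw [norm_mul,hun,hs z hz]; simp
 have h5 : u*z = 1 := by
  have hre : (u*z).re = 1 := by linarith
  have := Complex.sq_norm_sub_sq_re (u*z)
  rw [h4,hre] at this
  apply Complex.ext
  ·simp [hre]
  ·have : (u*z).im^2 = 0 := by linarith
   simpa using this
 exact eq_inv_of_mul_eq_one_right h5
lemma root_pow {d m : ℕ} {A : Matrix (Fin d) (Fin d) ℂ} (hA : A^m = 1) : ∀ z ∈ A.charpoly.roots,z^m = 1 := by
 intro z hz
 have h1 := (mem_roots'.1 hz).2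
 have h2 : Module.End.HasEigenvalue (Matrix.toLin' A) z := by
  rw [Module.End.hasEigenvalue_iff_isRoot_charpoly]
  rwa [Matrix.charpoly_toLin']
 obtain ⟨v,hv⟩ := h2.exists_hasEigenvector
 have h3 := hv.pow_apply m
 rw [←Matrix.toLin'_pow,hA,Matrix.toLin'_one] at h3
 have h4 : (z^m - 1)•v = 0 := by rw [sub_smul,←h3]; simp
 rcases smul_eq_zero.1 h4 with h | h
 ·exact sub_eq_zero.1 h
 ·exact absurd h hv.2
lemma scal {d m : ℕ} (hm : m ≠ 0) {A : Matrix (Fin d) (Fin d) ℂ} (hA : A^m = 1)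
  (hi : IsIntegral ℤ (A.trace / (d : ℂ))) : A.trace = 0 ∨ ∃ ζ : ℂ,A = algebraMap ℂ _ ζ := by
 by_cases h0 : A.trace = 0
 ·exact Or.inl h0
 right
 have hs := root_pow hA
 have hcard : Multiset.card A.charpoly.roots = d := by
  have := splits_iff_card_roots.1 (IsAlgClosed.splits A.charpoly)
  rw [this,Matrix.charpoly_natDegree_eq_dim,Fintype.card_fin]
 have htr := Matrix.trace_eq_sum_roots_charpoly A
 have h1 := avg A.charpoly.roots hm hs (by rwa [←htr]) (by rwa [←htr,hcard])
 obtain ⟨ζ,hζ⟩ := eq_of_norm _ (fun z hz => norm_root hm (hs z hz)) h1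
 have hrep : A.charpoly.roots = Multiset.replicate d ζ := by
  rw [Multiset.eq_replicate]; exact ⟨hcard,hζ⟩
 have hd : d ≠ 0 := by
  rintro rfl
  apply h0; simp [Matrix.trace]
 have hζm : ζ^m = 1 := hs ζ (by rw [hrep]; exact Multiset.mem_replicate.2 ⟨hd,rfl⟩)
 have hch : A.charpoly = (X - C ζ)^d := by
  rw [(IsAlgClosed.splits A.charpoly).eq_prod_roots_of_monic A.charpoly_monic,hrep]
  simp
 refine ⟨ζ,?_⟩
 have hroot : IsRoot (X^m - 1 : ℂ[X]) ζ := by simp [hζm]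
 obtain ⟨Q,hQ⟩ := dvd_iff_isRoot.2 hroot
 have hQζ : Q.eval ζ ≠ 0 := by
  have h2 := congrArg (fun p => (derivative p).eval ζ) hQ
  simp only [derivative_sub,derivative_X_pow,derivative_one,derivative_mul,derivative_X,derivative_C,eval_add,eval_mul,eval_sub,eval_X,eval_C,eval_pow,eval_one,sub_self,zero_mul,sub_zero,one_mul,eval_zero,add_zero,map_natCast,eval_natCast] at h2
  rw [←h2]
  have : ζ ≠ 0 := by rintro rfl; simp [hm] at hζm
  exact mul_ne_zero (by exact_mod_cast hm) (pow_ne_zero _ this)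
 have hco : IsCoprime ((X - C ζ)^d) Q := by
  apply IsCoprime.pow_left
  rw [Irreducible.coprime_iff_not_dvd (irreducible_X_sub_C ζ),dvd_iff_isRoot]
  exact hQζ
 obtain ⟨u,v,huv⟩ := hco
 have h5 : aeval A (X - C ζ) = 0 := by
  have h6 : (X - C ζ : ℂ[X]) = u*(X - C ζ)*A.charpoly+v*(X^m - 1) := by
   rw [hQ,hch]
   linear_combination (-(X - C ζ))*huv
  rw [h6,map_add,map_mul,Matrix.aeval_self_charpoly,mul_zero,map_mul,map_sub,map_pow,aeval_X,hA,map_one,sub_self,mul_zero,add_zero]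
 simpa [sub_eq_zero] using h5
end Brn
namespace Brn
open Finset
open Polynomial
section
variable {G : Type*} [Group G] [Finite G]
lemma trace_reg [Fintype G] {g : G} (hg : g ≠ 1) : LinearMap.trace ℂ _ (LinearMap.mulLeft ℂ (MonoidAlgebra.of ℂ G g)) = 0 := by
 classical
 rw [LinearMap.trace_eq_matrix_trace ℂ (MonoidAlgebra.basis G ℂ),Matrix.trace]
 apply Finset.sum_eq_zero
 intro x _
 rw [Matrix.diag_apply,LinearMap.toMatrix_apply,MonoidAlgebra.basis_apply,LinearMap.mulLeft_apply]
 simp only [MonoidAlgebra.of_apply,MonoidAlgebra.single_mul_single,mul_one]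
 rw [←MonoidAlgebra.basis_apply,Module.Basis.repr_self,Finsupp.single_apply,if_neg]
 intro h
 exact hg (mul_eq_right.1 h)
lemma trace_pi {n : ℕ} (d : Fin n → ℕ) (x : Π i,Matrix (Fin (d i)) (Fin (d i)) ℂ) :
  LinearMap.trace ℂ _ (LinearMap.mulLeft ℂ x) = ∑ i,(d i : ℂ)*(x i).trace := by
 classical
 rw [LinearMap.trace_eq_matrix_trace ℂ (Pi.basis fun i => Matrix.stdBasis ℂ (Fin (d i)) (Fin (d i))),Matrix.trace,Fintype.sum_sigma]
 refine sum_congr rfl fun i _ => ?_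
 rw [sum_prod_type]
 simp only [Matrix.diag_apply,LinearMap.toMatrix_apply,LinearMap.mulLeft_apply,Pi.basis_repr,Pi.basis_apply,Pi.mul_apply,Pi.single_eq_same,Matrix.stdBasis_eq_single]
 have : ∀ a b : Fin (d i),((Matrix.stdBasis ℂ (Fin (d i)) (Fin (d i))).repr (x i*Matrix.single a b 1)) (a,b) = x i a a := by
  intro a b
  change (x i*(Matrix.single a b 1 : Matrix (Fin (d i)) (Fin (d i)) ℂ)) a b = _
  simp
 simp only [this]
 rw [sum_comm]
 simp [Matrix.trace]
lemma class_int (C : Finset G) : IsIntegral ℤ (∑ h ∈ C,MonoidAlgebra.of ℂ G h) := by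
 have h1 : IsIntegral ℤ (∑ h ∈ C,MonoidAlgebra.of ℤ G h) := Algebra.IsIntegral.isIntegral _
 have h2 := h1.map (MonoidAlgebra.mapRingHom G (Int.castRingHom ℂ)).toIntAlgHom
 simpa using h2
lemma comm_all {z : MonoidAlgebra ℂ G} (hz : ∀ h,z*MonoidAlgebra.of ℂ G h = MonoidAlgebra.of ℂ G h*z) (w) : z*w = w*z := by
 induction w using MonoidAlgebra.induction_on with
 | of g => exact hz g
 | add a b ha hb => rw [mul_add,add_mul,ha,hb]
 | smul r a ha => rw [mul_smul_comm,smul_mul_assoc,ha]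
/-- main step of Burnside's theorem -/
theorem burnside_core {g : G} (hg : g ≠ 1) {p k : ℕ} (hp : p.Prime) (hC : Nat.card {h // IsConj g h} = p^k) :
  ∃ (d : ℕ) (ρ : G →* Matrix (Fin d) (Fin d) ℂ),(∃ h,ρ h ≠ 1) ∧ ∃ ζ : ℂ,ρ g = algebraMap ℂ _ ζ := by
 classical
 letI := ofFinite G
 obtain ⟨n,d,hd,⟨e⟩⟩ := IsSemisimpleRing.exists_algEquiv_pi_matrix_of_isAlgClosed ℂ (MonoidAlgebra ℂ G)
 let E : ∀ i,MonoidAlgebra ℂ G →ₐ[ℂ] Matrix (Fin (d i)) (Fin (d i)) ℂ := fun i =>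
  (Pi.evalAlgHom ℂ (fun i => Matrix (Fin (d i)) (Fin (d i)) ℂ) i).comp e.toAlgHom
 let ρ : ∀ i,G →* Matrix (Fin (d i)) (Fin (d i)) ℂ := fun i =>
  (E i : MonoidAlgebra ℂ G →* Matrix (Fin (d i)) (Fin (d i)) ℂ).comp (MonoidAlgebra.of ℂ G)
 have hρ : ∀ i h,ρ i h = e (MonoidAlgebra.of ℂ G h) i := fun i h => rfl
 by_contra! H
 have H' : ∀ i,(∃ h,ρ i h ≠ 1) → ∀ ζ : ℂ,ρ i g ≠ algebraMap ℂ _ ζ := fun i hi => H (d i) (ρ i) hi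
 have hsurj : ∀ i (M : Matrix (Fin (d i)) (Fin (d i)) ℂ),∃ z,e z i = M := by
  intro i M
  refine ⟨e.symm (Pi.single i M),by simp⟩
 have hscal : ∀ z : MonoidAlgebra ℂ G,(∀ h,z*MonoidAlgebra.of ℂ G h = MonoidAlgebra.of ℂ G h*z) → ∀ i,∃ l : ℂ,e z i = algebraMap ℂ _ l := by
  intro z hz i
  have : e z i ∈ Set.range (Matrix.scalar (Fin (d i))) := by
   rw [←Matrix.center_eq_range]
   rw [Semigroup.mem_center_iff]
   intro M
   obtain ⟨w,rfl⟩ := hsurj i M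
   rw [←Pi.mul_apply,←Pi.mul_apply,←map_mul,←map_mul,comm_all hz]
  obtain ⟨l,hl⟩ := this
  exact ⟨l,hl.symm⟩
 have hdpos : ∀ i,(d i : ℂ) ≠ 0 := fun i => by exact_mod_cast (hd i).ne
 have hinj : ∀ i,Injective (algebraMap ℂ (Matrix (Fin (d i)) (Fin (d i)) ℂ)) := fun i => by
  have := hd i
  exact (algebraMap ℂ (Matrix (Fin (d i)) (Fin (d i)) ℂ)).injective
 have htrs : ∀ i (l : ℂ),(algebraMap ℂ (Matrix (Fin (d i)) (Fin (d i)) ℂ) l).trace = d i*l := by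
  intro i l
  rw [Algebra.algebraMap_eq_smul_one,Matrix.trace_smul,trace_one]; simp [mul_comm]
 -- sum of d chi
 have hsum : ∑ i,(d i : ℂ)*(ρ i g).trace = 0 := by
  rw [←trace_reg hg]
  have h1 := trace_pi d (e (MonoidAlgebra.of ℂ G g))
  refine Eq.trans h1.symm ?_
  have h2 : LinearMap.mulLeft ℂ (e (MonoidAlgebra.of ℂ G g)) = e.toLinearEquiv.conj (LinearMap.mulLeft ℂ (MonoidAlgebra.of ℂ G g)) := by
   ext x i
   simp [LinearEquiv.conj_apply]
  rw [h2,LinearMap.trace_conj']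
 have hgm : g^Nat.card G = 1 := pow_card_eq_one'
 have hm : Nat.card G ≠ 0 := Nat.card_pos.ne'
 have hpow : ∀ i,ρ i g^Nat.card G = 1 := fun i => by rw [←map_pow,hgm,map_one]
 -- traces are integral
 have hχ : ∀ i,IsIntegral ℤ (ρ i g).trace := by
  intro i
  rw [Matrix.trace_eq_sum_roots_charpoly]
  apply IsIntegral.multiset_sum
  intro z hz
  exact int_root hm (root_pow (hpow i) z hz)
 -- class sum
 let C : Finset G := {h | IsConj g h}
 have hCc : (C.card : ℕ) = p^k := by
  rw [←hC,card_eq_fintype_card,Fintype.card_subtype]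
 let c := ∑ h ∈ C,MonoidAlgebra.of ℂ G h
 have hcc : ∀ h,c*MonoidAlgebra.of ℂ G h = MonoidAlgebra.of ℂ G h*c := by
  intro h
  simp only [c]
  rw [Finset.sum_mul,mul_sum]
  refine Finset.sum_bij' (fun x _ => h⁻¹*x*h) (fun x _ => h*x*h⁻¹) ?_ ?_ ?_ ?_ ?_
  ·intro x hx
   simp only [C,mem_filter,mem_univ,true_and] at hx ⊢
   refine hx.trans ?_
   exact isConj_iff.2 ⟨h⁻¹,by simp⟩
  ·intro x hx
   simp only [C,mem_filter,mem_univ,true_and] at hx ⊢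
   exact hx.trans (isConj_iff.2 ⟨h,rfl⟩)
  ·intro x _; group
  ·intro x _; group
  ·intro x _
   rw [←map_mul,←map_mul]
   congr 1; group
 choose l hl using hscal c hcc
 have hlint : ∀ i,IsIntegral ℤ (l i) := by
  intro i
  have h1 : IsIntegral ℤ c := class_int C
  have h2 := h1.map ((E i).restrictScalars ℤ)
  have h3 : IsIntegral ℤ (e c i) := h2
  rw [hl] at h3
  exact (isIntegral_algebraMap_iff (hinj i)).1 h3
 have hltr : ∀ i,(d i : ℂ)*l i = (p : ℂ)^k*(ρ i g).trace := by
  intro i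
  rw [←htrs,←hl]
  simp only [c]
  rw [map_sum,Finset.sum_apply,Matrix.trace_sum]
  have : ∀ h ∈ C,(e (MonoidAlgebra.of ℂ G h) i).trace = (ρ i g).trace := by
   intro h hh
   simp only [C,mem_filter,mem_univ,true_and] at hh
   obtain ⟨u,rfl⟩ := isConj_iff.1 hh
   rw [←hρ,map_mul,Matrix.trace_mul_comm,←map_mul]
   congr 2; group
  rw [sum_congr rfl this,Finset.sum_const,hCc]
  simp
 have hcast : ∀ u : ℤ,IsIntegral ℤ (u : ℂ) := fun u => by
  have := isIntegral_algebraMap (R := ℤ) (x := u) (A := ℂ)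
  simpa using this
 -- nontrivial components
 have hnon : ∀ i,(∃ h,ρ i h ≠ 1) → ∃ θ : ℂ,IsIntegral ℤ θ ∧ (d i : ℂ)*(ρ i g).trace = p*θ := by
  intro i hi
  by_cases hpd : p ∣ d i
  ·obtain ⟨q,hq⟩ := hpd
   refine ⟨q*(ρ i g).trace,?_,?_⟩
   ·have := (hcast q).mul (hχ i)
    exact_mod_cast this
   ·have hq' : (d i : ℂ) = p*q := by exact_mod_cast hq
    linear_combination (ρ i g).trace*hq'
  ·refine ⟨0,isIntegral_zero,?_⟩
   rw [mul_zero]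
   have hco : IsCoprime ((p^k : ℕ) : ℤ) (d i : ℤ) := by
    rw [Nat.isCoprime_iff_coprime]
    exact Coprime.pow_left _ ((Nat.Prime.coprime_iff_not_dvd hp).2 hpd)
   obtain ⟨u,v,huv⟩ := hco
   have h1 : (ρ i g).trace / (d i : ℂ) = (u : ℂ)*l i+(v : ℂ)*(ρ i g).trace := by
    rw [div_eq_iff (hdpos i)]
    have huv' : (u : ℂ)*(p : ℂ)^k+v*d i = 1 := by exact_mod_cast huv
    linear_combination (-(ρ i g).trace)*huv' - (u : ℂ)*hltr i
   have h2 : IsIntegral ℤ ((ρ i g).trace / (d i : ℂ)) := by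
    rw [h1]
    exact ((hcast u).mul (hlint i)).add ((hcast v).mul (hχ i))
   rcases scal hm (hpow i) h2 with h | ⟨ζ,hζ⟩
   ·rw [h,mul_zero]
   ·exact absurd hζ (H' i hi ζ)
 -- the trivial component
 let s := ∑ h : G,MonoidAlgebra.of ℂ G h
 have hsmul : ∀ h,MonoidAlgebra.of ℂ G h*s = s := by
  intro h
  simp only [s]
  rw [mul_sum]
  simp_rw [←map_mul]
  exact Fintype.sum_equiv (Equiv.mulLeft h) _ _ (fun x => rfl)
 have hmuls : ∀ h,s*MonoidAlgebra.of ℂ G h = s := by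
  intro h
  simp only [s]
  rw [Finset.sum_mul]
  simp_rw [←map_mul]
  exact Fintype.sum_equiv (Equiv.mulRight h) _ _ (fun x => rfl)
 have hs0 : s ≠ 0 := by
  intro h
  have h1 := congrArg (fun z => (MonoidAlgebra.basis G ℂ).repr z 1) h
  simp only [s,map_sum,MonoidAlgebra.of_apply] at h1
  simp_rw [←MonoidAlgebra.basis_apply,Module.Basis.repr_self] at h1
  simp [Finsupp.finsetSum_apply,Finsupp.single_apply] at h1
 choose m hms using hscal s (fun h => by rw [hsmul,hmuls])
 obtain ⟨i0,hi0⟩ : ∃ i,e s i ≠ 0 := by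
  by_contra! h
  exact hs0 (e.injective (by rw [map_zero]; ext1 i; exact h i))
 have htriv : ∀ h,ρ i0 h = 1 := by
  intro h
  have h1 : ρ i0 h*e s i0 = e s i0 := by
   rw [hρ,←Pi.mul_apply,←map_mul,hsmul]
  rw [hms] at h1 hi0
  have hm0 : m i0 ≠ 0 := fun h => hi0 (by rw [h,map_zero])
  rw [Algebra.algebraMap_eq_smul_one,mul_smul_comm,mul_one] at h1
  exact smul_right_injective _ hm0 h1
 have haug : ∀ i,(∀ h,ρ i h = 1) → ∀ z,∃ t : ℂ,e z i = algebraMap ℂ _ t ∧ ∀ j,(∀ h,ρ j h = 1) → e z j = algebraMap ℂ _ t := by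
  intro i hi z
  induction z using MonoidAlgebra.induction_on with
  | of h => exact ⟨1,by rw [←hρ,hi,map_one],fun j hj => by rw [←hρ,hj,map_one]⟩
  | add a b ha hb =>
   obtain ⟨t,ht,ht'⟩ := ha
   obtain ⟨t2,ht2,ht2'⟩ := hb
   exact ⟨t+t2,by rw [map_add,Pi.add_apply,ht,ht2,map_add],fun j hj => by rw [map_add,Pi.add_apply,ht' j hj,ht2' j hj,map_add]⟩
  | smul r a ha =>
   obtain ⟨t,ht,ht'⟩ := ha
   exact ⟨r*t,by rw [map_smul,Pi.smul_apply,ht,map_mul,Algebra.smul_def],fun j hj => by rw [map_smul,Pi.smul_apply,ht' j hj,map_mul,Algebra.smul_def]⟩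
 have huniq : ∀ i,i ≠ i0 → ∃ h,ρ i h ≠ 1 := by
  intro i hi
  by_contra! hh
  obtain ⟨t,h1,h2⟩ := haug i hh (e.symm (Pi.single i 1))
  have h3 := h2 i0 htriv
  rw [AlgEquiv.apply_symm_apply,Pi.single_eq_same] at h1
  rw [AlgEquiv.apply_symm_apply,Pi.single_eq_of_ne (Ne.symm hi)] at h3
  have h4 : t = 0 := hinj i0 (by rw [←h3,map_zero])
  have h5 : (1 : ℂ) = t := hinj i (by rw [←h1,map_one])
  rw [h4] at h5; exact one_ne_zero h5
 have hd1 : d i0 = 1 := by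
  by_contra hne
  have h2 : 2 ≤ d i0 := by have := (hd i0).ne; omega
  obtain ⟨z,hz⟩ := hsurj i0 (Matrix.single ⟨0,by omega⟩ ⟨1,by omega⟩ 1)
  obtain ⟨t,ht,_⟩ := haug i0 htriv z
  rw [hz] at ht
  have := congrFun (congrFun ht ⟨0,by omega⟩) ⟨1,by omega⟩
  rw [Matrix.algebraMap_matrix_apply] at this
  simp at this
 choose! θ hθ1 hθ2 using fun i (hi : i ≠ i0) => hnon i (huniq i hi)
 rw [←Finset.add_sum_erase _ _ (mem_univ i0),htriv,trace_one,hd1,sum_congr rfl (fun i hi => hθ2 i (Finset.ne_of_mem_erase hi)),←mul_sum] at hsum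
 have hTh : IsIntegral ℤ (∑ i ∈ univ.erase i0,θ i) := IsIntegral.sum _ fun i hi => hθ1 i (Finset.ne_of_mem_erase hi)
 set Θ := ∑ i ∈ univ.erase i0,θ i
 have hp0 : (p : ℂ) ≠ 0 := by exact_mod_cast hp.ne_zero
 have hΘ : Θ = ((-1 / p : ℚ) : ℂ) := by
  push_cast
  rw [eq_div_iff hp0]
  have : (1 : ℂ)+p*Θ = 0 := by simpa [hd1] using hsum
  linear_combination this
 rw [hΘ] at hTh
 have h7 : IsIntegral ℤ (-1 / p : ℚ) := by
  have : IsIntegral ℤ (algebraMap ℚ ℂ (-1 / p : ℚ)) := hTh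
  exact (isIntegral_algebraMap_iff (algebraMap ℚ ℂ).injective).1 this
 obtain ⟨y,hy⟩ := IsIntegrallyClosed.isIntegral_iff.1 h7
 have h8 : (y : ℚ)*p = -1 := by
  have hp0' : (p : ℚ) ≠ 0 := by exact_mod_cast hp.ne_zero
  rw [show (y : ℚ) = -1 / p from hy,div_mul_cancel₀ _ hp0']
 have h9 : y*(p : ℤ) = -1 := by exact_mod_cast h8
 have h10 : (p : ℤ) ∣ 1 := ⟨-y,by linarith⟩
 have := Int.natCast_dvd_natCast.1 (by exact_mod_cast h10 : (p : ℤ) ∣ ((1 : ℕ) : ℤ))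
 exact hp.one_lt.ne' (Nat.dvd_one.1 this)
end
end Brn
namespace Brn
open Finset
lemma simple_comm {G : Type*} [Group G] [Finite G] [IsSimpleGroup G] {g : G} (hg : g ≠ 1) {p k : ℕ} (hp : p.Prime)
  (hC : Nat.card {h // IsConj g h} = p^k) : ∀ a b : G,a*b = b*a := by
 obtain ⟨d,ρ,⟨h,hh⟩,ζ,hζ⟩ := burnside_core hg hp hC
 have hker : ρ.ker = ⊥ := by
  rcases ρ.normal_ker.eq_bot_or_eq_top with h1 | h1
  ·exact h1
  ·exfalso; apply hh
   have : h ∈ ρ.ker := by rw [h1]; trivial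
   exact this
 have hinj := (ker_eq_bot_iff ρ).1 hker
 have hcen : g ∈ center G := by
  rw [mem_center_iff]
  intro x
  apply hinj
  rw [map_mul,map_mul,hζ]
  exact (Algebra.commutes ζ (ρ x)).symm
 have htop : center G = ⊤ := by
  rcases (inferInstance : (center G).Normal).eq_bot_or_eq_top with h1 | h1
  ·rw [h1,mem_bot] at hcen; exact absurd hcen hg
  ·exact h1
 intro a b
 have : b ∈ center G := by rw [htop]; trivial
 exact mem_center_iff.1 this a
lemma card_conj {G : Type*} [Group G] [Finite G] (g : G) : Nat.card {h // IsConj g h} = (centralizer {g}).index := by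
 have h1 := index_stabilizer (ConjAct G) g
 rw [ConjAct.stabilizer_eq_centralizer] at h1
 have h2 : (centralizer {ConjAct.toConjAct g}).index = (centralizer {g}).index := rfl
 rw [←h2,h1]
 have h3 : MulAction.orbit (ConjAct G) g = {h | IsConj g h} := by
  ext h
  rw [ConjAct.mem_orbit_conjAct]
  exact isConj_comm
 rw [h3]
 rfl
lemma burnside_aux (n : ℕ) : ∀ (G : Type u) [Group G] [Finite G],Nat.card G = n →
  (∀ r : ℕ,r.Prime → r ∣ Nat.card G → r < 5) → Group.IsSolvable G := by
 induction n using Nat.strong_induction_on with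
 | _ n ih =>
 intro G _ _ hn hr
 by_cases hN : ∃ N : Subgroup G,N.Normal ∧ N ≠ ⊥ ∧ N ≠ ⊤
 ·obtain ⟨N,hNn,hb,ht⟩ := hN
  have hmul := N.card_eq_card_quotient_mul_card_subgroup
  have hN1 : 1 < Nat.card N := (Subgroup.one_lt_card_iff_ne_bot N).2 hb
  have hNi : 1 < Nat.card (G ⧸ N) := by
   have : N.index ≠ 1 := fun h => ht (index_eq_one.1 h)
   have h0 : N.index ≠ 0 := Subgroup.index_ne_zero_of_finite
   show 1 < N.index
   omega
  have hs1 : Group.IsSolvable N := by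
   apply ih (Nat.card N) _ N rfl
   ·intro r hp hd; exact hr r hp (hd.trans (card_subgroup_dvd_card N))
   ·rw [←hn,hmul]; nlinarith
  have hs2 : Group.IsSolvable (G ⧸ N) := by
   apply ih (Nat.card (G ⧸ N)) _ (G ⧸ N) rfl
   ·intro r hp hd; exact hr r hp (hd.trans (Subgroup.card_quotient_dvd_card N))
   ·rw [←hn,hmul]; nlinarith
  exact Group.isSolvable_of_ker_le_range N.subtype (mk' N) (by simp)
 ·push Not at hN
  rcases subsingleton_or_nontrivial G with hs | hnt
  ·infer_instance
  have hsim : IsSimpleGroup G := ⟨fun N hNn => by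
   by_cases hb : N = ⊥
   ·exact Or.inl hb
   ·exact Or.inr (hN N hNn hb)⟩
  have hc1 : Nat.card G ≠ 1 := by
   have := Finite.one_lt_card_iff_nontrivial.2 hnt
   omega
  obtain ⟨p,hp,hpd⟩ := Nat.exists_prime_and_dvd hc1
  have : Fact p.Prime := ⟨hp⟩
  let P : Sylow p G := default
  have hPnt : Nontrivial P := by
   rw [Subgroup.nontrivial_iff_ne_bot]
   intro h
   exact (P.ne_bot_of_dvd_card hpd) h
  have : Nontrivial (center P) := P.2.center_nontrivial
  obtain ⟨z,hz⟩ := exists_ne (1 : center P)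
  have hzG : ((z : P) : G) ≠ 1 := by
   intro h; apply hz; ext; simpa using h
  have hle : (P : Subgroup G) ≤ centralizer {((z : P) : G)} := by
   intro y hy
   rw [Subgroup.mem_centralizer_singleton_iff]
   have := mem_center_iff.1 z.2 ⟨y,hy⟩
   exact congrArg Subtype.val this
  have hdvd : (centralizer {((z : P) : G)}).index ∣ (P : Subgroup G).index := index_dvd_of_le hle
  have hnp : ¬ p ∣ (centralizer {((z : P) : G)}).index := fun h =>
   P.not_dvd_index (h.trans hdvd)
  have key : ∃ q k : ℕ,q.Prime ∧ (centralizer {((z : P) : G)}).index = q^k := by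
   have hidx : (centralizer {((z : P) : G)}).index ∣ Nat.card G := index_dvd_card _
   have h0 : (centralizer {((z : P) : G)}).index ≠ 0 := Subgroup.index_ne_zero_of_finite
   have hp5 := hr p hp hpd
   have h23 : ∀ r : ℕ,r.Prime → r < 5 → r = 2 ∨ r = 3 := by
    intro r h1 h2
    have := h1.two_le
    interval_cases r
    ·simp
    ·simp
    ·exact absurd h1 (by norm_num)
   refine ⟨5 - p,_,?_,Nat.eq_prime_pow_of_unique_prime_dvd h0 ?_⟩
   ·rcases h23 p hp hp5 with rfl | rfl <;> norm_num
   ·intro d hd hdd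
    have h5 := hr d hd (hdd.trans hidx)
    have hne : d ≠ p := fun h => hnp (h ▸ hdd)
    rcases h23 p hp hp5 with h | h <;> rcases h23 d hd h5 with h' | h' <;> omega
  obtain ⟨q,k,hq,hqk⟩ := key
  have := simple_comm hzG hq ((card_conj _).trans hqk)
  exact Group.isSolvable_of_comm this
theorem burnside (G : Type u) [Group G] [Finite G] (hr : ∀ r : ℕ,r.Prime → r ∣ Nat.card G → r < 5) : Group.IsSolvable G :=
 burnside_aux _ G rfl hr
end Brn
namespace Mn
open MulAction
variable {G : Type u} {Ω : Type*} [Group G] [MulAction G Ω]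
/-- the orbit of `α` under the subgroup `S` -/
def Orb (S : Subgroup G) (α : Ω) : Set Ω := {β | ∃ g ∈ S,g•α = β}
lemma orb_self (S : Subgroup G) (α : Ω) : α ∈ Orb S α := ⟨1,S.one_mem,one_smul _ _⟩
lemma orb_mono {S T : Subgroup G} (h : S ≤ T) (α : Ω) : Orb S α ⊆ Orb T α := by
 rintro β ⟨g,hg,rfl⟩; exact ⟨g,h hg,rfl⟩
lemma orb_card (S : Subgroup G) (α : Ω) : (Orb S α).ncard = (stabilizer G α).relIndex S := by
 have h1 : Orb S α = orbit S α := by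
  ext β
  constructor
  ·rintro ⟨g,hg,rfl⟩; exact ⟨⟨g,hg⟩,rfl⟩
  ·rintro ⟨⟨g,hg⟩,rfl⟩; exact ⟨g,hg,rfl⟩
 rw [h1,←index_stabilizer]
 rfl
lemma orb_sup (U : Subgroup G) (α : Ω) (hU : ∀ h ∈ stabilizer G α,∀ u ∈ U,h*u*h⁻¹ ∈ U) :
  Orb (U ⊔ stabilizer G α) α = Orb U α := by
 apply Set.Subset.antisymm _ (orb_mono le_sup_left α)
 rintro β ⟨g,hg,rfl⟩
 have hU' : ∀ h ∈ stabilizer G α,∀ β ∈ Orb U α,h•β ∈ Orb U α := by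
  rintro h hh β ⟨u,hu,rfl⟩
  refine ⟨h*u*h⁻¹,hU h hh u hu,?_⟩
  have : h⁻¹•α = α := (stabilizer G α).inv_mem hh
  rw [mul_smul,this,mul_smul]
 have : ∀ β ∈ Orb U α,g•β ∈ Orb U α := by
  rw [Subgroup.sup_eq_closure] at hg
  induction hg using Subgroup.closure_induction'' with
  | one => intro β hβ; rwa [one_smul]
  | mem x hx =>
   rcases hx with hx | hx
   ·rintro β ⟨u,hu,rfl⟩; exact ⟨x*u,U.mul_mem hx hu,mul_smul _ _ _⟩
   ·exact hU' x hx
  | inv_mem x hx =>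
   rcases hx with hx | hx
   ·rintro β ⟨u,hu,rfl⟩; exact ⟨x⁻¹*u,U.mul_mem (U.inv_mem hx) hu,mul_smul _ _ _⟩
   ·exact hU' x⁻¹ ((stabilizer G α).inv_mem hx)
  | mul x y _ _ hx hy => intro β hβ; rw [mul_smul]; exact hx _ (hy _ hβ)
 exact this α (orb_self U α)
/-- The situation of a minimal counterexample. -/
structure Hyp (G : Type u) {Ω : Type*} [Group G] [MulAction G Ω] (α : Ω) : Prop where
 card : Nat.card Ω = 48
 trans : ∀ β : Ω,∃ g : G,g•α = β
 min : ∀ K : Subgroup G,(∀ β : Ω,∃ g ∈ K,g•α = β) → K = ⊤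
 nob : ∀ S : Subgroup G,stabilizer G α ≤ S → 4 < (Orb S α).ncard ∨ (Orb S α).ncard = 1
variable [Finite G] [FaithfulSMul G Ω] {α : Ω}
lemma Hyp.ptr (h : Hyp G α) : IsPretransitive G Ω := by
 constructor
 intro x y
 obtain ⟨a,rfl⟩ := h.trans x
 obtain ⟨b,rfl⟩ := h.trans y
 exact ⟨b*a⁻¹,by rw [mul_smul,inv_smul_smul]⟩
lemma Hyp.index (h : Hyp G α) : (stabilizer G α).index = 48 := by
 have := h.ptr
 rw [index_stabilizer,MulAction.orbit_eq_univ,Set.ncard_univ,h.card]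
lemma Hyp.orb_mul (h : Hyp G α) {S : Subgroup G} (hS : stabilizer G α ≤ S) :
  (Orb S α).ncard*S.index = 48 := by
 rw [orb_card,relIndex_mul_index hS,h.index]
lemma Hyp.fin (h : Hyp G α) : Finite Ω := Nat.finite_of_card_ne_zero (by rw [h.card]; norm_num)
lemma orb_normal (N : Subgroup G) [hN : N.Normal] : Orb (N ⊔ stabilizer G α) α = Orb N α :=
 orb_sup N α (fun h _ u hu => hN.conj_mem u hu h)
lemma Hyp.orb_dvd (h : Hyp G α) (N : Subgroup G) [N.Normal] : (Orb N α).ncard ∣ 48 := by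
 rw [←orb_normal N]
 exact ⟨_,(h.orb_mul le_sup_right).symm⟩
lemma Hyp.orb_four (h : Hyp G α) (N : Subgroup G) [hN : N.Normal] (hb : N ≠ ⊥) : 4 < (Orb N α).ncard := by
 rcases h.nob (N ⊔ stabilizer G α) le_sup_right with h1 | h1
 ·rwa [orb_normal] at h1
 ·exfalso
  rw [orb_normal,Set.ncard_eq_one] at h1
  obtain ⟨a,ha⟩ := h1
  apply hb
  rw [eq_bot_iff]
  intro n hn
  rw [mem_bot]
  apply FaithfulSMul.eq_of_smul_eq_smul (α := Ω)
  intro β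
  obtain ⟨g,rfl⟩ := h.trans β
  have h1 : (g⁻¹*n*g)•α ∈ Orb N α := ⟨_,by simpa using hN.conj_mem n hn g⁻¹,rfl⟩
  have h2 := orb_self N α
  rw [ha] at h1 h2
  have h3 : (g⁻¹*n*g)•α = α := by rw [Set.mem_singleton_iff.1 h1,Set.mem_singleton_iff.1 h2]
  rw [mul_smul,mul_smul,inv_smul_eq_iff] at h3
  rw [h3,one_smul]
/-- an elementary abelian normal 2-subgroup has no small invariant sets in its orbit -/
lemma Hyp.small_one (h : Hyp G α) {E : Subgroup G} [hE : E.Normal] (hc : ∀ a ∈ E,∀ b ∈ E,a*b = b*a)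
  (h2 : ∀ a ∈ E,a*a = 1) {e : G} (he : e ∈ E) (hne : e•α ≠ α)
  (hH : ∀ h : G,h•α = α → h•e•α = e•α) : False := by
 have hU : ∃ U : Subgroup G,∀ u,u ∈ U ↔ (u ∈ E ∧ (u•α = α ∨ u•α = e•α)) := by
  refine ⟨⟨⟨⟨{u | u ∈ E ∧ (u•α = α ∨ u•α = e•α)},?_⟩,?_⟩,?_⟩,fun u => Iff.rfl⟩
  ·rintro a b ⟨ha,ha'⟩ ⟨hb,hb'⟩
   refine ⟨E.mul_mem ha hb,?_⟩
   rw [mul_smul]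
   rcases hb' with hb' | hb'
   ·rwa [hb']
   ·rw [hb',←mul_smul,hc a ha e he,mul_smul]
    rcases ha' with ha' | ha'
    ·rw [ha']; exact Or.inr rfl
    ·rw [ha',←mul_smul,h2 e he,one_smul]; exact Or.inl rfl
  ·exact ⟨E.one_mem,Or.inl (one_smul _ _)⟩
  ·rintro a ⟨ha,ha'⟩
   have : a⁻¹ = a := inv_eq_of_mul_eq_one_left (h2 a ha)
   show a⁻¹ ∈ E ∧ (a⁻¹•α = α ∨ a⁻¹•α = e•α)
   rw [this]
   exact ⟨ha,ha'⟩
 obtain ⟨U,hU⟩ := hU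
 have hinv : ∀ x ∈ stabilizer G α,∀ u ∈ U,x*u*x⁻¹ ∈ U := by
  intro x hx u hu
  rw [hU] at hu ⊢
  refine ⟨hE.conj_mem u hu.1 x,?_⟩
  have hx1 : x⁻¹•α = α := (stabilizer G α).inv_mem hx
  rw [mul_smul,hx1,mul_smul]
  rcases hu.2 with h3 | h3
  ·rw [h3]; exact Or.inl hx
  ·rw [h3]; exact Or.inr (hH x hx)
 have ho : Orb (U ⊔ stabilizer G α) α = {α,e•α} := by
  rw [orb_sup U α hinv]
  ext β
  constructor
  ·rintro ⟨u,hu,rfl⟩; exact ((hU u).1 hu).2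
  ·rintro (rfl | rfl)
   ·exact orb_self U _
   ·exact ⟨e,(hU e).2 ⟨he,Or.inr rfl⟩,rfl⟩
 have := h.nob (U ⊔ stabilizer G α) le_sup_right
 rw [ho,Set.ncard_pair hne.symm] at this
 omega
lemma Hyp.small_three (h : Hyp G α) {E : Subgroup G} [hE : E.Normal] (hc : ∀ a ∈ E,∀ b ∈ E,a*b = b*a)
  (h2 : ∀ a ∈ E,a*a = 1) {a b c : G} (ha : a ∈ E) (hb : b ∈ E) (hcc : c ∈ E)
  (h1a : a•α ≠ α) (h1b : b•α ≠ α) (h1c : c•α ≠ α)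
  (hab : a•α ≠ b•α) (hac : a•α ≠ c•α) (hbc : b•α ≠ c•α)
  (hs : a•b•c•α = α)
  (hH : ∀ h : G,h•α = α → ∀ β ∈ ({a•α,b•α,c•α} : Set Ω),h•β ∈ ({a•α,b•α,c•α} : Set Ω)) : False := by
 have sw : ∀ x ∈ E,∀ y ∈ E,∀ β : Ω,x•y•β = y•x•β := fun x hx y hy β => by
  rw [←mul_smul,hc x hx y hy,mul_smul]
 have sq : ∀ x ∈ E,∀ β : Ω,x•x•β = β := fun x hx β => by rw [←mul_smul,h2 x hx,one_smul]
 have e1 : a•b•α = c•α := by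
  have : c•a•b•c•α = c•α := by rw [hs]
  rwa [sw c hcc a ha,sw c hcc b hb,sq c hcc] at this
 have e2 : a•c•α = b•α := by
  have : b•a•b•c•α = b•α := by rw [hs]
  rwa [sw b hb a ha,sq b hb] at this
 have e3 : b•c•α = a•α := by
  have : a•a•b•c•α = a•α := by rw [hs]
  rwa [sq a ha] at this
 have hU : ∃ U : Subgroup G,∀ u,u ∈ U ↔ (u ∈ E ∧ u•α ∈ ({α,a•α,b•α,c•α} : Set Ω)) := by
  refine ⟨⟨⟨⟨{u | u ∈ E ∧ u•α ∈ ({α,a•α,b•α,c•α} : Set Ω)},?_⟩,?_⟩,?_⟩,fun u => Iff.rfl⟩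
  ·rintro x y ⟨hx,hx'⟩ ⟨hy,hy'⟩
   refine ⟨E.mul_mem hx hy,?_⟩
   rw [mul_smul]
   have e1' : b•a•α = c•α := by rw [sw b hb a ha,e1]
   have e2' : c•a•α = b•α := by rw [sw c hcc a ha,e2]
   have e3' : c•b•α = a•α := by rw [sw c hcc b hb,e3]
   rcases hx' with hx' | hx' | hx' | hx' <;> rcases hy' with hy' | hy' | hy' | hy' <;>
   first
    | (rw [hy',hx']; simp; done)
    | (rw [hy',sw x hx a ha,hx']; first | (simp; done) | (rw [sq a ha]; simp; done) | (rw [e1]; simp; done) | (rw [e2]; simp; done))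
    | (rw [hy',sw x hx b hb,hx']; first | (simp; done) | (rw [sq b hb]; simp; done) | (rw [e1']; simp; done) | (rw [e3]; simp; done))
    | (rw [hy',sw x hx c hcc,hx']; first | (simp; done) | (rw [sq c hcc]; simp; done) | (rw [e2']; simp; done) | (rw [e3']; simp; done))
  ·exact ⟨E.one_mem,Or.inl (one_smul _ _)⟩
  ·rintro a ⟨ha,ha'⟩
   have : a⁻¹ = a := inv_eq_of_mul_eq_one_left (h2 a ha)
   show a⁻¹ ∈ E ∧ a⁻¹•α ∈ _
   rw [this]
   exact ⟨ha,ha'⟩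
 obtain ⟨U,hU⟩ := hU
 have hinv : ∀ x ∈ stabilizer G α,∀ u ∈ U,x*u*x⁻¹ ∈ U := by
  intro x hx u hu
  rw [hU] at hu ⊢
  refine ⟨hE.conj_mem u hu.1 x,?_⟩
  have hx1 : x⁻¹•α = α := (stabilizer G α).inv_mem hx
  rw [mul_smul,hx1,mul_smul]
  rcases hu.2 with h3 | h3
  ·rw [h3]; exact Or.inl hx
  ·exact Or.inr (hH x hx _ h3)
 have ho : Orb (U ⊔ stabilizer G α) α = {α,a•α,b•α,c•α} := by
  rw [orb_sup U α hinv]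
  ext β
  constructor
  ·rintro ⟨u,hu,rfl⟩; exact ((hU u).1 hu).2
  ·rintro (rfl | rfl | rfl | rfl)
   ·exact orb_self U _
   ·exact ⟨a,(hU _).2 ⟨ha,by simp⟩,rfl⟩
   ·exact ⟨b,(hU _).2 ⟨hb,by simp⟩,rfl⟩
   ·exact ⟨c,(hU _).2 ⟨hcc,by simp⟩,rfl⟩
 have := h.nob (U ⊔ stabilizer G α) le_sup_right
 rw [ho,Set.ncard_insert_of_notMem,Set.ncard_insert_of_notMem,Set.ncard_pair hbc] at this
 ·omega
 ·simp [hab,hac]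
 ·simp [h1a.symm,h1b.symm,h1c.symm]
lemma Hyp.small (h : Hyp G α) {E : Subgroup G} [hE : E.Normal] (hc : ∀ a ∈ E,∀ b ∈ E,a*b = b*a)
  (h2 : ∀ a ∈ E,a*a = 1) (O : Set Ω) (hO : O ⊆ Orb E α) (hα : α ∉ O)
  (hH : ∀ h : G,h•α = α → ∀ β ∈ O,h•β ∈ O) (h0 : 0 < O.ncard) (h3 : O.ncard ≤ 3) : False := by
 have sw : ∀ x ∈ E,∀ y ∈ E,∀ β : Ω,x•y•β = y•x•β := fun x hx y hy β => by
  rw [←mul_smul,hc x hx y hy,mul_smul]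
 have sq : ∀ x ∈ E,∀ β : Ω,x•x•β = β := fun x hx β => by rw [←mul_smul,h2 x hx,one_smul]
 have cj : ∀ x : G,x•α = α → ∀ e : G,e ∈ E → ∀ f ∈ E,x•e•f•α = (x*e*x⁻¹)•(x*f*x⁻¹)•α := by
  intro x hx e _ f _
  have hx1 : x⁻¹•α = α := by rw [inv_smul_eq_iff,hx]
  simp only [mul_smul,hx1,inv_smul_smul]
 have cj1 : ∀ x : G,x•α = α → ∀ e : G,(x*e*x⁻¹)•α = x•e•α := by
  intro x hx e
  have hx1 : x⁻¹•α = α := by rw [inv_smul_eq_iff,hx]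
  simp only [mul_smul,hx1]
 -- well-definedness
 have wd : ∀ e ∈ E,∀ e' ∈ E,∀ f ∈ E,∀ f' ∈ E,e•α = e'•α → f•α = f'•α → e•f•α = e'•f'•α := by
  intro e he e' he' f hf f' hf' h1 h2
  rw [h2,sw e he f' hf',h1,sw f' hf' e' he']
 have c3 : O.ncard = 1 ∨ O.ncard = 2 ∨ O.ncard = 3 := by omega
 rcases c3 with c | c | c
 ·rw [Set.ncard_eq_one] at c
  obtain ⟨b,rfl⟩ := c
  obtain ⟨e,he,rfl⟩ := hO (Set.mem_singleton b)
  exact h.small_one hc h2 he (fun h => hα (by simp [h])) (fun x hx => hH x hx _ rfl)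
 ·rw [Set.ncard_eq_two] at c
  obtain ⟨b,b',hbb,rfl⟩ := c
  obtain ⟨e,he,rfl⟩ := hO (show b ∈ _ by simp)
  obtain ⟨f,hf,rfl⟩ := hO (show b' ∈ _ by simp)
  refine h.small_one hc h2 (E.mul_mem he hf) ?_ ?_
  ·intro h1
   rw [mul_smul] at h1
   apply hbb
   have := congrArg (e•·) h1
   simp only [sq e he] at this
   exact this.symm
  ·intro x hx
   rw [mul_smul,cj x hx e he f hf]
   have h1 := hH x hx (e•α) (by simp)
   have h1' := hH x hx (f•α) (by simp)
   have hne : x•e•α ≠ x•f•α := fun h => hbb (smul_left_cancel x h)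
   rcases h1 with h1 | h1 <;> rcases h1' with h1' | h1'
   ·exact absurd (h1.trans h1'.symm) hne
   ·exact wd _ (hE.conj_mem e he x) _ he _ (hE.conj_mem f hf x) _ hf ((cj1 x hx e).trans h1) ((cj1 x hx f).trans h1')
   ·rw [sw e he f hf]
    exact wd _ (hE.conj_mem e he x) _ hf _ (hE.conj_mem f hf x) _ he ((cj1 x hx e).trans h1) ((cj1 x hx f).trans h1')
   ·exact absurd (h1.trans h1'.symm) hne
 ·rw [Set.ncard_eq_three] at c
  obtain ⟨b1,b2,b3,h12,h13,h23,rfl⟩ := c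
  obtain ⟨a,ha,rfl⟩ := hO (show b1 ∈ _ by simp)
  obtain ⟨b,hb,rfl⟩ := hO (show b2 ∈ _ by simp)
  obtain ⟨c,hcc,rfl⟩ := hO (show b3 ∈ _ by simp)
  simp only [Set.mem_insert_iff,Set.mem_singleton_iff,not_or] at hα
  by_cases hs : a•b•c•α = α
  ·exact h.small_three hc h2 ha hb hcc (Ne.symm hα.1) (Ne.symm hα.2.1) (Ne.symm hα.2.2) h12 h13 h23 hs hH
  ·refine h.small_one hc h2 (E.mul_mem ha (E.mul_mem hb hcc)) (by rwa [mul_smul,mul_smul]) ?_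
   intro x hx
   have hx1 : x⁻¹•α = α := by rw [inv_smul_eq_iff,hx]
   have k1 := hH x hx (a•α) (by simp)
   have k2 := hH x hx (b•α) (by simp)
   have k3 := hH x hx (c•α) (by simp)
   have n12 : x•a•α ≠ x•b•α := fun h => h12 (smul_left_cancel x h)
   have n13 : x•a•α ≠ x•c•α := fun h => h13 (smul_left_cancel x h)
   have n23 : x•b•α ≠ x•c•α := fun h => h23 (smul_left_cancel x h)
   have main : x•(a*(b*c))•α = (x*a*x⁻¹)•(x*b*x⁻¹)•(x*c*x⁻¹)•α := by
    simp only [mul_smul,hx1,inv_smul_smul]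
   have wd3 : ∀ a' ∈ E,∀ b' ∈ E,∀ c' ∈ E,x•a•α = a'•α → x•b•α = b'•α → x•c•α = c'•α →
     x•(a*(b*c))•α = a'•b'•c'•α := by
    intro a' ha' b' hb' c' hc' g1 g2 g3
    rw [main]
    have q1 := (cj1 x hx a).trans g1
    have q2 := (cj1 x hx b).trans g2
    have q3 := (cj1 x hx c).trans g3
    have ma := hE.conj_mem a ha x
    have mb := hE.conj_mem b hb x
    have mc := hE.conj_mem c hcc x
    have := wd _ mb _ hb' _ mc _ hc' q2 q3
    rw [this,sw _ ma b' hb',sw _ ma c' hc',q1,sw a' ha' b' hb',sw a' ha' c' hc']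
   rw [mul_smul a,mul_smul b] at *
   rcases k1 with k1 | k1 | k1 <;> rcases k2 with k2 | k2 | k2 <;> rcases k3 with k3 | k3 | k3 <;>
   first
    | exact absurd (k1.trans k2.symm) n12
    | exact absurd (k1.trans k3.symm) n13
    | exact absurd (k2.trans k3.symm) n23
    | exact wd3 a ha b hb c hcc k1 k2 k3
    | (rw [wd3 a ha c hcc b hb k1 k2 k3,sw c hcc b hb])
    | (rw [wd3 b hb a ha c hcc k1 k2 k3,sw b hb a ha])
    | (rw [wd3 b hb c hcc a ha k1 k2 k3,sw c hcc a ha,sw b hb a ha])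
    | (rw [wd3 c hcc a ha b hb k1 k2 k3,sw c hcc a ha,sw c hcc b hb])
    | (rw [wd3 c hcc b hb a ha k1 k2 k3,sw b hb a ha,sw c hcc a ha,sw c hcc b hb])
lemma minnorm_aux (n : ℕ) : ∀ N : Subgroup G,N.Normal → N ≠ ⊥ → Nat.card N = n → ∃ M : Subgroup G,M ≤ N ∧ M.Normal ∧ M ≠ ⊥ ∧
  ∀ M' : Subgroup G,M'.Normal → M' ≤ M → M' ≠ ⊥ → M' = M := by
 induction n using Nat.strong_induction_on with
 | _ n ih =>
 intro N hN hb hn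
 by_cases hm : ∀ M' : Subgroup G,M'.Normal → M' ≤ N → M' ≠ ⊥ → M' = N
 ·exact ⟨N,le_rfl,hN,hb,hm⟩
 ·push Not at hm
  obtain ⟨M',h1,h2,h3,h4⟩ := hm
  have hlt : Nat.card M' < Nat.card N := by
   by_contra hge
   exact h4 (eq_of_le_of_card_ge h2 (not_lt.1 hge))
  obtain ⟨M,a,b⟩ := ih _ (hn ▸ hlt) M' h1 h3 rfl
  exact ⟨M,a.trans h2,b⟩
lemma minnorm (N : Subgroup G) (hN : N.Normal) (hb : N ≠ ⊥) : ∃ M : Subgroup G,M ≤ N ∧ M.Normal ∧ M ≠ ⊥ ∧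
  ∀ M' : Subgroup G,M'.Normal → M' ≤ M → M' ≠ ⊥ → M' = M := minnorm_aux _ N hN hb rfl
lemma Hyp.cover (h : Hyp G α) {E : Subgroup G} [hE : E.Normal] {K : Subgroup G} (hEK : E ≤ K)
  (hK : ∀ g : G,∃ k ∈ K,k⁻¹*g ∈ E ⊔ stabilizer G α) : K = ⊤ := by
 apply h.min
 intro β
 obtain ⟨g,rfl⟩ := h.trans β
 obtain ⟨k,hk,hl⟩ := hK g
 have : (k⁻¹*g)•α ∈ Orb (E ⊔ stabilizer G α) α := ⟨_,hl,rfl⟩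
 rw [orb_normal] at this
 obtain ⟨e,he,h2⟩ := this
 exact ⟨k*e,K.mul_mem hk (hEK he),by rw [mul_smul,h2,mul_smul,smul_inv_smul]⟩
lemma sylow_cover {p : ℕ} [Fact p.Prime] (P : Sylow p G) {L : Subgroup G} {k : ℕ} (hL : L.index = p^k) :
  ∀ g : G,∃ t ∈ P,t⁻¹*g ∈ L := by
 have h1 : (Orb (P : Subgroup G) ((1 : G) : G ⧸ L)).ncard = L.relIndex P := by
  rw [orb_card,stabilizer_quotient]
 have h2 : p^k ∣ L.relIndex P := by
  have e1 : L.relIndex P*(P : Subgroup G).index = (L ⊓ P).index := by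
   rw [←inf_relIndex_right]
   exact relIndex_mul_index inf_le_right
  have e2 : L.index ∣ (L ⊓ P).index := index_dvd_of_le inf_le_left
  rw [←e1,hL] at e2
  refine Coprime.dvd_of_dvd_mul_right ?_ e2
  apply Coprime.pow_left
  rw [Nat.Prime.coprime_iff_not_dvd Fact.out]
  exact P.not_dvd_index
 have h3 : Orb (P : Subgroup G) ((1 : G) : G ⧸ L) = Set.univ := by
  apply Set.eq_of_subset_of_ncard_le (Set.subset_univ _) _ Set.finite_univ
  rw [Set.ncard_univ,h1]
  show L.index ≤ _
  rw [hL]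
  apply le_of_dvd _ h2
  exact Nat.pos_of_ne_zero Subgroup.FiniteIndex.index_ne_zero
 intro g
 have : (g : G ⧸ L) ∈ Orb (P : Subgroup G) ((1 : G) : G ⧸ L) := by rw [h3]; trivial
 obtain ⟨t,ht,h4⟩ := this
 refine ⟨t,ht,?_⟩
 rw [←QuotientGroup.eq,←h4]
 simp
/-- if all stabilizer orbits on the E-orbit are small we win -/
lemma Hyp.elem_orbits (h : Hyp G α) {E : Subgroup G} [hE : E.Normal] (hc : ∀ a ∈ E,∀ b ∈ E,a*b = b*a)
  (h2 : ∀ a ∈ E,a*a = 1) :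
  ((Orb E α).ncard = 8 → ∃ β ∈ Orb E α,β ≠ α ∧ (Orb (stabilizer G α) β).ncard = 7) ∧
  ((Orb E α).ncard = 16 → ∃ β ∈ Orb E α,(Orb (stabilizer G α) β).ncard ∉ [1,3,9]) := by
 have := h.fin
 have hEO : ∀ x ∈ stabilizer G α,∀ β ∈ Orb E α,x•β ∈ Orb E α := by
  rintro x hx β ⟨e,he,rfl⟩
  refine ⟨x*e*x⁻¹,hE.conj_mem e he x,?_⟩
  have hx1 : x⁻¹•α = α := (stabilizer G α).inv_mem hx
  rw [mul_smul,hx1,mul_smul]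
 have hfix : ∀ x ∈ stabilizer G α,∀ β : Ω,x•β = α → β = α := by
  intro x hx β hβ
  have hx1 : x•α = α := hx
  exact smul_left_cancel x (hβ.trans hx1.symm)
 have hsub : ∀ β ∈ Orb E α,β ≠ α → Orb (stabilizer G α) β ⊆ Orb E α \ {α} := by
  rintro β hβ hne γ ⟨x,hx,rfl⟩
  exact ⟨hEO x hx β hβ,fun hh => hne (hfix x hx β hh)⟩
 have hinv : ∀ β : Ω,∀ x : G,x•α = α → ∀ γ ∈ Orb (stabilizer G α) β,x•γ ∈ Orb (stabilizer G α) β := by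
  rintro β x hx γ ⟨y,hy,rfl⟩
  exact ⟨x*y,(stabilizer G α).mul_mem hx hy,mul_smul _ _ _⟩
 have hinv2 : ∀ β : Ω,∀ x : G,x•α = α → ∀ γ ∈ (Orb E α \ {α}) \ Orb (stabilizer G α) β,x•γ ∈ (Orb E α \ {α}) \ Orb (stabilizer G α) β := by
  rintro β x hx γ ⟨⟨h1,h2⟩,h3⟩
  refine ⟨⟨hEO x hx γ h1,fun hh => h2 (hfix x hx γ hh)⟩,fun h4 => h3 ?_⟩
  have := hinv β x⁻¹ ((stabilizer G α).inv_mem hx) _ h4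
  rwa [inv_smul_smul] at this
 have hW : (Orb E α \ {α}).ncard = (Orb E α).ncard - 1 := by
  rw [Set.ncard_sdiff_singleton_of_mem (orb_self E α)]
 have hpos : ∀ β : Ω,0 < (Orb (stabilizer G α) β).ncard := fun β => (Set.ncard_pos).2 ⟨β,orb_self _ _⟩
 have hgt : ∀ β ∈ Orb E α,β ≠ α → 3 < (Orb (stabilizer G α) β).ncard := by
  intro β hβ hne
  by_contra hle
  exact h.small hc h2 (Orb (stabilizer G α) β) (fun γ hγ => (hsub β hβ hne hγ).1) (fun hh => (hsub β hβ hne hh).2 rfl) (hinv β) (hpos β) (not_lt.1 hle)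
 have hco : ∀ β ∈ Orb E α,β ≠ α → ((Orb E α \ {α}) \ Orb (stabilizer G α) β).ncard = (Orb E α).ncard - 1 - (Orb (stabilizer G α) β).ncard := by
  intro β hβ hne
  rw [Set.ncard_sdiff (hsub β hβ hne),hW]
 have hle : ∀ β ∈ Orb E α,β ≠ α → (Orb (stabilizer G α) β).ncard ≤ (Orb E α).ncard - 1 := by
  intro β hβ hne
  rw [←hW]
  exact ncard_le_ncard (hsub β hβ hne)
 have hex : 1 < (Orb E α).ncard → ∃ β ∈ Orb E α,β ≠ α := by
  intro h1
  exact Set.exists_ne_of_one_lt_ncard h1 α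
 constructor
 ·intro h8
  obtain ⟨β,hβ,hne⟩ := hex (by omega)
  refine ⟨β,hβ,hne,?_⟩
  by_contra h7
  have a1 := hgt β hβ hne
  have a2 := hle β hβ hne
  have a3 := hco β hβ hne
  exact h.small hc h2 ((Orb E α \ {α}) \ Orb (stabilizer G α) β) (fun γ hγ => hγ.1.1) (fun hh => hh.1.2 rfl) (hinv2 β) (by omega) (by omega)
 ·intro h16
  by_contra hcon
  push Not at hcon
  have nine : ∀ β ∈ Orb E α,β ≠ α → (Orb (stabilizer G α) β).ncard = 9 := by
   intro β hβ hne
   have a1 := hgt β hβ hne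
   have := hcon β hβ
   simp only [List.mem_cons,not_mem_nil,or_false] at this
   omega
  obtain ⟨β,hβ,hne⟩ := hex (by omega)
  have a3 := hco β hβ hne
  rw [nine β hβ hne] at a3
  have : 0 < ((Orb E α \ {α}) \ Orb (stabilizer G α) β).ncard := by omega
  obtain ⟨γ,hγ⟩ := (Set.ncard_pos).1 this
  have b1 := nine γ hγ.1.1 hγ.1.2
  have : Orb (stabilizer G α) γ ⊆ (Orb E α \ {α}) \ Orb (stabilizer G α) β := by
   rintro δ ⟨x,hx,rfl⟩
   exact hinv2 β x hx γ hγ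
  have := ncard_le_ncard this
  omega
lemma Hyp.no16 (h : Hyp G α) {E : Subgroup G} [hE : E.Normal] (hc : ∀ a ∈ E,∀ b ∈ E,a*b = b*a)
  (h2 : ∀ a ∈ E,a*a = 1) : (Orb E α).ncard ≠ 16 := by
 intro h16
 have := h.fin
 obtain ⟨β,hβ,hn⟩ := (h.elem_orbits hc h2).2 h16
 have hidx : (E ⊔ stabilizer G α).index = 3^1 := by
  have := h.orb_mul (S := E ⊔ stabilizer G α) le_sup_right
  rw [orb_normal,h16] at this
  omega
 have : Fact (Nat.Prime 3) := ⟨by norm_num⟩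
 let T : Sylow 3 G := default
 have htop : E ⊔ (T : Subgroup G) = ⊤ := by
  apply h.cover le_sup_left
  intro g
  obtain ⟨t,ht,h3⟩ := sylow_cover T hidx g
  exact ⟨t,Subgroup.mem_sup_right ht,h3⟩
 obtain ⟨k,hk⟩ := T.2.exists_card_eq
 have hEi : E.index ∣ 3^k := by
  rw [←relIndex_top_right,←htop,←hk,relIndex_sup_left]
  exact relIndex_dvd_card _ _
 have hfix : E ⊓ stabilizer G α ≤ stabilizer G β := by
  rintro x ⟨hx,hx'⟩
  obtain ⟨e,he,rfl⟩ := hβ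
  have hx1 : x•α = α := hx'
  show x•e•α = e•α
  rw [←mul_smul,hc x hx e he,mul_smul,hx1]
 have hd : (Orb (stabilizer G α) β).ncard ∣ 3^k := by
  rw [orb_card]
  refine (dvd_trans ?_ ((Subgroup.relIndex_dvd_index_of_normal E (stabilizer G α)))).trans hEi
  rw [←inf_relIndex_right E]
  exact Subgroup.relIndex_dvd_of_le_left _ hfix
 obtain ⟨j,hj,hj2⟩ := (Nat.dvd_prime_pow (by norm_num)).1 hd
 have hle : (Orb (stabilizer G α) β).ncard ≤ 16 := by
  rw [←h16]
  refine ncard_le_ncard ?_ (toFinite _)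
  rintro γ ⟨x,hx,rfl⟩
  obtain ⟨e,he,rfl⟩ := hβ
  refine ⟨x*e*x⁻¹,hE.conj_mem e he x,?_⟩
  have hx1 : x⁻¹•α = α := (stabilizer G α).inv_mem hx
  rw [mul_smul,hx1,mul_smul]
 have hj3 : j < 3 := by
  by_contra hj3
  have : 3^3 ≤ 3^j := Nat.pow_le_pow_right (by norm_num) (not_lt.1 hj3)
  omega
 interval_cases j <;> simp_all
lemma Hyp.no8 (h : Hyp G α) {E : Subgroup G} [hE : E.Normal] (hc : ∀ a ∈ E,∀ b ∈ E,a*b = b*a)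
  (h2 : ∀ a ∈ E,a*a = 1) : (Orb E α).ncard ≠ 8 := by
 intro h8
 have := h.fin
 obtain ⟨β,hβ,hne,hn⟩ := (h.elem_orbits hc h2).1 h8
 have h7G : 7 ∣ Nat.card G := by
  rw [←hn,orb_card]
  exact (relIndex_dvd_card _ _).trans (card_subgroup_dvd_card _)
 have hidx : (E ⊔ stabilizer G α).index = 6 := by
  have := h.orb_mul (S := E ⊔ stabilizer G α) le_sup_right
  rw [orb_normal,h8] at this
  omega
 set L := E ⊔ stabilizer G α with hL
 set K := L.normalCore with hKd
 have : Fact (Nat.Prime 7) := ⟨by norm_num⟩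
 have hKL : K ≤ L := L.normalCore_le
 have hKi : ¬ 7 ∣ K.index := by
  intro h7
  have : K.index ∣ Nat.card (Perm (G ⧸ L)) := by
   rw [hKd,Subgroup.normalCore_eq_ker,index_ker]
   exact card_subgroup_dvd_card _
  rw [card_perm] at this
  have h6 : Nat.card (G ⧸ L) = 6 := hidx
  rw [h6] at this
  have := h7.trans this
  revert this
  decide
 let R : Sylow 7 K := default
 have hfr := Sylow.normalizer_sup_eq_top R
 set R' := (R : Subgroup K).map K.subtype with hR'
 have hRK : R' ≤ K := by rintro _ ⟨x,_,rfl⟩; exact x.2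
 have hRi : ¬ 7 ∣ R'.index := by
  have : R'.index = (R : Subgroup K).index*K.index := by
   rw [hR',Subgroup.index_map_subtype]
  rw [this]
  intro h7
  rcases (Nat.Prime.dvd_mul (by norm_num)).1 h7 with h7 | h7
  ·exact R.not_dvd_index h7
  ·exact hKi h7
 set M := normalizer (R' : Set G) with hM
 have hRM : R' ≤ M := le_normalizer
 have : (R'.subgroupOf M).Normal := Subgroup.normal_in_normalizer
 have hRip : ¬ 7 ∣ (R'.subgroupOf M).index := fun h7 => hRi (h7.trans (Subgroup.relIndex_dvd_index_of_le hRM))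
 have hcop : Coprime (Nat.card (R'.subgroupOf M)) (R'.subgroupOf M).index := by
  obtain ⟨k,hk⟩ := R.2.exists_card_eq
  have : Nat.card (R'.subgroupOf M) = 7^k := by
   rw [card_congr (Subgroup.subgroupOfEquivOfLe hRM).toEquiv,hR',card_congr ((R : Subgroup K).equivMapOfInjective K.subtype K.subtype_injective).toEquiv.symm]
   exact hk
  rw [this]
  apply Coprime.pow_left
  rwa [Nat.Prime.coprime_iff_not_dvd (by norm_num)]
 obtain ⟨Z,hZ⟩ := Subgroup.exists_right_complement'_of_coprime hcop
 set Z' := Z.map M.subtype with hZ'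
 have htop : E ⊔ Z' = ⊤ := by
  apply h.cover le_sup_left
  intro g
  have hg : g ∈ M ⊔ K := by rw [hfr]; trivial
  rw [Subgroup.mem_sup_of_normal_right] at hg
  obtain ⟨n,hn,k,hk,rfl⟩ := hg
  obtain ⟨⟨z,r⟩,hzr⟩ := (hZ.symm.2 ⟨n,hn⟩)
  have hzr' : (z : M).1*(r : M).1 = n := congrArg Subtype.val hzr
  refine ⟨(z : M).1,Subgroup.mem_sup_right ⟨z,z.2,rfl⟩,?_⟩
  rw [←hzr']
  have : (r : M).1 ∈ R' := r.2
  have := L.mul_mem (hKL (hRK this)) (hKL hk)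
  simpa [mul_assoc] using this
 have hEi : E.index ∣ Nat.card Z := by
  rw [←relIndex_top_right,←htop,relIndex_sup_left]
  refine (relIndex_dvd_card _ _).trans ?_
  rw [card_congr (Z.equivMapOfInjective M.subtype M.subtype_injective).toEquiv]
 have hZc : Nat.card Z = (R'.subgroupOf M).index := hZ.symm.index_eq_card.symm
 have hE2 : IsPGroup 2 E := by
  intro e
  exact ⟨1,Subtype.ext (by simpa [pow_two] using h2 e e.2)⟩
 obtain ⟨k,hk⟩ := hE2.exists_card_eq
 rw [←E.card_mul_index,hk] at h7G
 rcases (Nat.Prime.dvd_mul (by norm_num)).1 h7G with h7 | h7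
 ·have := (Nat.Prime.dvd_of_dvd_pow (by norm_num) h7)
  revert this; decide
 ·exact hRip (hZc ▸ h7.trans hEi)
lemma Hyp.no3 (h : Hyp G α) {E : Subgroup G} [hE : E.Normal] (hb : E ≠ ⊥)
  (h2 : ∀ a ∈ E,a^3 = 1) : False := by
 have h4 := h.orb_four E hb
 have hd := h.orb_dvd E
 have : Fact (Nat.Prime 3) := ⟨by norm_num⟩
 have hE2 : IsPGroup 3 E := by
  intro e
  exact ⟨1,Subtype.ext (by simpa using h2 e e.2)⟩
 obtain ⟨k,hk⟩ := hE2.exists_card_eq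
 have h3 : (Orb E α).ncard ∣ 3^k := by
  rw [orb_card,←hk]
  exact relIndex_dvd_card _ _
 obtain ⟨j,hj,hj2⟩ := (Nat.dvd_prime_pow (by norm_num)).1 h3
 rw [hj2] at hd h4
 have hj3 : j < 2 := by
  by_contra hj3
  have : 3^2 ∣ 48 := (pow_dvd_pow 3 (not_lt.1 hj3)).trans hd
  revert this; decide
 interval_cases j <;> omega
lemma Hyp.no2 (h : Hyp G α) {E : Subgroup G} [hE : E.Normal] (hb : E ≠ ⊥) (hc : ∀ a ∈ E,∀ b ∈ E,a*b = b*a)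
  (h2 : ∀ a ∈ E,a^2 = 1) : False := by
 have h4 := h.orb_four E hb
 have hd := h.orb_dvd E
 have h2' : ∀ a ∈ E,a*a = 1 := fun a ha => by rw [←pow_two,h2 a ha]
 have h8 := h.no8 hc h2'
 have h16 := h.no16 hc h2'
 have : Fact (Nat.Prime 2) := ⟨by norm_num⟩
 have hE2 : IsPGroup 2 E := by
  intro e
  exact ⟨1,Subtype.ext (by simpa using h2 e e.2)⟩
 obtain ⟨k,hk⟩ := hE2.exists_card_eq
 have h3 : (Orb E α).ncard ∣ 2^k := by
  rw [orb_card,←hk]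
  exact relIndex_dvd_card _ _
 obtain ⟨j,hj,hj2⟩ := (Nat.dvd_prime_pow (by norm_num)).1 h3
 rw [hj2] at hd h4 h8 h16
 have hj3 : j < 5 := by
  by_contra hj3
  have : 2^5 ∣ 48 := (pow_dvd_pow 2 (not_lt.1 hj3)).trans hd
  revert this; decide
 interval_cases j <;> omega
theorem Hyp.big_prime (h : Hyp G α) (N : Subgroup G) (hN : N.Normal) (hb : N ≠ ⊥) :
  ∃ r : ℕ,r.Prime ∧ 5 ≤ r ∧ r ∣ Nat.card N := by
 by_contra hcon
 push Not at hcon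
 obtain ⟨M,hMN,hM,hMb,hmin⟩ := minnorm N hN hb
 have hsol : Group.IsSolvable M := by
  apply Brn.burnside
  intro r hr hd
  by_contra h5
  exact hcon r hr (not_lt.1 h5) (hd.trans (card_dvd_of_le hMN))
 have hcomm : ⁅M,M⁆ = ⊥ := by
  by_contra hne
  have h1 := hmin ⁅M,M⁆ inferInstance (Subgroup.commutator_le_left M M) hne
  have : Nontrivial M := (Subgroup.nontrivial_iff_ne_bot M).2 hMb
  have h2 := Group.IsSolvable.commutator_lt_top_of_nontrivial M
  apply h2.ne
  apply Subgroup.map_injective M.subtype_injective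
  rw [Subgroup.map_subtype_commutator,h1,←range_eq_map,Subgroup.range_subtype]
 have hc : ∀ a ∈ M,∀ b ∈ M,a*b = b*a := by
  intro a ha b hb
  exact (mem_centralizer_iff.1 (Subgroup.commutator_eq_bot_iff_le_centralizer.1 hcomm hb) a ha)
 have hc1 : Nat.card M ≠ 1 := fun h1 => hMb (Subgroup.card_eq_one.1 h1)
 obtain ⟨p,hp,hpd⟩ := Nat.exists_prime_and_dvd hc1
 have hp5 : p < 5 := by
  by_contra h5
  exact hcon p hp (not_lt.1 h5) (hpd.trans (card_dvd_of_le hMN))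
 have hEx : ∃ E : Subgroup G,∀ x,x ∈ E ↔ x ∈ M ∧ x^p = 1 := by
  refine ⟨⟨⟨⟨{x | x ∈ M ∧ x^p = 1},?_⟩,?_⟩,?_⟩,fun u => Iff.rfl⟩
  ·rintro a b ⟨ha,ha'⟩ ⟨hb,hb'⟩
   refine ⟨M.mul_mem ha hb,?_⟩
   rw [(show Commute a b from hc a ha b hb).mul_pow,ha',hb',one_mul]
  ·exact ⟨M.one_mem,one_pow _⟩
  ·rintro a ⟨ha,ha'⟩
   exact ⟨M.inv_mem ha,by rw [inv_pow,ha',inv_one]⟩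
 obtain ⟨E,hE⟩ := hEx
 have hEn : E.Normal := by
  constructor
  intro x hx g
  rw [hE] at hx ⊢
  exact ⟨hM.conj_mem x hx.1 g,by rw [conj_pow,hx.2]; simp⟩
 have hEb : E ≠ ⊥ := by
  intro h1
  have : Fact p.Prime := ⟨hp⟩
  obtain ⟨x,hx⟩ := exists_prime_orderOf_dvd_card' p hpd
  have : (x : G) ∈ E := by
   rw [hE]
   refine ⟨x.2,?_⟩
   have := pow_orderOf_eq_one x
   rw [hx] at this
   exact_mod_cast congrArg Subtype.val this
  rw [h1,mem_bot] at this
  have h3 : x = 1 := Subtype.ext this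
  rw [h3,orderOf_one] at hx
  exact hp.one_lt.ne hx
 have := hp.two_le
 interval_cases p
 ·exact h.no2 hEb (fun a ha b hb => hc a ((hE a).1 ha).1 b ((hE b).1 hb).1) (fun a ha => ((hE a).1 ha).2)
 ·exact h.no3 hEb (fun a ha => ((hE a).1 ha).2)
 ·exact absurd hp (by norm_num)
end Mn
namespace Mn
open MulAction
variable {G : Type u} {Ω : Type*} [Group G] [MulAction G Ω] [Finite G]
lemma orb_conj (N : Subgroup G) [hN : N.Normal] (g : G) (β : Ω) : Orb N (g•β) = (fun x => g•x) '' Orb N β := by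
 ext γ
 constructor
 ·rintro ⟨n,hn,rfl⟩
  refine ⟨(g⁻¹*n*g)•β,⟨_,by simpa using hN.conj_mem n hn g⁻¹,rfl⟩,?_⟩
  simp [←mul_smul,mul_assoc]
 ·rintro ⟨_,⟨n,hn,rfl⟩,rfl⟩
  exact ⟨g*n*g⁻¹,hN.conj_mem n hn g,by simp [←mul_smul,mul_assoc]⟩
lemma orb_conj_card (N : Subgroup G) [hN : N.Normal] (g : G) (β : Ω) : (Orb N (g•β)).ncard = (Orb N β).ncard := by
 rw [orb_conj]
 exact Set.ncard_image_of_injective _ (MulAction.injective g)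
lemma orb_zpow {x : G} {r : ℕ} (hr : r.Prime) (hx : orderOf x = r) {β : Ω} (hβ : x•β ≠ β) :
  (Orb (zpowers x) β).ncard = r := by
 have h1 : (Orb (zpowers x) β).ncard ∣ r := by
  rw [orb_card,←hx,←card_zpowers]
  exact relIndex_dvd_card _ _
 rcases (dvd_prime hr).1 h1 with h2 | h2
 ·exfalso
  rw [Set.ncard_eq_one] at h2
  obtain ⟨a,ha⟩ := h2
  have h3 := orb_self (zpowers x) β
  have h4 : x•β ∈ Orb (zpowers x) β := ⟨x,mem_zpowers x,rfl⟩
  rw [ha] at h3 h4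
  exact hβ (h4.trans h3.symm)
 ·exact h2
lemma orb_ge [Finite Ω] {N : Subgroup G} {x : G} (hxN : x ∈ N) {r : ℕ} (hr : r.Prime) (hx : orderOf x = r) {β : Ω} (hβ : x•β ≠ β) :
  r ≤ (Orb N β).ncard := by
 rw [←orb_zpow hr hx hβ]
 exact ncard_le_ncard (orb_mono (by simpa using hxN) β) (toFinite _)
lemma minover_aux (H : Subgroup G) (n : ℕ) : ∀ T : Subgroup G,H < T → Nat.card T = n → ∃ S,H < S ∧ S ≤ T ∧ ∀ U,H ≤ U → U ≤ S → U = H ∨ U = S := by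
 induction n using Nat.strong_induction_on with
 | _ n ih =>
 intro T hT hn
 by_cases hm : ∀ U,H ≤ U → U ≤ T → U = H ∨ U = T
 ·exact ⟨T,hT,le_rfl,hm⟩
 ·push Not at hm
  obtain ⟨U,h1,h2,h3,h4⟩ := hm
  have hlt : Nat.card U < Nat.card T := by
   by_contra hge
   exact h4 (eq_of_le_of_card_ge h2 (not_lt.1 hge))
  obtain ⟨S,a,b,c⟩ := ih _ (hn ▸ hlt) U (lt_of_le_of_ne h1 h3.symm) rfl
  exact ⟨S,a,b.trans h2,c⟩
lemma minover {H T : Subgroup G} (hT : H < T) : ∃ S,H < S ∧ S ≤ T ∧ ∀ U,H ≤ U → U ≤ S → U = H ∨ U = S :=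
 minover_aux H _ T hT rfl
lemma orb_eq_orbit (S : Subgroup G) (α : Ω) : Orb S α = orbit S α := by
 ext β
 constructor
 ·rintro ⟨g,hg,rfl⟩; exact ⟨⟨g,hg⟩,rfl⟩
 ·rintro ⟨⟨g,hg⟩,rfl⟩; exact ⟨g,hg,rfl⟩
lemma two_trans [Finite Ω] {α : Ω} {S : Subgroup G} (hS : stabilizer G α ≤ S) (hmax : ∀ U,stabilizer G α ≤ U → U ≤ S → U = stabilizer G α ∨ U = S)
  (hd : (Orb S α).ncard = 6 ∨ ((Orb S α).ncard ∈ [6,12,24,48] ∧ ∃ r : ℕ,r.Prime ∧ 5 ≤ r ∧ ∃ s ∈ S,orderOf s = r ∧ ∃ β ∈ Orb S α,s•β ≠ β)) :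
  ∀ b ∈ Orb S α,∀ c ∈ Orb S α,b ≠ α → c ≠ α → ∃ g ∈ S,g•α = α ∧ g•b = c := by
 intro b hb c hc hba hca
 rw [orb_eq_orbit] at hb hc hd
 let P := (toPermHom S (orbit S α)).range
 have : Fintype (orbit S α) := ofFinite _
 let α0 : orbit S α := ⟨α,mem_orbit_self α⟩
 have hact : ∀ (p : P) (s : S),toPermHom S (orbit S α) s = p.1 → ∀ x : orbit S α,p•x = s•x := by
  intro p s h x
  show p.1 x = s•x
  rw [←h]; rfl
 have hpt : ∀ x : orbit S α,∃ s : S,s•α0 = x := by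
  rintro ⟨x,s,hs⟩; exact ⟨s,Subtype.ext hs⟩
 have hmk : ∀ s : S,∃ p : P,∀ x : orbit S α,p•x = s•x := fun s => ⟨⟨_,s,rfl⟩,hact _ s rfl⟩
 have : IsPretransitive P (orbit S α) := by
  constructor
  intro x y
  obtain ⟨s,rfl⟩ := hpt x
  obtain ⟨t,rfl⟩ := hpt y
  obtain ⟨p,hp⟩ := hmk (t*s⁻¹)
  exact ⟨p,by rw [hp,←mul_smul,inv_mul_cancel_right]⟩
 have hprim : Sch.Prim P (orbit S α) := by
  intro r he hi
  have hi' : ∀ (s : S) (a b : orbit S α),r a b → r (s•a) (s•b) := by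
   intro s a b hab
   obtain ⟨p,hp⟩ := hmk s
   rw [←hp,←hp]
   exact hi p a b hab
  let U0 : Subgroup S := ⟨⟨⟨{s | r α0 (s•α0)},by
   intro s t hs ht
   have h1 := hi' s _ _ ht
   rw [←mul_smul] at h1
   exact he.trans hs h1⟩,by show r α0 ((1 : S)•α0); rw [one_smul]; exact he.refl _⟩,by
   intro s hs
   have h1 := hi' s⁻¹ _ _ hs
   rw [inv_smul_smul] at h1
   exact he.symm h1⟩
  have hU0 : ∀ s : S,s ∈ U0 ↔ r α0 (s•α0) := fun s => Iff.rfl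
  have h1 : stabilizer G α ≤ U0.map S.subtype := by
   intro h hh
   refine ⟨⟨h,hS hh⟩,?_,rfl⟩
   show r α0 _
   have : (⟨h,hS hh⟩ : S)•α0 = α0 := Subtype.ext hh
   rw [this]
   exact he.refl _
  rcases hmax _ h1 (by rintro _ ⟨x,_,rfl⟩; exact x.2) with h2 | h2
  ·left
   intro x y hxy
   obtain ⟨s,rfl⟩ := hpt x
   obtain ⟨t,rfl⟩ := hpt y
   have h3 := hi' s⁻¹ _ _ hxy
   rw [inv_smul_smul,←mul_smul] at h3
   have h4 : ((s⁻¹*t : S) : G) ∈ U0.map S.subtype := ⟨_,h3,rfl⟩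
   rw [h2] at h4
   have h5 : (s⁻¹*t)•α0 = α0 := Subtype.ext h4
   rw [mul_smul,inv_smul_eq_iff] at h5
   exact h5.symm
  ·right
   have : ∀ x,r α0 x := by
    intro x
    obtain ⟨s,rfl⟩ := hpt x
    have h4 : (s : G) ∈ U0.map S.subtype := by rw [h2]; exact s.2
    obtain ⟨t,ht,h5⟩ := h4
    have h6 : t = s := Subtype.ext h5
    exact h6 ▸ ht
   intro x y
   exact he.trans (he.symm (this x)) (this y)
 have hcard : Fintype.card (orbit S α) = (orbit S α).ncard := by
  rw [←card_eq_fintype_card]; rfl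
 have key : ∃ p : P,p•α0 = α0 ∧ p•(⟨b,hb⟩ : orbit S α) = ⟨c,hc⟩ := by
  have hb' : (⟨b,hb⟩ : orbit S α) ≠ α0 := fun h => hba (congrArg Subtype.val h)
  have hc' : (⟨c,hc⟩ : orbit S α) ≠ α0 := fun h => hca (congrArg Subtype.val h)
  rcases hd with hd | ⟨hd,r,hr,h5,s,hs,hsr,β,hβ,hne⟩
  ·exact Sch.prim_six hprim (hcard.trans hd) α0 _ _ hb' hc'
  ·refine Sch.prim_two_trans hprim (by rw [hcard]; exact hd) hr h5 ?_ α0 _ _ hb' hc'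
   let s' : S := ⟨s,hs⟩
   let p : P := ⟨_,s',rfl⟩
   have hp1 : p ≠ 1 := by
    intro h1
    apply hne
    have h2 : p•(⟨β,hβ⟩ : orbit S α) = ⟨β,hβ⟩ := by rw [h1,one_smul]
    rw [hact p s' rfl] at h2
    exact congrArg Subtype.val h2
   have hpr : p^r = 1 := by
    have : s'^r = 1 := Subtype.ext (show s^r = 1 by have h0 := pow_orderOf_eq_one s; rwa [hsr] at h0)
    apply Subtype.ext
    show toPermHom S (orbit S α) s'^r = 1
    rw [←map_pow,this,map_one]
   have : Fact r.Prime := ⟨hr⟩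
   rw [←orderOf_eq_prime hpr hp1]
   exact orderOf_dvd_natCard p
 obtain ⟨p,h1,h2⟩ := key
 obtain ⟨s,hs⟩ := p.2
 rw [hact p s hs] at h1 h2
 exact ⟨s,s.2,congrArg Subtype.val h1,congrArg Subtype.val h2⟩
section
variable [FaithfulSMul G Ω] {α : Ω}
lemma Hyp.noQ (h : Hyp G α) {p : ℕ} (hp : p.Prime) (h5 : p < 5) {Q N : Subgroup G} [hN : N.Normal] (hQ : IsPGroup p Q) (hb : Q ≠ ⊥)
  (hF : normalizer (Q : Set G) ⊔ N = ⊤)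
  (ht : ∀ β ∈ Orb N α,∃ g ∈ normalizer (Q : Set G),g•α = β) : False := by
 have htop : normalizer (Q : Set G) = ⊤ := by
  apply h.min
  intro β
  obtain ⟨g,rfl⟩ := h.trans β
  have hg : g ∈ normalizer (Q : Set G) ⊔ N := by rw [hF]; trivial
  rw [Subgroup.mem_sup_of_normal_right] at hg
  obtain ⟨m,hm,n,hn,rfl⟩ := hg
  obtain ⟨k,hk,h2⟩ := ht (n•α) ⟨n,hn,rfl⟩
  exact ⟨m*k,mul_mem hm hk,by rw [mul_smul,h2,mul_smul]⟩
 have hQn : Q.Normal := Subgroup.normalizer_eq_top_iff.1 htop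
 obtain ⟨r,hr,hr5,hd⟩ := h.big_prime Q hQn hb
 have : Fact p.Prime := ⟨hp⟩
 obtain ⟨k,hk⟩ := hQ.exists_card_eq
 rw [hk] at hd
 have := (Nat.prime_dvd_prime_iff_eq hr hp).1 (hr.dvd_of_dvd_pow hd)
 omega
lemma Hyp.orb_vals (h : Hyp G α) (N : Subgroup G) [hN : N.Normal] (hb : N ≠ ⊥) : (Orb N α).ncard ∈ [6,12,24,48] := by
 have h4 := h.orb_four N hb
 have hd := h.orb_dvd N
 have hpow : ∀ k,(Orb N α).ncard ≠ 2^k := by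
  intro k hk
  have : Fact (Nat.Prime 2) := ⟨by norm_num⟩
  let Q : Sylow 2 N := default
  have hidx : ((stabilizer G α).subgroupOf N).index = 2^k := by
   rw [←hk,orb_card]; rfl
  have hcov := sylow_cover Q hidx
  have htr : ∀ β ∈ Orb N α,∃ g ∈ (Q : Subgroup N).map N.subtype,g•α = β := by
   rintro β ⟨n,hn,rfl⟩
   obtain ⟨t,ht,h2⟩ := hcov ⟨n,hn⟩
   refine ⟨t,⟨t,ht,rfl⟩,?_⟩
   have h3 : ((t : G)⁻¹*n)•α = α := h2
   rw [mul_smul,inv_smul_eq_iff] at h3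
   exact h3.symm
  refine h.noQ (p := 2) (by norm_num) (by norm_num) (N := N) (Q := (Q : Subgroup N).map N.subtype) (Q.2.map _) ?_ (Sylow.normalizer_sup_eq_top Q) ?_
  ·intro hQb
   have : Orb N α = {α} := by
    ext β
    constructor
    ·intro hβ
     obtain ⟨g,hg,rfl⟩ := htr β hβ
     rw [hQb,mem_bot] at hg
     rw [hg,one_smul]; rfl
    ·rintro rfl; exact orb_self _ _
   rw [this,Set.ncard_singleton] at h4
   omega
  ·intro β hβ
   obtain ⟨g,hg,h2⟩ := htr β hβ
   exact ⟨g,le_normalizer hg,h2⟩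
 have hle : (Orb N α).ncard ≤ 48 := le_of_dvd (by norm_num) hd
 have h8 := hpow 3
 have h16 := hpow 4
 generalize (Orb N α).ncard = d at *
 interval_cases d <;> revert hd h8 h16 <;> decide
end
end Mn
namespace Mn
open MulAction
/-- no element of order 5 commutes with one of order 7 in degree 8 -/
lemma no35 {G X : Type*} [Group G] [MulAction G X] [Finite G] [FaithfulSMul G X] [Finite X] (hX : Nat.card X = 8) {u v : G} (hu : orderOf u = 5) (hv : orderOf v = 7)
  (huv : u*v = v*u) : False := by
 have hc : Commute u v := huv
 have hmv : ∀ x : G,x ≠ 1 → ∃ β : X,x•β ≠ β := by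
  intro x hx
  by_contra hcon
  push Not at hcon
  exact hx (FaithfulSMul.eq_of_smul_eq_smul (α := X) (fun β => by rw [hcon,one_smul]))
 have hu1 : u ≠ 1 := by rintro rfl; simp at hu
 have hv1 : v ≠ 1 := by rintro rfl; simp at hv
 have hw : orderOf (u*v) = 35 := by
  rw [hc.orderOf_mul_eq_mul_orderOf_of_coprime (by rw [hu,hv]; decide),hu,hv]
 have hle : ∀ s : Set X,s.ncard ≤ 8 := fun s => by
  rw [←hX,←Set.ncard_univ]; exact ncard_le_ncard (Set.subset_univ _) (toFinite _)
 have hu5 : u^5 = 1 := hu ▸ pow_orderOf_eq_one u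
 have hv7 : v^7 = 1 := hv ▸ pow_orderOf_eq_one v
 -- every point is fixed by u or by v
 have hfix : ∀ β : X,u•β = β ∨ v•β = β := by
  intro β
  have h1 : (stabilizer G β).relIndex (zpowers (u*v)) ∣ 35 := by
   rw [←hw,←card_zpowers]; exact relIndex_dvd_card _ _
  have h2 := hle (Orb (zpowers (u*v)) β)
  rw [orb_card] at h2
  have h3 : (u*v)^((stabilizer G β).relIndex (zpowers (u*v))) ∈ stabilizer G β := by
   let K := (stabilizer G β).subgroupOf (zpowers (u*v))
   have hn : K.Normal := inferInstance
   have := Subgroup.pow_index_mem K ⟨u*v,mem_zpowers _⟩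
   exact this
  have h4 : (stabilizer G β).relIndex (zpowers (u*v)) = 1 ∨ (stabilizer G β).relIndex (zpowers (u*v)) = 5 ∨ (stabilizer G β).relIndex (zpowers (u*v)) = 7 := by
   generalize (stabilizer G β).relIndex (zpowers (u*v)) = n at *
   interval_cases n <;> revert h1 <;> decide
  have hu21 : ((u*v)^7)^3 = u := by
   rw [hc.mul_pow,hv7,mul_one,←pow_mul]
   calc u^(7*3) = (u^5)^4*u := by rw [←pow_mul,←pow_succ]
    _ = u := by rw [hu5]; simp
  have hv15 : ((u*v)^5)^3 = v := by
   rw [hc.mul_pow,hu5,one_mul,←pow_mul]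
   calc v^(5*3) = (v^7)^2*v := by rw [←pow_mul,←pow_succ]
    _ = v := by rw [hv7]; simp
  rcases h4 with h4 | h4 | h4 <;> rw [h4] at h3
  ·left
   rw [pow_one] at h3
   have h5 := pow_mem (pow_mem h3 7) 3
   rw [hu21] at h5; exact h5
  ·right
   have h5 := pow_mem h3 3
   rw [hv15] at h5; exact h5
  ·left
   have h5 := pow_mem h3 3
   rw [hu21] at h5; exact h5
 obtain ⟨β,hβ⟩ := hmv u hu1
 obtain ⟨γ,hγ⟩ := hmv v hv1
 have c5 := orb_zpow (by norm_num) hu hβ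
 have c7 := orb_zpow (by norm_num) hv hγ
 have hvβ : v•β = β := (hfix β).resolve_left hβ
 have hdis : Disjoint (Orb (zpowers u) β) (Orb (zpowers v) γ) := by
  rw [Set.disjoint_left]
  rintro δ ⟨a,ha,rfl⟩ ⟨b,hb,h2⟩
  have ha1 : v*a = a*v := by
   obtain ⟨i,rfl⟩ := ha
   exact ((hc.symm.zpow_right i).eq)
  have hb1 : v*b = b*v := by
   obtain ⟨i,rfl⟩ := hb
   exact (((Commute.refl v).zpow_right i).eq)
  have e1 : v•a•β = a•β := by rw [←mul_smul,ha1,mul_smul,hvβ]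
  apply hγ
  rw [←h2,←mul_smul,hb1,mul_smul] at e1
  exact smul_left_cancel b e1
 have := hle (Orb (zpowers u) β ∪ Orb (zpowers v) γ)
 rw [Set.ncard_union_eq hdis (toFinite _) (toFinite _)] at this
 omega
end Mn
namespace Mn
open MulAction
variable {G : Type u} {Ω : Type*} [Group G] [MulAction G Ω] [Finite G] [FaithfulSMul G Ω] {α : Ω}
lemma core_faithful {U : Subgroup G} (hU : U.normalCore = ⊥) : FaithfulSMul G (G ⧸ U) := by
 constructor
 intro a b hab
 have h1 : toPermHom G (G ⧸ U) a = toPermHom G (G ⧸ U) b := by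
  ext x; exact hab x
 have h2 : (toPermHom G (G ⧸ U)).ker = ⊥ := by rw [←Subgroup.normalCore_eq_ker,hU]
 exact (ker_eq_bot_iff _).1 h2 h1
lemma core_card {U : Subgroup G} (hU : U.normalCore = ⊥) : Nat.card G ∣ (U.index).factorial := by
 have := core_faithful hU
 have h1 : Injective (toPermHom G (G ⧸ U)) := toPerm_injective
 have := Subgroup.card_dvd_of_injective _ h1
 rwa [card_perm] at this
/-- an element of order 5 normalizing a group of order 7 centralizes it -/
lemma comm57 {K : Type*} [Group K] {u v : K} (hu : orderOf u = 5) (hv : orderOf v = 7)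
  (hn : u*v*u⁻¹ ∈ zpowers v) : u*v = v*u := by
 have hfin : IsOfFinOrder v := orderOf_pos_iff.1 (by omega)
 rw [←hfin.mem_powers_iff_mem_zpowers] at hn
 obtain ⟨k,hk⟩ := hn
 simp only at hk
 have hpow : ∀ n : ℕ,u^n*v*(u^n)⁻¹ = v^(k^n) := by
  intro n
  induction n with
  | zero => simp
  | succ n ih =>
   rw [show u^(n+1)*v*(u^(n+1))⁻¹ = u*(u^n*v*(u^n)⁻¹)*u⁻¹ by rw [pow_succ',mul_inv_rev]; simp only [mul_assoc],
    ih,←conj_pow,←hk,←pow_mul,pow_succ']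
 have h5 := hpow 5
 have hu5 : u^5 = 1 := hu ▸ pow_orderOf_eq_one u
 rw [hu5] at h5
 simp only [one_mul,inv_one,mul_one] at h5
 have h6 : v^(k^5) = v^1 := by rw [←h5,pow_one]
 rw [pow_eq_pow_iff_modEq,hv] at h6
 have h7 : k ≡ 1 [MOD 7] := by
  have : k % 7 < 7 := Nat.mod_lt _ (by norm_num)
  have h8 : (k % 7)^5 % 7 = 1 := by rw [←Nat.pow_mod]; exact h6
  unfold Nat.ModEq
  generalize k % 7 = m at *
  interval_cases m <;> revert h8 <;> decide
 have h8 : v^k = v^1 := by rw [pow_eq_pow_iff_modEq,hv]; exact h7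
 rw [hk,pow_one] at h8
 calc u*v = u*v*u⁻¹*u := by group
  _ = v*u := by rw [h8]
lemma Hyp.simple_core (h : Hyp G α) (hs : ∀ M : Subgroup G,M.Normal → M ≠ ⊥ → M = ⊤) {U : Subgroup G} (hU : U ≠ ⊤) : U.normalCore = ⊥ := by
 by_contra hb
 have h1 := hs _ (normalCore_normal U) hb
 exact hU (top_le_iff.1 (h1 ▸ normalCore_le U))
lemma Hyp.c48 (h : Hyp G α) : 48 ∣ Nat.card G := by
 rw [←h.index]; exact index_dvd_card _
lemma Hyp.p4_seven (h : Hyp G α) (hs : ∀ M : Subgroup G,M.Normal → M ≠ ⊥ → M = ⊤) {S : Subgroup G}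
  (hi : S.index = 8) (h5 : 5 ∣ Nat.card S) : 7 ∣ Nat.card S := by
 classical
 have : Fact (Nat.Prime 5) := ⟨by norm_num⟩
 obtain ⟨t,ht⟩ := exists_prime_orderOf_dvd_card' 5 h5
 have hSt : S ≠ ⊤ := by rintro rfl; simp at hi
 have hcore := h.simple_core hs hSt
 have := core_faithful hcore
 have hX : Nat.card (G ⧸ S) = 8 := hi
 have : Nontrivial (G ⧸ S) := Finite.one_lt_card_iff_nontrivial.1 (by omega)
 have hmx : IsCoatom S := by
  refine ⟨hSt,fun U hU => ?_⟩
  by_contra hUt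
  have h1 := core_card (h.simple_core hs hUt)
  have h2 : S.relIndex U*U.index = 8 := by rw [relIndex_mul_index hU.le,hi]
  have h3 : S.relIndex U ≠ 1 := fun h3 => not_le_of_gt hU (relIndex_eq_one.1 h3)
  have h4 : U.index ≤ 4 := by
   have : S.relIndex U ≠ 0 := by intro h0; rw [h0] at h2; omega
   have : 2 ≤ S.relIndex U := by omega
   nlinarith
  have h6 := (h.c48.trans h1).trans (Nat.factorial_dvd_factorial h4)
  revert h6; decide
 have hpp : IsPreprimitive G (G ⧸ S) := by
  rw [←isCoatom_stabilizer_iff_preprimitive G ((1 : G) : G ⧸ S),stabilizer_quotient]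
  exact hmx
 let φ := toPermHom G (G ⧸ S)
 have hinj : Injective φ := toPerm_injective
 have : Fintype (G ⧸ S) := ofFinite _
 have hpP : IsPreprimitive φ.range (G ⧸ S) := by
  have hsurj : Surjective (fun x : G => (⟨φ x,⟨x,rfl⟩⟩ : φ.range)) := by
   rintro ⟨_,x,rfl⟩; exact ⟨x,rfl⟩
  let F : (G ⧸ S) →ₑ[fun x : G => (⟨φ x,⟨x,rfl⟩⟩ : φ.range)] (G ⧸ S) := ⟨id,fun m x => rfl⟩
  exact IsPreprimitive.of_surjective (f := F) Function.surjective_id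
 have hτ : orderOf (φ t) = 5 := by
  rw [orderOf_injective φ hinj,orderOf_coe,ht]
 have hcyc : (φ t).IsCycle := by
  apply isCycle_of_prime_order'
  ·rw [hτ]; norm_num
  ·rw [hτ,←card_eq_fintype_card,hX]; norm_num
 have hsupp : (φ t).support.card = 5 := by rw [←hcyc.orderOf,hτ]
 have h2t := hpP.is_two_pretransitive (s := ((φ t).support : Set (G ⧸ S))ᶜ) (n := 2) (by
   rw [Set.ncard_compl,ncard_coe_finset,hsupp,hX]) (by omega)
   (Perm.isPretransitive_of_isCycle_mem hcyc ⟨t,rfl⟩)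
 have h56 : 7 ∣ Nat.card φ.range := by
  have := h2t
  have hc := IsMultiplyPretransitive.index_of_fixingSubgroup_mul h2t
   (s := {((1 : G) : G ⧸ S),(((φ t).support.card_pos.1 (by omega)).choose)}) (by
    apply Set.ncard_pair
    have h9 := ((φ t).support.card_pos.1 (by omega)).choose_spec
    intro he
    rw [←he,mem_support] at h9
    apply h9
    change ((t : G)•((1 : G) : G ⧸ S)) = _
    have : (t : G) ∈ stabilizer G ((1 : G) : G ⧸ S) := by rw [stabilizer_quotient]; exact t.2
    exact this)
  rw [hX] at hc
  have h10 := index_dvd_card (fixingSubgroup φ.range ({((1 : G) : G ⧸ S),(((φ t).support.card_pos.1 (by omega)).choose)} : Set (G ⧸ S)))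
  have h11 : (8 - 2).factorial = 720 := by decide
  have h12 : (8 : ℕ).factorial = 40320 := by decide
  rw [h11,h12] at hc
  have h13 : (fixingSubgroup φ.range ({((1 : G) : G ⧸ S),(((φ t).support.card_pos.1 (by omega)).choose)} : Set (G ⧸ S))).index = 56 := by omega
  rw [h13] at h10
  exact (by norm_num : 7 ∣ 56).trans h10
 have h7G : 7 ∣ Nat.card G := h56.trans (by
  rw [←card_congr (ofInjective hinj).toEquiv])
 rw [←card_mul_index S,hi] at h7G
 exact (Coprime.dvd_mul_right (by norm_num)).1 h7G
lemma Hyp.p4_68 (h : Hyp G α) (hs : ∀ M : Subgroup G,M.Normal → M ≠ ⊥ → M = ⊤) {S : Subgroup G}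
  (hS : stabilizer G α ≤ S) (hmax : ∀ U,stabilizer G α ≤ U → U ≤ S → U = stabilizer G α ∨ U = S)
  (hc : (Orb S α).ncard = 6) : False := by
 classical
 have := h.fin
 have : Fact (Nat.Prime 5) := ⟨by norm_num⟩
 have : Fact (Nat.Prime 7) := ⟨by norm_num⟩
 have hi : S.index = 8 := by have := h.orb_mul hS; rw [hc] at this; omega
 have hSt : S ≠ ⊤ := by rintro rfl; simp at hi
 have hcore := h.simple_core hs hSt
 have := core_faithful hcore
 have hX : Nat.card (G ⧸ S) = 8 := hi
 have h8 := core_card hcore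
 rw [hi,←card_mul_index S,hi] at h8
 have h8' : Nat.card S ∣ 5040 := by
  have e : (8 : ℕ).factorial = 5040*8 := by decide
  rw [e] at h8
  exact Nat.dvd_of_mul_dvd_mul_right (by norm_num) h8
 have htt := two_trans hS hmax (Or.inl hc)
 obtain ⟨b,hb,hba⟩ : ∃ b ∈ Orb S α,b ≠ α := Set.exists_ne_of_one_lt_ncard (by omega) α
 have hO : Orb (stabilizer G α) b = Orb S α \ {α} := by
  ext c
  constructor
  ·rintro ⟨g,hg,rfl⟩
   obtain ⟨s,hs',rfl⟩ := hb
   refine ⟨⟨g*s,S.mul_mem (hS hg) hs',mul_smul _ _ _⟩,?_⟩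
   intro he
   have he : g•s•α = α := he
   apply hba
   rw [←smul_left_cancel_iff g,he]
   exact (mem_stabilizer_iff.1 hg).symm
  ·rintro ⟨h1,h2⟩
   obtain ⟨g,hg,h3,h4⟩ := htt b hb c h1 hba h2
   exact ⟨g,h3,h4⟩
 have hO5 : (Orb (stabilizer G α) b).ncard = 5 := by
  rw [hO,Set.ncard_sdiff_singleton_of_mem (orb_self S α),hc]
 rw [orb_card] at hO5
 let D := (toPermHom S (orbit S α)).ker
 have hD1 : D.index ∣ 720 := by
  have h1 : D.index = Nat.card (toPermHom S (orbit S α)).range := index_ker _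
  have h2 := card_subgroup_dvd_card (toPermHom S (orbit S α)).range
  have h3 : Nat.card (orbit S α) = 6 := by rw [←orb_eq_orbit]; exact hc
  rw [card_perm,h3] at h2
  rw [h1]; exact h2
 have hD5 : 5 ∣ D.index := by
  have h1 : D ≤ (stabilizer G b ⊓ stabilizer G α).subgroupOf S := by
   intro x hx
   have hx' : ∀ z : orbit S α,x•z = z := fun z => by
    have := congrArg (fun f => f z) (mem_ker.1 hx); exact this
   rw [Subgroup.mem_subgroupOf]
   rw [orb_eq_orbit] at hb
   exact ⟨congrArg Subtype.val (hx' ⟨b,hb⟩),congrArg Subtype.val (hx' ⟨α,mem_orbit_self α⟩)⟩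
  have h2 := index_dvd_of_le h1
  have h3 : (stabilizer G b ⊓ stabilizer G α).relIndex (stabilizer G α)*(stabilizer G α).relIndex S = (stabilizer G b ⊓ stabilizer G α).relIndex S :=
   relIndex_mul_relIndex _ _ _ inf_le_right hS
  rw [inf_relIndex_right,hO5] at h3
  exact (Dvd.intro _ h3).trans h2
 have hcm := card_mul_index D
 have h5S : 5 ∣ Nat.card S := hcm ▸ (hD5.mul_left _)
 have h7S := h.p4_seven hs hi h5S
 have h7D : 7 ∣ Nat.card D := by
  rw [←hcm] at h7S
  rcases (Nat.Prime.dvd_mul (by norm_num)).1 h7S with h1 | h1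
  ·exact h1
  ·exact absurd (h1.trans hD1) (by decide)
 -- Frattini
 let R : Sylow 7 D := default
 have hR7 : Nat.card R = 7 := by
  have h1 : Nat.card R ∣ 5040 := ((card_subgroup_dvd_card _).trans (card_subgroup_dvd_card D)).trans h8'
  obtain ⟨k,hk⟩ := (iff_card.1 R.isPGroup')
  have h2 : 7 ∣ Nat.card R := R.dvd_card_of_dvd_card h7D
  have hk' : Nat.card R = 7^k := hk
  rw [hk'] at h1 h2 ⊢
  match k with
  | 0 => revert h2; decide
  | 1 => rfl
  | k+2 =>
   exfalso
   have : 7^2 ∣ 5040 := (pow_dvd_pow 7 (by omega)).trans h1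
   revert this; decide
 have hF := Sylow.normalizer_sup_eq_top R
 set R' : Subgroup S := R.map D.subtype with hR'
 have hR'7 : Nat.card R' = 7 := by
  rw [hR',card_map_of_injective D.subtype_injective]; exact hR7
 have h5N : 5 ∣ Nat.card (normalizer (R' : Set S)) := by
  have h1 : D.relIndex (D ⊔ normalizer (R' : Set S)) = D.relIndex (normalizer (R' : Set S)) := relIndex_sup_left _ _
  rw [sup_comm,hF,relIndex_top_right] at h1
  rw [h1] at hD5
  exact hD5.trans (relIndex_dvd_card _ _)
 obtain ⟨u,hu⟩ := exists_prime_orderOf_dvd_card' 5 h5N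
 obtain ⟨v,hv⟩ := exists_prime_orderOf_dvd_card' (G := R') 7 (by rw [hR'7])
 have hz : zpowers (v : S) = R' := by
  apply eq_of_le_of_card_ge
  ·simp
  ·rw [hR'7,card_zpowers,orderOf_coe,hv]
 have hcomm : (u : S)*(v : S) = v*u := by
  apply comm57
  ·rw [orderOf_coe,hu]
  ·rw [orderOf_coe,hv]
  ·rw [hz]
   exact (mem_normalizer_iff.1 u.2 v.1).1 v.2
 refine no35 (G := G) (X := G ⧸ S) hX (u := ((u : S) : G)) (v := ((v : S) : G)) ?_ ?_ ?_
 ·rw [orderOf_coe,orderOf_coe,hu]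
 ·rw [orderOf_coe,orderOf_coe,hv]
 ·exact congrArg Subtype.val hcomm
lemma Hyp.p4_86 (h : Hyp G α) (hs : ∀ M : Subgroup G,M.Normal → M ≠ ⊥ → M = ⊤) {S : Subgroup G}
  (hi : S.index = 6) : False := by
 classical
 have hSt : S ≠ ⊤ := by rintro rfl; simp at hi
 have hcore := h.simple_core hs hSt
 have := core_faithful hcore
 have hX : Nat.card (G ⧸ S) = 6 := hi
 have : Fintype (G ⧸ S) := ofFinite _
 have : Nontrivial (G ⧸ S) := Finite.one_lt_card_iff_nontrivial.1 (by omega)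
 let φ := toPermHom G (G ⧸ S)
 have hinj : Injective φ := toPerm_injective
 let f := (Perm.sign (α := G ⧸ S)).comp φ
 have h48 := le_of_dvd Nat.card_pos h.c48
 have hk : f.ker = ⊤ := by
  by_cases hb : f.ker = ⊥
  ·exfalso
   have h1 := Nat.card_le_card_of_injective f ((ker_eq_bot_iff _).1 hb)
   have h2 : Nat.card ℤˣ = 2 := by rw [card_eq_fintype_card]; decide
   omega
  ·exact hs _ (MonoidHom.normal_ker f) hb
 have hr : φ.range ≤ alternatingGroup (G ⧸ S) := by
  rintro _ ⟨x,rfl⟩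
  rw [mem_alternatingGroup]
  have : x ∈ f.ker := by rw [hk]; trivial
  exact this
 have h1 := card_dvd_of_le hr
 have h2 := two_mul_nat_card_alternatingGroup (α := G ⧸ S)
 rw [card_perm,hX] at h2
 have h3 : (6 : ℕ).factorial = 720 := by decide
 rw [←card_congr (ofInjective hinj).toEquiv] at h1
 have h4 := h.c48.trans h1
 omega
/-- existence of a minimal normal subgroup whose orbit is a minimal block -/
theorem Hyp.main_normal (h : Hyp G α) : ∃ N : Subgroup G,N.Normal ∧ N ≠ ⊥ ∧ (∀ M : Subgroup G,M.Normal → M ≤ N → M ≠ ⊥ → M = N) ∧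
  ∀ U : Subgroup G,stabilizer G α ≤ U → U ≤ N ⊔ stabilizer G α → U = stabilizer G α ∨ U = N ⊔ stabilizer G α := by
 have := h.fin
 have hGb : (⊤ : Subgroup G) ≠ ⊥ := by
  intro he
  have := le_of_dvd Nat.card_pos h.c48
  rw [←Subgroup.card_top,he,Subgroup.card_bot] at this
  omega
 obtain ⟨N0, -,hN0,hb0,hmin0⟩ := minnorm (⊤ : Subgroup G) inferInstance hGb
 have hlt : ∀ N : Subgroup G,N.Normal → N ≠ ⊥ → stabilizer G α < N ⊔ stabilizer G α := by
  intro N hN hb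
  refine lt_of_le_of_ne le_sup_right (fun he => ?_)
  have h1 := h.orb_four N hb
  rw [←orb_normal,←he,orb_card,Subgroup.relIndex_self] at h1
  omega
 obtain ⟨S,hS1,hS2,hS3⟩ := minover (hlt N0 hN0 hb0)
 by_cases hC : S.normalCore = ⊥
 ·exfalso
  obtain ⟨r,hr,hr5,hrd⟩ := h.big_prime N0 hN0 hb0
  have : Fact r.Prime := ⟨hr⟩
  obtain ⟨x,hx⟩ := exists_prime_orderOf_dvd_card' r hrd
  have := core_faithful hC
  obtain ⟨β,hβ⟩ : ∃ β : G ⧸ S,(x : G)•β ≠ β := by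
   by_contra hcon
   push Not at hcon
   have : (x : G) = 1 := FaithfulSMul.eq_of_smul_eq_smul (α := G ⧸ S) (fun β => by rw [hcon,one_smul])
   rw [←orderOf_coe,this,orderOf_one] at hx
   omega
  have he : r ≤ (Orb N0 ((1 : G) : G ⧸ S)).ncard := by
   have h1 := orb_ge x.2 hr (by rw [orderOf_coe,hx]) hβ
   obtain ⟨g,rfl⟩ := QuotientGroup.mk_surjective β
   have h2 := orb_conj_card N0 g ((1 : G) : G ⧸ S)
   have h3 : g•((1 : G) : G ⧸ S) = ((g : G) : G ⧸ S) := by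
    change ((g*1 : G) : G ⧸ S) = _; rw [mul_one]
   rw [h3] at h2; omega
  rw [orb_card,stabilizer_quotient] at he
  have hN0S : N0 ⊔ S = N0 ⊔ stabilizer G α := by
   apply le_antisymm (sup_le le_sup_left hS2) (sup_le_sup_left hS1.le _)
  have hrel : S.relIndex (N0 ⊔ stabilizer G α) = S.relIndex N0 := by
   rw [←hN0S]
   have h1 := orb_normal (G := G) (α := ((1 : G) : G ⧸ S)) N0
   have h2 := congrArg Set.ncard h1
   rw [orb_card,orb_card,stabilizer_quotient] at h2
   exact h2
  have h48 := h.orb_mul hS1.le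
  have hcd : (Orb S α).ncard*S.relIndex (N0 ⊔ stabilizer G α) = (Orb N0 α).ncard := by
   rw [←orb_normal N0,orb_card,orb_card,relIndex_mul_relIndex _ _ _ hS1.le hS2]
  have hei : S.relIndex (N0 ⊔ stabilizer G α)*(N0 ⊔ stabilizer G α).index = S.index := relIndex_mul_index hS2
  have hc : 4 < (Orb S α).ncard := by
   rcases h.nob S hS1.le with h1 | h1
   ·exact h1
   ·rw [orb_card] at h1
    exact absurd (relIndex_eq_one.1 h1) (not_le_of_gt hS1)
  have hvals := h.orb_vals N0 hb0
  rw [hrel] at hei hcd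
  have hkey : ((Orb S α).ncard = 6 ∨ S.index = 6) ∧ (N0 ⊔ stabilizer G α).index = 1 := by
   generalize (Orb S α).ncard = c at *
   generalize S.relIndex N0 = e at *
   generalize (N0 ⊔ stabilizer G α).index = f at *
   generalize (Orb N0 α).ncard = d at *
   rw [←hei] at h48 ⊢
   have h5 : 5 ≤ e := by omega
   have hf : 0 < f := by
    rcases Nat.eq_zero_or_pos f with h0 | h0
    ·subst h0; simp at h48
    ·exact h0
   have hce : c*e*f = 48 := by rw [←h48]; ring
   have hc48 : c ∣ 48 := ⟨_,h48.symm⟩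
   have he48 : e ∣ 48 := ⟨c*f,by rw [←hce]; ring⟩
   have hcl : c ≤ 9 := by nlinarith
   have hel : e ≤ 9 := by nlinarith
   have hc' : c = 6 ∨ c = 8 := by interval_cases c <;> revert hc48 <;> decide
   have he' : e = 6 ∨ e = 8 := by interval_cases e <;> revert he48 <;> decide
   rcases hc' with rfl | rfl <;> rcases he' with rfl | rfl <;> omega
  have hN0t : N0 = ⊤ := by
   apply h.min
   intro β
   obtain ⟨g,rfl⟩ := h.trans β
   have : g•α ∈ Orb N0 α := by
    rw [←orb_normal,index_eq_one.1 hkey.2]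
    exact ⟨g,trivial,rfl⟩
   exact this
  have hs : ∀ M : Subgroup G,M.Normal → M ≠ ⊥ → M = ⊤ := by
   intro M hM hMb
   rw [hmin0 M hM (hN0t ▸ le_top) hMb,hN0t]
  rcases hkey.1 with h6 | h6
  ·exact h.p4_68 hs hS1.le hS3 h6
  ·exact h.p4_86 hs h6
 ·obtain ⟨N,hNC,hN,hb,hmin⟩ := minnorm S.normalCore (normalCore_normal S) hC
  have hNS : N ⊔ stabilizer G α = S := by
   have h1 : N ⊔ stabilizer G α ≤ S := sup_le (hNC.trans (normalCore_le S)) hS1.le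
   rcases hS3 _ le_sup_right h1 with h2 | h2
   ·exact absurd h2 (hlt N hN hb).ne'
   ·exact h2
  exact ⟨N,hN,hb,hmin,by rw [hNS]; exact hS3⟩
section syl
variable {N : Type*} [Group N] [Finite N]
/-- `T` is a Sylow `p`-subgroup of `W` -/
def IsSyl (p : ℕ) (T W : Subgroup N) : Prop := T ≤ W ∧ IsPGroup p T ∧ ¬ p ∣ T.relIndex W
/-- conjugate of a subgroup -/
def cj (n : N) (T : Subgroup N) : Subgroup N := T.map (MulAut.conj n).toMonoidHom
lemma mem_cj {n x : N} {T : Subgroup N} : x ∈ cj n T ↔ n⁻¹*x*n ∈ T := by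
 constructor
 ·rintro ⟨y,hy,rfl⟩
  simpa [mul_assoc] using hy
 ·intro h
  exact ⟨_,h,by simp [mul_assoc]⟩
lemma cj_normalizer {n : N} {T : Subgroup N} : n ∈ normalizer (T : Set N) ↔ cj n T = T := by
 rw [mem_normalizer_iff]
 constructor
 ·intro h
  ext x
  rw [mem_cj,h (n⁻¹*x*n)]
  simp [mul_assoc]
 ·intro h x
  conv_rhs => rw [←h]
  rw [mem_cj]; simp [mul_assoc]
lemma cj_cj (m n : N) (T : Subgroup N) : cj m (cj n T) = cj (m*n) T := by
 ext x; simp only [mem_cj,mul_inv_rev,mul_assoc]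
lemma exists_syl (p : ℕ) [Fact p.Prime] (W : Subgroup N) : ∃ T,IsSyl p T W := by
 let P : Sylow p W := default
 refine ⟨P.map W.subtype,map_subtype_le _,P.isPGroup'.map _,?_⟩
 have : (P.map W.subtype).subgroupOf W = P := Subgroup.comap_map_eq_self_of_injective W.subtype_injective _
 rw [relIndex,this]
 exact P.not_dvd_index
lemma IsSyl.conj {p : ℕ} [Fact p.Prime] {T U W : Subgroup N} (h1 : IsSyl p T W) (h2 : IsSyl p U W) : ∃ w ∈ W,U = cj w T := by
 have e1 : IsPGroup p (T.subgroupOf W) := h1.2.1.comap_of_injective W.subtype W.subtype_injective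
 have e2 : IsPGroup p (U.subgroupOf W) := h2.2.1.comap_of_injective W.subtype W.subtype_injective
 let P := e1.toSylow h1.2.2
 let R := e2.toSylow h2.2.2
 obtain ⟨w,hw⟩ := exists_smul_eq W P R
 refine ⟨w,w.2,?_⟩
 ext x
 rw [mem_cj]
 have key : ∀ y : W,y ∈ (R : Subgroup W) ↔ w⁻¹*y*w ∈ (P : Subgroup W) := by
  intro y
  rw [←hw,Sylow.coe_subgroup_smul]
  rw [Subgroup.mem_pointwise_smul_iff_inv_smul_mem]
  simp [MulAut.smul_def]
 constructor
 ·intro hx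
  have := (key ⟨x,h2.1 hx⟩).1 hx
  exact this
 ·intro hx
  have hxW : x ∈ W := by
   have := W.mul_mem (W.mul_mem w.2 (h1.1 hx)) (W.inv_mem w.2)
   simpa [mul_assoc] using this
  exact (key ⟨x,hxW⟩).2 hx
lemma IsSyl.ne_bot {p : ℕ} [Fact p.Prime] {T W : Subgroup N} (h : IsSyl p T W) (hd : p ∣ Nat.card W) : T ≠ ⊥ := by
 rintro rfl
 apply h.2.2
 rwa [relIndex_bot_left]
lemma IsSyl.map {M : Type*} [Group M] {p : ℕ} {T W : Subgroup N} (φ : N →* M) (h : IsSyl p T W) : IsSyl p (T.map φ) (W.map φ) := by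
 refine ⟨Subgroup.map_mono h.1,h.2.1.map φ,fun hd => h.2.2 (hd.trans ?_)⟩
 let f : W →* W.map φ := φ.subgroupMap W
 have hf : Surjective f := φ.subgroupMap_surjective W
 have h1 := Subgroup.index_map_dvd (T.subgroupOf W) hf
 have h2 : (T.subgroupOf W).map f = (T.map φ).subgroupOf (W.map φ) := by
  ext ⟨y,hy⟩
  constructor
  ·rintro ⟨w,hw,he⟩
   exact ⟨w,hw,congrArg Subtype.val he⟩
  ·rintro ⟨t,ht,he⟩
   exact ⟨⟨t,h.1 ht⟩,ht,Subtype.ext he⟩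
 rw [h2] at h1
 exact h1
lemma cj_map {M : Type*} [Group M] (φ : N →* M) (n : N) (T : Subgroup N) : (cj n T).map φ = cj (φ n) (T.map φ) := by
 ext y
 constructor
 ·rintro ⟨_,⟨t,ht,rfl⟩,rfl⟩
  exact ⟨φ t,⟨t,ht,rfl⟩,by simp⟩
 ·rintro ⟨_,⟨t,ht,rfl⟩,rfl⟩
  exact ⟨_,⟨t,ht,rfl⟩,by simp⟩
lemma IsSyl.cj {p : ℕ} {T : Subgroup N} (h : IsSyl p T ⊤) (n : N) : IsSyl p (cj n T) ⊤ := by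
 have := h.map (MulAut.conj n).toMonoidHom
 rwa [Subgroup.map_top_of_surjective _ (MulAut.conj n).surjective] at this
/-- normalizers of Sylow subgroups map onto normalizers -/
lemma IsSyl.lift {M : Type*} [Group M] {p : ℕ} [Fact p.Prime] (φ : N →* M) {T : Subgroup N} (h : IsSyl p T ⊤) (c : N)
  (hc : φ c ∈ normalizer ((T.map φ : Subgroup M) : Set M)) : ∃ n ∈ normalizer (T : Set N),φ n = φ c := by
 have hle : ∀ U : Subgroup N,IsSyl p U ⊤ → U ≤ T ⊔ φ.ker → IsSyl p U (T ⊔ φ.ker) := by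
  intro U hU hl
  refine ⟨hl,hU.2.1,fun hd => hU.2.2 ?_⟩
  rw [relIndex_top_right,←relIndex_mul_index hl]
  exact hd.mul_right _
 have h2 : Mn.cj c T ≤ T ⊔ φ.ker := by
  rintro x ⟨t,ht,rfl⟩
  have : φ c*φ t*(φ c)⁻¹ ∈ T.map φ := (mem_normalizer_iff.1 hc _).1 ⟨t,ht,rfl⟩
  rw [←Subgroup.comap_map_eq,mem_comap]
  simpa using this
 obtain ⟨w,hw,he⟩ := (hle T h le_sup_left).conj (hle _ (h.cj c) h2)
 rw [Subgroup.mem_sup_of_normal_right] at hw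
 obtain ⟨t,ht,k,hk,rfl⟩ := hw
 refine ⟨t*((t*k)⁻¹*c),Subgroup.mul_mem _ (le_normalizer ht) ?_,?_⟩
 ·rw [cj_normalizer,←cj_cj,he,cj_cj]
  simp only [inv_mul_cancel]
  ext x; simp [mem_cj]
 ·have : φ k = 1 := hk
  simp [this]
/-- Burnside transfer: Sylow normalizers in perfect groups -/
lemma perfect_transfer {p : ℕ} [Fact p.Prime] (hp : commutator N = ⊤) {T : Subgroup N} (h : IsSyl p T ⊤) (hb : T ≠ ⊥) :
  ∃ n ∈ normalizer (T : Set N),∃ t ∈ T,n*t ≠ t*n := by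
 by_contra hcon
 push Not at hcon
 have h3 : ¬ p ∣ T.index := by have := h.2.2; rwa [relIndex_top_right] at this
 let P : Sylow p N := h.2.1.toSylow h3
 have hP : normalizer ((P : Subgroup N) : Set N) ≤ centralizer (P : Set N) := by
  intro n hn
  rw [mem_centralizer_iff]
  intro t ht
  exact (hcon n hn t ht).symm
 have hcompl := MonoidHom.ker_transferSylow_isComplement' P hP
 have hk : (MonoidHom.transferSylow P hP).ker = ⊤ := by
  rw [eq_top_iff,←hp]
  have : IsMulCommutative P := ⟨⟨fun a b => Subtype.ext (hcon a.1 (le_normalizer a.2) b.1 b.2)⟩⟩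
  letI : CommGroup P := { mul_comm := fun a b => Subtype.ext (hcon a.1 (le_normalizer a.2) b.1 b.2) }
  exact Abelianization.commutator_subset_ker _
 rw [hk] at hcompl
 apply hb
 have := hcompl.disjoint
 rw [top_disjoint] at this
 exact this
end syl
section core
variable {N : Type*} [Group N] [Finite N]
/-- all images under `A` are conjugate in `N` -/
def Good (A : Subgroup (MulAut N)) (Q : Subgroup N) : Prop :=
 ∀ a ∈ A,∃ n : N,Q.map a.toMonoidHom = cj n Q
structure Core (A : Subgroup (MulAut N)) {d : ℕ} (φ : N →* Perm (Fin d)) : Prop where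
 inn : ∀ n : N,MulAut.conj n ∈ A
 cs : ∀ M : Subgroup N,(∀ a ∈ A,M.map a.toMonoidHom = M) → M = ⊥ ∨ M = ⊤
 tt : ∀ i j k l : Fin d,i ≠ j → k ≠ l → ∃ n,φ n i = k ∧ φ n j = l
 no : ∀ p : ℕ,p.Prime → p < 5 → ∀ Q : Subgroup N,IsPGroup p Q → Q ≠ ⊥ → Good A Q →
  ¬ ∀ i j : Fin d,∃ n ∈ normalizer (Q : Set N),φ n i = j
lemma IsSyl.good {A : Subgroup (MulAut N)} {p : ℕ} [Fact p.Prime] {T : Subgroup N} (h : IsSyl p T ⊤) : Good A T := by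
 intro a ha
 have h2 := h.map a.toMonoidHom
 rw [Subgroup.map_top_of_surjective _ a.surjective] at h2
 obtain ⟨w, -,hw⟩ := h.conj h2
 exact ⟨w,hw⟩
lemma Good.sub {A : Subgroup (MulAut N)} (hA : ∀ n : N,MulAut.conj n ∈ A) {Q : Subgroup N} (hQ : Good A Q) {p : ℕ} [Fact p.Prime] {T W : Subgroup N}
  (hW : ∀ a : MulAut N,Q.map a.toMonoidHom = Q → W.map a.toMonoidHom = W) (h : IsSyl p T W) : Good A T := by
 intro a ha
 obtain ⟨n,hn⟩ := hQ a ha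
 have hb : Q.map ((MulAut.conj n)⁻¹*a).toMonoidHom = Q := by
  have h1 : Q.map ((MulAut.conj n)⁻¹*a).toMonoidHom = (Q.map a.toMonoidHom).map (MulAut.conj n⁻¹).toMonoidHom := by
   rw [Subgroup.map_map,←map_inv]; rfl
  rw [h1,hn]
  change Mn.cj n⁻¹ (Mn.cj n Q) = Q
  rw [cj_cj]; ext x; simp [mem_cj]
 have h2 := h.map ((MulAut.conj n)⁻¹*a).toMonoidHom
 rw [hW _ hb] at h2
 obtain ⟨w, -,hw⟩ := h.conj h2
 refine ⟨n*w,?_⟩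
 rw [←cj_cj,←hw]
 unfold cj
 rw [Subgroup.map_map]
 congr 1
 ext x; simp [mul_assoc]
lemma normalizer_aut (Q : Subgroup N) (a : MulAut N) (ha : Q.map a.toMonoidHom = Q) :
  (normalizer (Q : Set N)).map a.toMonoidHom = normalizer (Q : Set N) := by
 have hm : ∀ x,a x ∈ Q ↔ x ∈ Q := fun x => by
  conv_lhs => rw [←ha]
  constructor
  ·rintro ⟨y,hy,he⟩
   rwa [←a.injective he]
  ·intro hx; exact ⟨x,hx,rfl⟩
 have h1 : ∀ n,a n ∈ normalizer (Q : Set N) ↔ n ∈ normalizer (Q : Set N) := by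
  intro n
  rw [mem_normalizer_iff,mem_normalizer_iff]
  constructor
  ·intro h x
   have := h (a x)
   rw [hm,←map_mul,←map_inv,←map_mul,hm] at this
   exact this
  ·intro h x
   obtain ⟨y,rfl⟩ := a.surjective x
   rw [hm,←map_mul,←map_inv,←map_mul,hm]
   exact h y
 ext x
 obtain ⟨y,rfl⟩ := a.surjective x
 rw [h1]
 constructor
 ·rintro ⟨z,hz,he⟩; rwa [←a.injective he]
 ·intro hy; exact ⟨y,hy,rfl⟩
lemma centralizer_aut (Q : Subgroup N) (a : MulAut N) (ha : Q.map a.toMonoidHom = Q) :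
  (centralizer (Q : Set N)).map a.toMonoidHom = centralizer (Q : Set N) := by
 have hm : ∀ x,a x ∈ Q ↔ x ∈ Q := fun x => by
  conv_lhs => rw [←ha]
  constructor
  ·rintro ⟨y,hy,he⟩
   rwa [←a.injective he]
  ·intro hx; exact ⟨x,hx,rfl⟩
 have h1 : ∀ n,a n ∈ centralizer (Q : Set N) ↔ n ∈ centralizer (Q : Set N) := by
  intro n
  simp only [mem_centralizer_iff,SetLike.mem_coe]
  constructor
  ·intro h x hx
   have := h (a x) ((hm x).2 hx)
   rw [←map_mul,←map_mul] at this
   exact a.injective this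
  ·intro h x hx
   obtain ⟨y,rfl⟩ := a.surjective x
   rw [←map_mul,←map_mul,h y ((hm y).1 hx)]
 ext x
 obtain ⟨y,rfl⟩ := a.surjective x
 rw [h1]
 constructor
 ·rintro ⟨z,hz,he⟩; rwa [←a.injective he]
 ·intro hy; exact ⟨y,hy,rfl⟩
variable {A : Subgroup (MulAut N)} {d : ℕ} {φ : N →* Perm (Fin d)}
/-- Sylow normalizers in the constituent are intransitive -/
lemma Core.sylow (h : Core A φ) {p : ℕ} (hp : p.Prime) (h5 : p < 5) {E : Subgroup (Perm (Fin d))} (hE : IsSyl p E φ.range) (hb : E ≠ ⊥)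
  (ht : ∀ i j : Fin d,∃ c ∈ φ.range,c ∈ normalizer (E : Set (Perm (Fin d))) ∧ c i = j) : False := by
 have : Fact p.Prime := ⟨hp⟩
 obtain ⟨T0,hT0⟩ := exists_syl p (⊤ : Subgroup N)
 have h1 := hT0.map φ
 rw [←range_eq_map] at h1
 obtain ⟨_,⟨n0,rfl⟩,hn0⟩ := h1.conj hE
 rw [←cj_map] at hn0
 have hT := hT0.cj n0
 generalize cj n0 T0 = T at *
 subst hn0
 refine h.no p hp h5 T hT.2.1 ?_ hT.good ?_
 ·rintro rfl; exact hb (Subgroup.map_bot φ)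
 ·intro i j
  obtain ⟨_,⟨c,rfl⟩,hc,hij⟩ := ht i j
  obtain ⟨n,hn,he⟩ := hT.lift φ c hc
  exact ⟨n,hn,by rw [he,hij]⟩
lemma Core.perfect (h : Core A φ) (hd : 3 ≤ d) : commutator N = ⊤ := by
 rcases h.cs (commutator N) (fun a _ => Subgroup.characteristic_iff_map_eq.1 inferInstance a) with h1 | h1
 ·exfalso
  have hc : ∀ a b : N,a*b = b*a := fun a b => by
   rw [commutator_def,Subgroup.commutator_eq_bot_iff_le_centralizer] at h1
   have h2 := h1 (mem_top b)
   rw [mem_centralizer_iff] at h2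
   exact h2 a (mem_top a)
  have hne : ∀ i j : ℕ,∀ hi : i < d,∀ hj : j < d,i ≠ j → (⟨i,hi⟩ : Fin d) ≠ ⟨j,hj⟩ := fun i j hi hj hij he => hij (congrArg Fin.val he)
  obtain ⟨a,ha1,ha2⟩ := h.tt ⟨0,by omega⟩ ⟨1,by omega⟩ ⟨0,by omega⟩ ⟨2,by omega⟩ (hne _ _ _ _ (by omega)) (hne _ _ _ _ (by omega))
  obtain ⟨b,hb1,hb2⟩ := h.tt ⟨0,by omega⟩ ⟨1,by omega⟩ ⟨1,by omega⟩ ⟨0,by omega⟩ (hne _ _ _ _ (by omega)) (hne _ _ _ _ (by omega))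
  have e1 : φ (a*b) ⟨0,by omega⟩ = ⟨2,by omega⟩ := by rw [map_mul,Perm.mul_apply,hb1,ha2]
  rw [hc,map_mul,Perm.mul_apply,ha1,hb1] at e1
  exact hne _ _ _ _ (by omega) e1
 ·exact h1
lemma Core.even (h : Core A φ) (hd : 3 ≤ d) (n : N) : Perm.sign (φ n) = 1 := by
 have h1 := Abelianization.commutator_subset_ker (Perm.sign.comp φ)
 rw [h.perfect hd] at h1
 exact h1 (mem_top n)
lemma Core.conj (h : Core A φ) (σ : Perm (Fin d)) : Core A ((MulAut.conj σ).toMonoidHom.comp φ) := by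
 refine ⟨h.inn,h.cs,?_,?_⟩
 ·intro i j k l hij hkl
  obtain ⟨n,h1,h2⟩ := h.tt (σ⁻¹ i) (σ⁻¹ j) (σ⁻¹ k) (σ⁻¹ l) (by simpa using hij) (by simpa using hkl)
  refine ⟨n,?_,?_⟩
  ·change (σ*φ n*σ⁻¹) i = k
   rw [Perm.mul_apply,Perm.mul_apply,h1]; simp
  ·change (σ*φ n*σ⁻¹) j = l
   rw [Perm.mul_apply,Perm.mul_apply,h2]; simp
 ·intro p hp h5 Q hQ hb hG ht
  apply h.no p hp h5 Q hQ hb hG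
  intro i j
  obtain ⟨n,hn,he⟩ := ht (σ i) (σ j)
  refine ⟨n,hn,?_⟩
  have he : (σ*φ n*σ⁻¹) (σ i) = σ j := he
  rw [Perm.mul_apply,Perm.mul_apply] at he
  simpa using he
end core
end Mn
namespace Mn
open MulAction
variable {G : Type u} {Ω : Type*} [Group G] [MulAction G Ω] [Finite G] [FaithfulSMul G Ω] {α : Ω}
lemma Hyp.stab_trans (h : Hyp G α) {N : Subgroup G} [hN : N.Normal] (hb : N ≠ ⊥)
  (hmax : ∀ U : Subgroup G,stabilizer G α ≤ U → U ≤ N ⊔ stabilizer G α → U = stabilizer G α ∨ U = N ⊔ stabilizer G α) :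
  ∀ b ∈ Orb N α,∀ c ∈ Orb N α,b ≠ α → c ≠ α → ∃ g ∈ N,g•α = α ∧ g•b = c := by
 have := h.fin
 obtain ⟨r,hr,hr5,hrd⟩ := h.big_prime N hN hb
 have : Fact r.Prime := ⟨hr⟩
 obtain ⟨x0,hx0⟩ := exists_prime_orderOf_dvd_card' r hrd
 have hvals := h.orb_vals N hb
 obtain ⟨x,hxN,hxr,hxα⟩ : ∃ x ∈ N,orderOf x = r ∧ x•α ≠ α := by
  obtain ⟨β,hβ⟩ : ∃ β : Ω,(x0 : G)•β ≠ β := by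
   by_contra hcon
   push Not at hcon
   have : (x0 : G) = 1 := FaithfulSMul.eq_of_smul_eq_smul (α := Ω) (fun β => by rw [hcon,one_smul])
   rw [←orderOf_coe,this,orderOf_one] at hx0
   omega
  obtain ⟨g,rfl⟩ := h.trans β
  refine ⟨g⁻¹*x0*g,by simpa using hN.conj_mem x0 x0.2 g⁻¹,?_,?_⟩
  ·have : g⁻¹*x0*g = MulAut.conj g⁻¹ (x0 : G) := by simp
   rw [this,MulEquiv.orderOf_eq,orderOf_coe,hx0]
  ·intro he
   apply hβ
   rw [mul_smul,mul_smul,inv_smul_eq_iff] at he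
   exact he
 have hd : (Orb N α).ncard ≠ 0 := by intro h0; rw [h0] at hvals; revert hvals; decide
 have htt := two_trans le_sup_right hmax (by
  right
  rw [orb_normal]
  exact ⟨hvals,r,hr,hr5,x,(le_sup_left : N ≤ _) hxN,hxr,α,orb_self _ _,hxα⟩)
 rw [orb_normal] at htt
 have hinv : ∀ g ∈ stabilizer G α,∀ b ∈ Orb N α,g•b ∈ Orb N α := by
  rintro g hg b ⟨n,hn,rfl⟩
  refine ⟨g*n*g⁻¹,hN.conj_mem n hn g,?_⟩
  have : g⁻¹•α = α := by rw [inv_smul_eq_iff]; exact (mem_stabilizer_iff.1 hg).symm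
  rw [mul_smul,mul_smul,this]
 intro b hbB c hcB hba hca
 have hO : Orb (stabilizer G α) b = Orb N α \ {α} := by
  ext c
  constructor
  ·rintro ⟨g,hg,rfl⟩
   refine ⟨hinv g hg b hbB,fun he => hba ?_⟩
   have he : g•b = α := he
   rw [←smul_left_cancel_iff g,he]
   exact (mem_stabilizer_iff.1 hg).symm
  ·rintro ⟨h1,h2⟩
   obtain ⟨g,hg,h3,h4⟩ := htt b hbB c h1 hba h2
   exact ⟨g,h3,h4⟩
 let K := (stabilizer G b).subgroupOf (stabilizer G α)
 let M := N.subgroupOf (stabilizer G α)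
 have hKp : K.index.Prime := by
  have h1 : K.index = (Orb (stabilizer G α) b).ncard := by rw [orb_card]; rfl
  rw [h1,hO,Set.ncard_sdiff_singleton_of_mem (orb_self N α)]
  simp only [List.mem_cons,not_mem_nil,or_false] at hvals
  rcases hvals with h2 | h2 | h2 | h2 <;> rw [h2] <;> norm_num
 have hmul : K.relIndex (M ⊔ K)*(M ⊔ K).index = K.index := relIndex_mul_index le_sup_right
 rcases (dvd_prime hKp).1 (Dvd.intro_left _ hmul) with h1 | h1
 ·obtain ⟨g, -,hgα,rfl⟩ := htt b hbB c hcB hba hca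
  have hg : (⟨g,hgα⟩ : stabilizer G α) ∈ M ⊔ K := by rw [index_eq_one.1 h1]; trivial
  rw [Subgroup.mem_sup_of_normal_left] at hg
  obtain ⟨m,hm,k,hk,he⟩ := hg
  refine ⟨m,hm,m.2,?_⟩
  have h2 : g = m*k := (congrArg Subtype.val he).symm
  have h3 : (k : G)•b = b := hk
  rw [h2,mul_smul,h3]
 ·exfalso
  rw [h1] at hmul
  have hK0 : 0 < K.index := hKp.pos
  have h2 : K.relIndex (M ⊔ K) = 1 := by nlinarith
  have hMK : M ≤ K := le_sup_left.trans (relIndex_eq_one.1 h2)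
  have hfix : ∀ m ∈ N,m•α = α → ∀ c ∈ Orb N α,m•c = c := by
   intro m hm hmα c hc
   by_cases hcα : c = α
   ·rw [hcα,hmα]
   ·obtain ⟨g, -,hgα,rfl⟩ := htt b hbB c hc hba hcα
    have hgi : g⁻¹•α = α := by rw [inv_smul_eq_iff]; exact hgα.symm
    have h3 : (g⁻¹*m*g)•α = α := by rw [mul_smul,mul_smul,hgα,hmα,hgi]
    have h4 : (⟨g⁻¹*m*g,h3⟩ : stabilizer G α) ∈ M := by
     have := hN.conj_mem m hm g⁻¹
     rw [inv_inv] at this; exact this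
    have h5 : (g⁻¹*m*g)•b = b := hMK h4
    rw [mul_smul,mul_smul,inv_smul_eq_iff] at h5
    exact h5
  have hnorm : ((stabilizer G α).subgroupOf N).Normal := by
   constructor
   intro m hm n
   have h3 := hfix m m.2 hm ((n⁻¹ : N)•α) ⟨_,(n⁻¹).2,rfl⟩
   change ((n : G)*m*(n : G)⁻¹)•α = α
   rw [mul_smul,mul_smul]
   have h4 : (m : G)•(n : G)⁻¹•α = (n : G)⁻¹•α := h3
   rw [h4,smul_inv_smul]
  have hpow := Subgroup.pow_index_mem ((stabilizer G α).subgroupOf N) ⟨x,hxN⟩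
  have hidx : ((stabilizer G α).subgroupOf N).index = (Orb N α).ncard := by rw [orb_card]; rfl
  rw [hidx] at hpow
  have hpow' : x^(Orb N α).ncard ∈ stabilizer G α := hpow
  have hco : Coprime (Orb N α).ncard (orderOf x) := by
   rw [hxr]
   apply Coprime.symm
   rw [Nat.Prime.coprime_iff_not_dvd hr]
   intro hdv
   have h48 : r ∣ 48 := hdv.trans (h.orb_dvd N)
   rw [show (48 : ℕ) = 2^4*3 by norm_num,hr.dvd_mul] at h48
   rcases h48 with h6 | h6
   ·have := le_of_dvd (by norm_num) (hr.dvd_of_dvd_pow h6); omega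
   ·have := le_of_dvd (by norm_num) h6; omega
  obtain ⟨m,hm⟩ := exists_pow_eq_self_of_coprime hco
  have := pow_mem hpow' m
  rw [hm] at this
  exact hxα this
theorem Hyp.core (h : Hyp G α) : ∃ (N : Subgroup G) (A : Subgroup (MulAut N)) (d : ℕ) (φ : N →* Perm (Fin d)),Core A φ ∧ d ∈ [6,12,24,48] := by
 have := h.fin
 obtain ⟨N,hN,hb,hmin,hmax⟩ := h.main_normal
 have hst := h.stab_trans hb hmax
 have hcard : Nat.card (orbit N α) = (Orb N α).ncard := by rw [orb_eq_orbit]; rfl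
 let e : orbit N α ≃ Fin (Orb N α).ncard := Finite.equivFinOfCardEq hcard
 let φ : N →* Perm (Fin (Orb N α).ncard) := e.permCongrHom.toMonoidHom.comp (toPermHom N (orbit N α))
 have hφ : ∀ (n : N) (b : orbit N α),φ n (e b) = e (n•b) := by
  intro n b
  change e (n•e.symm (e b)) = _
  rw [e.symm_apply_apply]
 let α0 : orbit N α := ⟨α,mem_orbit_self α⟩
 have htr : ∀ b : orbit N α,∃ n : N,n•α0 = b := by
  rintro ⟨_,n,rfl⟩
  exact ⟨n,rfl⟩
 have hst' : ∀ b c : orbit N α,b ≠ α0 → c ≠ α0 → ∃ n : N,n•α0 = α0 ∧ n•b = c := by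
  intro b c hb hc
  have hb' : b.1 ∈ Orb N α := by rw [orb_eq_orbit]; exact b.2
  have hc' : c.1 ∈ Orb N α := by rw [orb_eq_orbit]; exact c.2
  obtain ⟨g,hg,h1,h2⟩ := hst b.1 hb' c.1 hc' (fun h => hb (Subtype.ext h)) (fun h => hc (Subtype.ext h))
  exact ⟨⟨g,hg⟩,Subtype.ext h1,Subtype.ext h2⟩
 have htt : ∀ i j k l : orbit N α,i ≠ j → k ≠ l → ∃ n : N,n•i = k ∧ n•j = l := by
  intro i j k l hij hkl
  obtain ⟨a,rfl⟩ := htr i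
  obtain ⟨b,rfl⟩ := htr k
  have h1 : a⁻¹•j ≠ α0 := fun h => hij (by rw [←h,smul_inv_smul])
  have h2 : b⁻¹•l ≠ α0 := fun h => hkl (by rw [←h,smul_inv_smul])
  obtain ⟨n,h3,h4⟩ := hst' _ _ h1 h2
  refine ⟨b*n*a⁻¹,?_,?_⟩
  ·rw [mul_smul,mul_smul,inv_smul_smul,h3]
  ·rw [mul_smul,mul_smul,h4,smul_inv_smul]
 refine ⟨N,(conjNormal : G →* MulAut N).range,_,φ,⟨?_,?_,?_,?_⟩,h.orb_vals N hb⟩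
 ·intro n
  refine ⟨n,?_⟩
  ext x; simp
 ·intro M hM
  have hMn : (M.map N.subtype).Normal := by
   constructor
   rintro _ ⟨m,hm,rfl⟩ g
   have h1 : conjNormal g m ∈ M := by
    have := hM (conjNormal g) ⟨g,rfl⟩
    rw [←this]; exact ⟨m,hm,rfl⟩
   exact ⟨_,h1,by simp⟩
  by_cases hMb : M = ⊥
  ·exact Or.inl hMb
  ·right
   have h1 := hmin _ hMn (map_subtype_le M) (fun h0 => hMb ((Subgroup.map_eq_bot_iff_of_injective _ N.subtype_injective).1 h0))
   rw [eq_top_iff]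
   intro x _
   have hx : (x : G) ∈ M.map N.subtype := by rw [h1]; exact x.2
   obtain ⟨y,hy,he⟩ := hx
   rwa [←N.subtype_injective he]
 ·intro i j k l hij hkl
  obtain ⟨n,h1,h2⟩ := htt (e.symm i) (e.symm j) (e.symm k) (e.symm l) (fun h => hij (e.symm.injective h)) (fun h => hkl (e.symm.injective h))
  refine ⟨n,?_,?_⟩
  ·have := hφ n (e.symm i); rw [h1] at this; simpa using this
  ·have := hφ n (e.symm j); rw [h2] at this; simpa using this
 ·intro p hp h5 Q hQ hQb hgood ht
  refine h.noQ hp h5 (Q := Q.map N.subtype) (N := N) (hQ.map _) (fun h0 => hQb ((Subgroup.map_eq_bot_iff_of_injective _ N.subtype_injective).1 h0)) ?_ ?_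
  ·rw [eq_top_iff]
   intro g _
   obtain ⟨n,hn⟩ := hgood (conjNormal g) ⟨g,rfl⟩
   have h1 : ∀ q : N,q ∈ Q ↔ conjNormal ((n : G)⁻¹*g) q ∈ Q := by
    intro q
    have e1 : n*conjNormal ((n : G)⁻¹*g) q*n⁻¹ = conjNormal g q := by
     ext; simp [mul_assoc]
    have e2 : conjNormal g q ∈ Q.map (conjNormal g : MulAut N).toMonoidHom ↔ q ∈ Q := by
     constructor
     ·rintro ⟨q',hq',he⟩
      rwa [←(conjNormal g : MulAut N).injective he]
     ·intro hq; exact ⟨q,hq,rfl⟩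
    rw [←e2,hn,mem_cj,←e1]
    simp [mul_assoc]
   have h2 : (n : G)⁻¹*g ∈ normalizer ((Q.map N.subtype : Subgroup G) : Set G) := by
    rw [mem_normalizer_iff]
    intro y
    constructor
    ·rintro ⟨q,hq,rfl⟩
     exact ⟨_,(h1 q).1 hq,by simp [mul_assoc]⟩
    ·rintro ⟨q,hq,he⟩
     have hy : y ∈ N := by
      have : y = ((n : G)⁻¹*g)⁻¹*(q : G)*(((n : G)⁻¹*g)⁻¹)⁻¹ := by
       have he : (q : G) = _ := he
       rw [he]; group
      rw [this]; exact hN.conj_mem _ q.2 _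
     have h3 : conjNormal ((n : G)⁻¹*g) ⟨y,hy⟩ = q := by
      ext; rw [MulAut.conjNormal_apply]; exact he.symm
     exact ⟨⟨y,hy⟩,(h1 _).2 (h3 ▸ hq),rfl⟩
   have h3 : g = n*((n : G)⁻¹*g) := by group
   rw [h3]
   exact Subgroup.mul_mem _ ((le_sup_right : N ≤ _) n.2) ((le_sup_left : _ ≤ _ ⊔ N) h2)
  ·intro β hβ
   rw [orb_eq_orbit] at hβ
   obtain ⟨n,hn,he⟩ := ht (e α0) (e ⟨β,hβ⟩)
   rw [hφ] at he
   refine ⟨n,?_,congrArg Subtype.val (e.injective he)⟩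
   rw [mem_normalizer_iff] at hn ⊢
   intro y
   constructor
   ·rintro ⟨q,hq,rfl⟩
    exact ⟨_,(hn q).1 hq,by simp⟩
   ·rintro ⟨q,hq,hqe⟩
    have h3 : n⁻¹*q*n ∈ Q := by
     rw [SetLike.mem_coe,] at hq
     have := (hn (n⁻¹*q*n)).2 (by simpa [mul_assoc] using hq)
     exact this
    refine ⟨_,h3,?_⟩
    have hqe : (q : G) = n*y*(n : G)⁻¹ := hqe
    simp [hqe,mul_assoc]
section core
variable {N : Type*} [Group N] [Finite N] {A : Subgroup (MulAut N)} {d : ℕ} {φ : N →* Perm (Fin d)}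
lemma Core.tt2 (h : Core A φ) : IsMultiplyPretransitive φ.range (Fin d) 2 := by
 rw [is_two_pretransitive_iff]
 intro i j k l hij hkl
 obtain ⟨n,h1,h2⟩ := h.tt i j k l hij hkl
 exact ⟨⟨φ n,n,rfl⟩,h1,h2⟩
lemma Core.pre (h : Core A φ) : IsPreprimitive φ.range (Fin d) := isPreprimitive_of_is_two_pretransitive h.tt2
lemma Core.card_mul (h : Core A φ) (hd : 2 ≤ d) : d*(d - 1) ∣ Nat.card φ.range := by
 have h2 := h.tt2
 have hne : (⟨0,by omega⟩ : Fin d) ≠ ⟨1,by omega⟩ := by simp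
 have hc := IsMultiplyPretransitive.index_of_fixingSubgroup_mul h2 (s := {(⟨0,by omega⟩ : Fin d),⟨1,by omega⟩}) (Set.ncard_pair hne)
 have h10 := index_dvd_card (fixingSubgroup φ.range ({(⟨0,by omega⟩ : Fin d),⟨1,by omega⟩} : Set (Fin d)))
 obtain ⟨k,rfl⟩ := Nat.exists_eq_add_of_le hd
 rw [card_eq_fintype_card,Fintype.card_fin] at hc
 have h11 : (2+k).factorial = ((2+k)*(2+k - 1))*(2+k - 2).factorial := by
  rw [show 2+k = k+1+1 by ring,Nat.factorial_succ,Nat.factorial_succ]; simp [mul_assoc]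
 rw [h11] at hc
 rwa [Nat.eq_of_mul_eq_mul_right (Nat.factorial_pos _) hc] at h10
lemma Core.perfectX (h : Core A φ) (hd : 3 ≤ d) : commutator φ.range = ⊤ := by
 have h1 := h.perfect hd
 have h2 := Subgroup.map_commutator (⊤ : Subgroup N) ⊤ φ.rangeRestrict
 rw [←commutator_def,h1,Subgroup.map_top_of_surjective _ φ.rangeRestrict_surjective,←commutator_def] at h2
 exact h2.symm
lemma Core.transfer (h : Core A φ) (hd : 3 ≤ d) {p : ℕ} [Fact p.Prime] {E : Subgroup (Perm (Fin d))} (hE : IsSyl p E φ.range) (hb : E ≠ ⊥) :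
  ∃ n ∈ φ.range,n ∈ normalizer (E : Set (Perm (Fin d))) ∧ ∃ t ∈ E,n*t ≠ t*n := by
 have hs : IsSyl p (E.subgroupOf φ.range) ⊤ := by
  refine ⟨le_top,hE.2.1.comap_of_injective _ (Subgroup.subtype_injective _),?_⟩
  rw [relIndex_top_right]; exact hE.2.2
 obtain ⟨n,hn,t,ht,hne⟩ := perfect_transfer (h.perfectX hd) hs (by
  intro h0
  rw [Subgroup.subgroupOf_eq_bot,disjoint_iff,inf_eq_left.2 hE.1] at h0
  exact hb h0)
 refine ⟨n,n.2,?_,t,ht,fun he => hne (Subtype.ext he)⟩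
 rw [mem_normalizer_iff] at hn ⊢
 intro y
 constructor
 ·intro hy; exact (hn ⟨y,hE.1 hy⟩).1 hy
 ·intro hy
  have hy2 : y ∈ φ.range := by
   have := mul_mem (mul_mem (inv_mem n.2) (hE.1 hy)) n.2
   simpa [mul_assoc] using this
  exact (hn ⟨y,hy2⟩).2 hy
lemma Core.syl_lift (h : Core A φ) {p : ℕ} [Fact p.Prime] {E : Subgroup (Perm (Fin d))} (hE : IsSyl p E φ.range) :
  ∃ T : Subgroup N,IsSyl p T ⊤ ∧ T.map φ = E := by
 obtain ⟨T0,hT0⟩ := exists_syl p (⊤ : Subgroup N)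
 have h1 := hT0.map φ
 rw [←range_eq_map] at h1
 obtain ⟨_,⟨n,rfl⟩,he⟩ := h1.conj hE
 exact ⟨_,hT0.cj n,by rw [cj_map,he]⟩
lemma orbit_card {W X : Subgroup (Perm (Fin d))} (hW : W ≤ X) (i : Fin d) :
  ∃ o s : ℕ,o*s = Nat.card W ∧ s ∣ Nat.card (stabilizer X i) ∧ o ≤ d ∧ (o = d → ∀ j,∃ c ∈ W,c i = j) ∧
   o = (orbit W i).ncard := by
 refine ⟨(orbit W i).ncard,Nat.card (stabilizer W i),?_,?_,?_,?_,rfl⟩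
 ·rw [←Nat.card_coe_set_eq,←Nat.card_prod]
  exact card_congr (orbitProdStabilizerEquivGroup W i)
 ·let f : stabilizer W i →* stabilizer X i :=
   { toFun := fun w => ⟨⟨w.1.1,hW w.1.2⟩,w.2⟩,map_one' := rfl,map_mul' := fun _ _ => rfl }
  exact Subgroup.card_dvd_of_injective f (fun a b hab => Subtype.ext (Subtype.ext (congrArg (fun z => z.1.1) hab)))
 ·have := Set.ncard_le_card (orbit W i)
  simpa using this
 ·intro ho j
  have h1 : orbit W i = Set.univ := by
   apply Set.eq_of_subset_of_ncard_le (Set.subset_univ _) _ (toFinite _)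
   rw [ho,Set.ncard_univ]; simp
  have h2 : j ∈ orbit W i := h1 ▸ Set.mem_univ j
  obtain ⟨w,hw⟩ := h2
  exact ⟨w,w.2,hw⟩
lemma Core.stab_card (h : Core A φ) (i : Fin d) : d*Nat.card (stabilizer φ.range i) = Nat.card φ.range := by
 have := h.pre
 have := index_stabilizer_of_transitive φ.range i
 rw [card_eq_fintype_card,Fintype.card_fin] at this
 have h2 := card_mul_index (stabilizer φ.range i)
 rwa [this,mul_comm] at h2
lemma Core.le_alt (h : Core A φ) (hd : 3 ≤ d) : φ.range ≤ alternatingGroup (Fin d) := by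
 rintro _ ⟨n,rfl⟩
 exact h.even hd n
lemma Core.card_dvd (h : Core A φ) (hd : 3 ≤ d) : 2*Nat.card φ.range ∣ d.factorial := by
 have h1 := card_dvd_of_le (h.le_alt hd)
 have : Nontrivial (Fin d) := Fin.nontrivial_iff_two_le.2 (by omega)
 have h2 := two_mul_nat_card_alternatingGroup (α := Fin d)
 rw [card_perm,card_eq_fintype_card (α := Fin d),Fintype.card_fin] at h2
 rw [←h2]; exact Nat.mul_dvd_mul_left 2 h1
/-- order of a Sylow subgroup -/
lemma IsSyl.card {M : Type*} [Group M] [Finite M] {p : ℕ} [Fact p.Prime] {T W : Subgroup M} (h : IsSyl p T W) {a m : ℕ} (hW : Nat.card W = p^a*m) (hm : ¬ p ∣ m) : Nat.card T = p^a := by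
 have hp := Fact.out (p := p.Prime)
 obtain ⟨k,hk⟩ := iff_card.1 h.2.1
 have h1 := relIndex_mul_relIndex ⊥ T W bot_le h.1
 rw [relIndex_bot_left,relIndex_bot_left,mul_comm] at h1
 rw [hk,hW] at h1
 rw [hk]
 have c1 : Coprime (p^k) m := Coprime.pow_left _ ((Nat.Prime.coprime_iff_not_dvd hp).2 hm)
 have c2 : Coprime (p^a) (T.relIndex W) := Coprime.pow_left _ ((Nat.Prime.coprime_iff_not_dvd hp).2 h.2.2)
 apply Nat.dvd_antisymm
 ·exact c1.dvd_of_dvd_mul_right (h1 ▸ dvd_mul_left _ _)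
 ·exact c2.dvd_of_dvd_mul_left (h1.symm ▸ dvd_mul_right _ _)
end core
section core
lemma mem_norm_closure {P : Type*} [Group P] [Finite P] {s : Set P} {n : P} (h : ∀ e ∈ s,n*e*n⁻¹ ∈ Subgroup.closure s) :
  n ∈ normalizer ((Subgroup.closure s : Subgroup P) : Set P) := by
 rw [cj_normalizer]
 apply eq_of_le_of_card_ge
 ·unfold cj
  rw [Subgroup.map_le_iff_le_comap,Subgroup.closure_le]
  intro e he
  exact h e he
 ·unfold cj
  rw [card_congr (Subgroup.equivMapOfInjective _ (MulAut.conj n).toMonoidHom (MulAut.conj n).injective).toEquiv]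
/-- elementary abelian subgroups of order nine -/
lemma nine_syl {P : Type*} [Group P] [Finite P] {X : Subgroup P} {e1 e2 : P} (h1 : e1^3 = 1) (h2 : e2^3 = 1) (hc : e1*e2 = e2*e1)
  (hne : e1 ≠ 1) (hm : e2 ∉ zpowers e1) (m1 : e1 ∈ X) (m2 : e2 ∈ X) :
  9 ∣ Nat.card X ∧ ∀ m,Nat.card X = 9*m → ¬ 3 ∣ m → IsSyl 3 (Subgroup.closure {e1,e2}) X ∧ Subgroup.closure {e1,e2} ≠ ⊥ := by
 have k1 : e1 ∈ Subgroup.closure {e1,e2} := Subgroup.subset_closure (by simp)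
 have k2 : e2 ∈ Subgroup.closure {e1,e2} := Subgroup.subset_closure (by simp)
 have hle : Subgroup.closure {e1,e2} ≤ X := by
  rw [Subgroup.closure_le]
  rintro _ (rfl | rfl)
  ·exact m1
  ·exact m2
 have hcomm : ∀ a ∈ Subgroup.closure {e1,e2},∀ b ∈ Subgroup.closure {e1,e2},a*b = b*a := by
  have : ∀ a ∈ ({e1,e2} : Set P),∀ b ∈ ({e1,e2} : Set P),a*b = b*a := by
   rintro _ (rfl | rfl) _ (rfl | rfl)
   ·rfl
   ·exact hc
   ·exact hc.symm
   ·rfl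
  intro a ha b hb
  have := Subgroup.isMulCommutative_closure this
  exact congrArg Subtype.val (this.is_comm.comm ⟨a,ha⟩ ⟨b,hb⟩)
 have hp : IsPGroup 3 (Subgroup.closure {e1,e2}) := by
  rintro ⟨a,ha⟩
  refine ⟨1,Subtype.ext ?_⟩
  change a^3^1 = 1
  rw [pow_one]
  refine Subgroup.closure_induction (p := fun a _ => a^3 = 1) ?_ ?_ ?_ ?_ ha
  ·rintro _ (rfl | rfl) <;> assumption
  ·exact one_pow 3
  ·intro a b ha hb e f
   rw [Commute.mul_pow (hcomm a ha b hb),e,f,one_mul]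
  ·intro a _ e
   rw [inv_pow,e,inv_one]
 have : Fact (Nat.Prime 3) := ⟨by norm_num⟩
 obtain ⟨k,hk⟩ := iff_card.1 hp
 have hr := relIndex_mul_relIndex ⊥ _ X bot_le hle
 rw [relIndex_bot_left,relIndex_bot_left,hk] at hr
 have ho : orderOf e1 = 3 := orderOf_eq_prime h1 hne
 have hz : zpowers e1 ≤ Subgroup.closure {e1,e2} := by rwa [zpowers_le]
 have hk2 : 2 ≤ k := by
  by_contra hlt
  have h4 : zpowers e1 = Subgroup.closure {e1,e2} := by
   apply eq_of_le_of_card_ge hz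
   rw [hk,card_zpowers,ho]
   calc 3^k ≤ 3^1 := Nat.pow_le_pow_right (by norm_num) (by omega)
    _ = 3 := by norm_num
  exact hm (h4 ▸ k2)
 obtain ⟨j,rfl⟩ := Nat.exists_eq_add_of_le hk2
 refine ⟨⟨3^j*(Subgroup.closure {e1,e2}).relIndex X,by rw [←hr,pow_add]; ring⟩,fun m hX h3 => ⟨⟨hle,hp,?_⟩,?_⟩⟩
 ·rintro ⟨r,hr2⟩
  apply h3
  refine ⟨3^j*r,?_⟩
  rw [hr2,pow_add,hX] at hr
  have : 9*(3*(3^j*r)) = 9*m := by rw [←hr]; ring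
  omega
 ·intro h0
  rw [h0,mem_bot] at k1
  exact hne k1
lemma syl_nine {P : Type*} [Group P] [Finite P] {X : Subgroup P} {e1 e2 : P} (h1 : e1^3 = 1) (h2 : e2^3 = 1) (hc : e1*e2 = e2*e1)
  (hne : e1 ≠ 1) (hm : e2 ∉ zpowers e1) (m1 : e1 ∈ X) (m2 : e2 ∈ X) {m : ℕ} (hX : Nat.card X = 9*m) (h3 : ¬ 3 ∣ m) :
  IsSyl 3 (Subgroup.closure {e1,e2}) X ∧ Subgroup.closure {e1,e2} ≠ ⊥ := (nine_syl h1 h2 hc hne hm m1 m2).2 m hX h3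
variable {N : Type*} [Group N] [Finite N] {A : Subgroup (MulAut N)}
lemma six_num1 : ∀ o < 7,∀ s < 11,5 ≤ o ∧ 20 ∣ o*s ∧ o*s ∣ 60 ∧ s ∣ 10 → o*s = 60 := by decide
lemma six_num2 : ∀ o < 7,∀ s < 11,o*s = 60 → o = 6 := by decide
lemma six_num3 : ∀ o < 7,∀ s < 11,o*s = 12 → s ∣ 10 → o = 6 := by decide
lemma six_num4 : ∀ w < 61,4 ∣ w → w ∣ 60 → w ≠ 4 → ¬ 5 ∣ w → w = 12 := by decide
lemma Core.six_card {φ : N →* Perm (Fin 6)} (h : Core A φ) : Nat.card φ.range = 30 ∨ Nat.card φ.range = 60 ∨ Nat.card φ.range = 360 := by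
 have h1 := h.card_mul (by norm_num)
 have h2 := h.card_dvd (by norm_num)
 have hle := h.le_alt (by norm_num)
 have hc : Nat.card (alternatingGroup (Fin 6)) = 360 := by
  have h2 := two_mul_nat_card_alternatingGroup (α := Fin 6)
  rw [card_perm,card_eq_fintype_card (α := Fin 6),Fintype.card_fin] at h2
  have h3 : (6 : ℕ).factorial = 720 := by decide
  omega
 have hi := relIndex_mul_relIndex ⊥ _ _ bot_le hle
 rw [relIndex_bot_left,relIndex_bot_left,hc] at hi
 by_cases ht : φ.range.relIndex (alternatingGroup (Fin 6)) = 1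
 ·rw [ht] at hi; omega
 have : IsSimpleGroup (alternatingGroup (Fin 6)) := alternatingGroup.isSimpleGroup (by simp)
 let U := φ.range.subgroupOf (alternatingGroup (Fin 6))
 have hcore : U.normalCore = ⊥ := by
  rcases (normalCore_normal U).eq_bot_or_eq_top with h0 | h0
  ·exact h0
  ·exfalso
   have : U = ⊤ := top_le_iff.1 (h0 ▸ normalCore_le U)
   apply ht
   change U.index = 1
   rw [this,Subgroup.index_top]
 have h5 := core_card hcore
 rw [hc] at h5
 change _*U.index = 360 at hi
 have h6 : ¬ U.index ≤ 4 := fun hl => by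
  have := h5.trans (Nat.factorial_dvd_factorial hl)
  revert this; decide
 obtain ⟨k,hk⟩ := h1
 have hk2 : Nat.card φ.range = 30*k := by rw [hk]
 rw [hk2] at hi ⊢
 have : k*U.index = 12 := by nlinarith
 have hk3 : k ≤ 2 := by
  by_contra hc
  have : 5 ≤ U.index := by omega
  nlinarith
 interval_cases k <;> omega
set_option maxHeartbeats 1000000 in
lemma Core.not_six {φ : N →* Perm (Fin 6)} (h : Core A φ) : False := by
 have : Fact (Nat.Prime 2) := ⟨by norm_num⟩
 have : Fact (Nat.Prime 5) := ⟨by norm_num⟩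
 obtain ⟨E,hE⟩ := exists_syl 2 φ.range
 have hEb : E ≠ ⊥ := hE.ne_bot ((by norm_num : 2 ∣ 6*(6 - 1)).trans (h.card_mul (by norm_num)))
 obtain ⟨n,hn,hnn,t,ht,hne⟩ := h.transfer (by norm_num) hE hEb
 rcases h.six_card with hc | hc | hc
 ·have h2 : Nat.card E = 2 := by
   have := hE.card (a := 1) (m := 15) (by rw [hc]; norm_num) (by norm_num)
   simpa using this
  have h3 : n*t*n⁻¹ ∈ E := (mem_normalizer_iff.1 hnn t).1 ht
  rw [Nat.card_eq_two_iff' (1 : E)] at h2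
  obtain ⟨w,_,hw⟩ := h2
  have t1 : t ≠ 1 := by rintro rfl; simp at hne
  have e1 := hw ⟨t,ht⟩ (fun h0 => t1 (congrArg Subtype.val h0))
  have e2 := hw ⟨_,h3⟩ (fun h0 => t1 (by
   have : n*t*n⁻¹ = 1 := congrArg Subtype.val h0
   simpa [mul_inv_eq_one] using this))
  have e3 : n*t*n⁻¹ = t := congrArg Subtype.val (e2.trans e1.symm)
  exact hne (by rwa [mul_inv_eq_iff_eq_mul] at e3)
 ·have h2 : Nat.card E = 2^2 := hE.card (a := 2) (m := 15) (by rw [hc]; norm_num) (by norm_num)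
  let W := φ.range ⊓ normalizer (E : Set (Perm (Fin 6)))
  have hEW : E ≤ W := le_inf hE.1 le_normalizer
  have hWd : Nat.card W ∣ 60 := hc ▸ card_dvd_of_le inf_le_left
  have h4W : 4 ∣ Nat.card W := by
   have := card_dvd_of_le hEW
   rwa [h2] at this
  have hW4 : Nat.card W ≠ 4 := by
   intro h4
   have : E = W := eq_of_le_of_card_ge hEW (by rw [h4,h2]; norm_num)
   have hnE : n ∈ E := this ▸ ⟨hn,hnn⟩
   have := (IsPGroup.isMulCommutative_of_card_eq_prime_sq h2).is_comm.comm ⟨n,hnE⟩ ⟨t,ht⟩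
   exact hne (congrArg Subtype.val this)
  refine h.sylow (p := 2) (by norm_num) (by norm_num) hE hEb ?_
  intro i j
  have hs : Nat.card (stabilizer φ.range i) = 10 := by have := h.stab_card i; omega
  have horb : ∀ i,∃ o s : ℕ,o*s = Nat.card W ∧ s ∣ 10 ∧ o ≤ 6 ∧ (o = 6 → ∀ j,∃ c ∈ W,c i = j) ∧ o = (orbit W i).ncard := by
   intro i
   have hs : Nat.card (stabilizer φ.range i) = 10 := by have := h.stab_card i; omega
   obtain ⟨o,s,a1,a2,a3,a4,a5⟩ := orbit_card (W := W) (X := φ.range) inf_le_left i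
   exact ⟨o,s,a1,hs ▸ a2,a3,a4,a5⟩
  have key : ∃ c ∈ W,c i = j := by
   obtain ⟨o,s,a1,a2,a3,a4, -⟩ := horb i
   apply a4
   have hsle := le_of_dvd (by norm_num) a2
   have hWle := le_of_dvd (by norm_num) hWd
   by_cases h5 : 5 ∣ Nat.card W
   ·obtain ⟨⟨c,hcW⟩,hco⟩ := exists_prime_orderOf_dvd_card' 5 h5
    have hc1 : c ≠ 1 := by
     rintro rfl
     have : (⟨1,hcW⟩ : W) = 1 := rfl
     rw [this,orderOf_one] at hco; omega
    have hcyc : c.IsCycle := by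
     have h7 : orderOf c = 5 := by rw [←hco]; exact (orderOf_mk c hcW).symm
     apply isCycle_of_prime_order'
     ·rw [h7]; norm_num
     ·rw [h7]; simp
    have hco2 : c.support.card = 5 := by
     rw [←hcyc.orderOf,←hco]; exact (orderOf_mk c hcW).symm
    obtain ⟨i',hi'⟩ := c.support.card_pos.1 (by omega)
    obtain ⟨o',s',b1,b2,b3,b4,b5⟩ := horb i'
    have hsub : (c.support : Set (Fin 6)) ⊆ orbit W i' := by
     intro k hk
     obtain ⟨m,hm⟩ := hcyc.exists_zpow_eq (mem_support.1 hi') (mem_support.1 hk)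
     exact ⟨⟨c^m,W.zpow_mem hcW m⟩,hm⟩
    have h8 := ncard_le_ncard hsub (toFinite _)
    rw [ncard_coe_finset,hco2,←b5] at h8
    have hsle' := le_of_dvd (by norm_num) b2
    have : Nat.card W = 60 := by
     have h20 : 20 ∣ Nat.card W := Coprime.mul_dvd_of_dvd_of_dvd (by norm_num : Coprime 4 5) h4W h5
     rw [←b1] at h20 hWd ⊢
     exact six_num1 o' (by omega) s' (by omega) ⟨h8,h20,hWd,b2⟩
    rw [this] at a1
    exact six_num2 o (by omega) s (by omega) a1
   ·have h12 : Nat.card W = 12 := six_num4 _ (by omega) h4W hWd hW4 h5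
    rw [h12] at a1
    exact six_num3 o (by omega) s (by omega) a1 a2
  obtain ⟨c,hcW,hij⟩ := key
  exact ⟨c,hcW.1,hcW.2,hij⟩
 ·have hX : φ.range = alternatingGroup (Fin 6) := by
   apply eq_of_le_of_card_ge (h.le_alt (by norm_num))
   have h2 := two_mul_nat_card_alternatingGroup (α := Fin 6)
   rw [card_perm,card_eq_fintype_card (α := Fin 6),Fintype.card_fin] at h2
   have h3 : (6 : ℕ).factorial = 720 := by decide
   omega
  let e1 : Perm (Fin 6) := swap 0 1*swap 1 2
  let e2 : Perm (Fin 6) := swap 3 4*swap 4 5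
  let f : Perm (Fin 6) := swap 0 3*swap 1 4*swap 2 5*swap 0 1
  have m1 : e1 ∈ φ.range := by rw [hX,mem_alternatingGroup]; decide
  have m2 : e2 ∈ φ.range := by rw [hX,mem_alternatingGroup]; decide
  have m3 : f ∈ φ.range := by rw [hX,mem_alternatingGroup]; decide
  obtain ⟨hs,hb⟩ := syl_nine (e1 := e1) (e2 := e2) (X := φ.range) (m := 40) (by decide) (by decide) (by decide) (by decide)
   (by
    intro hz
    have : ∀ g ∈ zpowers e1,g 3 = 3 := by
     rintro _ ⟨k,rfl⟩
     exact Perm.zpow_apply_eq_self_of_apply_eq_self (by decide) k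
    exact absurd (this e2 hz) (by decide)) m1 m2 (by rw [hc]) (by norm_num)
  refine h.sylow (p := 3) (by norm_num) (by norm_num) hs hb ?_
  intro i j
  have k1 : e1 ∈ Subgroup.closure {e1,e2} := Subgroup.subset_closure (by simp)
  have k2 : e2 ∈ Subgroup.closure {e1,e2} := Subgroup.subset_closure (by simp)
  have kf : f ∈ normalizer ((Subgroup.closure {e1,e2} : Subgroup _) : Set (Perm (Fin 6))) := by
   apply mem_norm_closure
   rintro _ (rfl | rfl)
   ·have : f*e1*f⁻¹ = e2^2 := by decide
    rw [this]; exact pow_mem k2 2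
   ·have : f*e2*f⁻¹ = e1 := by decide
    rw [this]; exact k1
  have dd : ∀ i j : Fin 6,∃ a b : Fin 3,∃ c : Fin 2,(e1^(a : ℕ)*e2^(b : ℕ)*f^(c : ℕ)) i = j := by decide +kernel
  obtain ⟨a,b,c,hh⟩ := dd i j
  refine ⟨_,mul_mem (mul_mem (pow_mem m1 _) (pow_mem m2 _)) (pow_mem m3 _),?_,hh⟩
  exact mul_mem (mul_mem (pow_mem (le_normalizer k1) _) (pow_mem (le_normalizer k2) _)) (pow_mem kf _)
end core
section fns
variable {d : ℕ}
/-- `X` contains the permutation given by the function `f` -/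
def In (X : Subgroup (Perm (Fin d))) (f : ℕ → ℕ) : Prop := ∃ c ∈ X,∀ i : Fin d,((c i : Fin d) : ℕ) = f i
variable {X : Subgroup (Perm (Fin d))} {f g : ℕ → ℕ}
lemma In.comp (hf : In X f) (hg : In X g) : In X (fun i => f (g i)) := by
 obtain ⟨a,ha,ha2⟩ := hf
 obtain ⟨b,hb,hb2⟩ := hg
 exact ⟨a*b,mul_mem ha hb,fun i => by rw [Perm.mul_apply,ha2,hb2]⟩
lemma In.congr (hf : In X f) (h : ∀ i < d,f i = g i) : In X g := by
 obtain ⟨a,ha,ha2⟩ := hf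
 exact ⟨a,ha,fun i => by rw [ha2,h i i.2]⟩
lemma In.iter (hf : In X f) (n : ℕ) : In X (f^[n]) := by
 obtain ⟨a,ha,ha2⟩ := hf
 refine ⟨a^n,pow_mem ha n,?_⟩
 induction n with
 | zero => intro i; rfl
 | succ n ih => intro i; rw [pow_succ,Perm.mul_apply,ih,ha2,Function.iterate_succ_apply]
/-- Boolean check of a property at all points -/
def chk (d : ℕ) (P : ℕ → Bool) : Bool := (List.range d).all P
lemma chk_spec {P : ℕ → Bool} (h : chk d P = true) : ∀ i < d,P i = true := by
 intro i hi
 unfold chk at h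
 rw [all_eq_true] at h
 exact h i (List.mem_range.2 hi)
lemma chk_eq {a b : ℕ → ℕ} (h : chk d (fun i => beq (a i) (b i)) = true) : ∀ i < d,a i = b i :=
 fun i hi => eq_of_beq_eq_true (chk_spec h i hi)
/-- an involution with an odd number of two-cycles is odd -/
lemma odd_inv {σ : Perm (Fin d)} (h2 : σ^2 = 1) {m : ℕ} (hs : σ.support.card = 2*m) (hm : Odd m) : Perm.sign σ = -1 := by
 rw [Perm.sign_of_pow_two_eq_one h2]
 have h1 := Finset.card_le_univ σ.support
 have : Fintype.card (Function.fixedPoints σ) = d - 2*m := by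
  have := σ.card_fixedPoints
  rw [Fintype.card_fin,σ.sum_cycleType,hs] at this
  exact this
 rw [hs,Fintype.card_fin] at h1
 rw [Fintype.card_fin,this,show (d - (d - 2*m)) / 2 = m by omega,hm.neg_one_pow]
end fns
section core
variable {N : Type*} [Group N] [Finite N] {A : Subgroup (MulAut N)} {p : ℕ} {φ : N →* Perm (Fin (p+1))}
def xf (p i : ℕ) : ℕ := bif blt i p then (i+1) % p else i
def mf (p a i : ℕ) : ℕ := bif blt i p then (a*i) % p else i
lemma xf_lt {p i : ℕ} (h : i < p) : xf p i = (i+1) % p := by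
 unfold xf; rw [show blt i p = true from blt_eq ▸ h]; rfl
lemma xf_last (p : ℕ) : xf p p = p := by
 unfold xf
 have : blt p p = false := by
  rw [eq_false_iff]; intro h; rw [blt_eq] at h; exact lt_irrefl _ h
 rw [this]; rfl
lemma mf_lt {p a i : ℕ} (h : i < p) : mf p a i = (a*i) % p := by
 unfold mf; rw [show blt i p = true from blt_eq ▸ h]; rfl
lemma mf_last (p a : ℕ) : mf p a p = p := by
 unfold mf
 have : blt p p = false := by
  rw [eq_false_iff]; intro h; rw [blt_eq] at h; exact lt_irrefl _ h
 rw [this]; rfl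
lemma Core.norm_x (h : Core A φ) (hp : p.Prime) : ∃ σ : Perm (Fin (p+1)),In ((MulAut.conj σ).toMonoidHom.comp φ).range (xf p) := by
 have : Fact p.Prime := ⟨hp⟩
 have h1 : p ∣ Nat.card φ.range := (dvd_mul_left _ _).trans (h.card_mul (by have := hp.two_le; omega))
 obtain ⟨⟨c,hc⟩,ho⟩ := exists_prime_orderOf_dvd_card' p h1
 have hco : orderOf c = p := (orderOf_mk c hc).symm.trans ho
 have hcp : c^p = 1 := orderOf_dvd_iff_pow_eq_one.1 (dvd_of_eq hco)
 have hc1 : c ≠ 1 := by rintro rfl; rw [orderOf_one] at hco; exact hp.one_lt.ne hco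
 obtain ⟨a,ha⟩ : ∃ a,c a ≠ a := by
  by_contra hcon; push Not at hcon
  exact hc1 (Equiv.ext hcon)
 have hinj : ∀ i j : ℕ,i < j → j < p → (c^i) a ≠ (c^j) a := by
  intro i j hij hj he
  apply ha
  have h3 : (c^(j - i)) a = a := by
   have : (c^i) ((c^(j - i)) a) = (c^i) a := by
    rw [←Perm.mul_apply,←pow_add,he]; congr 2; omega
   exact (c^i).injective this
  obtain ⟨m,hm⟩ := exists_pow_eq_self_of_coprime (x := c) (n := j - i) (by
   rw [hco]; exact ((Nat.Prime.coprime_iff_not_dvd hp).2 (fun hd => by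
    have := le_of_dvd (by omega) hd; omega)).symm)
  rw [←hm]
  exact Perm.pow_apply_eq_self_of_apply_eq_self h3 m
 obtain ⟨f,hf⟩ : ∃ f : Fin (p+1),f ∉ (Finset.range p).image (fun i => (c^i) a) := by
  by_contra hcon; push Not at hcon
  have := card_le_card (fun x _ => hcon x : univ ⊆ (Finset.range p).image (fun i => (c^i) a))
  have h3 := Finset.card_image_le (s := Finset.range p) (f := fun i => (c^i) a)
  simp at this h3
  omega
 have hf2 : ∀ i : ℕ,(c^i) a ≠ f := by
  intro i he
  apply hf
  rw [mem_image]
  refine ⟨i % p,mem_range.2 (Nat.mod_lt _ hp.pos),?_⟩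
  rw [←he,←pow_mod_orderOf c i,hco]
 let F : Fin (p+1) → Fin (p+1) := fun i => if (i : ℕ) < p then (c^(i : ℕ)) a else f
 have hF : Injective F := by
  intro i j hij
  simp only [F] at hij
  split_ifs at hij with h4 h5 h5
  ·rcases lt_trichotomy (i : ℕ) j with h6 | h6 | h6
   ·exact absurd hij (hinj _ _ h6 h5)
   ·exact Fin.ext h6
   ·exact absurd hij.symm (hinj _ _ h6 h4)
  ·exact absurd hij (hf2 _)
  ·exact absurd hij.symm (hf2 _)
  ·apply Fin.ext; omega
 let σ : Perm (Fin (p+1)) := Equiv.ofBijective F (Finite.injective_iff_bijective.1 hF)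
 have hσ : ∀ i : Fin (p+1),(i : ℕ) < p → σ i = (c^(i : ℕ)) a := fun i hi => if_pos hi
 have hσ2 : ∀ i : Fin (p+1),¬ (i : ℕ) < p → σ i = f := fun i hi => if_neg hi
 have hcf : c f = f := by
  obtain ⟨i,hi⟩ := σ.surjective (c f)
  by_cases hip : (i : ℕ) < p
  ·exfalso
   rw [hσ i hip] at hi
   apply hf2 (p - 1+i)
   rw [pow_add,Perm.mul_apply,hi,←Perm.mul_apply,←pow_succ,Nat.sub_add_cancel hp.one_le,hcp]; rfl
  ·rw [←hi,hσ2 i hip]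
 obtain ⟨n,rfl⟩ := hc
 refine ⟨σ⁻¹,σ⁻¹*φ n*σ,⟨n,by simp⟩,fun i => ?_⟩
 suffices hh : ∃ j : Fin (p+1),(j : ℕ) = xf p i ∧ φ n (σ i) = σ j by
  obtain ⟨j,hj,he⟩ := hh
  rw [Perm.mul_apply,Perm.mul_apply,he]; simp [hj]
 by_cases hip : (i : ℕ) < p
 ·have hlt : (i+1 : ℕ) % p < p := Nat.mod_lt _ hp.pos
  refine ⟨⟨(i+1 : ℕ) % p,by omega⟩,(xf_lt hip).symm,?_⟩
  rw [hσ i hip,hσ _ hlt]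
  change _ = (φ n^((i+1 : ℕ) % p)) a
  have : φ n^((i+1 : ℕ) % p) = φ n^(i+1 : ℕ) := by
   conv_rhs => rw [←pow_mod_orderOf,hco]
  rw [this,pow_succ',Perm.mul_apply]
 ·have : (i : ℕ) = p := by omega
  refine ⟨i,by rw [this,xf_last],?_⟩
  rw [hσ2 i hip,hcf]
end core
section xx
variable {p : ℕ} {x : Perm (Fin (p+1))}
/-- `x` is the standard `p`-cycle -/
def IsX (p : ℕ) (x : Perm (Fin (p+1))) : Prop := ∀ i : Fin (p+1),((x i : Fin (p+1)) : ℕ) = xf p i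
lemma IsX.last (h : IsX p x) : x (Fin.last p) = Fin.last p := Fin.ext (by rw [h,val_last,xf_last])
lemma IsX.pow (h : IsX p x) (hp : p.Prime) (k : ℕ) {i : Fin (p+1)} (hi : (i : ℕ) < p) : (((x^k) i : Fin (p+1)) : ℕ) = (i+k) % p := by
 induction k with
 | zero => simp [mod_eq_of_lt hi]
 | succ k ih =>
  rw [pow_succ',Perm.mul_apply,h,ih,xf_lt (Nat.mod_lt _ hp.pos),Nat.mod_add_mod,add_assoc]
lemma IsX.pow_last (h : IsX p x) (k : ℕ) : (x^k) (Fin.last p) = Fin.last p :=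
 Perm.pow_apply_eq_self_of_apply_eq_self h.last k
lemma lt_of_ne_last {i : Fin (p+1)} (h : i ≠ Fin.last p) : (i : ℕ) < p := by
 have := Fin.val_lt_last h
 simpa using this
lemma IsX.powp (h : IsX p x) (hp : p.Prime) : x^p = 1 := by
 apply Equiv.ext
 intro i
 by_cases hi : i = Fin.last p
 ·rw [hi,h.pow_last]; rfl
 ·apply Fin.ext
  rw [h.pow hp _ (lt_of_ne_last hi),Nat.add_mod_right,mod_eq_of_lt (lt_of_ne_last hi)]; rfl
lemma IsX.order (h : IsX p x) (hp : p.Prime) : orderOf x = p := by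
 have : Fact p.Prime := ⟨hp⟩
 apply orderOf_eq_prime (h.powp hp)
 rintro rfl
 have := h 0
 rw [val_zero,xf_lt hp.pos,zero_add,mod_eq_of_lt hp.one_lt] at this
 simp at this
lemma IsX.tr (h : IsX p x) (hp : p.Prime) {i j : Fin (p+1)} (hi : i ≠ Fin.last p) (hj : j ≠ Fin.last p) : ∃ k : ℕ,(x^k) i = j := by
 have h1 := lt_of_ne_last hi
 have h2 := lt_of_ne_last hj
 refine ⟨j+(p - i),Fin.ext ?_⟩
 rw [h.pow hp _ h1]
 rw [show (i : ℕ)+(j+(p - i)) = j+p by omega,Nat.add_mod_right,mod_eq_of_lt h2]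
lemma IsX.fix (h : IsX p x) (hp : p.Prime) {i : Fin (p+1)} (hi : x i = i) : i = Fin.last p := by
 by_contra hl
 have h1 := lt_of_ne_last hl
 have h2 := h i
 rw [hi,xf_lt h1] at h2
 have := hp.two_le
 by_cases h3 : (i : ℕ)+1 = p
 ·rw [h3,Nat.mod_self] at h2; omega
 ·rw [mod_eq_of_lt (by omega)] at h2; omega
lemma IsX.fix_of (h : IsX p x) (hp : p.Prime) {c : Perm (Fin (p+1))} (hc : c*x*c⁻¹ ∈ zpowers x) : c (Fin.last p) = Fin.last p := by
 have h2 : c*x*c⁻¹ ≠ 1 := by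
  intro h0
  have h1 : x = 1 := by simpa using h0
  have := h.order hp
  rw [h1,orderOf_one] at this
  exact hp.one_lt.ne this
 obtain ⟨k,hk⟩ := hc
 simp only at hk
 have h3 : (c*x*c⁻¹) (c (Fin.last p)) = c (Fin.last p) := by simp [h.last]
 rw [←hk] at h3
 by_contra hl
 obtain ⟨e,he⟩ : ∃ e : ℤ,(x^k)^e = x := by
  have ho := h.order hp
  have h4 : orderOf (x^k) = p := by
   have : Fact p.Prime := ⟨hp⟩
   apply orderOf_eq_prime
   ·rw [←zpow_natCast,zpow_comm,zpow_natCast,h.powp hp,one_zpow]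
   ·rw [hk]; exact h2
  have h5 : zpowers (x^k) = zpowers x := by
   apply eq_of_le_of_card_ge
   ·rw [zpowers_le]; exact ⟨k,rfl⟩
   ·rw [card_zpowers,card_zpowers,h4,ho]
  have : x ∈ zpowers (x^k) := h5 ▸ mem_zpowers x
  exact this
 apply hl
 apply h.fix hp
 conv_lhs => rw [←he]
 exact Perm.zpow_apply_eq_self_of_apply_eq_self h3 e
lemma IsX.cent (h : IsX p x) (hp : p.Prime) {c : Perm (Fin (p+1))} (hc : c*x = x*c) : ∃ k : ℕ,c = x^k := by
 have hl : c (Fin.last p) = Fin.last p := by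
  apply h.fix hp
  rw [←Perm.mul_apply,←hc,Perm.mul_apply,h.last]
 have h0 : (0 : Fin (p+1)) ≠ Fin.last p := fun h0 => by
  have := congrArg Fin.val h0
  simp at this; exact hp.ne_zero this.symm
 obtain ⟨k,hk⟩ := h.tr hp h0 (fun h1 => h0 (c.injective (h1.trans hl.symm)) : c 0 ≠ Fin.last p)
 refine ⟨k,Equiv.ext fun i => ?_⟩
 by_cases hi : i = Fin.last p
 ·rw [hi,hl,h.pow_last]
 ·obtain ⟨j,rfl⟩ := h.tr hp h0 hi
  have hc2 : c*x^j = x^j*c := (Commute.pow_right hc j)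
  rw [←Perm.mul_apply,hc2,Perm.mul_apply,←hk,←Perm.mul_apply,←Perm.mul_apply,←pow_add,←pow_add,add_comm j k]
end xx
section core
variable {N : Type*} [Group N] [Finite N] {A : Subgroup (MulAut N)} {p : ℕ} {φ : N →* Perm (Fin (p+1))} {x : Perm (Fin (p+1))}
lemma p_sq (hp : p.Prime) (h2 : 2 < p) (W : Subgroup (Perm (Fin (p+1)))) : ¬ p^2 ∣ Nat.card W := by
 intro hd
 have h1 := hd.trans (card_subgroup_dvd_card W)
 rw [card_perm,card_eq_fintype_card,Fintype.card_fin] at h1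
 obtain ⟨m,rfl⟩ := Nat.exists_eq_succ_of_ne_zero hp.ne_zero
 rw [Nat.succ_eq_add_one] at *
 rw [Nat.factorial_succ,Nat.factorial_succ,pow_two] at h1
 have h3 : (m+1) ∣ (m+1+1)*m.factorial := by
  have : (m+1)*(m+1) ∣ (m+1)*((m+1+1)*m.factorial) := by
   rwa [mul_left_comm] at h1
  exact Nat.dvd_of_mul_dvd_mul_left (by omega) this
 rcases (hp.dvd_mul).1 h3 with h4 | h4
 ·have : m+1 ∣ 1 := (Nat.dvd_add_right (dvd_refl (m+1))).1 h4
  exact hp.one_lt.ne' (Nat.dvd_one.1 this)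
 ·have := (hp.dvd_factorial).1 h4; omega
lemma syl_p {W : Subgroup (Perm (Fin (p+1)))} (hp : p.Prime) (h2 : 2 < p) {u : Perm (Fin (p+1))} (hu : u ∈ W) (ho : orderOf u = p) :
  IsSyl p (zpowers u) W := by
 have : Fact p.Prime := ⟨hp⟩
 have hle : zpowers u ≤ W := by rwa [zpowers_le]
 refine ⟨hle,of_card (n := 1) (by rw [card_zpowers,ho,pow_one]),fun hd => ?_⟩
 have h1 := relIndex_mul_relIndex ⊥ _ W bot_le hle
 rw [relIndex_bot_left,relIndex_bot_left,card_zpowers,ho] at h1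
 apply p_sq hp h2 W
 rw [←h1,pow_two]
 exact Nat.mul_dvd_mul_left p hd
/-- nontrivial normal subgroups of the constituent -/
lemma Core.simple (h : Core A φ) (hp : p.Prime) (h2 : 2 < p) (hd2 : 2 ∣ p+1) (hd3 : 3 ∣ p+1) (hx : IsX p x) (hxX : x ∈ φ.range)
  {Y : Subgroup (Perm (Fin (p+1)))} (hY : Y ≤ φ.range) (hn : ∀ c ∈ φ.range,∀ y ∈ Y,c*y*c⁻¹ ∈ Y) (hb : Y ≠ ⊥) : Y = φ.range := by
 have : Fact p.Prime := ⟨hp⟩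
 have : Fact (Nat.Prime 2) := ⟨by norm_num⟩
 have : Fact (Nat.Prime 3) := ⟨by norm_num⟩
 -- transitivity
 have htr : ∀ i j,i ≠ j → ∃ y ∈ Y,y i = j := by
  intro i j hij
  obtain ⟨⟨y,hy⟩,hy0⟩ := Subgroup.ne_bot_iff_exists_ne_one.1 hb
  have hy1 : y ≠ 1 := fun h0 => hy0 (Subtype.ext h0)
  obtain ⟨k,hk⟩ : ∃ k,y k ≠ k := by
   by_contra hcon; push Not at hcon
   exact hy1 (Equiv.ext hcon)
  obtain ⟨n,h1,h3⟩ := h.tt k (y k) i j hk.symm hij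
  refine ⟨φ n*y*(φ n)⁻¹,hn _ ⟨n,rfl⟩ y hy,?_⟩
  rw [←h3,←h1]; simp
 have hdY : ∀ r,r ∣ p+1 → r ∣ Nat.card Y := by
  intro r hr
  refine hr.trans ?_
  have : IsPretransitive Y (Fin (p+1)) := ⟨fun i j => by
   by_cases hij : i = j
   ·exact ⟨1,by rw [one_smul,hij]⟩
   ·obtain ⟨y,hy,he⟩ := htr i j hij
    exact ⟨⟨y,hy⟩,he⟩⟩
  have h1 := index_stabilizer_of_transitive Y (Fin.last p)
  rw [card_eq_fintype_card,Fintype.card_fin] at h1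
  have h3 := index_dvd_card (stabilizer Y (Fin.last p))
  rwa [h1] at h3
 have h0 : (0 : Fin (p+1)) ≠ Fin.last p := fun h0 => by
  have := congrArg Fin.val h0
  simp at this; exact hp.ne_zero this.symm
 -- `p` divides the order
 have hpY : p ∣ Nat.card Y := by
  by_cases hreg : ∃ y ∈ Y,y ≠ 1 ∧ y (Fin.last p) = Fin.last p
  ·obtain ⟨y,hy,hy1,hyl⟩ := hreg
   obtain ⟨k,hk⟩ : ∃ k,y k ≠ k := by
    by_contra hcon; push Not at hcon
    exact hy1 (Equiv.ext hcon)
   have hkl : k ≠ Fin.last p := by rintro rfl; exact hk hyl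
   have hykl : y k ≠ Fin.last p := fun he => hkl (y.injective (he.trans hyl.symm))
   -- the element x * y * x⁻¹ ... the orbits
   by_contra hnd
   have hco : ∀ W : Subgroup (Perm (Fin (p+1))),W ≤ Y → ¬ p ∣ Nat.card W := fun W hW hd => hnd (hd.trans (card_dvd_of_le hW))
   -- orbits of the stabilizer have equal size
   let W : Subgroup (Perm (Fin (p+1))) := Y ⊓ stabilizer (Perm (Fin (p+1))) (Fin.last p)
   have hWx : ∀ (e : ℕ) (w),w ∈ W → x^e*w*(x^e)⁻¹ ∈ W := by
    intro e w hw
    refine ⟨hn _ (pow_mem hxX e) w hw.1,?_⟩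
    have h5 : (x^e)⁻¹ (Fin.last p) = Fin.last p := by
     rw [inv_eq_iff_eq,hx.pow_last]
    have h6 : w (Fin.last p) = Fin.last p := hw.2
    change (x^e*w*(x^e)⁻¹) (Fin.last p) = Fin.last p
    rw [Perm.mul_apply,h5,Perm.mul_apply,h6,hx.pow_last]
   have horb : ∀ i,i ≠ Fin.last p → (orbit W i).ncard = (orbit W k).ncard := by
    intro i hi
    obtain ⟨e,rfl⟩ := hx.tr hp hkl hi
    have : orbit W ((x^e) k) = (x^e) '' orbit W k := by
     ext j
     constructor
     ·rintro ⟨⟨w,hw⟩,rfl⟩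
      refine ⟨((x^e)⁻¹*w*(x^e)) k,⟨⟨(x^e)⁻¹*w*(x^e),?_⟩,rfl⟩,?_⟩
      ·have h8 : (x^e)⁻¹ = x^(e*(p - 1)) := by
        rw [inv_eq_iff_mul_eq_one,←pow_add,show e+e*(p - 1) = p*e by
         have : e*p = e*(p - 1)+e := by
          conv_lhs => rw [←Nat.sub_add_cancel hp.one_le]
          ring
         rw [mul_comm p e]; omega,pow_mul,hx.powp hp,one_pow]
       have h9 := hWx (e*(p - 1)) w hw
       rw [←h8,inv_inv] at h9
       exact h9
      ·change (x^e) ((x^e)⁻¹ (w ((x^e) k))) = w ((x^e) k)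
       simp
     ·rintro ⟨_,⟨⟨w,hw⟩,rfl⟩,rfl⟩
      refine ⟨⟨_,hWx e w hw⟩,?_⟩
      change (x^e*w*(x^e)⁻¹) ((x^e) k) = (x^e) (w k)
      simp
    rw [this,Set.ncard_image_of_injective _ (x^e).injective]
   have hlast : ∀ i,i ≠ Fin.last p → ∀ j ∈ orbit W i,j ≠ Fin.last p := by
    rintro i hi _ ⟨⟨w,hw⟩,rfl⟩ he
    exact hi (w.injective (he.trans (hw.2 : w (Fin.last p) = Fin.last p).symm))
   have hsp : (orbit W k).ncard ∣ p := by
    classical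
    let S : Finset (Fin (p+1)) := univ.erase (Fin.last p)
    have hS : S.card = p := by simp [S]
    have h7 := Finset.card_eq_sum_card_image (fun i => orbit W i) S
    rw [Finset.sum_const_nat (m := (orbit W k).ncard),hS] at h7
    ·exact Dvd.intro_left _ h7.symm
    ·intro b hb
     obtain ⟨i,hi,rfl⟩ := mem_image.1 hb
     have hi2 : i ≠ Fin.last p := Finset.ne_of_mem_erase hi
     rw [←horb i hi2,←ncard_coe_finset]
     congr 1
     ext j
     simp only [Finset.coe_filter,Set.mem_ofPred_eq]
     constructor
     ·rintro ⟨-,h8⟩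
      rw [←h8]; exact mem_orbit_self j
     ·intro h8
      exact ⟨Finset.mem_erase.2 ⟨hlast i hi2 j h8,mem_univ _⟩,orbit_eq_iff.2 h8⟩
   rcases (dvd_prime hp).1 hsp with h8 | h8
   ·rw [Set.ncard_eq_one] at h8
    obtain ⟨z,hz⟩ := h8
    have h9 : k ∈ orbit W k := mem_orbit_self k
    have h10 : y k ∈ orbit W k := ⟨⟨y,hy,hyl⟩,rfl⟩
    rw [hz] at h9 h10
    exact hk (h10.trans h9.symm)
   ·obtain ⟨o,s,h9, -, -, -,h10⟩ := orbit_card (X := Y) (W := W) inf_le_left k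
    apply hco W inf_le_left
    rw [←h9,h10,h8]
    exact dvd_mul_right _ _
  ·push Not at hreg
   exfalso
   obtain ⟨⟨u,hu⟩,hu2⟩ := exists_prime_orderOf_dvd_card' 2 (hdY 2 hd2)
   obtain ⟨⟨v,hv⟩,hv3⟩ := exists_prime_orderOf_dvd_card' 3 (hdY 3 hd3)
   rw [orderOf_mk] at hu2 hv3
   have hu1 : u ≠ 1 := by rintro rfl; simp at hu2
   have hv1 : v ≠ 1 := by rintro rfl; simp at hv3
   obtain ⟨k,hk⟩ := hx.tr hp (hreg u hu hu1) (hreg v hv hv1)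
   have h5 : v = x^k*u*(x^k)⁻¹ := by
    by_contra hne
    refine hreg (v⁻¹*(x^k*u*(x^k)⁻¹)) (mul_mem (inv_mem hv) (hn _ (pow_mem hxX k) u hu)) ?_ ?_
    ·intro h6; exact hne (by rwa [inv_mul_eq_one] at h6)
    ·have h7 : (x^k)⁻¹ (Fin.last p) = Fin.last p := by
      rw [inv_eq_iff_eq,hx.pow_last]
     rw [Perm.mul_apply,Perm.mul_apply,Perm.mul_apply,h7,hk]; simp
   have h6 : orderOf (x^k*u*(x^k)⁻¹) = orderOf u := by
    exact MulEquiv.orderOf_eq (MulAut.conj (x^k)) u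
   rw [←h5] at h6
   omega
 obtain ⟨⟨u,hu⟩,huo⟩ := exists_prime_orderOf_dvd_card' p hpY
 rw [orderOf_mk] at huo
 obtain ⟨w,hw,hwe⟩ := (syl_p hp h2 (hY hu) huo).conj (syl_p hp h2 hxX (hx.order hp))
 have hxY : x ∈ Y := by
  have h1 : x ∈ cj w (zpowers u) := hwe ▸ mem_zpowers x
  obtain ⟨_,⟨k,rfl⟩,he⟩ := h1
  rw [←he]
  exact hn w hw _ (zpow_mem hu k)
 -- Frattini
 have hfr : ∀ c ∈ φ.range,∃ y ∈ Y,∃ n ∈ φ.range,c = y*n ∧ n*x*n⁻¹ ∈ zpowers x := by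
  intro c hc
  have ho : orderOf (c*x*c⁻¹) = p := by
   have := MulEquiv.orderOf_eq (MulAut.conj c) x
   rw [hx.order hp] at this
   exact this
  obtain ⟨y,hy,he⟩ := (syl_p hp h2 hxY (hx.order hp)).conj (syl_p hp h2 (hn c hc x hxY) ho)
  refine ⟨y,hy,y⁻¹*c,mul_mem (inv_mem (hY hy)) hc,by group,?_⟩
  have h1 : c*x*c⁻¹ ∈ cj y (zpowers x) := he ▸ mem_zpowers _
  rw [mem_cj] at h1
  convert h1 using 1
  group
 have habel : ∀ m n : Perm (Fin (p+1)),m*x*m⁻¹ ∈ zpowers x → n*x*n⁻¹ ∈ zpowers x → m*n*m⁻¹*n⁻¹ ∈ Y := by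
  rintro m n ⟨a,ha⟩ ⟨b,hb⟩
  simp only at ha hb
  have h1 : (m*n)*x*(m*n)⁻¹ = (n*m)*x*(n*m)⁻¹ := by
   calc (m*n)*x*(m*n)⁻¹ = m*(n*x*n⁻¹)*m⁻¹ := by group
    _ = (m*x*m⁻¹)^b := by rw [←hb,conj_zpow]
    _ = (n*x*n⁻¹)^a := by rw [←ha,←hb,←zpow_mul,←zpow_mul,mul_comm]
    _ = n*(m*x*m⁻¹)*n⁻¹ := by rw [←ha,conj_zpow]
    _ = (n*m)*x*(n*m)⁻¹ := by group
  -- the commutator of inverses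
  have h2 : (n*m)⁻¹*(m*n)*x = x*((n*m)⁻¹*(m*n)) := by
   calc (n*m)⁻¹*(m*n)*x = (n*m)⁻¹*((m*n)*x*(m*n)⁻¹)*(m*n) := by group
    _ = x*((n*m)⁻¹*(m*n)) := by rw [h1]; group
  obtain ⟨k,hk⟩ := hx.cent hp h2
  have h3 : m*n*m⁻¹*n⁻¹ = (n*m)*x^k*(n*m)⁻¹ := by rw [←hk]; group
  rw [h3]
  have h4 : (n*m)*x^k*(n*m)⁻¹ = (x^a)^(b*k) := by
   calc (n*m)*x^k*(n*m)⁻¹ = ((n*m)*x*(n*m)⁻¹)^k := by rw [conj_pow]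
    _ = (n*(m*x*m⁻¹)*n⁻¹)^k := by congr 1
    _ = ((n*x*n⁻¹)^a)^k := by rw [←ha,conj_zpow]
    _ = (x^a)^(b*k) := by
     rw [←hb,←zpow_mul,←zpow_mul,←zpow_natCast,←zpow_mul]; congr 1; ring
  rw [h4]
  exact zpow_mem (zpow_mem hxY a) _
 -- all commutators lie in `Y`
 have hcom : ∀ c ∈ φ.range,∀ e ∈ φ.range,c*e*c⁻¹*e⁻¹ ∈ Y := by
  intro c hc e he
  let Z := Y.subgroupOf φ.range
  have : Z.Normal := ⟨fun y hy c => hn c c.2 y hy⟩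
  obtain ⟨y1,hy1,n1,hn1,rfl,hx1⟩ := hfr c hc
  obtain ⟨y2,hy2,n2,hn2,rfl,hx2⟩ := hfr e he
  have h1 : (y1*n1)*(y2*n2)*(y1*n1)⁻¹*(y2*n2)⁻¹
   = y1*(n1*y2*n1⁻¹)*(n1*n2*n1⁻¹*n2⁻¹)*(n2*y1⁻¹*n2⁻¹)*y2⁻¹ := by group
  rw [h1]
  exact mul_mem (mul_mem (mul_mem (mul_mem hy1 (hn _ hn1 _ hy2)) (habel _ _ hx1 hx2)) (hn _ hn2 _ (inv_mem hy1))) (inv_mem hy2)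
 apply le_antisymm hY
 have h1 : commutator φ.range ≤ Y.subgroupOf φ.range := by
  rw [commutator_def,Subgroup.commutator_le]
  intro a _ b _
  exact hcom a a.2 b b.2
 rw [h.perfectX (by omega)] at h1
 intro c hc
 exact h1 (mem_top (⟨c,hc⟩ : φ.range))
/-- elements of the constituent lift to elements with large centralizers -/
lemma Core.lift (h : Core A φ) (hp : p.Prime) (h2 : 2 < p) (hd2 : 2 ∣ p+1) (hd3 : 3 ∣ p+1) (hx : IsX p x) (hxX : x ∈ φ.range) :
  ∀ c ∈ φ.range,∃ m,φ m = c ∧ ∀ u,c*φ u = φ u*c → m*u = u*m := by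
 obtain ⟨n0,hn0⟩ := hxX
 have hx1 : x ≠ 1 := fun h0 => by
  have := hx.order hp
  rw [h0,orderOf_one] at this
  exact hp.one_lt.ne this
 have hn1 : n0 ≠ 1 := by rintro rfl; exact hx1 (hn0 ▸ map_one φ)
 let J : Subgroup N := ⨅ a : A,φ.ker.comap a.1.toMonoidHom
 have hJ : ∀ n,n ∈ J ↔ ∀ a ∈ A,φ (a n) = 1 := fun n => by
  simp only [J,Subgroup.mem_iInf,mem_comap,mem_ker,Subtype.forall]; rfl
 have hJb : J = ⊥ := by
  refine (h.cs J (fun a ha => ?_)).resolve_right (fun ht => ?_)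
  ·ext n
   constructor
   ·rintro ⟨m,hm,rfl⟩
    exact (hJ _).2 fun b hb => (hJ m).1 hm (b*a) (mul_mem hb ha)
   ·intro hn
    refine ⟨a⁻¹ n,(hJ _).2 fun b hb => (hJ n).1 hn (b*a⁻¹) (mul_mem hb (inv_mem ha)),?_⟩
    exact MulAut.apply_inv_self N a n
  ·have := (hJ n0).1 (ht ▸ mem_top n0) 1 (one_mem A)
   exact hx1 (hn0 ▸ this)
 obtain ⟨K,⟨hK,hKb⟩,hmin⟩ := Set.exists_min_image {K : Subgroup N | K.Normal ∧ K ≠ ⊥} (fun K => Nat.card K) (toFinite _)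
  ⟨⊤,inferInstance,fun hb => hn1 (mem_bot.1 (hb ▸ mem_top n0))⟩
 obtain ⟨⟨k,hk⟩,hk0⟩ := Subgroup.ne_bot_iff_exists_ne_one.1 hKb
 obtain ⟨a,ha,hak⟩ : ∃ a ∈ A,φ (a k) ≠ 1 := by
  by_contra hcon; push Not at hcon
  have h3 : k ∈ J := (hJ k).2 hcon
  rw [hJb] at h3
  exact hk0 (Subtype.ext (mem_bot.1 h3))
 let M := K.map a.toMonoidHom
 have hM : M.Normal := hK.map _ a.surjective
 have hMk : ∀ m ∈ M,φ m = 1 → m = 1 := by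
  let L := K ⊓ φ.ker.comap a.toMonoidHom
  have hL : L.Normal := inferInstance
  have hLb : L = ⊥ := by
   by_contra hb
   have h4 : L = K := eq_of_le_of_card_ge inf_le_left (hmin L ⟨hL,hb⟩)
   have h5 : k ∈ L := h4 ▸ hk
   exact hak h5.2
  rintro _ ⟨m,hm,rfl⟩ h1
  have h5 : m ∈ L := ⟨hm,h1⟩
  rw [hLb] at h5
  rw [mem_bot.1 h5,map_one]
 have hMX : M.map φ = φ.range := by
  apply h.simple hp h2 hd2 hd3 hx ⟨n0,hn0⟩
  ·rintro _ ⟨m, -,rfl⟩; exact ⟨m,rfl⟩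
  ·rintro _ ⟨c,rfl⟩ _ ⟨m,hm,rfl⟩
   exact ⟨c*m*c⁻¹,hM.conj_mem m hm c,by simp⟩
  ·intro hb
   have : φ (a k) ∈ M.map φ := ⟨a k,⟨k,hk,rfl⟩,rfl⟩
   rw [hb] at this
   exact hak (mem_bot.1 this)
 intro c hc
 rw [←hMX] at hc
 obtain ⟨m,hm,rfl⟩ := hc
 refine ⟨m,rfl,fun u hu => ?_⟩
 have h5 := hMk (m*u*m⁻¹*u⁻¹) (by
  have := M.mul_mem hm (hM.conj_mem _ (M.inv_mem hm) u)
  convert this using 1; group) (by simp only [map_mul,map_inv]; rw [hu]; group)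
 calc m*u = (m*u*m⁻¹*u⁻¹)*(u*m) := by group
  _ = u*m := by rw [h5,one_mul]
/-- the basic contradiction -/
lemma Core.two (h : Core A φ) (hl : ∀ c ∈ φ.range,∃ m,φ m = c ∧ ∀ u,c*φ u = φ u*c → m*u = u*m)
  {Q : Subgroup N} (hQ : IsPGroup 2 Q) (hb : Q ≠ ⊥) (hg : Good A Q) {t : Perm (Fin (p+1))} (hQt : ∀ u ∈ Q,φ u = 1 ∨ φ u = t)
  (ht : ∀ j : Fin (p+1),∃ c ∈ φ.range,c*t = t*c ∧ c 0 = j) : False := by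
 refine h.no 2 (by norm_num) (by norm_num) Q hQ hb hg fun i j => ?_
 have key : ∀ c ∈ φ.range,c*t = t*c → ∃ n ∈ centralizer (Q : Set N),φ n = c := by
  intro c hc hct
  obtain ⟨m,hm,hu⟩ := hl c hc
  refine ⟨m,?_,hm⟩
  rw [mem_centralizer_iff]
  intro u hu2
  refine (hu u ?_).symm
  rcases hQt u hu2 with h3 | h3 <;> rw [h3]
  ·simp
  ·exact hct
 have hle : centralizer (Q : Set N) ≤ normalizer (Q : Set N) := by
  intro n hn
  rw [mem_centralizer_iff] at hn
  rw [mem_normalizer_iff]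
  intro q
  have h6 : ∀ n q : N,q*n = n*q → n*q*n⁻¹ = q := fun n q he => by rw [←he]; group
  constructor
  ·intro hq
   rw [h6 n q (hn q hq)]; exact hq
  ·intro hq
   have h7 := hn _ hq
   have h8 : q*n = n*q := by
    calc q*n = n⁻¹*((n*q*n⁻¹)*n)*n := by group
     _ = n*q := by rw [h7]; group
   rwa [h6 n q h8] at hq
 obtain ⟨c,hc,hct,hci⟩ := ht i
 obtain ⟨e,he,het,hej⟩ := ht j
 obtain ⟨m,hm,rfl⟩ := key c hc hct
 obtain ⟨n,hn,rfl⟩ := key e he het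
 refine ⟨n*m⁻¹,hle (mul_mem hn (inv_mem hm)),?_⟩
 rw [map_mul,map_inv,Perm.mul_apply,←hci,←hej]
 simp
end core
section yy
variable {p q : ℕ} {y : Perm (Fin (p+1))} {P M : ℕ → Fin (p+1)}
/-- `y` fixes two points and has two orbits of length `q` -/
structure IsY (y : Perm (Fin (p+1))) (q : ℕ) (P M : ℕ → Fin (p+1)) : Prop where
 q2 : 2 < q
 qp : q.Prime
 yP : ∀ k,y (P k) = P (k+1)
 yM : ∀ k,y (M k) = M (k+1)
 pP : ∀ k,P (k+q) = P k
 pM : ∀ k,M (k+q) = M k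
 y0 : y 0 = 0
 yl : y (Fin.last p) = Fin.last p
 cov : ∀ i,i = 0 ∨ i = Fin.last p ∨ (∃ k < q,i = P k) ∨ ∃ k < q,i = M k
 P0 : ∀ k < q,P k = P 0 → k = 0
 PM : ∀ k < q,∀ l < q,P k ≠ M l
 ne : ∀ k < q,P k ≠ 0 ∧ P k ≠ Fin.last p ∧ M k ≠ 0 ∧ M k ≠ Fin.last p
 M0 : ∀ k < q,M k = M 0 → k = 0
 h0l : (0 : Fin (p+1)) ≠ Fin.last p
 card : p = 2*q+1
end yy
section yy
variable {p q : ℕ} {y c : Perm (Fin (p+1))} {P M : ℕ → Fin (p+1)}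
lemma IsY.symm (h : IsY y q P M) : IsY y q M P where
 q2 := h.q2
 qp := h.qp
 yP := h.yM
 yM := h.yP
 pP := h.pM
 pM := h.pP
 y0 := h.y0
 yl := h.yl
 cov i := (h.cov i).imp id (Or.imp id Or.symm)
 P0 := h.M0
 M0 := h.P0
 PM k hk l hl he := h.PM l hl k hk he.symm
 ne k hk := ⟨(h.ne k hk).2.2.1,(h.ne k hk).2.2.2,(h.ne k hk).1,(h.ne k hk).2.1⟩
 h0l := h.h0l
 card := h.card
lemma IsY.add (h : IsY y q P M) (k m : ℕ) : P (k+q*m) = P k := by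
 induction m with
 | zero => rfl
 | succ m ih => rw [mul_add,mul_one,←add_assoc,h.pP,ih]
lemma IsY.mod (h : IsY y q P M) (k : ℕ) : P (k % q) = P k := by
 conv_rhs => rw [←Nat.mod_add_div k q,h.add]
lemma IsY.pow (h : IsY y q P M) (k j : ℕ) : (y^j) (P k) = P (k+j) := by
 induction j with
 | zero => rfl
 | succ j ih => rw [pow_succ',Perm.mul_apply,ih,h.yP,add_assoc]
lemma IsY.eqP (h : IsY y q P M) {k l : ℕ} (he : P (k+l) = P k) : q ∣ l := by
 have h1 : P (l % q) = P 0 := by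
  have h3 : ∀ j,(y^(q*k - k)) (P (k+j)) = P j := fun j => by
   rw [h.pow,←h.add j k]; congr 1
   have : k ≤ q*k := Nat.le_mul_of_pos_left k h.qp.pos
   omega
  rw [h.mod,←h3 l,he]
  exact h3 0
 exact Nat.dvd_of_mod_eq_zero (h.P0 _ (Nat.mod_lt _ h.qp.pos) h1)
lemma IsY.neP (h : IsY y q P M) (k : ℕ) : P k ≠ 0 ∧ P k ≠ Fin.last p := by
 rw [←h.mod k]
 exact ⟨(h.ne _ (Nat.mod_lt _ h.qp.pos)).1,(h.ne _ (Nat.mod_lt _ h.qp.pos)).2.1⟩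
lemma IsY.nePM (h : IsY y q P M) (k l : ℕ) : P k ≠ M l := by
 rw [←h.mod k,←h.symm.mod l]
 exact h.PM _ (Nat.mod_lt _ h.qp.pos) _ (Nat.mod_lt _ h.qp.pos)
lemma IsY.fix (h : IsY y q P M) {i : Fin (p+1)} (hi : y i = i) : i = 0 ∨ i = Fin.last p := by
 have := h.q2
 rcases h.cov i with h1 | h1 | ⟨k,hk,rfl⟩ | ⟨k,hk,rfl⟩
 ·exact .inl h1
 ·exact .inr h1
 ·rw [h.yP] at hi; have := le_of_dvd one_pos (h.eqP hi); omega
 ·rw [h.yM] at hi; have := le_of_dvd one_pos (h.symm.eqP hi); omega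
lemma IsY.ext (h : IsY y q P M) {e f : Perm (Fin (p+1))} (h0 : e 0 = f 0) (hl : e (Fin.last p) = f (Fin.last p))
  (hP : ∀ k,e (P k) = f (P k)) (hM : ∀ k,e (M k) = f (M k)) : e = f := by
 apply Equiv.ext
 intro i
 rcases h.cov i with rfl | rfl | ⟨k,hk,rfl⟩ | ⟨k,hk,rfl⟩
 exacts [h0,hl,hP k,hM k]
lemma pw {i : Fin (p+1)} (hi : y i = i) (j : ℕ) : (y^j) i = i := Perm.pow_apply_eq_self_of_apply_eq_self hi j
lemma IsY.powq (h : IsY y q P M) : y^q = 1 := by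
 apply h.ext
 ·exact pw h.y0 q
 ·exact pw h.yl q
 ·intro k; rw [h.pow,h.pP]; rfl
 ·intro k; rw [h.symm.pow,h.pM]; rfl
lemma IsY.order (h : IsY y q P M) : orderOf y = q := by
 have : Fact q.Prime := ⟨h.qp⟩
 refine orderOf_eq_prime h.powq fun h1 => ?_
 have h2 := h.yP 0
 rw [h1] at h2
 have := le_of_dvd one_pos (h.eqP (k := 0) (l := 1) h2.symm)
 have := h.q2; omega
lemma IsY.fl (h : IsY y q P M) (hc : ∀ i,y i = i → y (c i) = c i) : (c 0 = 0 ∧ c (Fin.last p) = Fin.last p) ∨ (c 0 = Fin.last p ∧ c (Fin.last p) = 0) := by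
 have hne : c 0 ≠ c (Fin.last p) := fun he => h.h0l (c.injective he)
 rcases h.fix (hc _ h.y0) with h1 | h1 <;> rcases h.fix (hc _ h.yl) with h2 | h2
 ·exact absurd (h1.trans h2.symm) hne
 ·exact .inl ⟨h1,h2⟩
 ·exact .inr ⟨h1,h2⟩
 ·exact absurd (h1.trans h2.symm) hne
lemma IsY.fl' (h : IsY y q P M) (hc : c*y = y*c) : (c 0 = 0 ∧ c (Fin.last p) = Fin.last p) ∨ (c 0 = Fin.last p ∧ c (Fin.last p) = 0) :=
 h.fl fun i hi => by rw [←Perm.mul_apply,←hc,Perm.mul_apply,hi]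
lemma IsY.half (h : IsY y q P M) (hc : c*y = y*c) : (∃ a,∀ k,c (P k) = P (k+a)) ∨ ∃ a,∀ k,c (P k) = M (k+a) := by
 have h1 : ∀ k,c (P k) = (y^k) (c (P 0)) := fun k => by
  have h2 : c*y^k = y^k*c := Commute.pow_right hc k
  rw [←Perm.mul_apply,←h2,Perm.mul_apply,h.pow,zero_add]
 have h3 : ∀ k,c 0 ≠ c (P k) ∧ c (Fin.last p) ≠ c (P k) := fun k => ⟨fun he => (h.neP k).1 (c.injective he).symm,fun he => (h.neP k).2 (c.injective he).symm⟩
 rcases h.cov (c (P 0)) with h2 | h2 | ⟨a, -,h2⟩ | ⟨a, -,h2⟩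
 ·exfalso
  rcases h.fl' hc with h4 | h4
  ·exact (h3 0).1 (h4.1.trans h2.symm)
  ·exact (h3 0).2 (h4.2.trans h2.symm)
 ·exfalso
  rcases h.fl' hc with h4 | h4
  ·exact (h3 0).2 (h4.2.trans h2.symm)
  ·exact (h3 0).1 (h4.1.trans h2.symm)
 ·exact .inl ⟨a,fun k => by rw [h1,h2,h.pow,add_comm a]⟩
 ·exact .inr ⟨a,fun k => by rw [h1,h2,h.symm.pow,add_comm a]⟩
lemma IsY.cent (h : IsY y q P M) (hc : c*y = y*c) : (∃ a b,(∀ k,c (P k) = P (k+a)) ∧ ∀ k,c (M k) = M (k+b)) ∨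
  ∃ a b,(∀ k,c (P k) = M (k+a)) ∧ ∀ k,c (M k) = P (k+b) := by
 have key : ∀ a b : ℕ,∃ k,k+a = b+q*a := fun a b => ⟨b+q*a - a,by
  have : a ≤ q*a := Nat.le_mul_of_pos_left a h.qp.pos
  omega⟩
 rcases h.half hc with ⟨a,ha⟩ | ⟨a,ha⟩ <;> rcases h.symm.half hc with ⟨b,hb⟩ | ⟨b,hb⟩
 ·exact .inl ⟨a,b,ha,hb⟩
 ·obtain ⟨k,hk⟩ := key a (0+b)
  refine absurd (c.injective ?_) (h.nePM k 0)
  rw [ha,hb,hk,h.add]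
 ·obtain ⟨k,hk⟩ := key a (0+b)
  refine absurd (c.injective ?_) (h.nePM k 0)
  rw [ha,hb,hk,h.symm.add]
 ·exact .inr ⟨a,b,ha,hb⟩
/-- the involution number `b` -/
def IsT (q : ℕ) (P M : ℕ → Fin (p+1)) (b : ℕ) (c : Perm (Fin (p+1))) : Prop :=
 c 0 = Fin.last p ∧ c (Fin.last p) = 0 ∧ (∀ k,c (P k) = M (k+b)) ∧ ∀ k,c (M k) = P (k+(q - b))
lemma sh {P : ℕ → Fin (p+1)} {a : ℕ} (h1 : ∀ k,c (P k) = P (k+a)) (j k : ℕ) : (c^j) (P k) = P (k+a*j) := by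
 induction j with
 | zero => rfl
 | succ j ih => rw [pow_succ',Perm.mul_apply,ih,h1]; congr 1; ring
lemma IsY.tEven (h : IsY y q P M) (hc : c*y = y*c) (hs : Perm.sign c = 1) {m : ℕ} (hm : c^2^m = 1) :
  c = 1 ∨ ∃ b < q,IsT q P M b c := by
 have hq2 : Coprime q (2^m) := Coprime.pow_right m ((Nat.coprime_primes h.qp prime_two).2 (by have := h.q2; omega))
 have hfix : ∀ (e : Perm (Fin (p+1))) (i : Fin (p+1)),e^2^m = 1 → (e^q) i = i → e i = i := by
  intro e i he hi
  obtain ⟨n,hn⟩ := exists_pow_eq_self_of_coprime (x := e) (n := q) (hq2.coprime_dvd_right (orderOf_dvd_of_pow_eq_one he))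
  have := pw hi n
  rwa [hn] at this
 rcases h.cent hc with ⟨a,b,h1,h2⟩ | ⟨a,b,h1,h2⟩
 ·have hP : ∀ k,c (P k) = P k := fun k => hfix c _ hm (by rw [sh h1,mul_comm,h.add])
  have hM : ∀ k,c (M k) = M k := fun k => hfix c _ hm (by rw [sh h2,mul_comm,h.symm.add])
  rcases h.fl' hc with h4 | h4
  ·left; exact h.ext h4.1 h4.2 hP hM
  ·exfalso
   have : c = swap 0 (Fin.last p) := by
    apply h.ext
    ·rw [h4.1,Equiv.swap_apply_left]
    ·rw [h4.2,Equiv.swap_apply_right]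
    ·intro k; rw [hP,Equiv.swap_apply_of_ne_of_ne (h.neP k).1 (h.neP k).2]
    ·intro k; rw [hM,Equiv.swap_apply_of_ne_of_ne (h.symm.neP k).1 (h.symm.neP k).2]
   rw [this,Perm.sign_swap h.h0l] at hs
   exact absurd hs (by decide)
 ·have hm2 : (c^2)^2^m = 1 := by rw [←pow_mul,mul_comm,pow_mul,hm,one_pow]
  have h3 : ∀ k,(c^2) (P k) = P (k+(a+b)) := fun k => by rw [pow_two,Perm.mul_apply,h1,h2,add_assoc]
  have h4 : ∀ k,(c^2) (M k) = M (k+(a+b)) := fun k => by rw [pow_two,Perm.mul_apply,h2,h1]; congr 1; ring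
  have hP : ∀ k,(c^2) (P k) = P k := fun k => hfix _ _ hm2 (by rw [sh h3,mul_comm,h.add])
  have hM : ∀ k,(c^2) (M k) = M k := fun k => hfix _ _ hm2 (by rw [sh h4,mul_comm,h.symm.add])
  have hlt := Nat.mod_lt a h.qp.pos
  have h1' : ∀ k,c (P k) = M (k+a % q) := fun k => by rw [h1,←h.symm.add (k+a % q) (a / q),add_assoc,Nat.mod_add_div]
  rcases h.fl' hc with h5 | h5
  ·exfalso
   have hsq : c^2 = 1 := h.ext (pw h5.1 2) (pw h5.2 2) hP hM
   have hsup : c.support.card = 2*q := by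
    have h6 : c.support = univ \ {0,Fin.last p} := by
     ext i
     rw [mem_support,mem_sdiff,mem_insert,mem_singleton]
     rcases h.cov i with rfl | rfl | ⟨k,hk,rfl⟩ | ⟨k,hk,rfl⟩
     ·simp [h5.1]
     ·simp [h5.2]
     ·simp [h1,h.neP k,(h.nePM k (k+a)).symm]
     ·simp [h2,h.symm.neP k,h.nePM]
    rw [h6,Finset.card_sdiff_of_subset (subset_univ _),card_pair h.h0l,card_univ,Fintype.card_fin]
    have := h.card; omega
   have := odd_inv hsq hsup (h.qp.odd_of_ne_two (by have := h.q2; omega))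
   rw [this] at hs
   exact absurd hs (by decide)
  ·refine .inr ⟨a % q,hlt,h5.1,h5.2,h1',fun k => ?_⟩
   have h6 := h1' (k+(q - a % q))
   rw [show k+(q - a % q)+a % q = k+q by omega,h.pM] at h6
   rw [←h6,←Perm.mul_apply,←pow_two,hP]
lemma IsY.centOdd (h : IsY y q P M) {X : Subgroup (Perm (Fin (p+1)))} (hs : ∀ c ∈ X,Perm.sign c = 1) (hy : y ∈ X)
  (hT : ∀ b < q,∀ c ∈ X,¬ IsT q P M b c)
  (h2 : ∀ c ∈ X,c 0 = 0 → c (Fin.last p) = Fin.last p → (∀ k,c (P k) = P k) → ∀ b,(∀ k,c (M k) = M (k+b)) → q ∣ b)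
  (hcX : c ∈ X) (hc : c*y = y*c) : ∃ j : ℕ,c = y^j := by
 have hcq : c^q*y = y*c^q := Commute.pow_left hc q
 have hoq : Odd q := h.qp.odd_of_ne_two (by have := h.q2; omega)
 have hfl2 : (c^2) 0 = 0 ∧ (c^2) (Fin.last p) = Fin.last p := by
  rw [pow_two,Perm.mul_apply,Perm.mul_apply]
  rcases h.fl' hc with h4 | h4 <;> simp [h4.1,h4.2]
 have hc2q : (c^q)^2^1 = 1 := by
  rw [pow_one,←pow_mul,mul_comm,pow_mul]
  have h5 := pw hfl2.1 q
  have h6 := pw hfl2.2 q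
  rcases h.cent hc with ⟨a,b,h1,h3⟩ | ⟨a,b,h1,h3⟩
  ·refine h.ext h5 h6 (fun k => ?_) (fun k => ?_)
   ·rw [←pow_mul,sh h1,mul_comm 2,mul_left_comm,h.add]; rfl
   ·rw [←pow_mul,sh h3,mul_comm 2,mul_left_comm,h.symm.add]; rfl
  ·have h7 : ∀ k,(c^2) (P k) = P (k+(a+b)) := fun k => by rw [pow_two,Perm.mul_apply,h1,h3,add_assoc]
   have h8 : ∀ k,(c^2) (M k) = M (k+(a+b)) := fun k => by rw [pow_two,Perm.mul_apply,h3,h1]; congr 1; ring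
   refine h.ext h5 h6 (fun k => ?_) (fun k => ?_)
   ·rw [sh h7,mul_comm,h.add]; rfl
   ·rw [sh h8,mul_comm,h.symm.add]; rfl
 have hq1 : c^q = 1 := by
  rcases h.tEven hcq (hs _ (pow_mem hcX q)) hc2q with h3 | ⟨b,hb,h3⟩
  ·exact h3
  ·exact absurd h3 (hT b hb _ (pow_mem hcX q))
 obtain ⟨r,hr⟩ := hoq
 have hodd : c^q = c*(c^2)^r := by rw [hr,←pow_mul,pow_succ']
 rcases h.cent hc with ⟨a,b,h1,h3⟩ | ⟨a,b,h1,h3⟩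
 ·have h5 : c 0 = 0 ∧ c (Fin.last p) = Fin.last p := by
   refine (h.fl' hc).resolve_right fun h4 => ?_
   have h6 : (c^q) 0 = c 0 := by rw [hodd,Perm.mul_apply,pw hfl2.1]
   rw [hq1,h4.1] at h6
   exact h.h0l h6
  have hle : a ≤ q*a := Nat.le_mul_of_pos_left a h.qp.pos
  have h6 := h2 (y^(q*a - a)*c) (mul_mem (pow_mem hy _) hcX) (by rw [Perm.mul_apply,h5.1,pw h.y0])
   (by rw [Perm.mul_apply,h5.2,pw h.yl]) (fun k => by
    rw [Perm.mul_apply,h1,h.pow,add_assoc,Nat.add_sub_cancel' hle,h.add]) (b+(q*a - a)) (fun k => by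
    rw [Perm.mul_apply,h3,h.symm.pow,add_assoc])
  refine ⟨a,h.ext ?_ ?_ ?_ ?_⟩
  ·rw [h5.1,pw h.y0]
  ·rw [h5.2,pw h.yl]
  ·intro k; rw [h1,h.pow]
  ·intro k
   rw [h3,h.symm.pow]
   obtain ⟨s,hs⟩ := h6
   rw [←h.symm.add (k+b) a,←h.symm.add (k+a) s]; congr 1; omega
 ·exfalso
  have h7 : ∀ k,(c^2) (P k) = P (k+(a+b)) := fun k => by rw [pow_two,Perm.mul_apply,h1,h3,add_assoc]
  have h6 : (c^q) (P 0) = M (0+(a+b)*r+a) := by rw [hodd,Perm.mul_apply,sh h7,h1]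
  rw [hq1] at h6
  exact h.nePM _ _ h6
end yy
end Mn
namespace Mn
open MulAction
/-- numerical data -/
structure Num (p q g : ℕ) : Prop where
 hp : p.Prime
 hq : q.Prime
 q2 : 2 < q
 pq : p = 2*q+1
 d3 : 3 ∣ p+1
 root : ∀ a < p,1 < a → ∃ k < p,a^k % p = p - 1 ∨ a^k % p = g
 gq : g^q % p = 1
 g0 : ∀ k < q,g^k % p = 1 → k = 0
 gM : ∀ k < q,∀ l < q,g^k % p+g^l % p ≠ p
 cov : ∀ i < p,i = 0 ∨ (∃ k < q,i = g^k % p) ∨ ∃ k < q,i = p - g^k % p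
lemma num11 : Num 11 5 3 := by constructor <;> decide +kernel
lemma num23 : Num 23 11 2 := by constructor <;> decide +kernel
lemma num47 : Num 47 23 2 := by constructor <;> decide +kernel
def Pf (p g k : ℕ) : Fin (p+1) := Fin.ofNat (p+1) (g^k % p)
def Mf (p g k : ℕ) : Fin (p+1) := Fin.ofNat (p+1) (p - g^k % p)
section num
variable {p q g : ℕ} {x y : Perm (Fin (p+1))}
lemma Num.Pv (n : Num p q g) (k : ℕ) : (Pf p g k : ℕ) = g^k % p := by
 unfold Pf
 rw [Fin.val_ofNat,mod_eq_of_lt]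
 have := Nat.mod_lt (g^k) n.hp.pos; omega
lemma Num.Mv (n : Num p q g) (k : ℕ) : (Mf p g k : ℕ) = p - g^k % p := by
 unfold Mf
 rw [Fin.val_ofNat,mod_eq_of_lt]
 omega
lemma Num.gpos (n : Num p q g) (k : ℕ) : 0 < g^k % p := by
 apply Nat.pos_of_ne_zero
 intro h0
 have h1 := n.hp.dvd_of_dvd_pow (Nat.dvd_of_mod_eq_zero h0)
 have h2 := n.gq
 rw [Nat.mod_eq_zero_of_dvd (dvd_pow h1 n.hq.ne_zero)] at h2
 exact absurd h2 (by norm_num)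
lemma mul_sub_mod {a b : ℕ} (hb : b < p) (h0 : 0 < a*b % p) : a*(p - b) % p = p - a*b % p := by
 have h1 : a*(p - b)+a*b = a*p := by rw [←mul_add,Nat.sub_add_cancel hb.le]
 have h2 : 0 < p := by omega
 have h3 := Nat.mod_lt (a*b) h2
 have h4 := Nat.mod_lt (a*(p - b)) h2
 have h5 : (a*(p - b) % p+a*b % p) % p = 0 := by rw [←Nat.add_mod,h1,Nat.mul_mod_left]
 obtain ⟨s,hs⟩ := Nat.dvd_of_mod_eq_zero h5
 have h6 : s = 1 := by
  have : s < 2 := by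
   by_contra hc
   have : p*2 ≤ p*s := Nat.mul_le_mul_left p (by omega)
   omega
  have : s ≠ 0 := by rintro rfl; omega
  omega
 rw [h6] at hs; omega
lemma Num.isY (n : Num p q g) (hy : ∀ i : Fin (p+1),((y i : Fin (p+1)) : ℕ) = mf p g i) : IsY y q (Pf p g) (Mf p g) := by
 have hlt : ∀ k,g^k % p < p := fun k => Nat.mod_lt _ n.hp.pos
 have hgq : ∀ k,g^(k+q) % p = g^k % p := fun k => by rw [pow_add,Nat.mul_mod,n.gq,mul_one,Nat.mod_mod]
 have hsuc : ∀ k,g*(g^k % p) % p = g^(k+1) % p := fun k => by rw [Nat.mul_mod_mod,←pow_succ']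
 have hl : ((Fin.last p : Fin (p+1)) : ℕ) = p := val_last p
 refine ⟨n.q2,n.hq,?_,?_,?_,?_,?_,?_,?_,?_,?_,?_,?_,?_,n.pq⟩
 ·intro k; apply Fin.ext; rw [hy,n.Pv,n.Pv,mf_lt (hlt k),hsuc]
 ·intro k; apply Fin.ext
  have h1 := n.gpos k
  have h2 := hlt k
  have h3 : 0 < g*(g^k % p) % p := by rw [hsuc]; exact n.gpos _
  rw [hy,n.Mv,n.Mv,mf_lt (by omega),mul_sub_mod h2 h3,hsuc]
 ·intro k; apply Fin.ext; rw [n.Pv,n.Pv,hgq]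
 ·intro k; apply Fin.ext; rw [n.Mv,n.Mv,hgq]
 ·apply Fin.ext; rw [hy,val_zero,mf_lt n.hp.pos,mul_zero,zero_mod]
 ·apply Fin.ext; rw [hy,hl,mf_last]
 ·intro i
  by_cases hi : i = Fin.last p
  ·exact .inr (.inl hi)
  rcases n.cov i (lt_of_ne_last hi) with h1 | ⟨k,hk,h1⟩ | ⟨k,hk,h1⟩
  ·exact .inl (Fin.ext h1)
  ·exact .inr (.inr (.inl ⟨k,hk,Fin.ext (by rw [h1,n.Pv])⟩))
  ·exact .inr (.inr (.inr ⟨k,hk,Fin.ext (by rw [h1,n.Mv])⟩))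
 ·intro k hk he
  have he := congrArg Fin.val he
  rw [n.Pv,n.Pv,pow_zero,mod_eq_of_lt n.hp.one_lt] at he
  exact n.g0 k hk he
 ·intro k hk l hl he
  have he := congrArg Fin.val he
  rw [n.Pv,n.Mv] at he
  have := hlt l
  exact n.gM k hk l hl (by omega)
 ·intro k hk
  have h1 := n.gpos k
  have h2 := hlt k
  refine ⟨?_,?_,?_,?_⟩ <;> intro he <;> have he := congrArg Fin.val he <;>
   simp only [n.Pv,n.Mv,val_zero,hl] at he <;> omega
 ·intro k hk he
  have he := congrArg Fin.val he
  rw [n.Mv,n.Mv,pow_zero,mod_eq_of_lt n.hp.one_lt] at he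
  have := hlt k
  have := n.hp.one_lt
  exact n.g0 k hk (by omega)
 ·intro he
  have := congrArg Fin.val he
  rw [val_zero,hl] at this
  exact n.hp.ne_zero this.symm
/-- a generator of a normalizer -/
lemma Num.norm (n : Num p q g) (hx : IsX p x) {c : Perm (Fin (p+1))} (hc : c*x*c⁻¹ ∈ zpowers x) :
  ∃ a e : ℕ,a < p ∧ ∀ i : Fin (p+1),(((x^e*c) i : Fin (p+1)) : ℕ) = mf p a i := by
 have hl := hx.fix_of n.hp hc
 have h0 : (0 : Fin (p+1)) ≠ Fin.last p := fun h0 => by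
  have := congrArg Fin.val h0
  simp at this; exact n.hp.ne_zero this.symm
 obtain ⟨e,he⟩ := hx.tr n.hp (fun h1 => h0 (c.injective (h1.trans hl.symm)) : c 0 ≠ Fin.last p) h0
 obtain ⟨a,ha⟩ := (mem_powers_iff_mem_zpowers).2 hc
 simp only at ha
 refine ⟨a % p,e,Nat.mod_lt _ n.hp.pos,fun i => ?_⟩
 by_cases hi : i = Fin.last p
 ·rw [hi,Perm.mul_apply,hl,hx.pow_last,val_last,mf_last]
 ·have hip := lt_of_ne_last hi
  have h1 : (x^(i : ℕ)) 0 = i := Fin.ext (by rw [hx.pow n.hp _ (i := 0) (by simpa using n.hp.pos)]; simp [mod_eq_of_lt hip])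
  have h2 : c*x^(i : ℕ) = (x^a)^(i : ℕ)*c := by
   rw [ha,conj_pow]; group
  have h3 : (x^e*c) i = (x^(a*i)) 0 := by
   conv_lhs => rw [←h1]
   rw [←Perm.mul_apply,mul_assoc,h2,←pow_mul,←mul_assoc,←pow_add,add_comm e,pow_add,mul_assoc,Perm.mul_apply,Perm.mul_apply,he]
  rw [h3,hx.pow n.hp _ (i := 0) (by simpa using n.hp.pos),mf_lt hip]
  simp
end num
section core
variable {N : Type*} [Group N] [Finite N] {A : Subgroup (MulAut N)} {p q g : ℕ} {φ : N →* Perm (Fin (p+1))} {x : Perm (Fin (p+1))}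
lemma mf_iter {a : ℕ} (hp : 0 < p) (k : ℕ) : ∀ i < p+1,(mf p a)^[k] i = mf p (a^k % p) i := by
 induction k with
 | zero =>
  intro i hi
  by_cases h1 : i < p
  ·rw [mf_lt h1,pow_zero,Nat.mod_mul_mod,one_mul,mod_eq_of_lt h1]; rfl
  ·rw [show i = p by omega,mf_last]; rfl
 | succ k ih =>
  intro i hi
  by_cases h1 : i < p
  ·rw [iterate_succ_apply',ih i hi,mf_lt h1,mf_lt (Nat.mod_lt _ hp),mf_lt h1,Nat.mod_mul_mod,Nat.mul_mod_mod,Nat.mod_mul_mod,pow_succ']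
   ring_nf
  ·rw [show i = p by omega,iterate_succ_apply',ih p (by omega),mf_last,mf_last,mf_last]
lemma Core.exists_y (n : Num p q g) (h : Core A φ) (hx : IsX p x) (hxX : x ∈ φ.range) : In φ.range (mf p g) := by
 have hp := n.hp
 have hq2 := n.q2
 have hpq := n.pq
 have : Fact p.Prime := ⟨hp⟩
 have hx1 : x ≠ 1 := fun h0 => by
  have := hx.order hp
  rw [h0,orderOf_one] at this
  exact hp.one_lt.ne this
 obtain ⟨c,hcX,hcn,t,ht,hct⟩ := h.transfer (by omega) (syl_p hp (by omega) hxX (hx.order hp)) (by rwa [Ne,Subgroup.zpowers_eq_bot])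
 obtain ⟨a,e,ha,hae⟩ := n.norm hx ((mem_normalizer_iff.1 hcn x).1 (mem_zpowers x))
 have hm : In φ.range (mf p a) := ⟨x^e*c,mul_mem (pow_mem hxX e) hcX,hae⟩
 have ha1 : 1 < a := by
  by_contra h1
  have hae0 := hae
  obtain rfl | rfl : a = 0 ∨ a = 1 := by omega
  ·have h2 := hae 0
   have h3 := hae ⟨1,by omega⟩
   rw [val_zero,mf_lt hp.pos,zero_mul,zero_mod] at h2
   rw [mf_lt hp.one_lt,zero_mul,zero_mod,←h2] at h3
   have := congrArg Fin.val ((x^e*c).injective (Fin.ext h3))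
   simp at this
  ·have h2 : x^e*c = 1 := Equiv.ext fun i => Fin.ext (by
    rw [hae]
    by_cases h1 : (i : ℕ) < p
    ·rw [mf_lt h1,one_mul,mod_eq_of_lt h1]; rfl
    ·rw [show (i : ℕ) = p by omega,mf_last]; simp; omega)
   apply hct
   rw [eq_inv_of_mul_eq_one_right h2]
   obtain ⟨k,rfl⟩ := ht
   simp only [←zpow_natCast,←zpow_neg,←zpow_add,add_comm]
 obtain ⟨k,hk,h1 | h1⟩ := n.root a ha ha1
 ·exfalso
  obtain ⟨c,hc,hci⟩ := (hm.iter k).congr (mf_iter hp.pos k)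
  rw [h1] at hci
  have hv : ∀ i : Fin (p+1),(0 < (i : ℕ) ∧ (i : ℕ) < p) → ((c i : Fin (p+1)) : ℕ) = p - i := fun i hi => by
   rw [hci,mf_lt hi.2,mul_comm,mul_sub_mod hp.one_lt,mul_one,mod_eq_of_lt hi.2]
   rw [mul_one,mod_eq_of_lt hi.2]; exact hi.1
  have hv0 : c 0 = 0 := Fin.ext (by rw [hci,val_zero,mf_lt hp.pos,mul_zero,zero_mod])
  have hvl : c (Fin.last p) = Fin.last p := Fin.ext (by rw [hci,val_last,mf_last])
  have hcase : ∀ i : Fin (p+1),i = 0 ∨ i = Fin.last p ∨ (0 < (i : ℕ) ∧ (i : ℕ) < p) := fun i => by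
   by_cases hi : i = Fin.last p
   ·exact .inr (.inl hi)
   ·by_cases hi0 : (i : ℕ) = 0
    ·exact .inl (Fin.ext hi0)
    ·exact .inr (.inr ⟨by omega,lt_of_ne_last hi⟩)
  have hsq : c^2 = 1 := by
   apply Equiv.ext
   intro i
   rcases hcase i with rfl | rfl | hi
   ·exact pw hv0 2
   ·exact pw hvl 2
   ·apply Fin.ext
    rw [pow_two,Perm.mul_apply,hv _ (by rw [hv i hi]; omega),hv i hi]
    change _ = (i : ℕ); omega
  have h6 : c.support = univ \ {0,Fin.last p} := by
   ext i
   rw [mem_support,mem_sdiff,mem_insert,mem_singleton]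
   rcases hcase i with rfl | rfl | hi
   ·simp [hv0]
   ·simp [hvl]
   ·have h7 : i ≠ 0 := by rintro rfl; simp at hi
    have h8 : i ≠ Fin.last p := by rintro rfl; simp at hi
    have h9 : c i ≠ i := fun he => by
     have := hv i hi; rw [he] at this; omega
    simp [h7,h8,h9]
  have hsup : c.support.card = 2*q := by
   rw [h6,Finset.card_sdiff_of_subset (subset_univ _),card_pair,card_univ,Fintype.card_fin]
   ·omega
   ·intro he
    have := congrArg Fin.val he
    simp at this; omega
  obtain ⟨m,rfl⟩ := hc
  have h7 := odd_inv hsq hsup (n.hq.odd_of_ne_two (by omega))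
  rw [h.even (by omega)] at h7
  exact absurd h7 (by decide)
 ·rw [←h1]
  exact (hm.iter k).congr (mf_iter hp.pos k)
end core
end Mn
namespace Mn
open MulAction
/-- normalizers of groups of prime order -/
lemma norm_card {G : Type*} [Group G] [Finite G] {W : Subgroup G} {u : G} {r : ℕ} (hr : r.Prime) (ho : orderOf u = r)
  (hW : ∀ c ∈ W,c*u*c⁻¹ ∈ zpowers u) (hC : ∀ c ∈ W,c*u = u*c → c ∈ zpowers u) : Nat.card W ∣ r*(r - 1) := by
 have hle : W ≤ normalizer (zpowers u : Set G) := fun c hc => by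
  rw [Subgroup.mem_normalizer_iff_map_conj_eq]
  apply eq_of_le_of_card_ge
  ·rw [map_zpowers,zpowers_le]; exact hW c hc
  ·rw [card_map_of_injective (MulAut.conj c).injective]
 let f : W →* MulAut (zpowers u) := (Subgroup.normalizerMonoidHom _).comp (Subgroup.inclusion hle)
 have h1 : Nat.card f.ker ∣ r := by
  have h2 : f.ker.map W.subtype ≤ zpowers u := by
   rintro _ ⟨⟨c,hcW⟩,hc,rfl⟩
   apply hC c hcW
   have h3 : f ⟨c,hcW⟩ = 1 := hc
   have h4 := congrArg (fun e => ((e ⟨u,mem_zpowers u⟩ : zpowers u) : G)) h3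
   have h5 : c*u*c⁻¹ = u := h4
   rwa [mul_inv_eq_iff_eq_mul] at h5
  have h3 := card_dvd_of_le h2
  rwa [card_map_of_injective W.subtype_injective,card_zpowers,ho] at h3
 have h2 : Nat.card f.range ∣ r - 1 := by
  have := card_subgroup_dvd_card f.range
  rwa [IsCyclic.card_mulAut,card_zpowers,ho,Nat.totient_prime hr] at this
 rw [←card_mul_index f.ker,index_ker]
 exact mul_dvd_mul h1 h2
lemma syl_of {G : Type*} [Group G] [Finite G] {W : Subgroup G} {u : G} {r : ℕ} (hr : r.Prime) (ho : orderOf u = r) (hu : u ∈ W)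
  (hd : ¬ r^2 ∣ Nat.card W) : IsSyl r (zpowers u) W := by
 have : Fact r.Prime := ⟨hr⟩
 have hle : zpowers u ≤ W := by rwa [zpowers_le]
 refine ⟨hle,of_card (n := 1) (by rw [card_zpowers,ho,pow_one]),fun h => hd ?_⟩
 have h1 := relIndex_mul_relIndex ⊥ _ W bot_le hle
 rw [relIndex_bot_left,relIndex_bot_left,card_zpowers,ho] at h1
 rw [←h1,pow_two]
 exact Nat.mul_dvd_mul_left r h
def xe (p e i : ℕ) : ℕ := bif blt i p then (i+e) % p else i
def tf (p q a b i : ℕ) : ℕ := bif beq i p then 0 else bif beq i 0 then p else bif beq (i^q % p) 1 then a*i % p else b*i % p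
def zf (p q a i : ℕ) : ℕ := bif blt i p && beq (i^q % p) (p - 1) then a*i % p else i
def hf (p q a b i j m : ℕ) : ℕ → ℕ := (fun v => tf p q a b (xe p i (tf p q a b (xe p j (tf p q a b (xe p (p - j) (tf p q a b (xe p (p - i) v))))))))^[m]
/-- checks a row `(b, m, i, j)` of the table -/
def okT (p q g : ℕ) (r : ℕ × ℕ × ℕ × ℕ) : Bool :=
 let a := p - g^r.1 % p
 let b := p - g^(q - r.1) % p
 let h := hf p q a b r.2.2.1 r.2.2.2 r.2.1
 chk (p+1) (fun i => beq (h (tf p q a b i)) (tf p q a b (h i))) && blt 0 (h 0) && blt (h 0) p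
def wf (p q g a i b m : ℕ) : ℕ → ℕ := (fun v => zf p q (g^a % p) (xe p i (zf p q (g^b % p) (xe p (p - i) v))))^[m]
/-- more numerical data -/
structure Num2 (p q g : ℕ) : Prop where
 tab : ∀ b < q,∃ m i j,okT p q g (b,m,i,j) = true
 tP : ∀ b < q,∀ k < q,tf p q (p - g^b % p) (p - g^(q - b) % p) (g^k % p) = p - g^(k+b) % p
 tM : ∀ b < q,∀ k < q,tf p q (p - g^b % p) (p - g^(q - b) % p) (p - g^k % p) = g^(k+(q - b)) % p
 zP : ∀ k < q,(g^k % p)^q % p ≠ p - 1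
 zM : ∀ k < q,(p - g^k % p)^q % p = p - 1
 three : ∃ a i b m,(((List.range (p+1)).filter (fun v => !beq (wf p q g a i b m v) v)).length = 3)
lemma tabs {p q g : ℕ} (T : List (ℕ × ℕ × ℕ)) (hT : chk q (fun b => okT p q g (b,T.getD b (0,0,0))) = true) :
  ∀ b < q,∃ m i j,okT p q g (b,m,i,j) = true := fun b hb => ⟨_,_,_,chk_spec hT b hb⟩
set_option maxRecDepth 100000 in
lemma num2_11 : Num2 11 5 3 := ⟨tabs [(1,1,1),(2,1,5),(2,1,2),(2,1,1),(2,1,5)] (by decide +kernel),by decide +kernel,by decide +kernel,by decide +kernel,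
 by decide +kernel,1,1,1,5,by decide +kernel⟩
set_option maxRecDepth 100000 in
lemma num2_23 : Num2 23 11 2 := ⟨tabs [(1,1,1),(3,1,22),(3,1,7),(2,1,3),(3,1,22),(3,1,1),(3,1,22),(3,1,22),(2,1,8),(3,1,22),(3,1,22)] (by decide +kernel),
 by decide +kernel,by decide +kernel,by decide +kernel,by decide +kernel,3,1,6,7,by decide +kernel⟩
set_option maxRecDepth 100000 in
lemma num2_47 : Num2 47 23 2 := ⟨tabs [(1,1,1),(9,1,6),(6,1,18),(7,1,40),(6,1,46),(8,1,35),(8,1,2),(6,1,27),(9,1,25),(6,5,7),(6,1,46),(6,1,36),(6,1,17),(6,1,20),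
 (6,1,39),(9,1,32),(6,1,7),(8,1,8),(8,1,21),(6,1,46),(7,5,12),(6,5,6),(9,1,8)] (by decide +kernel),
 by decide +kernel,by decide +kernel,by decide +kernel,by decide +kernel,9,1,14,16,by decide +kernel⟩
section core
variable {N : Type*} [Group N] [Finite N] {A : Subgroup (MulAut N)} {p q g : ℕ} {φ : N →* Perm (Fin (p+1))} {x y t : Perm (Fin (p+1))}
 {X : Subgroup (Perm (Fin (p+1)))}
lemma In.xe (hp : p.Prime) (hx : IsX p x) (hxX : x ∈ X) (e : ℕ) : In X (xe p e) := by
 refine ⟨x^e,pow_mem hxX e,fun i => ?_⟩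
 unfold Mn.xe
 by_cases hi : i = Fin.last p
 ·rw [hi,hx.pow_last,val_last]
  have : blt p p = false := by
   rw [eq_false_iff]; intro h; rw [blt_eq] at h; exact lt_irrefl _ h
  rw [this]; rfl
 ·have h1 := lt_of_ne_last hi
  rw [hx.pow hp e h1,show blt i p = true from blt_eq ▸ h1]; rfl
lemma IsT.comm {P M : ℕ → Fin (p+1)} (h : IsY y q P M) {b : ℕ} (ht : IsT q P M b t) : t*y = y*t := by
 obtain ⟨h0,hl,hP,hM⟩ := ht
 apply h.ext <;> intros <;> simp only [Perm.mul_apply,h0,hl,hP,hM,h.y0,h.yl,h.yP,h.yM,add_right_comm]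
lemma IsT.sq {P M : ℕ → Fin (p+1)} (h : IsY y q P M) {b : ℕ} (hb : b < q) (ht : IsT q P M b t) : t*t = 1 := by
 obtain ⟨h0,hl,hP,hM⟩ := ht
 apply h.ext <;> intros <;> simp only [Perm.mul_apply,h0,hl,hP,hM,add_assoc,Nat.add_sub_cancel' hb.le,Nat.sub_add_cancel hb.le,h.pP,h.pM] <;> rfl
/-- centralizers of the involutions are transitive -/
lemma IsT.trans (n : Num p q g) (n2 : Num2 p q g) (h : IsY y q (Pf p g) (Mf p g)) (hx : IsX p x) (hxX : x ∈ X) (hyX : y ∈ X) (htX : t ∈ X) {b : ℕ} (hb : b < q)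
  (ht : IsT q (Pf p g) (Mf p g) b t) (j : Fin (p+1)) : ∃ c ∈ X,c*t = t*c ∧ c 0 = j := by
 have hyt := ht.comm h
 have ⟨h0,hl,hP,hM⟩ := ht
 obtain ⟨m,i,j',hok⟩ := n2.tab b hb
 simp only [okT,and_eq_true] at hok
 obtain ⟨⟨h1,h2⟩,h3⟩ := hok
 rw [blt_eq] at h2 h3
 have hpos := n.hp.pos
 have htv : ∀ i : Fin (p+1),((t i : Fin (p+1)) : ℕ) = tf p q (p - g^b % p) (p - g^(q - b) % p) i := by
  intro i
  rcases h.cov i with rfl | rfl | ⟨k,hk,rfl⟩ | ⟨k,hk,rfl⟩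
  ·rw [h0]
   unfold tf
   rw [val_zero,show beq 0 p = false by rw [eq_false_iff]; intro h9; exact hpos.ne (eq_of_beq_eq_true h9)]; simp
  ·rw [hl]; unfold tf; simp
  ·rw [hP,n.Pv,n.Mv,n2.tP b hb k hk]
  ·rw [hM,n.Pv,n.Mv,n2.tM b hb k hk]
 have htI : In X (tf p q (p - g^b % p) (p - g^(q - b) % p)) := ⟨t,htX,htv⟩
 have hxI := fun e => In.xe n.hp hx hxX e
 obtain ⟨c,hcX,hcv⟩ := (htI.comp ((hxI i).comp (htI.comp ((hxI j').comp (htI.comp ((hxI (p - j')).comp (htI.comp (hxI (p - i))))))))).iter m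
 have hct : c*t = t*c := Equiv.ext fun v => Fin.ext (by
  rw [Perm.mul_apply,Perm.mul_apply,hcv,htv,htv,hcv]
  exact chk_eq h1 v v.2)
 have hc0 : ((c 0 : Fin (p+1)) : ℕ) = hf p q (p - g^b % p) (p - g^(q - b) % p) i j' m 0 := hcv 0
 have hq : ∀ k l : ℕ,∃ e,k+e = l+q*k := fun k l => ⟨l+q*k - k,by
  have : k ≤ q*k := Nat.le_mul_of_pos_left k n.hq.pos
  omega⟩
 have hyc : ∀ e,y^e*t = t*y^e := fun e => (Commute.pow_right hyt e).symm
 obtain ⟨c1,hc1,hc1t,c2,hc2,hc2t,k,l,hk,hl'⟩ : ∃ c1 ∈ X,c1*t = t*c1 ∧ ∃ c2 ∈ X,c2*t = t*c2 ∧ ∃ k l,c1 0 = Pf p g k ∧ c2 0 = Mf p g l := by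
  have htc : (t*c)*t = t*(t*c) := by rw [mul_assoc,hct]
  rcases h.cov (c 0) with h5 | h5 | ⟨k,hk,h5⟩ | ⟨k,hk,h5⟩
  ·rw [h5,val_zero] at hc0; omega
  ·rw [h5,val_last] at hc0; omega
  ·exact ⟨c,hcX,hct,t*c,mul_mem htX hcX,htc,k,_,h5,by rw [Perm.mul_apply,h5,hP]⟩
  ·exact ⟨t*c,mul_mem htX hcX,htc,c,hcX,hct,_,k,by rw [Perm.mul_apply,h5,hM],h5⟩
 have hcomm : ∀ e (c : Perm (Fin (p+1))),c*t = t*c → y^e*c*t = t*(y^e*c) := fun e c hc => by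
  rw [mul_assoc,hc,←mul_assoc,hyc,mul_assoc]
 rcases h.cov j with rfl | rfl | ⟨r,hr,rfl⟩ | ⟨r,hr,rfl⟩
 ·exact ⟨1,one_mem _,by simp,rfl⟩
 ·exact ⟨t,htX,rfl,h0⟩
 ·obtain ⟨e,he⟩ := hq k r
  exact ⟨y^e*c1,mul_mem (pow_mem hyX e) hc1,hcomm e c1 hc1t,by rw [Perm.mul_apply,hk,h.pow,he,h.add]⟩
 ·obtain ⟨e,he⟩ := hq l r
  exact ⟨y^e*c2,mul_mem (pow_mem hyX e) hc2,hcomm e c2 hc2t,by rw [Perm.mul_apply,hl',h.symm.pow,he,h.symm.add]⟩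
/-- the first branch -/
lemma Core.brI (n : Num p q g) (n2 : Num2 p q g) (h : Core A φ) (hx : IsX p x) (hxX : x ∈ φ.range) (hyX : y ∈ φ.range) (hy : IsY y q (Pf p g) (Mf p g))
  (hyx : y*x*y⁻¹ ∈ zpowers x) (htX : t ∈ φ.range) {b : ℕ} (hb : b < q) (ht : IsT q (Pf p g) (Mf p g) b t) : False := by
 have hp := n.hp
 have hq2 := n.q2
 have hpq := n.pq
 have : Fact p.Prime := ⟨hp⟩
 have : Fact q.Prime := ⟨n.hq⟩
 have : Fact (Nat.Prime 2) := ⟨prime_two⟩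
 have hlift := h.lift hp (by omega) (by omega) n.d3 hx hxX
 obtain ⟨R,hR,hRx⟩ := h.syl_lift (syl_p hp (by omega) hxX (hx.order hp))
 let K := normalizer (R : Set N)
 have hK1 : ∀ c ∈ K.map φ,c*x*c⁻¹ ∈ zpowers x := by
  rintro _ ⟨k,hk,rfl⟩
  have hxR : x ∈ R.map φ := hRx ▸ mem_zpowers x
  obtain ⟨r,hr,rfl⟩ := hxR
  rw [←hRx]
  exact ⟨k*r*k⁻¹,(mem_normalizer_iff.1 hk r).1 hr,by simp⟩
 have hyK : y ∈ K.map φ := by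
  obtain ⟨m,rfl⟩ := hyX
  obtain ⟨k,hk,he⟩ := hR.lift φ m (by
   rw [hRx,Subgroup.mem_normalizer_iff_map_conj_eq]
   apply eq_of_le_of_card_ge
   ·rw [map_zpowers,zpowers_le]; exact hyx
   ·rw [card_map_of_injective (MulAut.conj (φ m)).injective])
  exact ⟨k,hk,he⟩
 have hsy : IsSyl q (zpowers y) (K.map φ) := by
  refine syl_of n.hq hy.order hyK fun hd => ?_
  have h1 := hd.trans (norm_card hp (hx.order hp) hK1 fun c _ hc => by
   obtain ⟨k,rfl⟩ := hx.cent hp hc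
   exact pow_mem (mem_zpowers x) k)
  have h2 : p*(p - 1) = q*(2*p) := by rw [show p - 1 = 2*q by omega]; ring
  rw [h2,pow_two] at h1
  have h3 := Nat.dvd_of_mul_dvd_mul_left n.hq.pos h1
  have h4 : 2*p = 4*q+2 := by omega
  rw [h4] at h3
  have h5 := (Nat.dvd_add_right (dvd_mul_left q 4)).1 h3
  have := le_of_dvd (by norm_num) h5; omega
 obtain ⟨S0,hS0⟩ := exists_syl q K
 obtain ⟨_,⟨k,hk,rfl⟩,hke⟩ := (hS0.map φ).conj hsy
 have hS : IsSyl q (cj k S0) K := by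
  have := hS0.map (MulAut.conj k).toMonoidHom
  rwa [normalizer_aut R (MulAut.conj k) (cj_normalizer.1 hk)] at this
 rw [←cj_map] at hke
 generalize cj k S0 = S at hS hke
 have hSg : Good A S := Good.sub h.inn hR.good (normalizer_aut R) hS
 obtain ⟨Q,hQ⟩ := exists_syl 2 (centralizer (S : Set N))
 have hQg : Good A Q := Good.sub h.inn hSg (centralizer_aut S) hQ
 have hyS : y ∈ S.map φ := hke ▸ mem_zpowers y
 have hQ1 : ∀ u ∈ Q,φ u = 1 ∨ ∃ b < q,IsT q (Pf p g) (Mf p g) b (φ u) := by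
  intro u hu
  obtain ⟨m,hm⟩ := hQ.2.1 ⟨u,hu⟩
  have hm : u^2^m = 1 := congrArg Subtype.val hm
  refine hy.tEven ?_ (h.even (by omega) u) (m := m) (by rw [←map_pow,hm,map_one])
  obtain ⟨s,hs,rfl⟩ := hyS
  rw [←map_mul,←map_mul,mem_centralizer_iff.1 (hQ.1 hu) s hs]
 have hQb : Q ≠ ⊥ := by
  apply hQ.ne_bot
  obtain ⟨m,hm,hmu⟩ := hlift t htX
  have hmS : m ∈ centralizer (S : Set N) := by
   rw [mem_centralizer_iff]
   intro s hs
   refine (hmu s ?_).symm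
   have : φ s ∈ zpowers y := hke ▸ ⟨s,hs,rfl⟩
   obtain ⟨e,he⟩ := this
   rw [←he]
   exact Commute.zpow_right (ht.comm hy) e
  have ho : orderOf t = 2 := orderOf_eq_prime (by rw [pow_two,ht.sq hy hb]) (by
   rintro rfl; exact hy.h0l ht.1)
  have h1 := orderOf_map_dvd φ m
  rw [hm,ho] at h1
  refine h1.trans ?_
  rw [←orderOf_mk m hmS]
  exact orderOf_dvd_natCard _
 obtain ⟨t',ht'X,b',hb',ht',hQt⟩ : ∃ t' ∈ φ.range,∃ b' < q,IsT q (Pf p g) (Mf p g) b' t' ∧ ∀ u ∈ Q,φ u = 1 ∨ φ u = t' := by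
  by_cases hcon : ∃ u ∈ Q,φ u ≠ 1
  ·obtain ⟨u,hu,hu1⟩ := hcon
   obtain ⟨b',hb',ht'⟩ := (hQ1 u hu).resolve_left hu1
   refine ⟨φ u,⟨u,rfl⟩,b',hb',ht',fun v hv => ?_⟩
   rcases hQ1 v hv with h1 | ⟨b2,hb2,h2⟩
   ·exact .inl h1
   ·right
    rcases hQ1 (v*u) (mul_mem hv hu) with h3 | ⟨b3, -,h3⟩
    ·rw [map_mul] at h3
     rw [eq_inv_of_mul_eq_one_left h3]
     exact inv_eq_of_mul_eq_one_left (ht'.sq hy hb')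
    ·have h4 := h3.1
     rw [map_mul,Perm.mul_apply,ht'.1,h2.2.1] at h4
     exact absurd h4 hy.h0l
  ·push Not at hcon
   exact ⟨t,htX,b,hb,ht,fun u hu => .inl (hcon u hu)⟩
 exact h.two hlift hQ.2.1 hQb hQg hQt (ht'.trans n n2 hy hx hxX hyX ht'X hb')
/-- the situation under study -/
structure St (A : Subgroup (MulAut N)) (p q g : ℕ) (φ : N →* Perm (Fin (p+1))) (x y : Perm (Fin (p+1))) : Prop where
 n : Num p q g
 n2 : Num2 p q g
 h : Core A φ
 hx : IsX p x
 hxX : x ∈ φ.range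
 yv : ∀ i : Fin (p+1),((y i : Fin (p+1)) : ℕ) = mf p g i
 hyX : y ∈ φ.range
lemma St.hy (s : St A p q g φ x y) : IsY y q (Pf p g) (Mf p g) := s.n.isY s.yv
lemma St.xI (s : St A p q g φ x y) (e : ℕ) : In φ.range (xe p e) := In.xe s.n.hp s.hx s.hxX e
lemma St.hyx (s : St A p q g φ x y) : y*x*y⁻¹ ∈ zpowers x := by
 suffices h1 : y*x = x^g*y by
  rw [h1,mul_inv_cancel_right]; exact pow_mem (mem_zpowers x) g
 apply Equiv.ext
 intro i
 apply Fin.ext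
 rw [Perm.mul_apply,Perm.mul_apply,s.yv,s.hx]
 by_cases hi : i = Fin.last p
 ·rw [hi,s.hy.yl,s.hx.pow_last,val_last,xf_last,mf_last]
 ·have h1 := lt_of_ne_last hi
  have hp := s.n.hp.pos
  have h2 := s.yv i
  rw [mf_lt h1] at h2
  have h3 := Nat.mod_lt (g*i) hp
  rw [s.hx.pow s.n.hp g (by rw [h2]; exact h3),h2,xf_lt h1,mf_lt (Nat.mod_lt _ hp),Nat.mul_mod_mod,Nat.mod_add_mod,mul_add,mul_one]
lemma St.noT (s : St A p q g φ x y) {b : ℕ} (hb : b < q) (htX : t ∈ φ.range) : ¬ IsT q (Pf p g) (Mf p g) b t :=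
 fun ht => s.h.brI s.n s.n2 s.hx s.hxX s.hyX s.hy s.hyx htX hb ht
lemma St.noAlt (s : St A p q g φ x y) (hA : alternatingGroup (Fin (p+1)) ≤ φ.range) : False := by
 have hpq := s.n.pq
 have hlt : ∀ k,g^k % p < p := fun k => Nat.mod_lt _ s.n.hp.pos
 have hv : ∀ i : Fin (p+1),((revPerm i : Fin (p+1)) : ℕ) = p - i := fun i => by
  rw [Fin.revPerm_apply,Fin.val_rev]; omega
 refine s.noT (t := revPerm) s.n.hq.pos (hA ?_) ⟨?_,?_,fun k => ?_,fun k => ?_⟩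
 ·rw [mem_alternatingGroup,Perm.sign_of_pow_two_eq_one (Equiv.ext fun i => by simp [pow_two])]
  have h0 : IsEmpty (Function.fixedPoints (revPerm : Perm (Fin (p+1)))) := ⟨fun ⟨i,hi⟩ => by
   have h1 := hv i
   rw [show revPerm i = i from hi] at h1; omega⟩
  rw [Fintype.card_eq_zero (α := Function.fixedPoints _),Fintype.card_fin,show (p+1 - 0) / 2 = q+1 by omega]
  exact Even.neg_one_pow ((s.n.hq.odd_of_ne_two (by have := s.n.q2; omega)).add_odd odd_one)
 ·apply Fin.ext; rw [hv]; simp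
 ·apply Fin.ext; rw [hv]; simp
 ·apply Fin.ext; rw [hv,s.n.Pv,s.n.Mv]; rfl
 ·apply Fin.ext
  have := hlt k
  rw [hv,s.n.Mv,Nat.sub_zero,s.hy.pP,s.n.Pv]; omega
lemma St.noThree (s : St A p q g φ x y) {f : ℕ → ℕ} (hf : In φ.range f)
  (h3 : ((List.range (p+1)).filter (fun v => !beq (f v) v)).length = 3) : False := by
 obtain ⟨c,hcX,hc⟩ := hf
 have hcard : c.support.card = 3 := by
  rw [←h3,←List.toFinset_card_of_nodup (List.Nodup.filter _ List.nodup_range),←Finset.card_map Fin.valEmbedding]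
  congr 1
  ext v
  simp only [Finset.mem_map,mem_support,Fin.valEmbedding_apply,List.mem_toFinset,List.mem_filter,List.mem_range,not_eq_true',eq_false_iff]
  constructor
  ·rintro ⟨i,hi,rfl⟩
   exact ⟨i.2,fun h => hi (Fin.ext ((hc i).trans (eq_of_beq_eq_true h)))⟩
  ·rintro ⟨hv,h⟩
   refine ⟨⟨v,hv⟩,fun he => h ?_,rfl⟩
   have := hc ⟨v,hv⟩
   rw [he] at this
   rw [←this]; exact beq_refl _
 exact s.noAlt (Perm.alternatingGroup_le_of_isPreprimitive_of_isThreeCycle_mem s.h.pre (card_support_eq_three_iff.1 hcard) hcX)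
lemma St.noZ (s : St A p q g φ x y) {c : Perm (Fin (p+1))} (hcX : c ∈ φ.range) (h0 : c 0 = 0) (hl : c (Fin.last p) = Fin.last p)
  (hP : ∀ k,c (Pf p g k) = Pf p g k) {b : ℕ} (hM : ∀ k,c (Mf p g k) = Mf p g (k+b)) : q ∣ b := by
 by_contra hb
 have hy := s.hy
 have hpos := s.n.hp.pos
 have hlt : ∀ k,g^k % p < p := fun k => Nat.mod_lt _ hpos
 have hz : ∀ j,In φ.range (zf p q (g^j % p)) := by
  intro j
  obtain ⟨e,he⟩ : ∃ e,b*e ≡ j [MOD q] := by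
   have hco : Coprime b q := ((Nat.Prime.coprime_iff_not_dvd s.n.hq).2 hb).symm
   obtain ⟨e, -,he⟩ := Nat.exists_mul_mod_eq_one_of_coprime hco (by have := s.n.q2; omega)
   refine ⟨e*j,?_⟩
   have : b*e ≡ 1 [MOD q] := by
    rw [Nat.ModEq,he,mod_eq_of_lt]; have := s.n.q2; omega
   have := this.mul_right j
   rwa [one_mul,mul_assoc] at this
  have hit : ∀ e k,(c^e) (Mf p g k) = Mf p g (k+b*e) := by
   intro e
   induction e with
   | zero => intro k; rfl
   | succ e ih => intro k; rw [pow_succ',Perm.mul_apply,ih,hM,mul_add,mul_one,add_assoc]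
  refine ⟨c^e,pow_mem hcX e,fun i => ?_⟩
  unfold zf
  have hbz : beq (0^q % p) (p - 1) = false := by
   rw [eq_false_iff]; intro h9
   have := eq_of_beq_eq_true h9
   rw [zero_pow s.n.hq.ne_zero,zero_mod] at this
   have := s.n.hp.one_lt; omega
  rcases hy.cov i with rfl | rfl | ⟨k,hk,rfl⟩ | ⟨k,hk,rfl⟩
  ·rw [pw h0,val_zero,hbz,Bool.and_false]; rfl
  ·rw [pw hl,val_last]
   have : blt p p = false := by
    rw [eq_false_iff]; intro h; rw [blt_eq] at h; exact lt_irrefl _ h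
   rw [this]; rfl
  ·have : beq ((g^k % p)^q % p) (p - 1) = false := by
    rw [eq_false_iff]; intro h9; exact s.n2.zP k hk (eq_of_beq_eq_true h9)
   rw [pw (hP k),s.n.Pv,this,Bool.and_false]; rfl
  ·have h1 := s.n.gpos k
   have h2 : g^j % p*(g^k % p) % p = g^(k+j) % p := by rw [←Nat.mul_mod,←pow_add,add_comm j]
   have h4 : p - g^k % p < p := by have := hlt k; omega
   rw [hit,s.n.Mv k,s.n2.zM k hk,show beq (p - 1) (p - 1) = true from beq_refl _,
    show blt (p - g^k % p) p = true from blt_eq ▸ h4,Bool.and_self,cond_true,mul_sub_mod (hlt k) (by rw [h2]; exact s.n.gpos _),h2,←s.n.Mv]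
   congr 1
   rw [←hy.symm.mod,←hy.symm.mod (k+j)]
   congr 1
   exact Nat.ModEq.add_left k he
 obtain ⟨a,i,b',m,h3⟩ := s.n2.three
 exact s.noThree (((hz a).comp ((s.xI i).comp ((hz b').comp (s.xI (p - i))))).iter m) h3
lemma St.cent (s : St A p q g φ x y) {c : Perm (Fin (p+1))} (hcX : c ∈ φ.range) (hc : c*y = y*c) : ∃ j : ℕ,c = y^j := by
 refine s.hy.centOdd ?_ s.hyX (fun b hb c hc => s.noT hb hc) ?_ hcX hc
 ·rintro _ ⟨u,rfl⟩; exact s.h.even (by have := s.n.pq; have := s.n.q2; omega) u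
 ·intro c hc h0 hl hP b hM; exact s.noZ hc h0 hl hP hM
end core
end Mn
namespace Mn
open MulAction
lemma syl_cent {G : Type*} [Group G] [Finite G] {W : Subgroup G} {u : G} {r : ℕ} (hr : r.Prime) (ho : orderOf u = r) (hu : u ∈ W)
  (hC : ∀ c ∈ W,c*u = u*c → c ∈ zpowers u) : IsSyl r (zpowers u) W := by
 have : Fact r.Prime := ⟨hr⟩
 have hou : orderOf (⟨u,hu⟩ : W) = r := (orderOf_mk u hu).trans ho
 have hpg : IsPGroup r (zpowers (⟨u,hu⟩ : W)) := of_card (n := 1) (by rw [card_zpowers,hou,pow_one])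
 obtain ⟨P,hP⟩ := hpg.exists_le_sylow
 have huP : (⟨u,hu⟩ : W) ∈ P := hP (mem_zpowers _)
 have hne : (⟨⟨u,hu⟩,huP⟩ : P) ≠ 1 := fun h => by
  have h1 : (⟨u,hu⟩ : W) = 1 := congrArg Subtype.val h
  rw [h1,orderOf_one] at hou
  exact hr.one_lt.ne hou
 have : Nontrivial P := ⟨⟨_,_,hne⟩⟩
 have := P.isPGroup'.center_nontrivial
 obtain ⟨⟨z,hz⟩,hz1⟩ := exists_ne (1 : center P)
 have hcz := mem_center_iff.1 hz
 have h1 : ((z : W) : G) ∈ zpowers u := hC _ (z : W).2 (congrArg (fun v : P => ((v : W) : G)) (hcz ⟨⟨u,hu⟩,huP⟩)).symm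
 have h2 : zpowers ((z : W) : G) = zpowers u := by
  apply eq_of_le_of_card_ge (by rwa [zpowers_le])
  have h3 := card_dvd_of_le (show zpowers ((z : W) : G) ≤ zpowers u by rwa [zpowers_le])
  rw [card_zpowers u,ho] at h3 ⊢
  rcases (dvd_prime hr).1 h3 with h4 | h4
  ·exfalso; apply hz1
   rw [card_zpowers,orderOf_eq_one_iff] at h4
   exact Subtype.ext (Subtype.ext (Subtype.ext h4))
  ·exact h4.ge
 have h3 : zpowers u = P.map W.subtype := by
  apply le_antisymm
  ·rw [zpowers_le]; exact ⟨⟨u,hu⟩,huP,rfl⟩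
  ·rintro _ ⟨c,hc,rfl⟩
   apply hC _ c.2
   have h4 : u ∈ zpowers ((z : W) : G) := h2 ▸ mem_zpowers u
   obtain ⟨k,hk⟩ := h4
   rw [←hk]
   exact Commute.zpow_right (congrArg (fun v : P => ((v : W) : G)) (hcz ⟨c,hc⟩)) k
 rw [h3]
 refine ⟨map_subtype_le _,P.isPGroup'.map _,?_⟩
 have : (P.map W.subtype).subgroupOf W = P := Subgroup.comap_map_eq_self_of_injective W.subtype_injective _
 rw [relIndex,this]
 exact P.not_dvd_index
def nf (p i : ℕ) : ℕ := bif beq i p then 0 else bif beq i 0 then p else p - i^(p - 2) % p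
def Wf (p g i k j v : ℕ) : ℕ := xe p i (mf p (g^k % p) (nf p (xe p j v)))
def okR (p g i k j i' k' j' : ℕ) (E : List ℕ) : Bool :=
 chk (p+1) (fun v => beq (Wf p g i k j (nf p v)) (nf p (Wf p g i k j v))) &&
 chk (p+1) (fun v => beq (Wf p g i' k' j' (nf p v)) (nf p (Wf p g i' k' j' v))) &&
 chk (p+1) (fun v => beq ((Wf p g i k j)^[E.getD v 0 / 2] ((Wf p g i' k' j')^[E.getD v 0 % 2] 0)) v)
/-- even more numerical data -/
structure Num3 (p q g : ℕ) : Prop where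
 nP : ∀ i < q,nf p (g^i % p) = p - g^((q - 1)*i) % p
 nM : ∀ i < q,nf p (p - g^i % p) = g^((q - 1)*i) % p
 ok : ∃ i k j i' k' j' E,okR p g i k j i' k' j' E = true
set_option maxRecDepth 100000 in
lemma num3_11 : Num3 11 5 3 := ⟨by decide +kernel,by decide +kernel,5,4,5,1,2,10,[0,7,2,11,3,8,4,5,9,10,1,6],by decide +kernel⟩
set_option maxRecDepth 100000 in
lemma num3_23 : Num3 23 11 2 := ⟨by decide +kernel,by decide +kernel,5,8,5,2,6,21,[0,6,13,9,17,14,23,16,7,2,20,1,3,4,22,21,8,5,10,11,19,15,18,12],by decide +kernel⟩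
set_option maxRecDepth 100000 in
lemma num3_47 : Num3 47 23 2 := ⟨by decide +kernel,by decide +kernel,7,19,7,2,9,45,[0,36,25,23,8,17,42,26,30,9,20,10,16,39,44,7,37,34,15,43,2,3,5,1,35,31,33,46,41,21,14,47,29,4,45,32,38,28,27,18,22,6,19,40,13,11,12,24],by decide +kernel⟩
section core
variable {N : Type*} [Group N] [Finite N] {A : Subgroup (MulAut N)} {p q g : ℕ} {φ : N →* Perm (Fin (p+1))} {x y w : Perm (Fin (p+1))}
 {P M : ℕ → Fin (p+1)}
/-- the elements inverting `y` -/
def IsR (q : ℕ) (P M : ℕ → Fin (p+1)) (k : ℕ) (w : Perm (Fin (p+1))) : Prop :=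
 w 0 = Fin.last p ∧ w (Fin.last p) = 0 ∧ (∀ i,w (P i) = M (k+(q - 1)*i)) ∧ ∀ i,w (M i) = P (k+(q - 1)*i)
lemma IsY.inv_of (h : IsY y q P M) {k : ℕ} (hw : w*y*w⁻¹ = y⁻¹) {P' : ℕ → Fin (p+1)} (hP' : P' = P ∨ P' = M) (h0 : w (P 0) = P' k) (i : ℕ) :
  w (P i) = P' (k+(q - 1)*i) := by
 have h1 : ∀ j,(y^j) (P' k) = P' (k+j) := by
  rcases hP' with rfl | rfl
  ·exact h.pow k
  ·exact h.symm.pow k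
 have h2 : w*y^i = y^((q - 1)*i)*w := by
  have h3 : y⁻¹ = y^(q - 1) := by
   rw [inv_eq_iff_mul_eq_one,←pow_succ',Nat.sub_add_cancel h.qp.pos,h.powq]
  rw [pow_mul,←h3,←hw,conj_pow]; group
 have h4 : P i = (y^i) (P 0) := by rw [h.pow,zero_add]
 rw [h4,←Perm.mul_apply,h2,Perm.mul_apply,h0,h1]
lemma IsY.iff (h : IsY y q P M) {a b : ℕ} : P a = P b ↔ (a : ZMod q) = b := by
 rw [ZMod.natCast_eq_natCast_iff]
 constructor
 ·intro he
  rcases le_total a b with hab | hab <;> obtain ⟨l,rfl⟩ := Nat.exists_eq_add_of_le hab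
  ·exact ((Nat.modEq_zero_iff_dvd.2 (h.eqP he.symm)).add_left a).symm
  ·exact (Nat.modEq_zero_iff_dvd.2 (h.eqP he)).add_left b
 ·intro he
  rw [←h.mod a,←h.mod b]; exact congrArg P he
lemma IsY.cq (h : IsY y q P M) : ((q - 1 : ℕ) : ZMod q) = -1 ∧ ∃ r : ℕ,(2 : ZMod q)*r = 1 := by
 have h1 := h.qp.one_lt
 refine ⟨by rw [Nat.cast_sub h1.le,ZMod.natCast_self]; simp,(q+1) / 2,?_⟩
 have h2 : 2*((q+1) / 2) = q+1 := by
  have := (h.qp.odd_of_ne_two (by have := h.q2; omega)).add_odd odd_one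
  obtain ⟨m,hm⟩ := this; omega
 have := congrArg (Nat.cast : ℕ → ZMod q) h2
 push_cast at this
 rw [this,ZMod.natCast_self,zero_add]
lemma IsR.zero_of (h : IsY y q P M) {k : ℕ} (hw : IsR q P M k w) : ∃ j : ℕ,IsR q P M 0 (y^j*w*(y^j)⁻¹) := by
 obtain ⟨h1,r,hr⟩ := h.cq
 obtain ⟨h0,hl,hP,hM⟩ := hw
 refine ⟨(q - 1)*(r*k),?_⟩
 have hi : ∀ {P M : ℕ → Fin (p+1)} (h : IsY y q P M) (j i),(y^j)⁻¹ (P i) = P (i+(q - 1)*j) := fun h j i => by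
  rw [inv_eq_iff_eq,h.pow,h.iff]; push_cast; rw [h1]; ring
 have h0' : ∀ j,(y^j)⁻¹ 0 = 0 := fun j => by rw [inv_eq_iff_eq,pw h.y0]
 have hl' : ∀ j,(y^j)⁻¹ (Fin.last p) = Fin.last p := fun j => by rw [inv_eq_iff_eq,pw h.yl]
 refine ⟨?_,?_,fun i => ?_,fun i => ?_⟩ <;> simp only [Perm.mul_apply]
 ·rw [h0',h0,pw h.yl]
 ·rw [hl',hl,pw h.y0]
 ·rw [hi h,hP,h.symm.pow,h.symm.iff]; push_cast; rw [h1]; linear_combination (-k : ZMod q)*hr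
 ·rw [hi h.symm,hM,h.pow,h.iff]; push_cast; rw [h1]; linear_combination (-k : ZMod q)*hr
/-- involutions inverting `y` -/
lemma IsY.isR (h : IsY y q P M) (hw : w*y*w⁻¹ = y⁻¹) (h0 : w 0 = Fin.last p) (h2 : w*w = 1) (hs : Perm.sign w = 1) : ∃ k,IsR q P M k w := by
 have hww : ∀ i,w (w i) = i := fun i => by rw [←Perm.mul_apply,h2]; rfl
 have hl : w (Fin.last p) = 0 := by rw [←h0,hww]
 obtain ⟨h1,r,hr⟩ := h.cq
 rcases h.cov (w (P 0)) with h3 | h3 | ⟨k, -,h3⟩ | ⟨k, -,h3⟩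
 ·exact absurd (by rw [←hww (P 0),h3,h0]) (h.neP 0).2
 ·exact absurd (by rw [←hww (P 0),h3,hl]) (h.neP 0).1
 ·exfalso
  have hP := h.inv_of hw (.inl rfl) h3
  obtain ⟨l,hl3⟩ : ∃ l,w (M 0) = M l := by
   rcases h.cov (w (M 0)) with h4 | h4 | ⟨l, -,h4⟩ | ⟨l, -,h4⟩
   ·exact absurd (by rw [←hww (M 0),h4,h0]) (h.symm.neP 0).2
   ·exact absurd (by rw [←hww (M 0),h4,hl]) (h.symm.neP 0).1
   ·exact absurd (by rw [←hww (M 0),h4,hP]) (h.nePM _ 0).symm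
   ·exact ⟨l,h4⟩
  have hM := h.symm.inv_of hw (.inl rfl) hl3
  have hfix : ∀ {P M : ℕ → Fin (p+1)} (h : IsY y q P M) {k} (hP : ∀ i,w (P i) = P (k+(q - 1)*i)) i,w (P i) = P i ↔ P i = P (r*k) := by
   intro P M h k hP i
   rw [hP,h.iff,h.iff]; push_cast; rw [h1]
   constructor
   ·intro h5; linear_combination (-i : ZMod q)*hr - (r : ZMod q)*h5
   ·intro h5; linear_combination (-2 : ZMod q)*h5 - (k : ZMod q)*hr
  have hsup : w.support = univ \ {P (r*k),M (r*l)} := by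
   ext i
   rw [mem_support,mem_sdiff,mem_insert,mem_singleton,not_or]
   simp only [mem_univ,true_and]
   rcases h.cov i with rfl | rfl | ⟨j, -,rfl⟩ | ⟨j, -,rfl⟩
   ·simp [h0,h.h0l.symm,(h.neP _).1.symm,(h.symm.neP _).1.symm]
   ·simp [hl,h.h0l,(h.neP _).2.symm,(h.symm.neP _).2.symm]
   ·simp [hfix h hP,h.nePM]
   ·simp [hfix h.symm hM,(h.nePM _ _).symm]
  have hc : w.support.card = 2*q := by
   rw [hsup,Finset.card_sdiff_of_subset (subset_univ _),card_univ,Fintype.card_fin,card_pair (h.nePM _ _),h.card]; omega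
  have := odd_inv (by rw [pow_two,h2]) hc (h.qp.odd_of_ne_two (by have := h.q2; omega))
  rw [hs] at this
  exact absurd this (by decide)
 ·have hP := h.inv_of hw (.inr rfl) h3
  refine ⟨k,h0,hl,hP,h.symm.inv_of hw (.inr rfl) ?_⟩
  rw [←hww (P k),hP]
  congr 1
  rw [h.symm.iff]; push_cast; rw [h1]; ring
lemma St.transR (s : St A p q g φ x y) (n3 : Num3 p q g) {k : ℕ} (hw : IsR q (Pf p g) (Mf p g) k w) (hwX : w ∈ φ.range) (j : Fin (p+1)) :
  ∃ c ∈ φ.range,c*w = w*c ∧ c 0 = j := by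
 have hy := s.hy
 have hpos := s.n.hp.pos
 obtain ⟨e,he⟩ := hw.zero_of hy
 have hX := mul_mem (mul_mem (pow_mem s.hyX e) hwX) (inv_mem (pow_mem s.hyX e))
 obtain ⟨t,ht⟩ : ∃ t,t = y^e*w*(y^e)⁻¹ := ⟨_,rfl⟩
 rw [←ht] at he hX
 obtain ⟨h0,hl,hP,hM⟩ := he
 have htv : ∀ i : Fin (p+1),((t i : Fin (p+1)) : ℕ) = nf p i := by
  intro i
  rcases hy.cov i with rfl | rfl | ⟨k,hk,rfl⟩ | ⟨k,hk,rfl⟩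
  ·rw [h0]
   unfold nf
   rw [val_zero,show beq 0 p = false by rw [eq_false_iff]; intro h9; exact hpos.ne (eq_of_beq_eq_true h9)]; simp
  ·rw [hl]; unfold nf; simp
  ·rw [hP,s.n.Pv,s.n.Mv,n3.nP k hk,zero_add]
  ·rw [hM,s.n.Pv,s.n.Mv,n3.nM k hk,zero_add]
 have htI : In φ.range (nf p) := ⟨t,hX,htv⟩
 have hyI : ∀ k,In φ.range (mf p (g^k % p)) := fun k => In.congr (In.iter ⟨y,s.hyX,s.yv⟩ k) (mf_iter hpos k)
 obtain ⟨i,k1,j1,i',k',j',E,hok⟩ := n3.ok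
 simp only [okR,and_eq_true] at hok
 obtain ⟨⟨h1,h2⟩,h3⟩ := hok
 have hW : ∀ i k j,chk (p+1) (fun v => beq (Wf p g i k j (nf p v)) (nf p (Wf p g i k j v))) = true →
   ∃ c ∈ φ.range,c*t = t*c ∧ ∀ m (v : Fin (p+1)),(((c^m) v : Fin (p+1)) : ℕ) = (Wf p g i k j)^[m] v := by
  intro i k j hc
  obtain ⟨c,hcX,hcv⟩ := (s.xI i).comp ((hyI k).comp (htI.comp (s.xI j)))
  refine ⟨c,hcX,Equiv.ext fun v => Fin.ext ?_,fun m => ?_⟩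
  ·rw [Perm.mul_apply,Perm.mul_apply,hcv,htv,htv,hcv]
   exact chk_eq hc v v.2
  ·induction m with
   | zero => intro v; rfl
   | succ m ih => intro v; rw [pow_succ',Perm.mul_apply,hcv,ih,iterate_succ_apply']; rfl
 obtain ⟨c1,hc1,hc1t,hc1v⟩ := hW _ _ _ h1
 obtain ⟨c2,hc2,hc2t,hc2v⟩ := hW _ _ _ h2
 obtain ⟨j0,hj0⟩ : ∃ j0,j0 = (y^e) j := ⟨_,rfl⟩
 have hj : ((c1^(E.getD j0 0 / 2)*c2^(E.getD j0 0 % 2)) 0 : Fin (p+1)) = j0 := Fin.ext (by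
  rw [Perm.mul_apply,hc1v,hc2v]
  exact chk_eq h3 j0 j0.2)
 have hct : (c1^(E.getD j0 0 / 2)*c2^(E.getD j0 0 % 2))*t = t*(c1^(E.getD j0 0 / 2)*c2^(E.getD j0 0 % 2)) :=
  Commute.mul_left (Commute.pow_left hc1t _) (Commute.pow_left hc2t _)
 have hcX := mul_mem (pow_mem hc1 (E.getD j0 0 / 2)) (pow_mem hc2 (E.getD j0 0 % 2))
 generalize c1^(E.getD j0 0 / 2)*c2^(E.getD j0 0 % 2) = c at hj hct hcX
 refine ⟨(y^e)⁻¹*c*y^e,mul_mem (mul_mem (inv_mem (pow_mem s.hyX e)) hcX) (pow_mem s.hyX e),?_,?_⟩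
 ·rw [ht] at hct
  have := congrArg (fun v => (y^e)⁻¹*v*y^e) hct
  simp only [mul_assoc,inv_mul_cancel_left,mul_one,inv_mul_cancel] at this ⊢
  exact this
 ·rw [Perm.mul_apply,Perm.mul_apply,pw hy.y0,hj,hj0]
  exact (y^e).symm_apply_apply j
end core
end Mn
namespace Mn
open MulAction
lemma nz {G : Type*} [Group G] [Finite G] {c u : G} : c ∈ normalizer (zpowers u : Set G) ↔ c*u*c⁻¹ ∈ zpowers u := by
 refine ⟨fun h => (mem_normalizer_iff.1 h u).1 (mem_zpowers u),fun h => ?_⟩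
 rw [Subgroup.mem_normalizer_iff_map_conj_eq]
 apply eq_of_le_of_card_ge
 ·rw [map_zpowers,zpowers_le]; exact h
 ·rw [card_map_of_injective (MulAut.conj c).injective]
section core
variable {N : Type*} [Group N] [Finite N] {A : Subgroup (MulAut N)} {p q g : ℕ} {φ : N →* Perm (Fin (p+1))} {x y w : Perm (Fin (p+1))}
lemma St.hsyl (s : St A p q g φ x y) : IsSyl q (zpowers y) φ.range :=
 syl_cent s.n.hq s.hy.order s.hyX fun c hc hcy => by
  obtain ⟨j,rfl⟩ := s.cent hc hcy
  exact pow_mem (mem_zpowers y) j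
lemma St.swap (s : St A p q g φ x y) : ∃ w ∈ φ.range,w*y*w⁻¹ ∈ zpowers y ∧ w 0 = Fin.last p ∧ w (Fin.last p) = 0 := by
 have : Fact q.Prime := ⟨s.n.hq⟩
 have hy := s.hy
 obtain ⟨n,h1,h2⟩ := s.h.tt 0 (Fin.last p) (Fin.last p) 0 hy.h0l hy.h0l.symm
 obtain ⟨c,hc⟩ : ∃ c,c = φ n := ⟨_,rfl⟩
 rw [←hc] at h1 h2
 have hcX : c ∈ φ.range := ⟨n,hc.symm⟩
 let W : Subgroup (Perm (Fin (p+1))) := φ.range ⊓ (stabilizer _ (0 : Fin (p+1)) ⊓ stabilizer _ (Fin.last p))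
 have hW : ∀ v,v ∈ W ↔ v ∈ φ.range ∧ v 0 = 0 ∧ v (Fin.last p) = Fin.last p := fun v => Iff.rfl
 have hyW : y ∈ W := ⟨s.hyX,hy.y0,hy.yl⟩
 have e1 : IsSyl q (zpowers y) W := syl_cent s.n.hq hy.order hyW fun v hv hvy => by
  obtain ⟨j,rfl⟩ := s.cent hv.1 hvy
  exact pow_mem (mem_zpowers y) j
 have e2 : IsSyl q (cj c (zpowers y)) W := by
  have := e1.map (MulAut.conj c).toMonoidHom
  rwa [show W.map (MulAut.conj c).toMonoidHom = W from ?_] at this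
  have hi1 : c⁻¹ (Fin.last p) = 0 := by rw [inv_eq_iff_eq,h1]
  have hi2 : c⁻¹ 0 = Fin.last p := by rw [inv_eq_iff_eq,h2]
  apply eq_of_le_of_card_ge
  ·rintro _ ⟨v,hv,rfl⟩
   obtain ⟨a1,a2,a3⟩ := (hW v).1 hv
   refine (hW _).2 ⟨mul_mem (mul_mem hcX a1) (inv_mem hcX),?_,?_⟩
   ·change c (v (c⁻¹ 0)) = 0; rw [hi2,a3,h2]
   ·change c (v (c⁻¹ (Fin.last p))) = _; rw [hi1,a2,h1]
  ·rw [card_map_of_injective (MulAut.conj c).injective]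
 obtain ⟨v,hv,he⟩ := e1.conj e2
 obtain ⟨a1,a2,a3⟩ := (hW v).1 hv
 refine ⟨v⁻¹*c,mul_mem (inv_mem a1) hcX,?_,?_,?_⟩
 ·rw [←nz,cj_normalizer,←cj_cj,he,cj_cj,inv_mul_cancel]
  ext z; rw [mem_cj]; simp
 ·rw [Perm.mul_apply,h1,inv_eq_iff_eq,a3]
 ·rw [Perm.mul_apply,h2,inv_eq_iff_eq,a2]
/-- involutions among the swapping elements -/
lemma St.swap2 (s : St A p q g φ x y) (hA : ∀ c ∈ φ.range,∀ m,c^2^m = 1 → c*y*c⁻¹ ∈ zpowers y → c*y*c⁻¹ = y ∨ c*y*c⁻¹ = y⁻¹)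
  {c : Perm (Fin (p+1))} (hcX : c ∈ φ.range) {m : ℕ} (hm : c^2^m = 1) (hcy : c*y*c⁻¹ ∈ zpowers y) (h0 : c 0 = Fin.last p) :
  c*y*c⁻¹ = y⁻¹ ∧ c*c = 1 ∧ ∃ k,IsR q (Pf p g) (Mf p g) k c := by
 have hy := s.hy
 have hpq := s.n.pq
 have hq2 := s.n.q2
 rcases hA c hcX m hm hcy with h1 | h1
 ·exfalso
  obtain ⟨j,rfl⟩ := s.cent hcX (mul_inv_eq_iff_eq_mul.1 h1)
  rw [pw hy.y0] at h0
  exact hy.h0l h0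
 ·have h2 : c*c = 1 := by
   have h3 : c*y⁻¹*c⁻¹ = y := by rw [show c*y⁻¹*c⁻¹ = (c*y*c⁻¹)⁻¹ by group,h1,inv_inv]
   obtain ⟨j,hj⟩ := s.cent (mul_mem hcX hcX) (show c*c*y = y*(c*c) by
    have : c*c*y*(c*c)⁻¹ = y := by
     rw [show c*c*y*(c*c)⁻¹ = c*(c*y*c⁻¹)*c⁻¹ by group,h1,h3]
    rwa [mul_inv_eq_iff_eq_mul] at this)
   have h4 : c*y^j*c⁻¹ = (y^j)⁻¹ := by rw [←conj_pow,h1,inv_pow]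
   rw [←hj,←mul_assoc,mul_inv_cancel_right,hj,eq_inv_iff_mul_eq_one,←pow_add,←two_mul,←orderOf_dvd_iff_pow_eq_one,hy.order] at h4
   rw [hj,←orderOf_dvd_iff_pow_eq_one,hy.order]
   exact (Coprime.dvd_mul_left ((Nat.coprime_primes s.n.hq prime_two).2 (by omega))).1 h4
  obtain ⟨n,rfl⟩ := hcX
  exact ⟨h1,h2,hy.isR h1 h0 h2 (s.h.even (by omega) n)⟩
/-- the second branch -/
lemma St.brII (s : St A p q g φ x y) (n3 : Num3 p q g)
  (hA : ∀ c ∈ φ.range,∀ m,c^2^m = 1 → c*y*c⁻¹ ∈ zpowers y → c*y*c⁻¹ = y ∨ c*y*c⁻¹ = y⁻¹) : False := by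
 have hy := s.hy
 have hp := s.n.hp
 have hpq := s.n.pq
 have hq2 := s.n.q2
 have : Fact q.Prime := ⟨s.n.hq⟩
 have : Fact (Nat.Prime 2) := ⟨prime_two⟩
 obtain ⟨w,hwX,hwy,hw0,m,hwm⟩ : ∃ w ∈ φ.range,w*y*w⁻¹ ∈ zpowers y ∧ w 0 = Fin.last p ∧ ∃ m,w^2^m = 1 := by
  obtain ⟨w,hwX,hwy,hw0,hwl⟩ := s.swap
  obtain ⟨m,r,⟨r',hr⟩,ho⟩ := Nat.exists_eq_two_pow_mul_odd (orderOf_pos w).ne'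
  refine ⟨w^r,pow_mem hwX r,nz.1 (pow_mem (nz.2 hwy) r),?_,m,?_⟩
  ·rw [hr,pow_succ,Perm.mul_apply,hw0,pow_mul]
   apply pw; rw [pow_two,Perm.mul_apply,hwl,hw0]
  ·rw [←pow_mul,mul_comm,←ho,pow_orderOf_eq_one]
 obtain ⟨hwi,hw2,k,hwk⟩ := s.swap2 hA hwX hwm hwy hw0
 obtain ⟨S,hS,hSy⟩ := s.h.syl_lift s.hsyl
 have hlift := s.h.lift hp (by omega) (by omega) s.n.d3 s.hx s.hxX
 obtain ⟨Q,hQ⟩ := exists_syl 2 (normalizer (S : Set N))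
 have hQg : Good A Q := Good.sub s.h.inn hS.good (normalizer_aut S) hQ
 have hQ1 : ∀ u ∈ Q,φ u = 1 ∨ φ u*φ u = 1 ∧ ∃ k,IsR q (Pf p g) (Mf p g) k (φ u) := by
  intro u hu
  obtain ⟨m,hm⟩ := hQ.2.1 ⟨u,hu⟩
  have hm : u^2^m = 1 := congrArg Subtype.val hm
  have hm : φ u^2^m = 1 := by rw [←map_pow,hm,map_one]
  have huy : φ u*y*(φ u)⁻¹ ∈ zpowers y := by
   have hyS : y ∈ S.map φ := hSy ▸ mem_zpowers y
   obtain ⟨r,hr,hr2⟩ := hyS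
   rw [←hSy]
   exact ⟨u*r*u⁻¹,(mem_normalizer_iff.1 (hQ.1 hu) r).1 hr,by simp [hr2]⟩
  by_cases h0 : φ u 0 = Fin.last p
  ·exact .inr (s.swap2 hA ⟨u,rfl⟩ hm huy h0).2
  ·left
   obtain ⟨j,hj⟩ : ∃ j : ℕ,φ u = y^j := by
    apply s.cent ⟨u,rfl⟩
    rcases hA _ ⟨u,rfl⟩ m hm huy with h1 | h1
    ·exact mul_inv_eq_iff_eq_mul.1 h1
    ·exfalso
     have h3 : w*y⁻¹*w⁻¹ = y := by rw [show w*y⁻¹*w⁻¹ = (w*y*w⁻¹)⁻¹ by group,hwi,inv_inv]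
     obtain ⟨j,hj⟩ := s.cent (mul_mem hwX ⟨u,rfl⟩) (show w*φ u*y = y*(w*φ u) by
      have : w*φ u*y*(w*φ u)⁻¹ = y := by
       rw [show w*φ u*y*(w*φ u)⁻¹ = w*(φ u*y*(φ u)⁻¹)*w⁻¹ by group,h1,h3]
      rwa [mul_inv_eq_iff_eq_mul] at this)
     have h4 := congrArg (fun e : Perm (Fin (p+1)) => e 0) hj
     simp only [Perm.mul_apply,pw hy.y0] at h4
     exact h0 (w.injective (h4.trans hwk.2.1.symm))
   rw [hj] at hm ⊢
   rw [←pow_mul,←orderOf_dvd_iff_pow_eq_one,hy.order] at hm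
   rw [←orderOf_dvd_iff_pow_eq_one,hy.order]
   exact (Coprime.dvd_mul_right (Coprime.pow_right m ((Nat.coprime_primes s.n.hq prime_two).2 (by omega)))).1 hm
 have hQb : Q ≠ ⊥ := by
  apply hQ.ne_bot
  obtain ⟨n,rfl⟩ := hwX
  obtain ⟨r,hr,hrw⟩ := hS.lift φ n (by rw [hSy]; exact nz.2 hwy)
  have ho : orderOf (φ n) = 2 := orderOf_eq_prime (by rw [pow_two,hw2]) (by
   intro h1; rw [h1] at hw0; exact hy.h0l hw0)
  have h1 := orderOf_map_dvd φ r
  rw [hrw,ho] at h1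
  refine h1.trans ?_
  rw [←orderOf_mk r hr]
  exact orderOf_dvd_natCard _
 obtain ⟨t',ht'X,k',ht',hQt⟩ : ∃ t' ∈ φ.range,∃ k',IsR q (Pf p g) (Mf p g) k' t' ∧ ∀ u ∈ Q,φ u = 1 ∨ φ u = t' := by
  by_cases hcon : ∃ u ∈ Q,φ u ≠ 1
  ·obtain ⟨u,hu,hu1⟩ := hcon
   obtain ⟨hu2,k',hk'⟩ := (hQ1 u hu).resolve_left hu1
   refine ⟨φ u,⟨u,rfl⟩,k',hk',fun v hv => ?_⟩
   rcases hQ1 v hv with h1 | ⟨-,b2,h2⟩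
   ·exact .inl h1
   ·right
    rcases hQ1 (v*u) (mul_mem hv hu) with h3 | ⟨-,b3,h3⟩
    ·rw [map_mul] at h3
     rw [eq_inv_of_mul_eq_one_left h3]
     exact inv_eq_of_mul_eq_one_left hu2
    ·have h4 := h3.1
     rw [map_mul,Perm.mul_apply,hk'.1,h2.2.1] at h4
     exact absurd h4 hy.h0l
  ·push Not at hcon
   exact ⟨w,hwX,k,hwk,fun u hu => .inl (hcon u hu)⟩
 exact s.h.two hlift hQ.2.1 hQb hQg hQt (s.transR n3 ht' ht'X)
/-- the degrees 24 and 48 -/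
lemma St.big (s : St A p q g φ x y) (n3 : Num3 p q g) (h4 : q % 4 = 3) : False := by
 have : Fact q.Prime := ⟨s.n.hq⟩
 have hy := s.hy
 refine s.brII n3 fun c hc m hm hcy => ?_
 obtain ⟨a,ha⟩ := (mem_powers_iff_mem_zpowers).2 hcy
 simp only at ha
 have hit : ∀ i,c^i*y*(c^i)⁻¹ = y^a^i := by
  intro i
  induction i with
  | zero => simp
  | succ i ih =>
   rw [show c^(i+1)*y*(c^(i+1))⁻¹ = c^i*(c*y*c⁻¹)*(c^i)⁻¹ by rw [pow_succ]; group,←ha,←conj_pow,ih,←pow_mul,←pow_succ]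
 have hmod : ∀ {i j : ℕ},y^i = y^j ↔ (i : ZMod q) = j := by
  intro i j; rw [pow_eq_pow_iff_modEq,hy.order,ZMod.natCast_eq_natCast_iff]
 have h1 := hit (2^m)
 rw [hm,one_mul,inv_one,mul_one] at h1
 have h2 : (a : ZMod q)^2^m = 1 := by
  have := hmod (i := 1) (j := a^2^m)
  rw [pow_one] at this
  have := this.1 h1
  push_cast at this; exact this.symm
 have h0 : (a : ZMod q) ≠ 0 := by
  intro h; rw [h,zero_pow (by positivity)] at h2; exact zero_ne_one h2
 have h3 := ZMod.pow_card_sub_one_eq_one h0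
 have h5 : orderOf (a : ZMod q) ∣ Nat.gcd (2^m) (q - 1) := Nat.dvd_gcd (orderOf_dvd_of_pow_eq_one h2) (orderOf_dvd_of_pow_eq_one h3)
 have h6 : Nat.gcd (2^m) (q - 1) ∣ 2 := by
  rw [show q - 1 = 2*(q / 2) by omega]
  have : Coprime (2^m) (q / 2) := Coprime.pow_left m ((Nat.coprime_two_left).2 (Nat.odd_iff.2 (by omega)))
  rw [Coprime.gcd_mul_right_cancel_right _ this.symm]
  exact Nat.gcd_dvd_right _ _
 have h7 : (a : ZMod q)^2 = 1 := orderOf_dvd_iff_pow_eq_one.1 (h5.trans h6)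
 rcases sq_eq_one_iff.1 h7 with h8 | h8
 ·left; rw [←ha]
  have := hmod (i := a) (j := 1)
  rw [pow_one] at this
  exact this.2 (by rw [h8]; simp)
 ·right; rw [←ha,eq_inv_iff_mul_eq_one,←pow_succ]
  have := hmod (i := a+1) (j := 0)
  rw [pow_zero] at this
  exact this.2 (by push_cast; rw [h8]; simp)
end core
end Mn
namespace Mn
open MulAction
lemma IsSyl.modEq {G : Type*} [Group G] [Finite G] {p : ℕ} [Fact p.Prime] {T W : Subgroup G} (h : IsSyl p T W) :
  ∃ k,Nat.card W = Nat.card (W ⊓ normalizer (T : Set G) : Subgroup G)*k ∧ k % p = 1 := by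
 have e1 : IsPGroup p (T.subgroupOf W) := h.2.1.comap_of_injective W.subtype W.subtype_injective
 let P := e1.toSylow h.2.2
 have hP : (P : Subgroup W) = T.subgroupOf W := rfl
 have h1 := card_sylow_modEq_one p W
 rw [Sylow.card_eq_index_normalizer P] at h1
 refine ⟨_,?_,Eq.trans (b := 1 % p) h1 (mod_eq_of_lt (Fact.out (p := p.Prime)).one_lt)⟩
 rw [←card_mul_index (normalizer ((P : Subgroup W) : Set W))]
 congr 1
 rw [hP,←Subgroup.subgroupOf_normalizer_eq h.1,←Subgroup.inf_subgroupOf_left,card_congr (Subgroup.subgroupOfEquivOfLe (inf_le_left : W ⊓ normalizer (T : Set G) ≤ W)).toEquiv]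
lemma ar1 : ∀ a < 129,∀ b < 190,a ∣ 128 ∧ b ∣ 189 ∧ a*b % 5 = 4 ∧ (a*b % 11 = 4 ∨ a*b % 11 = 8) → a*b = 4 ∨ a*b = 224 := by decide +kernel
lemma ar2 {n k l w : ℕ} (h1 : 1980 ∣ n) (h2 : n ∣ 239500800) (h3 : ¬ 25 ∣ n) (h4 : n = 20*k) (h5 : k % 5 = 1) (h6 : n = w*l) (h7 : l % 11 = 1)
  (h8 : w = 55 ∨ w = 110) : n = 7920 ∨ n = 443520 := by
 obtain ⟨j,rfl⟩ := h1
 have h9 : j % 5 = 4 := by clear h2 h3; omega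
 have h10 : j % 11 = 4 ∨ j % 11 = 8 := by
  clear h2 h3 h4 h5 h9
  rcases h8 with h8 | h8
  ·have h6 : l = 36*j := by rw [h8] at h6; clear h7; omega
   omega
  ·have h6 : l = 18*j := by rw [h8] at h6; clear h7; omega
   omega
 have hj : j ∣ 120960 := by
  rw [show 239500800 = 1980*120960 by norm_num] at h2
  exact (Nat.mul_dvd_mul_iff_left (by norm_num)).1 h2
 have h11 : j ∣ 128*189 := by
  have hc : Coprime j 5 := ((Nat.Prime.coprime_iff_not_dvd Nat.prime_five).2 (by omega)).symm
  exact hc.dvd_of_dvd_mul_left (by rwa [show 5*(128*189) = 120960 by norm_num])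
 obtain ⟨a,b,ha,hb,rfl⟩ := (Nat.dvd_mul).1 h11
 have := ar1 a (by have := le_of_dvd (by norm_num) ha; omega) b (by have := le_of_dvd (by norm_num) hb; omega) ⟨ha,hb,h9,h10⟩
 omega
section core
variable {N : Type*} [Group N] [Finite N] {A : Subgroup (MulAut N)} {φ : N →* Perm (Fin (11+1))} {x y u : Perm (Fin (11+1))}
lemma no7 (s : St A 11 5 3 φ x y) (h7 : 7 ∣ Nat.card φ.range) : 665280 ∣ Nat.card φ.range := by
 have : Fact (Nat.Prime 7) := ⟨by norm_num⟩
 obtain ⟨⟨c,hcX⟩,hco⟩ := exists_prime_orderOf_dvd_card' 7 h7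
 have hc7 : orderOf c = 7 := (orderOf_mk c hcX).symm.trans hco
 have hcyc : c.IsCycle := by
  apply isCycle_of_prime_order'
  ·rw [hc7]; norm_num
  ·rw [hc7]; simp
 have hsupp : c.support.card = 7 := by rw [←hcyc.orderOf,hc7]
 have := Perm.isPretransitive_of_isCycle_mem hcyc hcX
 have hs : ((c.support : Set (Fin (11+1)))ᶜ).ncard = 4+1 := by
  rw [Set.ncard_compl,ncard_coe_finset,hsupp,card_eq_fintype_card,Fintype.card_fin]
 have hpr : IsPreprimitive (fixingSubgroup φ.range (c.support : Set (Fin (11+1)))ᶜ) (SubMulAction.ofFixingSubgroup φ.range (c.support : Set (Fin (11+1)))ᶜ) := by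
  apply IsPreprimitive.of_prime_card
  have : Nat.card (SubMulAction.ofFixingSubgroup φ.range (c.support : Set (Fin (11+1)))ᶜ) = 7 := by
   rw [←hsupp,←ncard_coe_finset,←Nat.card_coe_set_eq]
   apply card_congr
   apply Equiv.setCongr
   ext i
   simp [SubMulAction.mem_ofFixingSubgroup_iff]
  rw [this]; norm_num
 have h6 := (s.h.pre.isMultiplyPreprimitive hs (by rw [card_eq_fintype_card,Fintype.card_fin]; norm_num) hpr).isMultiplyPretransitive
 obtain ⟨t,ht⟩ : ∃ t : Set (Fin (11+1)),t.ncard = 4+2 := ⟨((Finset.range 6).image (fun i => (Fin.ofNat 12 i : Fin (11+1))) : Finset _),by rw [ncard_coe_finset]; decide⟩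
 have h8 := IsMultiplyPretransitive.index_of_fixingSubgroup_mul h6 ht
 have h9 := index_dvd_card (fixingSubgroup φ.range t)
 rw [card_eq_fintype_card,Fintype.card_fin,show Nat.factorial (11+1 - (4+2)) = 720 by decide,show Nat.factorial (11+1) = 479001600 by decide] at h8
 rwa [show (fixingSubgroup φ.range t).index = 665280 by omega] at h9
/-- the order in the remaining case of degree twelve -/
lemma St.card12 (s : St A 11 5 3 φ x y) (huX : u ∈ φ.range) (hu : u*y*u⁻¹ = y^2) (h9 : 9 ∣ Nat.card φ.range) : Nat.card φ.range = 7920 := by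
 have : Fact (Nat.Prime 5) := ⟨Nat.prime_five⟩
 have : Fact (Nat.Prime 11) := ⟨by norm_num⟩
 have hoy : orderOf y = 5 := s.hy.order
 have hox : orderOf x = 11 := s.hx.order s.n.hp
 have h5 : 5 ∣ Nat.card φ.range := by
  rw [←hoy,←orderOf_mk y s.hyX]; exact orderOf_dvd_natCard _
 have h132 : 132 ∣ Nat.card φ.range := s.h.card_mul (by norm_num)
 have h1980 : 1980 ∣ Nat.card φ.range := by omega
 have hd : Nat.card φ.range ∣ 239500800 := by
  have := s.h.card_dvd (by norm_num)
  rw [show Nat.factorial (11+1) = 2*239500800 by decide] at this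
  exact (Nat.mul_dvd_mul_iff_left (by norm_num)).1 this
 have h25 : ¬ 25 ∣ Nat.card φ.range := by
  intro h
  have := relIndex_mul_relIndex ⊥ _ _ bot_le s.hsyl.1
  rw [relIndex_bot_left,relIndex_bot_left,card_zpowers,hoy] at this
  exact s.hsyl.2.2 (by omega)
 obtain ⟨k,hk,hk5⟩ := s.hsyl.modEq
 obtain ⟨l,hl,hl11⟩ := (syl_p s.n.hp (by norm_num) s.hxX hox).modEq
 have hin : ∀ {W : Subgroup (Perm (Fin (11+1)))} {c},c ∈ W → orderOf c ∣ Nat.card W := by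
  intro W c hc
  rw [←orderOf_mk c hc]; exact orderOf_dvd_natCard _
 have hY : Nat.card (φ.range ⊓ normalizer (zpowers y : Set (Perm (Fin (11+1)))) : Subgroup _) = 20 := by
  have a1 := norm_card Nat.prime_five hoy (W := φ.range ⊓ normalizer (zpowers y : Set (Perm (Fin (11+1))))) (fun c hc => nz.1 hc.2) (fun c hc hcy => by
   obtain ⟨j,rfl⟩ := s.cent hc.1 hcy
   exact pow_mem (mem_zpowers y) j)
  have a2 := hin (W := φ.range ⊓ normalizer (zpowers y : Set (Perm (Fin (11+1))))) ⟨s.hyX,le_normalizer (mem_zpowers y)⟩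
  have a3 := hin (W := φ.range ⊓ normalizer (zpowers y : Set (Perm (Fin (11+1))))) (c := u) ⟨huX,nz.2 (hu ▸ pow_mem (mem_zpowers y) 2)⟩
  have a4 : 4 ∣ orderOf u := by
   have hit : ∀ i,u^i*y*(u^i)⁻¹ = y^2^i := by
    intro i
    induction i with
    | zero => simp
    | succ i ih =>
     rw [show u^(i+1)*y*(u^(i+1))⁻¹ = u^i*(u*y*u⁻¹)*(u^i)⁻¹ by rw [pow_succ]; group,hu,←conj_pow,ih,←pow_mul,←pow_succ]
   have h1 := hit (orderOf u)
   rw [pow_orderOf_eq_one,one_mul,inv_one,mul_one] at h1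
   have h2 : 1 ≡ 2^orderOf u [MOD 5] := by
    rw [←hoy,←pow_eq_pow_iff_modEq,pow_one]; exact h1
   rw [←Nat.div_add_mod (orderOf u) 4,pow_add,pow_mul] at h2
   have h3 : 1 ≡ 2^(orderOf u % 4) [MOD 5] := by
    refine h2.trans ?_
    have := ((show 2^4 ≡ 1 [MOD 5] by decide).pow (orderOf u / 4)).mul_right (2^(orderOf u % 4))
    rwa [one_pow,one_mul] at this
   have h4 := Nat.mod_lt (orderOf u) (show 0 < 4 by norm_num)
   generalize hr : orderOf u % 4 = r at *
   have : ∀ r < 4,1 ≡ 2^r [MOD 5] → r = 0 := by decide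
   have := this r h4 h3
   omega
  rw [hoy] at a2
  have a5 := a4.trans a3
  have a6 := le_of_dvd (by norm_num) a1
  obtain ⟨r,hr⟩ : 20 ∣ Nat.card (φ.range ⊓ normalizer (zpowers y : Set (Perm (Fin (11+1)))) : Subgroup _) := by omega
  exact Nat.dvd_antisymm a1 ⟨r,hr⟩
 have hXx : Nat.card (φ.range ⊓ normalizer (zpowers x : Set (Perm (Fin (11+1)))) : Subgroup _) = 55 ∨
   Nat.card (φ.range ⊓ normalizer (zpowers x : Set (Perm (Fin (11+1)))) : Subgroup _) = 110 := by
  have a1 := norm_card s.n.hp hox (W := φ.range ⊓ normalizer (zpowers x : Set (Perm (Fin (11+1))))) (fun c hc => nz.1 hc.2) (fun c hc hcy => by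
   obtain ⟨j,rfl⟩ := s.hx.cent s.n.hp hcy
   exact pow_mem (mem_zpowers x) j)
  have a2 := hin (W := φ.range ⊓ normalizer (zpowers x : Set (Perm (Fin (11+1))))) ⟨s.hxX,le_normalizer (mem_zpowers x)⟩
  have a3 := hin (W := φ.range ⊓ normalizer (zpowers x : Set (Perm (Fin (11+1))))) (c := y) ⟨s.hyX,nz.2 s.hyx⟩
  rw [hox] at a2
  rw [hoy] at a3
  have a6 := le_of_dvd (by norm_num) a1
  have a7 := Nat.pos_of_dvd_of_pos a1 (by norm_num)
  omega
 rw [hY] at hk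
 rcases ar2 h1980 hd h25 hk hk5 hl hl11 hXx with h | h
 ·exact h
 ·have := no7 s (by rw [h]; norm_num)
  rw [h] at this
  exact absurd (le_of_dvd (by norm_num) this) (by norm_num)
end core
end Mn
namespace Mn
open MulAction
def m9 (k i : ℕ) : ℕ := (fun i => mf 11 3 (mf 11 3 i))^[k] i
def uf (a b i : ℕ) : ℕ := [11,a,m9 2 b,m9 1 a,m9 4 a,m9 3 a,m9 3 b,m9 4 b,m9 1 b,m9 2 a,b,0].getD i 0
def wd (a b l i m j v : ℕ) : ℕ := (uf a b)^[l] (xe 11 i ((uf a b)^[m] (xe 11 j v)))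
def len3 (f : ℕ → ℕ) : Bool := beq ((List.range 12).filter (fun v => !beq (f v) v)).length 3
def wtab (a b : ℕ) : ℕ × ℕ × ℕ × ℕ × ℕ :=
 bif beq a 1 then [(0,0,0,0,0),(0,0,0,0,0),(4,1,2,1,2),(0,0,0,0,0),(0,0,0,0,0),(0,0,0,0,0),(4,1,4,1,4),(2,1,5,2,2),(2,1,1,2,10),(0,0,0,0,0),(2,1,3,1,8)].getD b (0,0,0,0,0)
 else [(0,0,0,0,0),(2,1,3,1,3),(0,0,0,0,0),(4,1,7,1,10),(4,1,1,1,3)].getD b (0,0,0,0,0)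
def wcheck (a b : ℕ) : Bool := (List.range 12).any (fun i => !beq i 10 && beq (uf a b i) b) ||
 len3 ((wd a b (wtab a b).2.1 (wtab a b).2.2.1 (wtab a b).2.2.2.1 (wtab a b).2.2.2.2)^[(wtab a b).1]) || (beq a 10 && (beq b 5 || beq b 9))
lemma wall : chk 11 (fun b => wcheck 1 b && wcheck 10 b) = true := by decide +kernel
def f9 (f1 f2 : ℕ → ℕ) (a b v : ℕ) : ℕ := f1^[a] (f2^[b] v)
def nineck (f1 f2 fn : ℕ → ℕ) (a b a' b' : ℕ) : Bool :=
 chk 12 (fun v => beq (f1^[3] v) v && beq (f2^[3] v) v && beq (f1 (f2 v)) (f2 (f1 v)) &&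
  beq (fn (f1 v)) (f9 f1 f2 a b (fn v)) && beq (fn (f2 v)) (f9 f1 f2 a' b' (fn v)) &&
  (List.range 36).any (fun k => beq (fn^[k % 4] (f9 f1 f2 (k / 4 % 3) (k / 12) 0)) v)) &&
 !chk 12 (fun v => beq (f1 v) v) && chk 3 (fun k => !chk 12 (fun v => beq (f2 v) (f1^[k] v)))
section core
variable {N : Type*} [Group N] [Finite N] {A : Subgroup (MulAut N)} {φ : N →* Perm (Fin (11+1))} {x y u : Perm (Fin (11+1))}
lemma val_iter {d : ℕ} {c : Perm (Fin d)} {f : ℕ → ℕ} (h : ∀ i,((c i : Fin d) : ℕ) = f i) (k : ℕ) : ∀ i,(((c^k) i : Fin d) : ℕ) = f^[k] i := by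
 induction k with
 | zero => intro i; rfl
 | succ k ih => intro i; rw [pow_succ,Perm.mul_apply,ih,h,Function.iterate_succ_apply]
lemma St.nine (s : St A 11 5 3 φ x y) (huX : u ∈ φ.range) (hu : u*y*u⁻¹ = y^2) {f1 f2 fn : ℕ → ℕ} (h1 : In φ.range f1) (h2 : In φ.range f2)
  (hn : In φ.range fn) {a b a' b' : ℕ} (hck : nineck f1 f2 fn a b a' b' = true) : False := by
 obtain ⟨e1,m1,v1⟩ := h1
 obtain ⟨e2,m2,v2⟩ := h2
 obtain ⟨n,mn,vn⟩ := hn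
 unfold nineck at hck
 rw [and_eq_true,and_eq_true] at hck
 obtain ⟨⟨c1,c2⟩,c3⟩ := hck
 have c1 := fun i : Fin (11+1) => chk_spec c1 i i.2
 simp only [and_eq_true,beq_eq] at c1
 have i1 := val_iter v1
 have i2 := val_iter v2
 have i3 := val_iter vn
 have k1 : e1^3 = 1 := Equiv.ext fun i => Fin.ext (by rw [i1]; exact (c1 i).1.1.1.1.1)
 have k2 : e2^3 = 1 := Equiv.ext fun i => Fin.ext (by rw [i2]; exact (c1 i).1.1.1.1.2)
 have k3 : e1*e2 = e2*e1 := Equiv.ext fun i => Fin.ext (by simp only [Perm.mul_apply,v1,v2]; exact (c1 i).1.1.1.2)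
 have k4 : n*e1 = e1^a*e2^b*n := Equiv.ext fun i => Fin.ext (by simp only [Perm.mul_apply,v1,i1,i2,vn]; exact (c1 i).1.1.2)
 have k5 : n*e2 = e1^a'*e2^b'*n := Equiv.ext fun i => Fin.ext (by simp only [Perm.mul_apply,v2,i1,i2,vn]; exact (c1 i).1.2)
 have k6 : e1 ≠ 1 := by
  rintro rfl
  rw [not_eq_true'] at c2
  apply eq_false_iff.1 c2
  unfold chk; rw [all_eq_true]
  intro v hv
  rw [List.mem_range] at hv
  rw [←v1 ⟨v,hv⟩]; exact beq_refl _
 have ho : orderOf e1 = 3 := by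
  have : Fact (Nat.Prime 3) := ⟨by norm_num⟩
  exact orderOf_eq_prime k1 k6
 have k7 : e2 ∉ zpowers e1 := by
  intro hm
  obtain ⟨k,hk⟩ := (mem_powers_iff_mem_zpowers).2 hm
  simp only at hk
  rw [←pow_mod_orderOf,ho] at hk
  have := chk_spec c3 (k % 3) (Nat.mod_lt _ (by norm_num))
  rw [not_eq_true'] at this
  apply eq_false_iff.1 this
  unfold chk; rw [all_eq_true]
  intro v hv
  rw [List.mem_range] at hv
  have h9 := i1 (k % 3) ⟨v,hv⟩
  rw [hk,v2] at h9
  simp only at h9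
  rw [h9]; exact beq_refl _
 have l1 : e1 ∈ Subgroup.closure {e1,e2} := Subgroup.subset_closure (by simp)
 have l2 : e2 ∈ Subgroup.closure {e1,e2} := Subgroup.subset_closure (by simp)
 have ln : n ∈ normalizer ((Subgroup.closure {e1,e2} : Subgroup _) : Set (Perm (Fin (11+1)))) := by
  apply mem_norm_closure
  rintro _ (rfl | rfl)
  ·rw [k4,mul_inv_cancel_right]; exact mul_mem (pow_mem l1 _) (pow_mem l2 _)
  ·rw [k5,mul_inv_cancel_right]; exact mul_mem (pow_mem l1 _) (pow_mem l2 _)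
 obtain ⟨h9,hX9⟩ := nine_syl k1 k2 k3 k6 k7 m1 m2
 have hX := s.card12 huX hu h9
 obtain ⟨hs,hb⟩ := hX9 880 (by rw [hX]) (by norm_num)
 refine s.h.sylow (p := 3) (by norm_num) (by norm_num) hs hb ?_
 have h0 : ∀ j,∃ c ∈ φ.range ⊓ normalizer ((Subgroup.closure {e1,e2} : Subgroup _) : Set (Perm (Fin (11+1)))),c 0 = j := by
  intro j
  obtain ⟨k, -,hk⟩ := any_eq_true.1 (c1 j).2
  refine ⟨n^(k % 4)*(e1^(k / 4 % 3)*e2^(k / 12)),⟨mul_mem (pow_mem mn _) (mul_mem (pow_mem m1 _) (pow_mem m2 _)),mul_mem (pow_mem ln _) (le_normalizer (mul_mem (pow_mem l1 _) (pow_mem l2 _)))⟩,Fin.ext ?_⟩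
  rw [Perm.mul_apply,Perm.mul_apply,i3,i1,i2]
  exact eq_of_beq_eq_true hk
 intro i j
 obtain ⟨c,hc,hci⟩ := h0 i
 obtain ⟨e,he,hej⟩ := h0 j
 have := mul_mem he (inv_mem hc)
 refine ⟨e*c⁻¹,this.1,this.2,?_⟩
 rw [Perm.mul_apply,←hci,show c⁻¹ (c 0) = 0 from c.symm_apply_apply 0,hej]
lemma St.mk12 (s : St A 11 5 3 φ x y) (huX : u ∈ φ.range) (hu : u*y*u⁻¹ = y^2) (hu0 : u 0 = Fin.last 11) (hul : u (Fin.last 11) = 0) (hv : (u 1 : ℕ) = 1 ∨ (u 1 : ℕ) = 10) : False := by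
 have hy : ∀ i : Fin (11+1),((u (y i) : Fin (11+1)) : ℕ) = mf 11 3 (mf 11 3 (u i)) := fun i => by
  have : u (y i) = y (y (u i)) := by
   have h1 : u*y = y^2*u := by rw [←hu,inv_mul_cancel_right]
   exact congrArg (fun e : Perm (Fin (11+1)) => e i) h1
  rw [this,s.yv,s.yv]
 have hst : ∀ i j : Fin (11+1),mf 11 3 i = j → ((u j : Fin (11+1)) : ℕ) = mf 11 3 (mf 11 3 (u i)) := fun i j h => by
  rw [←hy,show y i = j from Fin.ext ((s.yv i).trans h)]
 have hval : ∀ i : Fin (11+1),((u i : Fin (11+1)) : ℕ) = uf (u 1) (u 10) i := by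
  have a1 := hst 1 3 (by decide)
  have a2 := hst 3 9 (by decide)
  have a3 := hst 9 5 (by decide)
  have a4 := hst 5 4 (by decide)
  have b1 := hst 10 8 (by decide)
  have b2 := hst 8 2 (by decide)
  have b3 := hst 2 6 (by decide)
  have b4 := hst 6 7 (by decide)
  rw [a1] at a2; rw [a2] at a3; rw [a3] at a4
  rw [b1] at b2; rw [b2] at b3; rw [b3] at b4
  intro i
  fin_cases i
  ·exact congrArg Fin.val hu0
  ·rfl
  ·exact b2
  ·exact a1
  ·exact a4
  ·exact a3
  ·exact b3
  ·exact b4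
  ·exact b1
  ·exact a2
  ·rfl
  ·exact congrArg Fin.val hul
 have hb : (u 10 : ℕ) < 11 := by
  by_contra h
  have h1 : u 10 = Fin.last 11 := Fin.ext (by have := (u 10).2; simp; omega)
  exact absurd (u.injective (h1.trans hu0.symm)) (by decide)
 have hUI : In φ.range (uf (u 1) (u 10)) := ⟨u,huX,hval⟩
 have hW : ∀ l i m j,In φ.range (wd (u 1) (u 10) l i m j) := fun l i m j => (hUI.iter l).comp ((s.xI i).comp ((hUI.iter m).comp (s.xI j)))
 have hw : wcheck (u 1) (u 10) = true := by
  have := chk_spec wall _ hb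
  rw [and_eq_true] at this
  rcases hv with h | h
  ·rw [h]; exact this.1
  ·rw [h]; exact this.2
 have hne : ∀ i : Fin (11+1),uf (u 1) (u 10) i = u 10 → i = 10 := fun i h => u.injective (Fin.ext ((hval i).trans h))
 generalize (u 1 : ℕ) = a at *
 generalize (u 10 : ℕ) = b at *
 unfold wcheck at hw
 rw [or_eq_true,or_eq_true] at hw
 rcases hw with (hw | hw) | hw
 ·obtain ⟨i,hi,h⟩ := any_eq_true.1 hw
  rw [and_eq_true] at h
  have h3 := hne ⟨i,List.mem_range.1 hi⟩ (eq_of_beq_eq_true h.2)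
  have h4 : i = 10 := congrArg Fin.val h3
  rw [h4] at h
  exact absurd h.1 (by decide)
 ·exact s.noThree ((hW _ _ _ _).iter _) (eq_of_beq_eq_true hw)
 ·rw [and_eq_true,or_eq_true] at hw
  obtain ⟨ha,hb | hb⟩ := hw
  ·obtain rfl := eq_of_beq_eq_true ha
   obtain rfl := eq_of_beq_eq_true hb
   exact s.nine huX hu (hW 1 5 1 0) (hW 2 5 2 4) (hW 1 0 2 5) (a := 1) (b := 1) (a' := 1) (b' := 0) (by decide +kernel)
  ·obtain rfl := eq_of_beq_eq_true ha
   obtain rfl := eq_of_beq_eq_true hb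
   exact s.nine huX hu (hW 1 3 1 0) (hW 2 9 2 3) (hW 2 3 3 0) (a := 0) (b := 1) (a' := 1) (b' := 2) (by decide +kernel)
lemma St.u12 (s : St A 11 5 3 φ x y) (huX : u ∈ φ.range) (hu : u*y*u⁻¹ = y^2) : False := by
 have hy := s.hy
 have hoy : orderOf y = 5 := hy.order
 have hmod : ∀ {i j : ℕ},y^i = y^j ↔ i ≡ j [MOD 5] := by
  intro i j; rw [pow_eq_pow_iff_modEq,hoy]
 have hsw : u 0 = Fin.last 11 ∧ u (Fin.last 11) = 0 := by
  refine (hy.fl (c := u) fun i hi => ?_).resolve_left fun hu0 => ?_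
  ·have h1 : u*y = y^2*u := by rw [←hu,inv_mul_cancel_right]
   have h2 : (y^2) (u i) = u i := by
    have := congrArg (fun e : Perm (Fin (11+1)) => e i) h1
    simp only [Perm.mul_apply,hi] at this
    exact this.symm
   have h3 := pw h2 3
   rwa [←pow_mul,show y^(2*3) = y from by simpa using (hmod (i := 6) (j := 1)).2 (by decide)] at h3
  ·obtain ⟨w,hwX,hwy,hw0, -⟩ := s.swap
   obtain ⟨b,hb⟩ := (mem_powers_iff_mem_zpowers).2 hwy
   simp only at hb
   have hb0 : b % 5 ≠ 0 := by
    intro h0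
    have h1 : y^b = y^0 := hmod.2 h0
    rw [hb,pow_zero,mul_inv_eq_one] at h1
    have : y = 1 := by simpa using h1
    rw [this,orderOf_one] at hoy; omega
   obtain ⟨k,hk⟩ : ∃ k,b*2^k ≡ 1 [MOD 5] := by
    have : ∀ r < 5,r ≠ 0 → ∃ k < 4,r*2^k ≡ 1 [MOD 5] := by decide
    obtain ⟨k, -,hk⟩ := this (b % 5) (Nat.mod_lt _ (by norm_num)) hb0
    exact ⟨k,((Nat.mod_modEq b 5).symm.mul_right _).trans hk⟩
   have hit : ∀ i,u^i*y*(u^i)⁻¹ = y^2^i := by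
    intro i
    induction i with
    | zero => simp
    | succ i ih =>
     rw [show u^(i+1)*y*(u^(i+1))⁻¹ = u^i*(u*y*u⁻¹)*(u^i)⁻¹ by rw [pow_succ]; group,hu,←conj_pow,ih,←pow_mul,←pow_succ]
   obtain ⟨j,hj⟩ := s.cent (mul_mem hwX (pow_mem huX k)) (show w*u^k*y = y*(w*u^k) by
    have : w*u^k*y*(w*u^k)⁻¹ = y := by
     rw [show w*u^k*y*(w*u^k)⁻¹ = w*(u^k*y*(u^k)⁻¹)*w⁻¹ by group,hit,←conj_pow,←hb,←pow_mul]
     simpa using hmod.2 hk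
    rwa [mul_inv_eq_iff_eq_mul] at this)
   have h4 := congrArg (fun e : Perm (Fin (11+1)) => e 0) hj
   simp only [Perm.mul_apply,pw hy.y0,pw hu0.1,hw0] at h4
   exact hy.h0l h4.symm
 have hlt : ∀ a < 12,a ≠ 0 → a ≠ 11 → ∃ j < 5,(mf 11 3)^[j] a = 1 ∨ (mf 11 3)^[j] a = 10 := by decide +kernel
 obtain ⟨j, -,hj⟩ := hlt (u 1) (u 1).2 (fun h => absurd (u.injective ((Fin.ext h : u 1 = 0).trans hsw.2.symm)) (by decide))
  (fun h => absurd (u.injective ((Fin.ext h : u 1 = Fin.last 11).trans hsw.1.symm)) (by decide))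
 refine s.mk12 (u := y^j*u) (mul_mem (pow_mem s.hyX j) huX) ?_ ?_ ?_ ?_
 ·rw [show y^j*u*y*(y^j*u)⁻¹ = y^j*(u*y*u⁻¹)*(y^j)⁻¹ by group,hu,pow_mul_comm,mul_inv_cancel_right]
 ·rw [Perm.mul_apply,hsw.1,pw hy.yl]
 ·rw [Perm.mul_apply,hsw.2,pw hy.y0]
 ·rw [Perm.mul_apply,val_iter s.yv]; exact hj
/-- degree twelve -/
lemma St.twelve (s : St A 11 5 3 φ x y) : False := by
 have hy := s.hy
 have hoy : orderOf y = 5 := hy.order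
 have hmod : ∀ {i j : ℕ},y^i = y^j ↔ i ≡ j [MOD 5] := by
  intro i j; rw [pow_eq_pow_iff_modEq,hoy]
 refine s.brII num3_11 fun c hc m hm hcy => ?_
 obtain ⟨a,ha⟩ := (mem_powers_iff_mem_zpowers).2 hcy
 simp only at ha
 have h5 := Nat.mod_lt a (show 0 < 5 by norm_num)
 have hr : y^(a % 5) = c*y*c⁻¹ := by rw [←ha,hmod]; exact Nat.mod_modEq a 5
 generalize a % 5 = r at *
 interval_cases r
 ·exfalso
  rw [pow_zero,eq_comm,mul_inv_eq_one] at hr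
  have : y = 1 := by simpa using hr
  rw [this,orderOf_one] at hoy; omega
 ·left; rw [←hr,pow_one]
 ·exact (s.u12 hc hr.symm).elim
 ·refine (s.u12 (u := c^3) (pow_mem hc 3) ?_).elim
  have e : ∀ k,c*y^k*c⁻¹ = y^(3*k) := fun k => by rw [←conj_pow,←hr,←pow_mul]
  rw [show c^3*y*(c^3)⁻¹ = c*(c*(c*y^1*c⁻¹)*c⁻¹)*c⁻¹ by rw [pow_one,pow_succ,pow_two]; group,e,e,e,hmod]
  decide
 ·right
  rw [←hr,eq_inv_iff_mul_eq_one,←pow_succ,←pow_zero y,hmod]; decide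
end core
section core
variable {N : Type*} [Group N] [Finite N] {A : Subgroup (MulAut N)} {p q g : ℕ} {φ : N →* Perm (Fin (p+1))}
lemma Core.st (h : Core A φ) (n : Num p q g) (n2 : Num2 p q g) : ∃ (ψ : N →* Perm (Fin (p+1))) (x y : _),St A p q g ψ x y := by
 obtain ⟨σ,x,hxX,hx⟩ := h.norm_x n.hp
 have h' := h.conj σ
 obtain ⟨y,hyX,hy⟩ := h'.exists_y n (x := x) hx hxX
 exact ⟨_,x,y,n,n2,h',hx,hxX,hy,hyX⟩
end core
lemma Core.none {N : Type*} [Group N] [Finite N] {A : Subgroup (MulAut N)} {d : ℕ} {φ : N →* Perm (Fin d)} (h : Core A φ) (hd : d ∈ [6,12,24,48]) : False := by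
 simp only [List.mem_cons,not_mem_nil,or_false] at hd
 rcases hd with rfl | rfl | rfl | rfl
 ·exact h.not_six
 ·obtain ⟨ψ,x,y,s⟩ := Core.st (p := 11) h num11 num2_11
  exact s.twelve
 ·obtain ⟨ψ,x,y,s⟩ := Core.st (p := 23) h num23 num2_23
  exact s.big num3_23 (by norm_num)
 ·obtain ⟨ψ,x,y,s⟩ := Core.st (p := 47) h num47 num2_47
  exact s.big num3_47 (by norm_num)
lemma orb_smul {G Ω : Type*} [Group G] [MulAction G Ω] {α : Ω} (ht : ∀ β : Ω,∃ g : G,g•α = β) {S : Subgroup G} (hS : stabilizer G α ≤ S) :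
  ∃ P : Set (Set Ω),Setoid.IsPartition P ∧ (∀ B ∈ P,B.ncard = (Orb S α).ncard) ∧ ∀ g : G,∀ B ∈ P,(fun b => g•b) '' B ∈ P := by
 have key : ∀ a b : G,a•α ∈ (fun x => b•x) '' Orb S α → b⁻¹*a ∈ S := by
  rintro a b ⟨_,⟨c,hc,rfl⟩,h2⟩
  simp only at h2
  have : c⁻¹*(b⁻¹*a) ∈ S := hS (by rw [mem_stabilizer_iff,mul_smul,mul_smul,←h2,inv_smul_smul,inv_smul_smul])
  have := mul_mem hc this
  rwa [mul_inv_cancel_left] at this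
 refine ⟨{B | ∃ g : G,B = (fun b => g•b) '' Orb S α},⟨?_,?_⟩,?_,?_⟩
 ·rintro ⟨g,hg⟩
  have := Set.mem_image_of_mem (fun b => g•b) (orb_self S α)
  rw [←hg] at this; exact this
 ·intro β
  obtain ⟨a,rfl⟩ := ht β
  refine ⟨(fun b => a•b) '' Orb S α,⟨⟨a,rfl⟩,⟨α,orb_self S α,rfl⟩⟩,?_⟩
  rintro _ ⟨⟨b,rfl⟩,hb⟩
  have hk := key a b hb
  apply Set.Subset.antisymm
  ·rintro _ ⟨_,⟨c,hc,rfl⟩,rfl⟩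
   refine ⟨_,⟨a⁻¹*b*c,mul_mem ?_ hc,rfl⟩,?_⟩
   ·have := inv_mem hk; rwa [mul_inv_rev,inv_inv] at this
   ·simp only [←mul_smul]; group
  ·rintro _ ⟨_,⟨c,hc,rfl⟩,rfl⟩
   refine ⟨_,⟨b⁻¹*a*c,mul_mem hk hc,rfl⟩,?_⟩
   simp only [←mul_smul]; group
 ·rintro _ ⟨g,rfl⟩
  exact Set.ncard_image_of_injective _ (MulAction.injective g)
 ·rintro g _ ⟨a,rfl⟩
  refine ⟨g*a,?_⟩
  rw [Set.image_image]
  simp only [mul_smul]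
end Mn

open MulAction
/-- Every minimal transitive subgroup of `S₄₈` is imprimitive, preserving a block system
whose blocks have size 2, 3 or 4. -/
theorem minimal_transitive_block_sizes
    (G : Subgroup (Equiv.Perm (Fin 48))) (hG : IsMinimalTransitive G) :
    HasBlockSystem G 2 ∨ HasBlockSystem G 3 ∨ HasBlockSystem G 4 := by
  by_contra hcon
  push Not at hcon
  obtain ⟨c2, c3, c4⟩ := hcon
  obtain ⟨ht, hm⟩ := hG
  have htr : ∀ β : Fin 48, ∃ g : G, g • (0 : Fin 48) = β := fun β => by
    obtain ⟨g, hg, h⟩ := ht 0 β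
    exact ⟨⟨g, hg⟩, h⟩
  have h : Mn.Hyp G (0 : Fin 48) := by
    refine ⟨by simp, htr, ?_, ?_⟩
    · intro K hK
      by_contra hne
      refine hm (K.map G.subtype) (lt_of_le_of_ne (Subgroup.map_subtype_le K) ?_) ?_
      · intro he
        apply hne
        rw [eq_top_iff]
        intro g _
        have h1 : (g : Equiv.Perm (Fin 48)) ∈ K.map G.subtype := by rw [he]; exact g.2
        obtain ⟨k, hk, hkg⟩ := h1
        rwa [Subtype.ext hkg] at hk
      · intro a b
        obtain ⟨g, hg, h1⟩ := hK a
        obtain ⟨k, hk, h2⟩ := hK b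
        refine ⟨((k * g⁻¹ : G) : Equiv.Perm (Fin 48)), ⟨_, mul_mem hk (inv_mem hg), rfl⟩, ?_⟩
        change (k * g⁻¹) • a = b
        rw [← h1, ← h2, mul_smul, inv_smul_smul]
    · intro S hS
      obtain ⟨P, p1, p2, p3⟩ := Mn.orb_smul htr hS
      have hb : ∀ k, (Mn.Orb S (0 : Fin 48)).ncard = k → HasBlockSystem G k := fun k hk =>
        ⟨P, p1, fun B hB => (p2 B hB).trans hk, fun g hg B hB => p3 ⟨g, hg⟩ B hB⟩
      have h0 : (Mn.Orb S (0 : Fin 48)).ncard ≠ 0 := by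
        rw [← Nat.pos_iff_ne_zero, Set.ncard_pos (Set.toFinite _)]
        exact ⟨_, Mn.orb_self S 0⟩
      have h2 : (Mn.Orb S (0 : Fin 48)).ncard ≠ 2 := fun h => c2 (hb 2 h)
      have h3 : (Mn.Orb S (0 : Fin 48)).ncard ≠ 3 := fun h => c3 (hb 3 h)
      have h4 : (Mn.Orb S (0 : Fin 48)).ncard ≠ 4 := fun h => c4 (hb 4 h)
      omega
  obtain ⟨N, A, d, φ, hc, hd⟩ := h.core
  exact hc.none hd
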